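/- Let 1 < p < ∞, let w ∈ A_p be a Muckenhoupt weight on ℝⁿ, and let f ∈ L^p_w(ℝⁿ). Then the following are equivalent: (1) f ∈ W^{1,p}_w(ℝⁿ); (2) Tf ∈ L^p_w(ℝⁿ); (3) Sf ∈ L^p_w(ℝⁿ). Moreover, for f ∈ W^{1,p}_w(ℝⁿ) there is a constant C ≥ 1 (depending on n, p, w) such that C^{-1}‖∇f‖_{L^p_w} ≤ ‖Tf‖_{L^p_w} ≤ C‖∇f‖_{L^p_w} and C^{-1}‖∇f‖_{L^p_w} ≤ ‖Sf‖_{L^p_w} ≤ C‖∇f‖_{L^p_w}. -/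

import Mathlib

open MeasureTheory Metric Filter Set
open scoped ENNReal NNReal RealInnerProductSpace FourierTransform Topology

noncomputable section

/-- `ℝⁿ` as a Euclidean space. -/
abbrev Eucl (n : ℕ) := EuclideanSpace ℝ (Fin n)

/-- `ω_n`, the volume of the unit ball in `ℝⁿ`. -/
def ballVol (n : ℕ) : ℝ := ((volume : Measure (Eucl n)) (ball 0 1)).toReal

/-- A measure on the unit sphere of `ℝⁿ` (the cone measure, which is proportional to the
`(n-1)`-dimensional surface measure). -/
def sphereMeasure (n : ℕ) : Measure (Eucl n) :=
  Measure.map (fun x : Eucl n => ‖x‖⁻¹ • x)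
    ((volume : Measure (Eucl n)).restrict (ball 0 1 \ {0}))

/-- The average `f_{S(x,t)}` of `f` over the sphere `S(x,t)` with respect to the
`(n-1)`-dimensional surface measure. -/
def sphereAvg (n : ℕ) (f : Eucl n → ℝ) (x : Eucl n) (t : ℝ) : ℝ :=
  ⨍ z, f (x + t • z) ∂(sphereMeasure n)

/-- The average `f_{B(x,t)}` of `f` over the ball `B(x,t)` with respect to Lebesgue measure. -/
def ballAvg (n : ℕ) (f : Eucl n → ℝ) (x : Eucl n) (t : ℝ) : ℝ :=
  ⨍ y in ball x t, f y

/-- `F` is the weak (distributional) gradient of `f`. -/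
def HasWeakGradient (n : ℕ) (f : Eucl n → ℝ) (F : Eucl n → Eucl n) : Prop :=
  ∀ φ : Eucl n → ℝ, ContDiff ℝ (⊤ : ℕ∞) φ → HasCompactSupport φ →
    ∀ v : Eucl n, ∫ x, f x * fderiv ℝ φ x v = - ∫ x, ⟪F x, v⟫ * φ x

/-- `f ∈ W^{1,1}_loc(ℝⁿ)` with weak gradient `F`. -/
def MemW11loc (n : ℕ) (f : Eucl n → ℝ) (F : Eucl n → Eucl n) : Prop :=
  LocallyIntegrable f volume ∧ LocallyIntegrable F volume ∧ HasWeakGradient n f F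

/-- The square function `Tf` (with spherical averages), as an `ℝ≥0∞`-valued function. -/
def Tsq (n : ℕ) (f : Eucl n → ℝ) (x : Eucl n) : ℝ≥0∞ :=
  (∫⁻ t in Ioi (0:ℝ), ENNReal.ofReal ((f x - sphereAvg n f x t) ^ 2 / t ^ 3)) ^ (1/2 : ℝ)

/-- The square function `Sf` (with ball averages), as an `ℝ≥0∞`-valued function. -/
def Ssq (n : ℕ) (f : Eucl n → ℝ) (x : Eucl n) : ℝ≥0∞ :=
  (∫⁻ t in Ioi (0:ℝ), ENNReal.ofReal ((f x - ballAvg n f x t) ^ 2 / t ^ 3)) ^ (1/2 : ℝ)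

/-- The kernel `φ(x) = (1/(nω_n)) (x/|x|ⁿ) χ_{B(0,1)}(x)`. -/
def phiK (n : ℕ) (x : Eucl n) : Eucl n :=
  if ‖x‖ < 1 then (((n : ℝ) * ballVol n)⁻¹ * (‖x‖ ^ n)⁻¹) • x else 0

/-- The kernel `η(x) = (1/(nω_n)) x χ_{B(0,1)}(x)`. -/
def etaK (n : ℕ) (x : Eucl n) : Eucl n :=
  if ‖x‖ < 1 then ((n : ℝ) * ballVol n)⁻¹ • x else 0

/-- The kernel `ψ(x) = (1/(nω_n)) (x/|x|ⁿ - x) χ_{B(0,1)}(x) = φ(x) - η(x)`. -/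
def psiK (n : ℕ) (x : Eucl n) : Eucl n := phiK n x - etaK n x

/-- The dilation `K_t(x) = t^{-n} K(x/t)` of a kernel. -/
def dil (n : ℕ) (K : Eucl n → Eucl n) (t : ℝ) (x : Eucl n) : Eucl n :=
  (t ^ n)⁻¹ • K (t⁻¹ • x)

/-- `φ_t(x) = t^{-n} φ(x/t)`. -/
def phit (n : ℕ) (t : ℝ) (x : Eucl n) : Eucl n := dil n (phiK n) t x

/-- `ψ_t(x) = t^{-n} ψ(x/t)`. -/
def psit (n : ℕ) (t : ℝ) (x : Eucl n) : Eucl n := dil n (psiK n) t x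

/-- The square function `T̃` applied to a vector field `G` (which plays the role of `Rg`):
`(∫₀^∞ |(φ_t * G)(x)|² dt/t)^{1/2}`, as an `ℝ≥0∞`-valued function. -/
def TtilSq (n : ℕ) (G : Eucl n → Eucl n) (x : Eucl n) : ℝ≥0∞ :=
  (∫⁻ t in Ioi (0:ℝ), ENNReal.ofReal ((∫ y, ⟪phit n t y, G (x - y)⟫) ^ 2 / t)) ^ (1/2 : ℝ)

/-- The square function `S̃` applied to a vector field `G`. -/
def StilSq (n : ℕ) (G : Eucl n → Eucl n) (x : Eucl n) : ℝ≥0∞ :=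
  (∫⁻ t in Ioi (0:ℝ), ENNReal.ofReal ((∫ y, ⟪psit n t y, G (x - y)⟫) ^ 2 / t)) ^ (1/2 : ℝ)

/-- The `j`-th Riesz transform of a (Schwartz-class or integrable) function, defined via the
Fourier multiplier `-i ξ_j/|ξ|`:  `R_j φ = (-i (ξ_j/|ξ|) φ̂(ξ))^∨`. -/
def rieszOne (n : ℕ) (j : Fin n) (φ : Eucl n → ℝ) (x : Eucl n) : ℝ :=
  (𝓕⁻ (fun ξ : Eucl n => (-Complex.I) * ((ξ j / ‖ξ‖ : ℝ) : ℂ)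
      * 𝓕 (fun y : Eucl n => ((φ y : ℝ) : ℂ)) ξ) x).re

/-- `G = Rg` is the (vector valued) Riesz transform of `g`, characterized by duality against
Schwartz functions (the transpose of `R_j` is `-R_j`). -/
def IsRiesz (n : ℕ) (g : Eucl n → ℝ) (G : Eucl n → Eucl n) : Prop :=
  LocallyIntegrable G volume ∧
    ∀ (j : Fin n) (φ : SchwartzMap (Eucl n) ℝ),
      ∫ x, G x j * φ x = - ∫ x, g x * rieszOne n j (⇑φ) x

/-- The fractional Laplacian `(-Δ)^{1/2} φ = (2π|ξ| φ̂(ξ))^∨`. -/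
def fracLapHalf (n : ℕ) (φ : Eucl n → ℝ) (x : Eucl n) : ℝ :=
  (𝓕⁻ (fun ξ : Eucl n => ((2 * Real.pi * ‖ξ‖ : ℝ) : ℂ)
      * 𝓕 (fun y : Eucl n => ((φ y : ℝ) : ℂ)) ξ) x).re


/-- `w` is a Muckenhoupt `A_p` weight on `ℝⁿ`. -/
def IsApWeight (n : ℕ) (p : ℝ) (w : Eucl n → ℝ) : Prop :=
  Measurable w ∧ (∀ x, 0 < w x) ∧
    (∀ (x : Eucl n) (r : ℝ), 0 < r → IntegrableOn w (ball x r) volume) ∧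
    (∀ (x : Eucl n) (r : ℝ), 0 < r →
      IntegrableOn (fun y => w y ^ (-1 / (p - 1) : ℝ)) (ball x r) volume) ∧
    ∃ A : ℝ, ∀ (x : Eucl n) (r : ℝ), 0 < r →
      (⨍ y in ball x r, w y) * (⨍ y in ball x r, w y ^ (-1 / (p - 1) : ℝ)) ^ (p - 1) ≤ A

/-- The weighted `L^p_w` norm of a scalar function. -/
def wLpNormS (n : ℕ) (p : ℝ) (w : Eucl n → ℝ) (g : Eucl n → ℝ) : ℝ≥0∞ :=
  (∫⁻ x, ENNReal.ofReal (|g x| ^ p * w x)) ^ (1/p)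

/-- The weighted `L^p_w` norm of a vector field. -/
def wLpNormV (n : ℕ) (p : ℝ) (w : Eucl n → ℝ) (G : Eucl n → Eucl n) : ℝ≥0∞ :=
  (∫⁻ x, ENNReal.ofReal (‖G x‖ ^ p * w x)) ^ (1/p)

/-- `g ∈ L^p_w(ℝⁿ)` (scalar valued). -/
def MemwLpS (n : ℕ) (p : ℝ) (w : Eucl n → ℝ) (g : Eucl n → ℝ) : Prop :=
  AEStronglyMeasurable g volume ∧ wLpNormS n p w g < ∞

/-- `G ∈ L^p_w(ℝⁿ)` (vector valued). -/
def MemwLpV (n : ℕ) (p : ℝ) (w : Eucl n → ℝ) (G : Eucl n → Eucl n) : Prop :=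
  AEStronglyMeasurable G volume ∧ wLpNormV n p w G < ∞

/-! ## Part 1: general tools -/

/-- The measure `dt/t` on `(0,∞)`. -/
def mdt : Measure ℝ := (volume.restrict (Ioi (0:ℝ))).withDensity (fun t => ENNReal.ofReal t⁻¹)

instance : SFinite mdt := by unfold mdt; infer_instance

lemma mdt_lintegral {g : ℝ → ℝ≥0∞} (hg : AEMeasurable g volume) :
    ∫⁻ t, g t ∂mdt = ∫⁻ t in Ioi (0:ℝ), ENNReal.ofReal t⁻¹ * g t := by
  unfold mdt
  rw [lintegral_withDensity_eq_lintegral_mul₀ (by fun_prop) hg.restrict]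
  rfl

lemma mdt_ac : mdt ≪ volume :=
  (withDensity_absolutelyContinuous _ _).trans Measure.restrict_le_self.absolutelyContinuous

lemma mdt_restrict_lintegral {I : Set ℝ} (hI : MeasurableSet I) (h0 : I ⊆ Ioi 0)
    {g : ℝ → ℝ≥0∞} (hg : AEMeasurable g volume) :
    ∫⁻ t in I, g t ∂mdt = ∫⁻ t in I, ENNReal.ofReal t⁻¹ * g t := by
  unfold mdt
  rw [restrict_withDensity hI, lintegral_withDensity_eq_lintegral_mul₀ (by fun_prop)
    (hg.restrict.restrict), Measure.restrict_restrict hI, inter_eq_self_of_subset_left h0]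
  rfl

lemma mdt_ae_pos : ∀ᵐ t ∂mdt, 0 < t := by
  unfold mdt
  apply (withDensity_absolutelyContinuous _ _).ae_le
  exact ae_restrict_mem measurableSet_Ioi

lemma mdt_le {I : Set ℝ} (hI : MeasurableSet I) {a : ℝ} (ha : 0 < a) (h : I ⊆ Ici a) :
    mdt I ≤ ENNReal.ofReal a⁻¹ * volume I := by
  have h0 : I ⊆ Ioi 0 := fun t ht => lt_of_lt_of_le ha (h ht)
  have := mdt_restrict_lintegral hI h0 (g := fun _ => 1) (by fun_prop)
  simp only [lintegral_const, mul_one, one_mul, Measure.restrict_apply_univ] at this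
  rw [this]
  calc _ ≤ ∫⁻ t in I, ENNReal.ofReal a⁻¹ := by
        apply setLIntegral_mono' hI
        intro t ht
        apply ENNReal.ofReal_le_ofReal
        exact inv_anti₀ ha (h ht)
    _ = _ := by simp

lemma mdt_lt_top {a b : ℝ} (ha : 0 < a) : mdt (Ioo a b) < ∞ := by
  refine lt_of_le_of_lt (mdt_le measurableSet_Ioo ha (fun t ht => ht.1.le)) ?_
  simp [ENNReal.mul_lt_top]

/-- scale invariance of `dt/t` -/
lemma mdt_scale {g : ℝ → ℝ≥0∞} (hg : Measurable g) {c : ℝ} (hc : 0 < c) :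
    ∫⁻ t, g (c * t) ∂mdt = ∫⁻ t, g t ∂mdt := by
  rw [mdt_lintegral (by fun_prop), mdt_lintegral (by fun_prop)]
  rw [← lintegral_indicator measurableSet_Ioi, ← lintegral_indicator measurableSet_Ioi]
  set F : ℝ → ℝ≥0∞ := (Ioi (0:ℝ)).indicator fun t => ENNReal.ofReal t⁻¹ * g t with hF
  have hFm : Measurable F := Measurable.indicator (by fun_prop) measurableSet_Ioi
  have h1 : ∀ t, (Ioi (0:ℝ)).indicator (fun t => ENNReal.ofReal t⁻¹ * g (c * t)) t
      = ENNReal.ofReal c * F (c * t) := by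
    intro t
    by_cases ht : 0 < t
    · have hct : 0 < c * t := by positivity
      simp only [hF, indicator, mem_Ioi, ht, hct, if_true]
      rw [← mul_assoc, ← ENNReal.ofReal_mul hc.le]
      congr 2
      field_simp
    · have hct : ¬ 0 < c * t := by
        intro h; exact ht (pos_of_mul_pos_right h hc.le)
      simp [hF, indicator, ht, hct]
  simp_rw [h1]
  rw [lintegral_const_mul _ (by fun_prop)]
  have h2 := Real.map_volume_mul_left hc.ne'
  have h3 : ∫⁻ t, F (c * t) = ∫⁻ t, F t ∂(Measure.map (c * ·) volume) := by
    rw [lintegral_map hFm (by fun_prop)]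
  rw [h3, h2, lintegral_smul_measure, smul_eq_mul, ← mul_assoc, ← ENNReal.ofReal_mul hc.le,
    abs_of_pos (inv_pos.2 hc), mul_inv_cancel₀ hc.ne']
  simp

/-- `∫_ℓ^∞ t^{-m} dt/t = ℓ^{-m}/m`, as an upper bound. -/
lemma mdt_pow {m : ℕ} (hm : 0 < m) {l : ℝ} (hl : 0 < l) :
    ∫⁻ t in Ioi l, ENNReal.ofReal ((t ^ m)⁻¹) ∂mdt ≤ ENNReal.ofReal ((l ^ m)⁻¹) := by
  rw [mdt_restrict_lintegral measurableSet_Ioi (fun t ht => hl.trans ht) (by fun_prop)]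
  have h1 : ∀ t ∈ Ioi l, ENNReal.ofReal t⁻¹ * ENNReal.ofReal ((t ^ m)⁻¹)
      = ENNReal.ofReal (t ^ (-(m:ℝ) - 1)) := by
    intro t ht
    have ht0 : 0 < t := hl.trans ht
    rw [← ENNReal.ofReal_mul (by positivity)]
    congr 1
    rw [Real.rpow_sub ht0, Real.rpow_neg ht0.le, Real.rpow_natCast, Real.rpow_one]
    field_simp
  rw [setLIntegral_congr_fun measurableSet_Ioi h1]
  have hlt : (-(m:ℝ) - 1) < -1 := by
    have : (0:ℝ) < m := by exact_mod_cast hm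
    linarith
  rw [← ofReal_integral_eq_lintegral_ofReal (integrableOn_Ioi_rpow_of_lt hlt hl)
    (by filter_upwards [ae_restrict_mem measurableSet_Ioi] with t ht
        exact Real.rpow_nonneg (hl.trans ht).le _)]
  rw [integral_Ioi_rpow_of_lt hlt hl]
  apply ENNReal.ofReal_le_ofReal
  have hm1 : (1:ℝ) ≤ m := by exact_mod_cast hm
  have : (-(m:ℝ) - 1 + 1) = -m := by ring
  rw [this, Real.rpow_neg hl.le, Real.rpow_natCast, neg_div_neg_eq]
  exact div_le_self (by positivity) hm1

/-- Cauchy-Schwarz -/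
lemma lint_cs {α : Type*} [MeasurableSpace α] (μ : Measure α) {f g : α → ℝ≥0∞}
    (hf : AEMeasurable f μ) (hg : AEMeasurable g μ) :
    (∫⁻ a, f a * g a ∂μ) ^ 2 ≤ (∫⁻ a, f a ^ 2 ∂μ) * ∫⁻ a, g a ^ 2 ∂μ := by
  have h := ENNReal.lintegral_mul_le_Lp_mul_Lq μ (p := 2) (q := 2) (by constructor <;> norm_num) hf hg
  simp only [Pi.mul_apply, ENNReal.rpow_two] at h
  calc _ ≤ ((∫⁻ a, f a ^ 2 ∂μ) ^ (1/2:ℝ) * (∫⁻ a, g a ^ 2 ∂μ) ^ (1/2:ℝ)) ^ 2 := by gcongr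
    _ = _ := by
      rw [mul_pow, ← ENNReal.rpow_mul_natCast, ← ENNReal.rpow_mul_natCast]
      norm_num

lemma ennreal_sq_le {a b : ℝ≥0∞} : a ^ 2 ≤ b ^ 2 ↔ a ≤ b :=
  ⟨fun h => by
    by_contra hc
    push Not at hc
    exact absurd h (not_le.2 (ENNReal.pow_right_strictMono (by norm_num) hc)), fun h => by gcongr⟩

lemma cs_of_sq_le {α : Type*} [MeasurableSpace α] (μ : Measure α) {f g : α → ℝ≥0∞}
    (hf : AEMeasurable f μ) (hg : AEMeasurable g μ) {a b : ℝ≥0∞}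
    (ha : ∫⁻ x, f x ^ 2 ∂μ ≤ a ^ 2) (hb : ∫⁻ x, g x ^ 2 ∂μ ≤ b ^ 2) :
    ∫⁻ x, f x * g x ∂μ ≤ a * b := by
  rw [← ennreal_sq_le, mul_pow]
  exact (lint_cs μ hf hg).trans (by gcongr)

/-- Minkowski's integral inequality in `L²`. -/
lemma mink {α β : Type*} [MeasurableSpace α] [MeasurableSpace β] (μ : Measure α) [SFinite μ]
    (ν : Measure β) [SFinite ν] {k : α → β → ℝ≥0∞} (hk : Measurable (Function.uncurry k))
    {g N : β → ℝ≥0∞} (hg : Measurable g) (hNm : Measurable N)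
    (hN : ∀ z, ∫⁻ t, k t z ^ 2 ∂μ ≤ N z ^ 2) :
    ∫⁻ t, (∫⁻ z, k t z * g z ∂ν) ^ 2 ∂μ ≤ (∫⁻ z, N z * g z ∂ν) ^ 2 := by
  have hk1 : ∀ t, Measurable (k t) := fun t => hk.comp (measurable_const.prodMk measurable_id)
  have hk2 : ∀ z, Measurable (fun t => k t z) := fun z => hk.comp (measurable_id.prodMk measurable_const)
  have e : ∀ t, (∫⁻ z, k t z * g z ∂ν) ^ 2
      = ∫⁻ z, ∫⁻ z', (k t z * k t z') * (g z * g z') ∂ν ∂ν := by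
    intro t
    rw [sq, ← lintegral_mul_const _ (by have := hk1 t; fun_prop)]
    refine lintegral_congr fun z => ?_
    rw [← lintegral_const_mul _ (by have := hk1 t; fun_prop)]
    refine lintegral_congr fun z' => ?_
    ring
  simp_rw [e]
  have hm3 : Measurable (fun q : (α × β) × β => (k q.1.1 q.1.2 * k q.1.1 q.2) * (g q.1.2 * g q.2)) := by
    have a1 : Measurable fun q : (α × β) × β => k q.1.1 q.1.2 := hk.comp measurable_fst
    have a2 : Measurable fun q : (α × β) × β => k q.1.1 q.2 :=
      hk.comp ((measurable_fst.comp measurable_fst).prodMk measurable_snd)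
    fun_prop
  rw [lintegral_lintegral_swap]
  swap
  · exact (hm3.lintegral_prod_right' (ν := ν)).aemeasurable
  have e2 : (∫⁻ z, N z * g z ∂ν) ^ 2 = ∫⁻ z, ∫⁻ z', (N z * N z') * (g z * g z') ∂ν ∂ν := by
    rw [sq, ← lintegral_mul_const _ (by fun_prop)]
    refine lintegral_congr fun z => ?_
    rw [← lintegral_const_mul _ (by fun_prop)]
    refine lintegral_congr fun z' => ?_
    ring
  rw [e2]
  refine lintegral_mono fun z => ?_
  rw [lintegral_lintegral_swap]
  swap
  · exact (hm3.comp (((measurable_fst).prodMk measurable_const).prodMk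
      measurable_snd)).aemeasurable
  refine lintegral_mono fun z' => ?_
  rw [lintegral_mul_const _ (by have := hk2 z; have := hk2 z'; fun_prop)]
  gcongr
  exact cs_of_sq_le μ (hk2 z).aemeasurable (hk2 z').aemeasurable (hN z) (hN z')

lemma enorm_sq_eq (a : ℝ) : ‖a‖ₑ ^ 2 = ENNReal.ofReal (a ^ 2) := by
  rw [← enorm_pow, Real.enorm_eq_ofReal (sq_nonneg a)]

/-- Schur test together with the `T T*` argument. -/
lemma ttstar {X Z : Type*} [MeasurableSpace X] [MeasurableSpace Z] (m : Measure X) [SFinite m]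
    (ν : Measure Z) [SFinite ν] {a : X → Z → ℝ} (ha : Measurable (Function.uncurry a))
    {g : Z → ℝ} (hg : Measurable g) (hgi : Integrable g ν)
    {V : X → ℝ} (hVm : Measurable V) (hV : ∀ x, V x = ∫ z, a x z * g z ∂ν)
    {B : ℝ≥0∞} (hB : ∀ x, ‖V x‖ₑ ≤ B) (hBt : B ≠ ∞) (hVi : Integrable V m)
    {A1 A2 C : ℝ≥0∞} (hA1 : ∀ x, ∫⁻ z, ‖a x z‖ₑ ∂ν ≤ A1) (hA1t : A1 ≠ ∞)
    (hA2 : ∀ z, ∫⁻ x, ‖a x z‖ₑ ∂m ≤ A2) (hA2t : A2 ≠ ∞)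
    (hC : ∀ x, ∫⁻ x', ‖∫ z, a x z * a x' z ∂ν‖ₑ ∂m ≤ C) :
    ∫⁻ x, ‖V x‖ₑ ^ 2 ∂m ≤ C * ∫⁻ z, ‖g z‖ₑ ^ 2 ∂ν := by
  have ha1 : ∀ x, Measurable (a x) := fun t => ha.comp (measurable_const.prodMk measurable_id)
  have ha2 : ∀ z, Measurable (fun t => a t z) :=
    fun z => ha.comp (measurable_id.prodMk measurable_const)
  set J := ∫⁻ x, ‖V x‖ₑ ^ 2 ∂m with hJ
  have hJt : J ≠ ∞ := by
    refine ne_of_lt (lt_of_le_of_lt (b := ∫⁻ x, B * ‖V x‖ₑ ∂m) ?_ ?_)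
    · refine lintegral_mono fun x => ?_
      rw [sq]; gcongr; exact hB x
    · rw [lintegral_const_mul _ (by fun_prop)]
      exact ENNReal.mul_lt_top hBt.lt_top hVi.2
  set W : Z → ℝ := fun z => ∫ x, V x * a x z ∂m with hW
  have hm2 : Measurable (fun q : X × Z => V q.1 * a q.1 q.2) := by
    have : Measurable fun q : X × Z => a q.1 q.2 := ha
    fun_prop
  have hWm : Measurable W := by
    have : StronglyMeasurable (fun q : Z × X => V q.2 * a q.2 q.1) :=
      (hm2.comp measurable_swap).stronglyMeasurable
    exact this.integral_prod_right'.measurable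
  -- step 1
  have h1 : ∫ x, V x ^ 2 ∂m = ∫ z, g z * W z ∂ν := by
    have hintg : Integrable (Function.uncurry fun (x : X) (z : Z) => V x * a x z * g z) (m.prod ν) := by
      refine ⟨(hm2.mul (hg.comp measurable_snd)).aestronglyMeasurable, ?_⟩
      unfold HasFiniteIntegral
      rw [lintegral_prod_symm]
      swap
      · exact ((hm2.mul (hg.comp measurable_snd)).enorm).aemeasurable
      refine lt_of_le_of_lt (b := ∫⁻ z, (B * A2) * ‖g z‖ₑ ∂ν) ?_ ?_
      · refine lintegral_mono fun z => ?_
        simp only [Function.uncurry]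
        calc ∫⁻ x, ‖V x * a x z * g z‖ₑ ∂m ≤ ∫⁻ x, (B * ‖g z‖ₑ) * ‖a x z‖ₑ ∂m := by
              refine lintegral_mono fun x => ?_
              rw [enorm_mul, enorm_mul]
              calc _ ≤ B * ‖a x z‖ₑ * ‖g z‖ₑ := by gcongr; exact hB x
                _ = _ := by ring
          _ = (B * ‖g z‖ₑ) * ∫⁻ x, ‖a x z‖ₑ ∂m := lintegral_const_mul _ (ha2 z).enorm
          _ ≤ (B * ‖g z‖ₑ) * A2 := by gcongr; exact hA2 z
          _ = _ := by ring
      · rw [lintegral_const_mul _ hg.enorm]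
        exact ENNReal.mul_lt_top (ENNReal.mul_lt_top hBt.lt_top hA2t.lt_top) hgi.2
    calc ∫ x, V x ^ 2 ∂m = ∫ x, ∫ z, V x * a x z * g z ∂ν ∂m := by
          refine integral_congr_ae (Eventually.of_forall fun x => ?_)
          simp only
          rw [sq]
          nth_rewrite 2 [hV x]
          rw [← integral_const_mul]
          simp only [mul_assoc]
      _ = ∫ z, ∫ x, V x * a x z * g z ∂m ∂ν := integral_integral_swap hintg
      _ = _ := by
          refine integral_congr_ae (Eventually.of_forall fun z => ?_)
          simp only [hW]
          rw [integral_mul_const, mul_comm]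
  -- step 2
  set k : X → X → ℝ := fun x x' => ∫ z, a x z * a x' z ∂ν with hk
  have hm3 : Measurable (fun q : (X × X) × Z => (V q.1.1 * a q.1.1 q.2) * (V q.1.2 * a q.1.2 q.2)) := by
    have a1 : Measurable fun q : (X × X) × Z => V q.1.1 * a q.1.1 q.2 :=
      hm2.comp ((measurable_fst.comp measurable_fst).prodMk measurable_snd)
    have a2 : Measurable fun q : (X × X) × Z => V q.1.2 * a q.1.2 q.2 :=
      hm2.comp ((measurable_snd.comp measurable_fst).prodMk measurable_snd)
    exact a1.mul a2
  have hkm : Measurable (Function.uncurry k) := by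
    have : StronglyMeasurable (fun q : (X × X) × Z => a q.1.1 q.2 * a q.1.2 q.2) := by
      have a1 : Measurable fun q : (X × X) × Z => a q.1.1 q.2 :=
        ha.comp ((measurable_fst.comp measurable_fst).prodMk measurable_snd)
      have a2 : Measurable fun q : (X × X) × Z => a q.1.2 q.2 :=
        ha.comp ((measurable_snd.comp measurable_fst).prodMk measurable_snd)
      exact (a1.mul a2).stronglyMeasurable
    exact this.integral_prod_right'.measurable
  have hint3 : Integrable (fun q : (X × X) × Z => (V q.1.1 * a q.1.1 q.2) * (V q.1.2 * a q.1.2 q.2))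
      ((m.prod m).prod ν) := by
    refine ⟨hm3.aestronglyMeasurable, ?_⟩
    unfold HasFiniteIntegral
    rw [lintegral_prod_symm _ hm3.enorm.aemeasurable]
    have : ∀ z, ∫⁻ q : X × X, ‖V q.1 * a q.1 z * (V q.2 * a q.2 z)‖ₑ ∂(m.prod m)
        = (∫⁻ x, ‖V x * a x z‖ₑ ∂m) * ∫⁻ x, ‖V x * a x z‖ₑ ∂m := by
      intro z
      simp_rw [enorm_mul (V _ * a _ _)]
      exact lintegral_prod_mul (f := fun x => ‖V x * a x z‖ₑ) (g := fun x => ‖V x * a x z‖ₑ)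
        ((hVm.mul (ha2 z)).enorm.aemeasurable) ((hVm.mul (ha2 z)).enorm.aemeasurable)
    simp_rw [this]
    refine lt_of_le_of_lt (b := ∫⁻ z, (B * A2) * ∫⁻ x, ‖V x * a x z‖ₑ ∂m ∂ν) ?_ ?_
    · refine lintegral_mono fun z => ?_
      simp only
      gcongr
      calc ∫⁻ x, ‖V x * a x z‖ₑ ∂m ≤ ∫⁻ x, B * ‖a x z‖ₑ ∂m := by
            refine lintegral_mono fun x => ?_
            rw [enorm_mul]; gcongr; exact hB x
        _ = B * ∫⁻ x, ‖a x z‖ₑ ∂m := lintegral_const_mul _ (ha2 z).enorm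
        _ ≤ _ := by gcongr; exact hA2 z
    · rw [lintegral_const_mul]
      swap
      · exact (hm2.comp measurable_swap).enorm.lintegral_prod_right'
      refine ENNReal.mul_lt_top (ENNReal.mul_lt_top hBt.lt_top hA2t.lt_top) ?_
      rw [lintegral_lintegral_swap]
      swap
      · exact (hm2.comp measurable_swap).enorm.aemeasurable
      calc _ ≤ ∫⁻ x, A1 * ‖V x‖ₑ ∂m := by
            refine lintegral_mono fun x => ?_
            simp_rw [enorm_mul]
            rw [lintegral_const_mul _ (ha1 x).enorm, mul_comm]
            gcongr; exact hA1 x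
        _ = A1 * ∫⁻ x, ‖V x‖ₑ ∂m := lintegral_const_mul _ hVm.enorm
        _ < ∞ := ENNReal.mul_lt_top hA1t.lt_top hVi.2
  have hWsq : ∀ z, W z ^ 2 = ∫ q : X × X, (V q.1 * a q.1 z) * (V q.2 * a q.2 z) ∂(m.prod m) := by
    intro z
    rw [integral_prod_mul (f := fun x => V x * a x z) (g := fun x => V x * a x z), sq]
  have hWi : Integrable (fun z => W z ^ 2) ν := by
    simp_rw [hWsq]
    exact hint3.integral_prod_right
  have h2 : ∫⁻ z, ‖W z‖ₑ ^ 2 ∂ν ≤ C * J := by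
    have e1 : ∫⁻ z, ‖W z‖ₑ ^ 2 ∂ν = ENNReal.ofReal (∫ z, W z ^ 2 ∂ν) := by
      simp_rw [enorm_sq_eq]
      rw [ofReal_integral_eq_lintegral_ofReal hWi (Eventually.of_forall fun z => sq_nonneg _)]
    have e2 : ∫ z, W z ^ 2 ∂ν = ∫ q : X × X, V q.1 * V q.2 * k q.1 q.2 ∂(m.prod m) := by
      simp_rw [hWsq]
      have := integral_integral_swap (f := fun (q : X × X) (z : Z) => (V q.1 * a q.1 z) * (V q.2 * a q.2 z)) hint3
      rw [← this]
      refine integral_congr_ae (Eventually.of_forall fun q => ?_)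
      simp only [hk]
      rw [← integral_const_mul]
      congr 1; ext z; ring
    have hsym : ∀ x x', ‖k x x'‖ₑ = ‖k x' x‖ₑ := by
      intro x x'; simp only [hk]; simp_rw [mul_comm]
    calc ∫⁻ z, ‖W z‖ₑ ^ 2 ∂ν = ENNReal.ofReal (∫ q : X × X, V q.1 * V q.2 * k q.1 q.2 ∂(m.prod m)) := by
          rw [e1, e2]
      _ ≤ ‖∫ q : X × X, V q.1 * V q.2 * k q.1 q.2 ∂(m.prod m)‖ₑ := by
          rw [Real.enorm_eq_ofReal_abs]; exact ENNReal.ofReal_le_ofReal (le_abs_self _)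
      _ ≤ ∫⁻ q : X × X, ‖V q.1 * V q.2 * k q.1 q.2‖ₑ ∂(m.prod m) := enorm_integral_le_lintegral_enorm _
      _ ≤ ∫⁻ q : X × X, (2⁻¹ * (‖V q.1‖ₑ ^ 2 * ‖k q.1 q.2‖ₑ) + 2⁻¹ * (‖V q.2‖ₑ ^ 2 * ‖k q.1 q.2‖ₑ)) ∂(m.prod m) := by
          refine lintegral_mono fun q => ?_
          simp only
          rw [enorm_mul, enorm_mul, ← mul_add, ← add_mul, ← mul_assoc]
          refine mul_le_mul_left ?_ _
          rw [enorm_sq_eq, enorm_sq_eq, ← enorm_mul, Real.enorm_eq_ofReal_abs,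
            ← ENNReal.ofReal_add (sq_nonneg _) (sq_nonneg _)]
          have : (2⁻¹ : ℝ≥0∞) = ENNReal.ofReal 2⁻¹ := by
            rw [ENNReal.ofReal_inv_of_pos (by norm_num)]; simp
          rw [this, ← ENNReal.ofReal_mul (by norm_num)]
          apply ENNReal.ofReal_le_ofReal
          rw [abs_mul, ← sq_abs (V q.1), ← sq_abs (V q.2)]
          nlinarith [sq_nonneg (|V q.1| - |V q.2|)]
      _ = 2⁻¹ * (∫⁻ q : X × X, ‖V q.1‖ₑ ^ 2 * ‖k q.1 q.2‖ₑ ∂(m.prod m))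
          + 2⁻¹ * (∫⁻ q : X × X, ‖V q.2‖ₑ ^ 2 * ‖k q.1 q.2‖ₑ ∂(m.prod m)) := by
          have hk' : Measurable fun q : X × X => k q.1 q.2 := hkm
          rw [lintegral_add_left (by fun_prop), lintegral_const_mul _ (by fun_prop),
            lintegral_const_mul _ (by fun_prop)]
      _ ≤ 2⁻¹ * (C * J) + 2⁻¹ * (C * J) := by
          have hk' : Measurable fun q : X × X => k q.1 q.2 := hkm
          have hk1 : ∀ x, Measurable (k x) := fun t => hkm.comp (measurable_const.prodMk measurable_id)
          have hk2 : ∀ x', Measurable (fun x => k x x') :=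
            fun t => hkm.comp (measurable_id.prodMk measurable_const)
          gcongr
          · rw [lintegral_prod _ (by fun_prop), hJ, ← lintegral_const_mul _ (by fun_prop)]
            refine lintegral_mono fun x => ?_
            simp only
            rw [lintegral_const_mul _ (hk1 x).enorm, mul_comm]
            gcongr; exact hC x
          · rw [lintegral_prod_symm _ (by fun_prop), hJ, ← lintegral_const_mul _ (by fun_prop)]
            refine lintegral_mono fun x => ?_
            simp only
            rw [lintegral_const_mul _ (hk2 x).enorm, mul_comm]
            gcongr
            simp_rw [hsym _ x]; exact hC x
      _ = C * J := by rw [← add_mul, ENNReal.inv_two_add_inv_two, one_mul]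
  -- conclusion
  have h3 : J ^ 2 ≤ (C * ∫⁻ z, ‖g z‖ₑ ^ 2 ∂ν) * J := by
    have hVsq : Integrable (fun x => V x ^ 2) m := by
      refine ⟨(hVm.pow_const 2).aestronglyMeasurable, ?_⟩
      unfold HasFiniteIntegral
      simp_rw [enorm_pow]
      exact hJt.lt_top
    have e1 : J = ENNReal.ofReal (∫ x, V x ^ 2 ∂m) := by
      rw [hJ]
      simp_rw [enorm_sq_eq]
      rw [ofReal_integral_eq_lintegral_ofReal hVsq (Eventually.of_forall fun z => sq_nonneg _)]
    have e2 : J ≤ ∫⁻ z, ‖g z‖ₑ * ‖W z‖ₑ ∂ν := by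
      rw [e1, h1]
      calc _ ≤ ‖∫ z, g z * W z ∂ν‖ₑ := by
            rw [Real.enorm_eq_ofReal_abs]; exact ENNReal.ofReal_le_ofReal (le_abs_self _)
        _ ≤ ∫⁻ z, ‖g z * W z‖ₑ ∂ν := enorm_integral_le_lintegral_enorm _
        _ = _ := by simp_rw [enorm_mul]
    calc J ^ 2 ≤ (∫⁻ z, ‖g z‖ₑ * ‖W z‖ₑ ∂ν) ^ 2 := by gcongr
      _ ≤ (∫⁻ z, ‖g z‖ₑ ^ 2 ∂ν) * ∫⁻ z, ‖W z‖ₑ ^ 2 ∂ν :=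
          lint_cs ν hg.enorm.aemeasurable hWm.enorm.aemeasurable
      _ ≤ (∫⁻ z, ‖g z‖ₑ ^ 2 ∂ν) * (C * J) := by gcongr
      _ = _ := by ring
  by_cases hJ0 : J = 0
  · rw [hJ0]; exact zero_le
  · rw [sq] at h3
    exact (ENNReal.mul_le_mul_iff_left hJ0 hJt).1 h3

/-- volume of the unit ball -/
def om (n : ℕ) : ℝ≥0∞ := volume (ball (0 : Eucl n) 1)

lemma om_ne_top (n : ℕ) : om n ≠ ∞ := measure_ball_lt_top.ne

lemma om_pos (n : ℕ) : om n ≠ 0 := (measure_ball_pos _ _ one_pos).ne'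

lemma vol_ball {n : ℕ} (x : Eucl n) {r : ℝ} (hr : 0 < r) :
    volume (ball x r) = ENNReal.ofReal (r ^ n) * om n := by
  rw [Measure.addHaar_ball_of_pos _ _ hr, finrank_euclideanSpace_fin, om]

lemma lint_smul {n : ℕ} {f : Eucl n → ℝ≥0∞} (hf : Measurable f) {t : ℝ} (ht : 0 < t) :
    ∫⁻ x, ENNReal.ofReal ((t ^ n)⁻¹) * f (t⁻¹ • x) = ∫⁻ x, f x := by
  have h := Measure.map_addHaar_smul (volume : Measure (Eucl n)) (r := t⁻¹) (by positivity)
  rw [finrank_euclideanSpace_fin, abs_of_pos (by positivity)] at h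
  rw [lintegral_const_mul _ (by fun_prop)]
  have h2 : ∫⁻ x, f (t⁻¹ • x) = ∫⁻ x, f x ∂(Measure.map (fun x : Eucl n => t⁻¹ • x) volume) := by
    rw [lintegral_map hf (by fun_prop)]
  rw [h2, h, lintegral_smul_measure, smul_eq_mul, ← mul_assoc, ← ENNReal.ofReal_mul (by positivity)]
  have : (t ^ n)⁻¹ * ((t⁻¹) ^ n)⁻¹ = 1 := by
    have : t ^ n ≠ 0 := by positivity
    rw [inv_pow, inv_inv]; field_simp
  rw [this]; simp

/-- the class of admissible kernels -/
structure CZK (n : ℕ) (K : Eucl n → ℝ) (C : ℝ) : Prop where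
  meas : Measurable K
  supp : ∀ x, 1 ≤ ‖x‖ → K x = 0
  bdd : ∀ x, |K x| ≤ C
  lip : ∀ x y, ‖x‖ < 1 → ‖y‖ < 1 → |K x - K y| ≤ C * ‖x - y‖
  mean : ∫ x, K x = 0

lemma CZK.nonneg {n : ℕ} {K : Eucl n → ℝ} {C : ℝ} (hK : CZK n K C) : 0 ≤ C :=
  (abs_nonneg _).trans (hK.bdd 0)

/-- dilated kernel -/
def kd {n : ℕ} (K : Eucl n → ℝ) (t : ℝ) (x : Eucl n) : ℝ := (t ^ n)⁻¹ * K (t⁻¹ • x)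

lemma kd_meas {n : ℕ} {K : Eucl n → ℝ} (hK : Measurable K) :
    Measurable (fun q : ℝ × Eucl n => kd K q.1 q.2) := by
  unfold kd
  have : Measurable fun q : ℝ × Eucl n => K (q.1⁻¹ • q.2) := hK.comp (by fun_prop)
  fun_prop

lemma kd_meas1 {n : ℕ} {K : Eucl n → ℝ} (hK : Measurable K) (t : ℝ) : Measurable (kd K t) := by
  unfold kd; fun_prop

lemma kd_supp {n : ℕ} {K : Eucl n → ℝ} (hs : ∀ x, 1 ≤ ‖x‖ → K x = 0) {t : ℝ} (ht : 0 < t)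
    {x : Eucl n} (hx : t ≤ ‖x‖) : kd K t x = 0 := by
  unfold kd
  rw [hs, mul_zero]
  rw [norm_smul, Real.norm_of_nonneg (by positivity), ← div_eq_inv_mul, le_div_iff₀ ht]
  linarith

lemma kd_bdd {n : ℕ} {K : Eucl n → ℝ} {C : ℝ} (hs : ∀ x, |K x| ≤ C) {t : ℝ} (ht : 0 < t)
    (x : Eucl n) : |kd K t x| ≤ C * (t ^ n)⁻¹ := by
  unfold kd
  rw [abs_mul, abs_of_pos (by positivity), mul_comm]
  gcongr
  exact hs _

lemma kd_lip {n : ℕ} {K : Eucl n → ℝ} {C : ℝ} (hK : CZK n K C) {t : ℝ} (ht : 0 < t)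
    {x y : Eucl n} (hx : ‖x‖ < t) (hy : ‖y‖ < t) :
    |kd K t x - kd K t y| ≤ C * ‖x - y‖ * (t ^ (n + 1))⁻¹ := by
  unfold kd
  rw [← mul_sub, abs_mul, abs_of_pos (by positivity)]
  have h : ∀ z : Eucl n, ‖z‖ < t → ‖t⁻¹ • z‖ < 1 := by
    intro z hz
    rw [norm_smul, Real.norm_of_nonneg (by positivity), ← div_eq_inv_mul, div_lt_one ht]
    exact hz
  have := hK.lip _ _ (h x hx) (h y hy)
  rw [← smul_sub, norm_smul, Real.norm_of_nonneg (by positivity)] at this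
  calc _ ≤ (t ^ n)⁻¹ * (C * (t⁻¹ * ‖x - y‖)) := by gcongr
    _ = _ := by rw [pow_succ, mul_inv]; ring

lemma kd_integral {n : ℕ} {K : Eucl n → ℝ} {t : ℝ} (ht : 0 < t) :
    ∫ x, kd K t x = ∫ x, K x := by
  unfold kd
  rw [integral_const_mul, Measure.integral_comp_smul, finrank_euclideanSpace_fin,
    abs_of_pos (by positivity), smul_eq_mul, ← mul_assoc, inv_pow, inv_inv,
    inv_mul_cancel₀ (by positivity), one_mul]

lemma kd_integrable {n : ℕ} {K : Eucl n → ℝ} {C : ℝ} (hm : Measurable K)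
    (hs : ∀ x, 1 ≤ ‖x‖ → K x = 0) (hb : ∀ x, |K x| ≤ C) {t : ℝ} (ht : 0 < t) :
    Integrable (kd K t) volume := by
  have h1 : IntegrableOn (kd K t) (ball 0 t) volume := by
    refine Measure.integrableOn_of_bounded (M := C * (t ^ n)⁻¹) measure_ball_lt_top.ne
      (kd_meas1 hm t).aestronglyMeasurable (Eventually.of_forall fun x => kd_bdd hb ht x)
  refine (integrableOn_iff_integrable_of_support_subset ?_).1 h1
  intro x hx
  rw [mem_ball_zero_iff]
  by_contra h
  exact hx (kd_supp hs ht (not_lt.1 h))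

lemma kd_l1 {n : ℕ} {K : Eucl n → ℝ} {C : ℝ} (hm : Measurable K)
    (hs : ∀ x, 1 ≤ ‖x‖ → K x = 0) (hb : ∀ x, |K x| ≤ C) {t : ℝ} (ht : 0 < t) :
    ∫⁻ x, ‖kd K t x‖ₑ ≤ ENNReal.ofReal C * om n := by
  have h1 : ∀ x, ‖kd K t x‖ₑ = ENNReal.ofReal ((t ^ n)⁻¹) * ‖K (t⁻¹ • x)‖ₑ := by
    intro x; unfold kd
    rw [enorm_mul, Real.enorm_eq_ofReal (by positivity)]
  simp_rw [h1]
  rw [lint_smul (f := fun x => ‖K x‖ₑ) (by fun_prop) ht]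
  calc ∫⁻ x, ‖K x‖ₑ ≤ ∫⁻ x, (ball (0 : Eucl n) 1).indicator (fun _ => ENNReal.ofReal C) x := by
        refine lintegral_mono fun x => ?_
        by_cases hx : x ∈ ball (0 : Eucl n) 1
        · rw [indicator_of_mem hx, Real.enorm_eq_ofReal_abs]
          exact ENNReal.ofReal_le_ofReal (hb x)
        · rw [hs x (by simpa using hx)]; simp
    _ = _ := by rw [lintegral_indicator_const measurableSet_ball]; rfl

lemma vol_shell {n : ℕ} (hn : 0 < n) {d : ℝ} (hd : 0 ≤ d) :
    volume {x : Eucl n | 1 - d ≤ ‖x‖ ∧ ‖x‖ < 1} ≤ ENNReal.ofReal (n * d) * om n := by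
  by_cases h1 : d < 1
  · have e : {x : Eucl n | 1 - d ≤ ‖x‖ ∧ ‖x‖ < 1} = ball 0 1 \ ball 0 (1 - d) := by
      ext x; simp [and_comm]
    rw [e, measure_sdiff (ball_subset_ball (by linarith)) measurableSet_ball.nullMeasurableSet
      measure_ball_lt_top.ne, vol_ball _ (by linarith : 0 < 1 - d), ← om]
    rw [tsub_le_iff_right, ← add_mul, ← ENNReal.ofReal_add (by positivity) (by
      have : 0 < 1 - d := by linarith
      positivity)]
    have := one_add_mul_le_pow (a := -d) (by linarith) n
    calc om n = ENNReal.ofReal 1 * om n := by simp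
      _ ≤ _ := by
        gcongr
        rw [← sub_eq_add_neg] at this
        linarith
  · calc _ ≤ volume (ball (0 : Eucl n) 1) := measure_mono fun x hx => by simpa using hx.2
      _ = ENNReal.ofReal 1 * om n := by simp [om]
      _ ≤ _ := by
        gcongr
        have : (1:ℝ) ≤ n := by exact_mod_cast hn
        nlinarith

/-- `L¹` modulus of continuity -/
lemma CZK.shift {n : ℕ} (hn : 0 < n) {K : Eucl n → ℝ} {C : ℝ} (hK : CZK n K C) (h : Eucl n) :
    ∫⁻ x, ‖K (x + h) - K x‖ₑ ≤ ENNReal.ofReal (C * (2 * n + 1) * ‖h‖) * om n := by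
  have hC := hK.nonneg
  set Sh := {x : Eucl n | 1 - ‖h‖ ≤ ‖x‖ ∧ ‖x‖ < 1} with hSh
  have hShm : MeasurableSet Sh := by
    apply MeasurableSet.inter
    · exact measurableSet_le measurable_const measurable_norm
    · exact measurableSet_lt measurable_norm measurable_const
  have hmI : Measurable (Sh.indicator (fun _ => ENNReal.ofReal C)) :=
    measurable_const.indicator hShm
  have hpt : ∀ x, ‖K (x + h) - K x‖ₑ ≤ (ball (0 : Eucl n) 1).indicator (fun _ => ENNReal.ofReal (C * ‖h‖)) x
      + (Sh.indicator (fun _ => ENNReal.ofReal C) x + Sh.indicator (fun _ => ENNReal.ofReal C) (x + h)) := by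
    intro x
    by_cases hx : ‖x‖ < 1 <;> by_cases hxh : ‖x + h‖ < 1
    · rw [indicator_of_mem (by simpa using hx)]
      refine le_trans ?_ le_self_add
      rw [Real.enorm_eq_ofReal_abs]
      apply ENNReal.ofReal_le_ofReal
      simpa using hK.lip _ _ hxh hx
    · rw [hK.supp (x + h) (not_lt.1 hxh)]
      have : x ∈ Sh := by
        refine ⟨?_, hx⟩
        have := norm_add_le x h
        push Not at hxh
        linarith
      rw [indicator_of_mem this]
      refine le_trans ?_ (le_add_left le_self_add)
      rw [Real.enorm_eq_ofReal_abs, zero_sub, abs_neg]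
      exact ENNReal.ofReal_le_ofReal (hK.bdd x)
    · rw [hK.supp x (not_lt.1 hx)]
      have : x + h ∈ Sh := by
        refine ⟨?_, hxh⟩
        have := norm_sub_le (x + h) h
        rw [add_sub_cancel_right] at this
        push Not at hx
        linarith
      rw [indicator_of_mem this]
      refine le_trans ?_ (le_add_left le_add_self)
      rw [Real.enorm_eq_ofReal_abs, sub_zero]
      exact ENNReal.ofReal_le_ofReal (hK.bdd _)
    · rw [hK.supp _ (not_lt.1 hx), hK.supp _ (not_lt.1 hxh)]; simp
  calc _ ≤ _ := lintegral_mono hpt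
    _ = ENNReal.ofReal (C * ‖h‖) * om n + (ENNReal.ofReal C * volume Sh + ENNReal.ofReal C * volume Sh) := by
        rw [lintegral_add_left (measurable_const.indicator measurableSet_ball),
          lintegral_add_left hmI,
          lintegral_add_right_eq_self (Sh.indicator fun _ => ENNReal.ofReal C),
          lintegral_indicator_const measurableSet_ball, lintegral_indicator_const hShm]
        rfl
    _ ≤ ENNReal.ofReal (C * ‖h‖) * om n + (ENNReal.ofReal C * (ENNReal.ofReal (n * ‖h‖) * om n)
          + ENNReal.ofReal C * (ENNReal.ofReal (n * ‖h‖) * om n)) := by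
        gcongr <;> exact vol_shell hn (norm_nonneg _)
    _ = _ := by
        rw [← mul_assoc, ← ENNReal.ofReal_mul hC, ← add_mul, ← add_mul,
          ← ENNReal.ofReal_add (by positivity) (by positivity),
          ← ENNReal.ofReal_add (by positivity) (by positivity)]
        congr 2; ring

lemma CZK.shift_t {n : ℕ} (hn : 0 < n) {K : Eucl n → ℝ} {C : ℝ} (hK : CZK n K C) (h : Eucl n)
    {t : ℝ} (ht : 0 < t) :
    ∫⁻ x, ‖kd K t (x + h) - kd K t x‖ₑ ≤ ENNReal.ofReal (C * (2 * n + 1) * (‖h‖ / t)) * om n := by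
  have h1 : ∀ x, ‖kd K t (x + h) - kd K t x‖ₑ = ENNReal.ofReal ((t ^ n)⁻¹) *
      (fun y => ‖K (y + t⁻¹ • h) - K y‖ₑ) (t⁻¹ • x) := by
    intro x; unfold kd
    rw [← mul_sub, enorm_mul, Real.enorm_eq_ofReal (by positivity), smul_add]
  simp_rw [h1]
  have := hK.meas
  rw [lint_smul (f := fun y => ‖K (y + t⁻¹ • h) - K y‖ₑ) (by fun_prop) ht]
  refine (hK.shift hn _).trans ?_
  rw [norm_smul, Real.norm_of_nonneg (by positivity), div_eq_inv_mul]

/-- convolution with the dilated kernel -/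
def cv {n : ℕ} (K : Eucl n → ℝ) (t : ℝ) (G : Eucl n → ℝ) (x : Eucl n) : ℝ :=
  ∫ z, kd K t (x - z) * G z

/-- square of the square function -/
def Asq {n : ℕ} (K : Eucl n → ℝ) (I : Set ℝ) (G : Eucl n → ℝ) (x : Eucl n) : ℝ≥0∞ :=
  ∫⁻ t in I, ‖cv K t G x‖ₑ ^ 2 ∂mdt

lemma cv_meas {n : ℕ} {K : Eucl n → ℝ} (hK : Measurable K) {G : Eucl n → ℝ} (hG : Measurable G) :
    Measurable (fun q : ℝ × Eucl n => cv K q.1 G q.2) := by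
  have : Measurable (fun q : (ℝ × Eucl n) × Eucl n => kd K q.1.1 (q.1.2 - q.2) * G q.2) := by
    have h1 : Measurable (fun q : (ℝ × Eucl n) × Eucl n => kd K q.1.1 (q.1.2 - q.2)) :=
      (kd_meas hK).comp (by fun_prop : Measurable fun q : (ℝ × Eucl n) × Eucl n => (q.1.1, q.1.2 - q.2))
    fun_prop
  exact this.stronglyMeasurable.integral_prod_right'.measurable

lemma cv_meas_x {n : ℕ} {K : Eucl n → ℝ} (hK : Measurable K) {G : Eucl n → ℝ} (hG : Measurable G)
    (t : ℝ) : Measurable (cv K t G) := (cv_meas hK hG).comp (by fun_prop : Measurable fun x => (t, x))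

lemma cv_meas_t {n : ℕ} {K : Eucl n → ℝ} (hK : Measurable K) {G : Eucl n → ℝ} (hG : Measurable G)
    (x : Eucl n) : Measurable (fun t => cv K t G x) :=
  (cv_meas hK hG).comp (by fun_prop : Measurable fun t => (t, x))

lemma Asq_meas {n : ℕ} {K : Eucl n → ℝ} (hK : Measurable K) {G : Eucl n → ℝ} (hG : Measurable G)
    (I : Set ℝ) : Measurable (Asq K I G) := by
  unfold Asq
  have : Measurable (fun q : Eucl n × ℝ => ‖cv K q.2 G q.1‖ₑ ^ 2) :=
    (((cv_meas hK hG).comp measurable_swap).enorm).pow_const 2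
  exact this.lintegral_prod_right'

lemma CZK.ortho {n : ℕ} (hn : 0 < n) {K : Eucl n → ℝ} {C : ℝ} (hK : CZK n K C)
    {s t : ℝ} (hs : 0 < s) (ht : 0 < t) :
    ∫⁻ y, ‖∫ u, kd K s u * kd K t (y + u)‖ₑ ≤
      ENNReal.ofReal (C ^ 2 * (2 * n + 1) * (s / t)) * om n ^ 2 := by
  have hC := hK.nonneg
  have hm := hK.meas
  have hms := kd_meas1 hm s
  have hmt := kd_meas1 hm t
  have hi := kd_integrable hm hK.supp hK.bdd hs
  have h1 : ∀ y, ∫ u, kd K s u * kd K t (y + u) = ∫ u, kd K s u * (kd K t (y + u) - kd K t y) := by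
    intro y
    simp_rw [mul_sub]
    rw [integral_sub, integral_mul_const, kd_integral hs, hK.mean, zero_mul, sub_zero]
    · refine hi.mul_bdd (c := C * (t ^ n)⁻¹) (hmt.comp (by fun_prop)).aestronglyMeasurable ?_
      exact Eventually.of_forall fun x => kd_bdd hK.bdd ht _
    · exact hi.mul_const _
  calc ∫⁻ y, ‖∫ u, kd K s u * kd K t (y + u)‖ₑ
      ≤ ∫⁻ y, ∫⁻ u, ‖kd K s u‖ₑ * ‖kd K t (y + u) - kd K t y‖ₑ := by
        refine lintegral_mono fun y => ?_
        simp only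
        rw [h1 y]
        refine (enorm_integral_le_lintegral_enorm _).trans_eq ?_
        simp_rw [enorm_mul]
    _ = ∫⁻ u, ∫⁻ y, ‖kd K s u‖ₑ * ‖kd K t (y + u) - kd K t y‖ₑ := by
        rw [lintegral_lintegral_swap]
        have : Measurable (fun q : Eucl n × Eucl n => ‖kd K s q.2‖ₑ * ‖kd K t (q.1 + q.2) - kd K t q.1‖ₑ) := by
          fun_prop
        exact this.aemeasurable
    _ ≤ ∫⁻ u, ‖kd K s u‖ₑ * (ENNReal.ofReal (C * (2 * n + 1) * (s / t)) * om n) := by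
        refine lintegral_mono fun u => ?_
        simp only
        rw [lintegral_const_mul _ (by fun_prop)]
        by_cases hu : s ≤ ‖u‖
        · rw [kd_supp hK.supp hs hu]; simp
        · gcongr
          refine (hK.shift_t hn u ht).trans ?_
          gcongr
          exact (not_le.1 hu).le
    _ = (∫⁻ u, ‖kd K s u‖ₑ) * (ENNReal.ofReal (C * (2 * n + 1) * (s / t)) * om n) := by
        rw [lintegral_mul_const _ (by fun_prop)]
    _ ≤ (ENNReal.ofReal C * om n) * (ENNReal.ofReal (C * (2 * n + 1) * (s / t)) * om n) := by
        gcongr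
        exact kd_l1 hm hK.supp hK.bdd hs
    _ = _ := by
        rw [mul_mul_mul_comm, ← ENNReal.ofReal_mul hC, ← sq]
        congr 2; ring

lemma CZK.ortho2 {n : ℕ} (hn : 0 < n) {K : Eucl n → ℝ} {C : ℝ} (hK : CZK n K C)
    {s t : ℝ} (hs : 0 < s) (ht : 0 < t) (x : Eucl n) :
    ∫⁻ y, ‖∫ z, kd K t (x - z) * kd K s (y - z)‖ₑ ≤
      ENNReal.ofReal (C ^ 2 * (2 * n + 1)) * om n ^ 2 * ENNReal.ofReal (min (s / t) (t / s)) := by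
  have hC := hK.nonneg
  have key1 : ∫⁻ y, ‖∫ z, kd K t (x - z) * kd K s (y - z)‖ₑ ≤
      ENNReal.ofReal (C ^ 2 * (2 * n + 1) * (s / t)) * om n ^ 2 := by
    have h1 : ∀ y, ∫ z, kd K t (x - z) * kd K s (y - z) =
        ∫ u, kd K s u * kd K t ((x - y) + u) := by
      intro y
      rw [← integral_sub_left_eq_self (fun u => kd K s u * kd K t ((x - y) + u)) _ y]
      congr 1; ext z
      rw [mul_comm]; congr 2; abel
    simp_rw [h1]
    rw [lintegral_sub_left_eq_self (fun y => ‖∫ u, kd K s u * kd K t (y + u)‖ₑ) x]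
    exact hK.ortho hn hs ht
  have key2 : ∫⁻ y, ‖∫ z, kd K t (x - z) * kd K s (y - z)‖ₑ ≤
      ENNReal.ofReal (C ^ 2 * (2 * n + 1) * (t / s)) * om n ^ 2 := by
    have h1 : ∀ y, ∫ z, kd K t (x - z) * kd K s (y - z) =
        ∫ u, kd K t u * kd K s ((y - x) + u) := by
      intro y
      rw [← integral_sub_left_eq_self (fun u => kd K t u * kd K s ((y - x) + u)) _ x]
      congr 1; ext z
      congr 2; abel
    simp_rw [h1]
    rw [lintegral_sub_right_eq_self (fun y => ‖∫ u, kd K t u * kd K s (y + u)‖ₑ) x]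
    exact hK.ortho hn ht hs
  rw [mul_right_comm, ← ENNReal.ofReal_mul (by positivity)]
  rcases min_choice (s / t) (t / s) with h | h <;> rw [h] <;> assumption

lemma mdt_min {t : ℝ} (ht : 0 < t) : ∫⁻ s, ENNReal.ofReal (min (s / t) (t / s)) ∂mdt ≤ 2 := by
  have hm : Measurable fun s => ENNReal.ofReal (min (s / t) (t / s)) := by fun_prop
  rw [← lintegral_add_compl _ (measurableSet_Ioi (a := t))]
  have h1 : ∫⁻ s in Ioi t, ENNReal.ofReal (min (s / t) (t / s)) ∂mdt ≤ 1 := by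
    calc _ ≤ ∫⁻ s in Ioi t, ENNReal.ofReal t * ENNReal.ofReal ((s ^ 1)⁻¹) ∂mdt := by
          refine lintegral_mono fun s => ?_
          simp only
          rw [← ENNReal.ofReal_mul ht.le]
          apply ENNReal.ofReal_le_ofReal
          rw [pow_one, ← div_eq_mul_inv]
          exact min_le_right _ _
      _ ≤ ENNReal.ofReal t * ENNReal.ofReal ((t ^ 1)⁻¹) := by
          rw [lintegral_const_mul _ (by fun_prop)]
          gcongr
          exact mdt_pow one_pos ht
      _ = 1 := by
          rw [← ENNReal.ofReal_mul ht.le, pow_one, mul_inv_cancel₀ ht.ne']; simp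
  have h2 : ∫⁻ s in (Ioi t)ᶜ, ENNReal.ofReal (min (s / t) (t / s)) ∂mdt ≤ 1 := by
    have e : ∫⁻ s in (Ioi t)ᶜ, ENNReal.ofReal (min (s / t) (t / s)) ∂mdt
        = ∫⁻ s in Ioc 0 t, ENNReal.ofReal (min (s / t) (t / s)) ∂mdt := by
      apply setLIntegral_congr
      filter_upwards [mdt_ae_pos] with s hs
      apply propext
      change s ∈ (Ioi t)ᶜ ↔ s ∈ Ioc 0 t
      simp [hs]
    rw [e, mdt_restrict_lintegral measurableSet_Ioc (fun s hs => hs.1) (by fun_prop)]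
    calc _ ≤ ∫⁻ s in Ioc 0 t, ENNReal.ofReal t⁻¹ := by
          refine setLIntegral_mono' measurableSet_Ioc fun s hs => ?_
          rw [← ENNReal.ofReal_mul (by have := hs.1; positivity)]
          apply ENNReal.ofReal_le_ofReal
          calc s⁻¹ * min (s / t) (t / s) ≤ s⁻¹ * (s / t) := by
                have := hs.1
                gcongr; exact min_le_left _ _
            _ = t⁻¹ := by have := hs.1; field_simp
      _ = 1 := by
          simp only [lintegral_const, Measure.restrict_apply_univ, Real.volume_Ioc, sub_zero]
          rw [← ENNReal.ofReal_mul (by positivity), inv_mul_cancel₀ ht.ne']; simp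
  calc _ ≤ (1 : ℝ≥0∞) + 1 := add_le_add h1 h2
    _ = 2 := by norm_num

lemma CZK.l2 {n : ℕ} (hn : 0 < n) {K : Eucl n → ℝ} {C : ℝ} (hK : CZK n K C)
    {a b : ℝ} (ha : 0 < a) {g : Eucl n → ℝ} (hg : Measurable g) (hgi : Integrable g volume)
    {M : ℝ} (hM : ∀ z, |g z| ≤ M) :
    ∫⁻ x, Asq K (Ioo a b) g x ≤
      (ENNReal.ofReal (C ^ 2 * (2 * n + 1)) * om n ^ 2 * 2) * ∫⁻ z, ‖g z‖ₑ ^ 2 := by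
  have hC := hK.nonneg
  have hm := hK.meas
  set I := Ioo a b with hI
  have hIm : MeasurableSet I := measurableSet_Ioo
  set m : Measure (ℝ × Eucl n) := (mdt.restrict I).prod volume with hmdef
  set A : ℝ × Eucl n → Eucl n → ℝ := fun q z => I.indicator (fun t => kd K t (q.2 - z)) q.1 with hA
  set V : ℝ × Eucl n → ℝ := fun q => I.indicator (fun t => cv K t g q.2) q.1 with hV
  have hAm : Measurable (Function.uncurry A) := by
    have h1 : Measurable (fun q : (ℝ × Eucl n) × Eucl n => kd K q.1.1 (q.1.2 - q.2)) :=
      (kd_meas hm).comp (by fun_prop : Measurable fun q : (ℝ × Eucl n) × Eucl n => (q.1.1, q.1.2 - q.2))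
    exact h1.indicator (s := (fun q : (ℝ × Eucl n) × Eucl n => q.1.1) ⁻¹' I) ((measurable_fst.comp measurable_fst) hIm)
  have hVm : Measurable V := by
    exact (cv_meas hm hg).indicator (s := Prod.fst ⁻¹' I) (measurable_fst hIm)
  have hVeq : ∀ q, V q = ∫ z, A q z * g z := by
    intro q
    simp only [hV, hA]
    by_cases hq : q.1 ∈ I
    · simp only [indicator_of_mem hq]; rfl
    · simp only [indicator_of_notMem hq]; simp
  have hA1 : ∀ q, ∫⁻ z, ‖A q z‖ₑ ≤ ENNReal.ofReal C * om n := by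
    intro q
    simp only [hA]
    by_cases hq : q.1 ∈ I
    · simp only [indicator_of_mem hq]
      rw [lintegral_sub_left_eq_self (fun z => ‖kd K q.1 z‖ₑ)]
      exact kd_l1 hm hK.supp hK.bdd (ha.trans hq.1)
    · simp only [indicator_of_notMem hq]; simp
  have hAq : ∀ q, Measurable fun z => ‖A q z‖ₑ := fun q =>
    (hAm.comp (measurable_const.prodMk measurable_id)).enorm
  have hAz : ∀ z, Measurable fun q => ‖A q z‖ₑ := fun z =>
    (hAm.comp (measurable_id.prodMk measurable_const)).enorm
  have hmdt : mdt I ≠ ∞ := (mdt_lt_top ha).ne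
  have hCt : ENNReal.ofReal C * om n ≠ ∞ := ENNReal.mul_ne_top ENNReal.ofReal_ne_top (om_ne_top n)
  have hA2 : ∀ z, ∫⁻ q, ‖A q z‖ₑ ∂m ≤ mdt I * (ENNReal.ofReal C * om n) := by
    intro z
    have hAz : Measurable fun q => ‖A q z‖ₑ :=
      (hAm.comp (measurable_id.prodMk measurable_const)).enorm
    rw [hmdef, lintegral_prod _ hAz.aemeasurable]
    calc _ ≤ ∫⁻ t in I, (ENNReal.ofReal C * om n) ∂mdt := by
          refine setLIntegral_mono' hIm fun t ht => ?_
          simp only [hA, indicator_of_mem ht]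
          rw [lintegral_sub_right_eq_self (fun x => ‖kd K t x‖ₑ)]
          exact kd_l1 hm hK.supp hK.bdd (ha.trans ht.1)
      _ = _ := by simp [mul_comm]
  have hVB : ∀ q, ‖V q‖ₑ ≤ ENNReal.ofReal C * om n * ENNReal.ofReal M := by
    intro q
    rw [hVeq]
    refine (enorm_integral_le_lintegral_enorm _).trans ?_
    calc _ ≤ ∫⁻ z, ‖A q z‖ₑ * ENNReal.ofReal M := by
          refine lintegral_mono fun z => ?_
          simp only
          rw [enorm_mul]
          gcongr
          rw [Real.enorm_eq_ofReal_abs]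
          exact ENNReal.ofReal_le_ofReal (hM z)
      _ ≤ _ := by
          rw [lintegral_mul_const _ (hAq q)]
          gcongr
          exact hA1 q
  have hVi : Integrable V m := by
    refine ⟨hVm.aestronglyMeasurable, ?_⟩
    unfold HasFiniteIntegral
    have hmm : Measurable fun r : (ℝ × Eucl n) × Eucl n => ‖A r.1 r.2 * g r.2‖ₑ :=
      (Measurable.mul hAm (hg.comp measurable_snd)).enorm
    calc _ ≤ ∫⁻ q, ∫⁻ z, ‖A q z * g z‖ₑ ∂volume ∂m := by
          refine lintegral_mono fun q => ?_
          simp only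
          rw [hVeq]
          exact enorm_integral_le_lintegral_enorm _
      _ = ∫⁻ z, ∫⁻ q, ‖A q z * g z‖ₑ ∂m := lintegral_lintegral_swap hmm.aemeasurable
      _ ≤ ∫⁻ z, (mdt I * (ENNReal.ofReal C * om n)) * ‖g z‖ₑ := by
          refine lintegral_mono fun z => ?_
          simp_rw [enorm_mul]
          rw [lintegral_mul_const _ (hAz z)]
          gcongr
          exact hA2 z
      _ = (mdt I * (ENNReal.ofReal C * om n)) * ∫⁻ z, ‖g z‖ₑ := lintegral_const_mul _ hg.enorm
      _ < ∞ := ENNReal.mul_lt_top (ENNReal.mul_lt_top hmdt.lt_top hCt.lt_top) hgi.2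
  have hmain := ttstar m volume hAm hg hgi hVm hVeq hVB (ENNReal.mul_ne_top hCt ENNReal.ofReal_ne_top)
    hVi hA1 hCt hA2 (ENNReal.mul_ne_top hmdt hCt)
    (C := ENNReal.ofReal (C ^ 2 * (2 * n + 1)) * om n ^ 2 * 2) (by
      intro q
      have hAA : Measurable fun r : (ℝ × Eucl n) => ‖∫ z, A q z * A r z‖ₑ := by
        have : Measurable fun r : (ℝ × Eucl n) × Eucl n => A q r.2 * A r.1 r.2 := by
          have h1 : Measurable fun r : (ℝ × Eucl n) × Eucl n => A q r.2 :=
            hAm.comp (measurable_const.prodMk measurable_snd)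
          exact h1.mul hAm
        exact this.stronglyMeasurable.integral_prod_right'.measurable.enorm
      by_cases hq : q.1 ∈ I
      · have hq0 : 0 < q.1 := ha.trans hq.1
        rw [hmdef, lintegral_prod _ hAA.aemeasurable]
        calc _ ≤ ∫⁻ s in I, ENNReal.ofReal (C ^ 2 * (2 * n + 1)) * om n ^ 2
                * ENNReal.ofReal (min (s / q.1) (q.1 / s)) ∂mdt := by
              refine setLIntegral_mono' hIm fun s hs => ?_
              simp only [hA, indicator_of_mem hs, indicator_of_mem hq]
              exact hK.ortho2 hn (ha.trans hs.1) hq0 q.2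
          _ ≤ ∫⁻ s, ENNReal.ofReal (C ^ 2 * (2 * n + 1)) * om n ^ 2
                * ENNReal.ofReal (min (s / q.1) (q.1 / s)) ∂mdt := setLIntegral_le_lintegral _ _
          _ ≤ _ := by
              rw [lintegral_const_mul _ (by fun_prop)]
              gcongr
              exact mdt_min hq0
      · simp only [hA, indicator_of_notMem hq]; simp)
  refine le_trans (le_of_eq ?_) hmain
  rw [hmdef, lintegral_prod_symm _ (hVm.enorm.pow_const 2).aemeasurable]
  refine lintegral_congr fun x => ?_
  unfold Asq
  refine setLIntegral_congr_fun hIm fun t ht => ?_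
  simp only [hV, indicator_of_mem ht]

/-- majorant for smoothness estimates -/
def Nl (n : ℕ) (l : ℝ) (x : Eucl n) : ℝ≥0∞ :=
  ∑' j : ℕ, (ball (0 : Eucl n) (2 ^ j * l)).indicator
    (fun _ => ENNReal.ofReal ((3 / 4) ^ j * ((2 ^ j * l) ^ n)⁻¹)) x

lemma Nl_ge {n : ℕ} {l : ℝ} {x : Eucl n} (j : ℕ) (h : ‖x‖ < 2 ^ j * l) :
    ENNReal.ofReal ((3 / 4) ^ j * ((2 ^ j * l) ^ n)⁻¹) ≤ Nl n l x := by
  unfold Nl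
  refine le_trans ?_ (ENNReal.le_tsum j)
  rw [indicator_of_mem (by simpa using h)]

lemma Nl_meas (n : ℕ) : Measurable (fun q : ℝ × Eucl n => Nl n q.1 q.2) := by
  unfold Nl
  refine Measurable.tsum fun j => ?_
  have h1 : Measurable fun q : ℝ × Eucl n => ENNReal.ofReal ((3 / 4) ^ j * ((2 ^ j * q.1) ^ n)⁻¹) := by
    fun_prop
  have h2 : MeasurableSet {q : ℝ × Eucl n | ‖q.2‖ < 2 ^ j * q.1} :=
    measurableSet_lt (by fun_prop) (by fun_prop)
  have h3 := h1.indicator h2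
  convert h3 using 1
  ext q
  by_cases hq : ‖q.2‖ < 2 ^ j * q.1
  · rw [indicator_of_mem (by simpa using hq), indicator_of_mem (by exact hq)]
  · rw [indicator_of_notMem (by simpa using hq), indicator_of_notMem (by exact hq)]

lemma Nl_meas1 (n : ℕ) (l : ℝ) : Measurable (Nl n l) := by
  unfold Nl
  exact Measurable.tsum fun j => measurable_const.indicator measurableSet_ball

set_option maxHeartbeats 1000000 in
lemma CZK.smooth {n : ℕ} (hn : 0 < n) {K : Eucl n → ℝ} {C : ℝ} (hK : CZK n K C) {D : ℝ} (hD : 1 ≤ D) :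
    ∃ C' : ℝ, 0 ≤ C' ∧ ∀ (l : ℝ), 0 < l → ∀ x y : Eucl n, ‖x - y‖ ≤ D * l →
      ∫⁻ t in Ioi l, ‖kd K t x - kd K t y‖ₑ ^ 2 ∂mdt ≤ (ENNReal.ofReal C' * Nl n l x) ^ 2 := by
  have hC := hK.nonneg
  obtain ⟨J0, hJ0⟩ := pow_unbounded_of_one_lt (2 * D) (one_lt_two)
  refine ⟨2 * C * ((4 / 3) ^ J0 * (2 ^ J0) ^ n) + 2 * C * D * 4 ^ (n + 1), by positivity, ?_⟩
  intro l hl x y hxy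
  have mono : ∀ {c : ℝ} {j : ℕ} {L : ℝ≥0∞}, 0 ≤ c → c ≤ 2 * C * ((4 / 3) ^ J0 * (2 ^ J0) ^ n) + 2 * C * D * 4 ^ (n + 1) →
      ‖x‖ < 2 ^ j * l → L ≤ ENNReal.ofReal ((c * ((3 / 4) ^ j * ((2 ^ j * l) ^ n)⁻¹)) ^ 2) →
      L ≤ (ENNReal.ofReal (2 * C * ((4 / 3) ^ J0 * (2 ^ J0) ^ n) + 2 * C * D * 4 ^ (n + 1)) * Nl n l x) ^ 2 := by
    intro c j L hc0 hc hj hL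
    refine hL.trans ?_
    rw [ENNReal.ofReal_pow (by positivity), ENNReal.ofReal_mul hc0]
    gcongr
    exact Nl_ge j hj
  have pw2 : ∀ t : ℝ, 0 < t → ‖kd K t x - kd K t y‖ₑ ^ 2 ≤ ENNReal.ofReal (4 * C ^ 2) * ENNReal.ofReal ((t ^ (2 * n))⁻¹) := by
    intro t ht
    rw [enorm_sq_eq, ← ENNReal.ofReal_mul (by positivity)]
    apply ENNReal.ofReal_le_ofReal
    have h1 := kd_bdd hK.bdd ht x
    have h2 := kd_bdd hK.bdd ht y
    have h3 : |kd K t x - kd K t y| ≤ 2 * (C * (t ^ n)⁻¹) := by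
      have := abs_sub (kd K t x) (kd K t y)
      linarith
    calc _ = |kd K t x - kd K t y| ^ 2 := (sq_abs _).symm
      _ ≤ (2 * (C * (t ^ n)⁻¹)) ^ 2 := by gcongr
      _ = _ := by rw [mul_comm 2 n, pow_mul, ]; ring
  by_cases hx : ‖x‖ < 2 * D * l
  · -- trivial region
    refine mono (c := 2 * C * ((4 / 3) ^ J0 * (2 ^ J0) ^ n)) (j := J0) (by positivity) (le_add_of_nonneg_right (by positivity)) (hx.trans (by gcongr)) ?_
    calc _ ≤ ∫⁻ t in Ioi l, ENNReal.ofReal (4 * C ^ 2) * ENNReal.ofReal ((t ^ (2 * n))⁻¹) ∂mdt := by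
          refine setLIntegral_mono' measurableSet_Ioi fun t ht => pw2 t (hl.trans ht)
      _ ≤ ENNReal.ofReal (4 * C ^ 2) * ENNReal.ofReal ((l ^ (2 * n))⁻¹) := by
          rw [lintegral_const_mul _ (by fun_prop)]
          gcongr
          exact mdt_pow (by omega) hl
      _ = _ := by
          rw [← ENNReal.ofReal_mul (by positivity)]
          congr 1
          have : (4 / 3 : ℝ) ^ J0 * (3 / 4) ^ J0 = 1 := by rw [← mul_pow]; norm_num
          have h2 : 2 * C * ((4 / 3) ^ J0 * (2 ^ J0) ^ n) * ((3 / 4) ^ J0 * ((2 ^ J0 * l) ^ n)⁻¹)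
              = 2 * C * (l ^ n)⁻¹ := by
            rw [mul_pow, mul_inv]
            calc _ = 2 * C * ((4 / 3 : ℝ) ^ J0 * (3 / 4) ^ J0) * ((2 ^ J0) ^ n * ((2 ^ J0) ^ n)⁻¹) * (l ^ n)⁻¹ := by ring
              _ = _ := by rw [this, mul_inv_cancel₀ (by positivity)]; ring
          rw [h2, mul_comm 2 n, pow_mul]; ring
  · push Not at hx
    set R := ‖x‖ with hR
    have hDl : 0 < D * l := by positivity
    set r := R / 2 with hr
    have hr0 : 0 < r := by rw [hr]; nlinarith
    have hDr : D * l ≤ r := by rw [hr]; linarith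
    have hyr : r ≤ ‖y‖ := by
      have := norm_sub_norm_le x y
      rw [hr]; linarith
    have hxr : r ≤ ‖x‖ := by rw [← hR, hr]; linarith
    set S := Icc (min ‖x‖ ‖y‖) (max ‖x‖ ‖y‖) with hS
    have hlen : volume S ≤ ENNReal.ofReal (D * l) := by
      rw [hS, Real.volume_Icc]
      apply ENNReal.ofReal_le_ofReal
      rw [max_sub_min_eq_abs']
      exact (abs_norm_sub_norm_le x y).trans hxy
    have hSr : S ⊆ Ici r := fun t ht => (le_min hxr hyr).trans ht.1
    have pw : ∀ t : ℝ, 0 < t → ‖kd K t x - kd K t y‖ₑ ^ 2 ≤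
        (Ioi r).indicator (fun t => ENNReal.ofReal ((C * (D * l)) ^ 2) * ENNReal.ofReal ((t ^ (2 * (n + 1)))⁻¹)) t
        + S.indicator (fun _ => ENNReal.ofReal ((C * (r ^ n)⁻¹) ^ 2)) t := by
      intro t ht
      rw [enorm_sq_eq]
      by_cases hxt : ‖x‖ < t <;> by_cases hyt : ‖y‖ < t
      · rw [indicator_of_mem (show t ∈ Ioi r from lt_of_le_of_lt hxr hxt)]
        refine le_trans ?_ le_self_add
        rw [← ENNReal.ofReal_mul (by positivity)]
        apply ENNReal.ofReal_le_ofReal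
        have := kd_lip hK ht hxt hyt
        calc _ = |kd K t x - kd K t y| ^ 2 := (sq_abs _).symm
          _ ≤ (C * ‖x - y‖ * (t ^ (n + 1))⁻¹) ^ 2 := by gcongr
          _ ≤ (C * (D * l) * (t ^ (n + 1))⁻¹) ^ 2 := by gcongr
          _ = _ := by rw [mul_comm 2 (n + 1), pow_mul]; ring
      · push Not at hyt
        have htS : t ∈ S := ⟨(min_le_left _ _).trans hxt.le, hyt.trans (le_max_right _ _)⟩
        rw [indicator_of_mem htS, kd_supp hK.supp ht hyt, sub_zero]
        refine le_trans ?_ le_add_self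
        apply ENNReal.ofReal_le_ofReal
        rw [← sq_abs]
        have := hSr htS
        have := kd_bdd hK.bdd ht x
        calc _ ≤ (C * (t ^ n)⁻¹) ^ 2 := by gcongr
          _ ≤ _ := by gcongr; assumption
      · push Not at hxt
        have htS : t ∈ S := ⟨(min_le_right _ _).trans hyt.le, hxt.trans (le_max_left _ _)⟩
        rw [indicator_of_mem htS, kd_supp hK.supp ht hxt, zero_sub]
        refine le_trans ?_ le_add_self
        apply ENNReal.ofReal_le_ofReal
        rw [← sq_abs, abs_neg]
        have := hSr htS
        have := kd_bdd hK.bdd ht y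
        calc _ ≤ (C * (t ^ n)⁻¹) ^ 2 := by gcongr
          _ ≤ _ := by gcongr; assumption
      · rw [kd_supp hK.supp ht (not_lt.1 hxt), kd_supp hK.supp ht (not_lt.1 hyt)]; simp
    have hRl : 1 ≤ R / l := by
      rw [le_div_iff₀ hl]; nlinarith
    obtain ⟨k, hk1, hk2⟩ := exists_nat_pow_near hRl one_lt_two
    rw [le_div_iff₀ hl] at hk1
    rw [div_lt_iff₀ hl] at hk2
    refine mono (c := 2 * C * D * 4 ^ (n + 1)) (j := k + 1) (by positivity) (le_add_of_nonneg_left (by positivity)) hk2 ?_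
    have hSm : MeasurableSet S := measurableSet_Icc
    have hrk : (2 ^ (k + 1) * l) / 4 ≤ r := by rw [hr, pow_succ]; linarith
    calc _ ≤ ∫⁻ t in Ioi l, ((Ioi r).indicator (fun t => ENNReal.ofReal ((C * (D * l)) ^ 2) * ENNReal.ofReal ((t ^ (2 * (n + 1)))⁻¹)) t
        + S.indicator (fun _ => ENNReal.ofReal ((C * (r ^ n)⁻¹) ^ 2)) t) ∂mdt := by
          refine setLIntegral_mono' measurableSet_Ioi fun t ht => pw t (hl.trans ht)
      _ ≤ ∫⁻ t, ((Ioi r).indicator (fun t => ENNReal.ofReal ((C * (D * l)) ^ 2) * ENNReal.ofReal ((t ^ (2 * (n + 1)))⁻¹)) t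
        + S.indicator (fun _ => ENNReal.ofReal ((C * (r ^ n)⁻¹) ^ 2)) t) ∂mdt := setLIntegral_le_lintegral _ _
      _ = ENNReal.ofReal ((C * (D * l)) ^ 2) * (∫⁻ t in Ioi r, ENNReal.ofReal ((t ^ (2 * (n + 1)))⁻¹) ∂mdt)
          + ENNReal.ofReal ((C * (r ^ n)⁻¹) ^ 2) * mdt S := by
          rw [lintegral_add_right _ (measurable_const.indicator hSm), lintegral_indicator measurableSet_Ioi,
            lintegral_indicator_const hSm, lintegral_const_mul _ (by fun_prop)]
      _ ≤ ENNReal.ofReal ((C * (D * l)) ^ 2) * ENNReal.ofReal ((r ^ (2 * (n + 1)))⁻¹)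
          + ENNReal.ofReal ((C * (r ^ n)⁻¹) ^ 2) * (ENNReal.ofReal r⁻¹ * ENNReal.ofReal (D * l)) := by
          gcongr
          · exact mdt_pow (by omega) hr0
          · exact (mdt_le hSm hr0 hSr).trans (by gcongr)
      _ = ENNReal.ofReal ((C * (D * l)) ^ 2 * (r ^ (2 * (n + 1)))⁻¹ + (C * (r ^ n)⁻¹) ^ 2 * (r⁻¹ * (D * l))) := by
          rw [← ENNReal.ofReal_mul (by positivity), ← ENNReal.ofReal_mul (by positivity),
            ← ENNReal.ofReal_mul (by positivity), ← ENNReal.ofReal_add (by positivity) (by positivity)]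
      _ ≤ _ := by
          apply ENNReal.ofReal_le_ofReal
          set q := 2 ^ (k + 1) * l with hq
          have hq0 : 0 < q := by positivity
          have e1 : (C * (D * l)) ^ 2 * (r ^ (2 * (n + 1)))⁻¹ ≤ C ^ 2 * (r ^ (2 * n + 1))⁻¹ * (D * l) := by
            calc _ = C ^ 2 * (r ^ (2 * n + 1))⁻¹ * (D * l) * ((D * l) / r) := by
                  field_simp
                  ring
              _ ≤ C ^ 2 * (r ^ (2 * n + 1))⁻¹ * (D * l) * 1 := by
                  gcongr
                  rwa [div_le_one hr0]
              _ = _ := by ring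
          have e2 : (C * (r ^ n)⁻¹) ^ 2 * (r⁻¹ * (D * l)) = C ^ 2 * (r ^ (2 * n + 1))⁻¹ * (D * l) := by
            field_simp
            ring
          have e3 : (r ^ (2 * n + 1))⁻¹ ≤ ((q / 4) ^ (2 * n + 1))⁻¹ := by gcongr
          have e4 : ((1:ℝ) / 2) ^ (k + 1) ≤ ((3 / 4) ^ (k + 1)) ^ 2 := by
            rw [← pow_mul, mul_comm, pow_mul]; gcongr; norm_num
          calc _ ≤ 2 * (C ^ 2 * (r ^ (2 * n + 1))⁻¹ * (D * l)) := by rw [e2]; linarith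
            _ ≤ 2 * (C ^ 2 * ((q / 4) ^ (2 * n + 1))⁻¹ * (D * l)) := by gcongr
            _ = 2 * C ^ 2 * D * 4 ^ (2 * n + 1) * (((q ^ n)⁻¹) ^ 2 * (l / q)) := by
                rw [div_pow]
                field_simp
                ring
            _ = 2 * C ^ 2 * D * 4 ^ (2 * n + 1) * (((q ^ n)⁻¹) ^ 2 * (1 / 2) ^ (k + 1)) := by
                congr 2
                rw [hq, one_div, inv_pow]; field_simp
            _ ≤ 4 * C ^ 2 * (D * D) * (4 * 4 ^ (2 * n + 1)) * (((q ^ n)⁻¹) ^ 2 * ((3 / 4) ^ (k + 1)) ^ 2) := by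
                have : (4:ℝ) ^ (2 * n + 1) ≤ 4 * 4 ^ (2 * n + 1) := by
                  have : (0:ℝ) < 4 ^ (2 * n + 1) := by positivity
                  linarith
                have h3 : D ≤ D * D := by nlinarith
                gcongr
                norm_num
            _ = _ := by
                ring

/-- uncentered maximal function -/
def Mx {n : ℕ} (μ : Measure (Eucl n)) (g : Eucl n → ℝ≥0∞) (x : Eucl n) : ℝ≥0∞ :=
  ⨆ (q : Eucl n × ℝ) (_ : 0 < q.2 ∧ x ∈ ball q.1 q.2),
    (μ (ball q.1 q.2))⁻¹ * ∫⁻ y in ball q.1 q.2, g y ∂μ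

/-- doubling measures -/
structure Dbl {n : ℕ} (μ : Measure (Eucl n)) (Cd : ℝ≥0∞) : Prop where
  pos : ∀ (x : Eucl n) (r : ℝ), 0 < r → μ (ball x r) ≠ 0
  fin : ∀ (x : Eucl n) (r : ℝ), μ (ball x r) ≠ ∞
  ct : Cd ≠ ∞
  dbl : ∀ (x : Eucl n) (r : ℝ), 0 < r → μ (ball x (6 * r)) ≤ Cd * μ (ball x r)

lemma Mx_lt_iff {n : ℕ} {μ : Measure (Eucl n)} {g : Eucl n → ℝ≥0∞} {x : Eucl n} {l : ℝ≥0∞} :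
    l < Mx μ g x ↔ ∃ q : Eucl n × ℝ, (0 < q.2 ∧ x ∈ ball q.1 q.2) ∧
      l < (μ (ball q.1 q.2))⁻¹ * ∫⁻ y in ball q.1 q.2, g y ∂μ := by
  unfold Mx
  simp only [lt_iSup_iff, exists_prop]

lemma le_Mx {n : ℕ} (μ : Measure (Eucl n)) (g : Eucl n → ℝ≥0∞) {x c : Eucl n} {r : ℝ} (hr : 0 < r)
    (hx : x ∈ ball c r) : (μ (ball c r))⁻¹ * ∫⁻ y in ball c r, g y ∂μ ≤ Mx μ g x := by
  unfold Mx
  exact le_iSup₂_of_le (c, r) ⟨hr, hx⟩ le_rfl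

lemma lint_le_Mx {n : ℕ} {μ : Measure (Eucl n)} {Cd : ℝ≥0∞} (hμ : Dbl μ Cd) (g : Eucl n → ℝ≥0∞)
    {x c : Eucl n} {r : ℝ} (hr : 0 < r)
    (hx : x ∈ ball c r) : ∫⁻ y in ball c r, g y ∂μ ≤ μ (ball c r) * Mx μ g x := by
  have := le_Mx μ g hr hx
  rwa [mul_comm, ← div_eq_mul_inv, ENNReal.div_le_iff_le_mul (Or.inl (hμ.pos _ _ hr)) (Or.inl (hμ.fin _ _)), mul_comm] at this

lemma Mx_open {n : ℕ} (μ : Measure (Eucl n)) (g : Eucl n → ℝ≥0∞) (l : ℝ≥0∞) :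
    IsOpen {x | l < Mx μ g x} := by
  have : {x | l < Mx μ g x} = ⋃ q ∈ {q : Eucl n × ℝ | 0 < q.2 ∧
      l < (μ (ball q.1 q.2))⁻¹ * ∫⁻ y in ball q.1 q.2, g y ∂μ}, ball q.1 q.2 := by
    ext x
    simp only [mem_ofPred_eq, Mx_lt_iff, mem_iUnion, exists_prop]
    constructor
    · rintro ⟨q, ⟨h1, h2⟩, h3⟩; exact ⟨q, ⟨h1, h3⟩, h2⟩
    · rintro ⟨q, ⟨h1, h3⟩, h2⟩; exact ⟨q, ⟨h1, h2⟩, h3⟩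
  rw [this]
  exact isOpen_biUnion fun q _ => isOpen_ball

lemma Mx_meas {n : ℕ} (μ : Measure (Eucl n)) (g : Eucl n → ℝ≥0∞) : Measurable (Mx μ g) :=
  measurable_of_Ioi fun l => (Mx_open μ g l).measurableSet

lemma Mx_weak {n : ℕ} {μ : Measure (Eucl n)} {Cd : ℝ≥0∞} (hμ : Dbl μ Cd)
    (g : Eucl n → ℝ≥0∞) (l : ℝ≥0∞) : l * μ {x | l < Mx μ g x} ≤ Cd * ∫⁻ y, g y ∂μ := by
  set F : ℕ → Set (Eucl n × ℝ) := fun N => {q | 0 < q.2 ∧ q.2 ≤ N ∧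
      l < (μ (ball q.1 q.2))⁻¹ * ∫⁻ y in ball q.1 q.2, g y ∂μ} with hF
  have hU : {x | l < Mx μ g x} = ⋃ N : ℕ, ⋃ q ∈ F N, ball q.1 q.2 := by
    ext x
    simp only [mem_ofPred_eq, Mx_lt_iff, mem_iUnion, exists_prop, hF]
    constructor
    · rintro ⟨q, ⟨h1, h2⟩, h3⟩
      obtain ⟨N, hN⟩ := exists_nat_ge q.2
      exact ⟨N, q, ⟨h1, hN, h3⟩, h2⟩
    · rintro ⟨N, q, ⟨h1, h3, h4⟩, h2⟩; exact ⟨q, ⟨h1, h2⟩, h4⟩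
  have hmono : Monotone fun N : ℕ => ⋃ q ∈ F N, ball q.1 q.2 := by
    intro N M hNM
    apply biUnion_subset_biUnion_left
    rintro q ⟨h1, h2, h3⟩
    exact ⟨h1, h2.trans (by exact_mod_cast hNM), h3⟩
  rw [hU, hmono.measure_iUnion, ENNReal.mul_iSup]
  refine iSup_le fun N => ?_
  obtain ⟨u, hu, hdisj, hcov⟩ := Vitali.exists_disjoint_subfamily_covering_enlargement_closedBall
    (F N) (fun q => q.1) (fun q => q.2) N (fun q hq => hq.2.1) 5 (by norm_num)
  have hcount : u.Countable := by
    refine hdisj.countable_of_nonempty_interior fun q hq => ?_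
    exact ⟨q.1, mem_interior.2 ⟨ball q.1 q.2, ball_subset_closedBall, isOpen_ball,
      mem_ball_self (hu hq).1⟩⟩
  have hdisj' : u.PairwiseDisjoint fun q : Eucl n × ℝ => ball q.1 q.2 :=
    hdisj.mono_on fun q _ => ball_subset_closedBall
  have hsub : (⋃ q ∈ F N, ball q.1 q.2) ⊆ ⋃ q ∈ u, ball q.1 (6 * q.2) := by
    intro x hx
    simp only [mem_iUnion, exists_prop] at hx ⊢
    obtain ⟨q, hq, hxq⟩ := hx
    obtain ⟨b, hb, hqb⟩ := hcov q hq
    refine ⟨b, hb, ?_⟩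
    have := hqb (ball_subset_closedBall hxq)
    have hb0 := (hu hb).1
    exact closedBall_subset_ball (by linarith) this
  calc l * μ (⋃ q ∈ F N, ball q.1 q.2) ≤ l * ∑' q : u, μ (ball q.1.1 (6 * q.1.2)) := by
        gcongr
        exact (measure_mono hsub).trans (measure_biUnion_le _ hcount _)
    _ ≤ ∑' q : u, Cd * ∫⁻ y in ball q.1.1 q.1.2, g y ∂μ := by
        rw [← ENNReal.tsum_mul_left]
        refine ENNReal.tsum_le_tsum fun q => ?_
        have hq := hu q.2
        calc l * μ (ball q.1.1 (6 * q.1.2)) ≤ l * (Cd * μ (ball q.1.1 q.1.2)) := by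
              gcongr; exact hμ.dbl _ _ hq.1
          _ = Cd * (l * μ (ball q.1.1 q.1.2)) := by ring
          _ ≤ _ := by
              gcongr
              have h3 := hq.2.2
              rw [mul_comm, ← div_eq_mul_inv, ENNReal.lt_div_iff_mul_lt (Or.inl (hμ.pos _ _ hq.1)) (Or.inl (hμ.fin _ _))] at h3
              exact h3.le
    _ = Cd * ∫⁻ y in ⋃ q ∈ u, ball q.1 q.2, g y ∂μ := by
        rw [ENNReal.tsum_mul_left, lintegral_biUnion hcount (fun _ _ => measurableSet_ball) hdisj']
    _ ≤ _ := mul_le_mul_right (setLIntegral_le_lintegral _ _) _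

lemma Mx_weak2 {n : ℕ} {μ : Measure (Eucl n)} {Cd : ℝ≥0∞} (hμ : Dbl μ Cd)
    {g : Eucl n → ℝ≥0∞} (hg : Measurable g) (l : ℝ≥0∞) :
    l * μ {x | l < Mx μ g x} ≤ 2 * Cd * ∫⁻ y, {y | l < 2 * g y}.indicator g y ∂μ := by
  set g1 := {y | l < 2 * g y}.indicator g with hg1
  have hsub : {x | l < Mx μ g x} ⊆ {x | l / 2 < Mx μ g1 x} := by
    intro x hx
    simp only [mem_ofPred_eq, Mx_lt_iff] at hx ⊢
    obtain ⟨q, hq, h⟩ := hx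
    refine ⟨q, hq, ?_⟩
    by_contra hc
    push Not at hc
    have hg2 : ∀ y, g y ≤ g1 y + l / 2 := by
      intro y
      by_cases hy : l < 2 * g y
      · simp only [hg1, indicator_of_mem (show y ∈ {y | l < 2 * g y} from hy)]
        exact le_self_add
      · push Not at hy
        refine le_trans ?_ le_add_self
        rw [ENNReal.le_div_iff_mul_le (by simp) (by simp), mul_comm]; exact hy
    have : (μ (ball q.1 q.2))⁻¹ * ∫⁻ y in ball q.1 q.2, g y ∂μ ≤ l := by
      calc _ ≤ (μ (ball q.1 q.2))⁻¹ * ∫⁻ y in ball q.1 q.2, (g1 y + l / 2) ∂μ := by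
            gcongr with y; exact hg2 y
        _ = (μ (ball q.1 q.2))⁻¹ * (∫⁻ y in ball q.1 q.2, g1 y ∂μ) + l / 2 := by
            rw [lintegral_add_right _ measurable_const, mul_add, lintegral_const,
              Measure.restrict_apply_univ, mul_comm (l / 2), ← mul_assoc,
              ENNReal.inv_mul_cancel (hμ.pos _ _ hq.1) (hμ.fin _ _), one_mul]
        _ ≤ l / 2 + l / 2 := by gcongr
        _ = l := ENNReal.add_halves l
    exact absurd h (not_lt.2 this)
  calc _ = 2 * (l / 2 * μ {x | l < Mx μ g x}) := by
        rw [← mul_assoc, ENNReal.mul_div_cancel (by simp) (by simp)]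
    _ ≤ 2 * (l / 2 * μ {x | l / 2 < Mx μ g1 x}) := by gcongr
    _ ≤ 2 * (Cd * ∫⁻ y, g1 y ∂μ) := by gcongr 2 * ?_; exact Mx_weak hμ g1 _
    _ = _ := by ring

lemma cake (a : ℝ≥0∞) {s : ℝ} (hs : 0 < s) :
    ∫⁻ t in Ioi (0:ℝ), {t : ℝ | ENNReal.ofReal t < a}.indicator (fun t => ENNReal.ofReal (s * t ^ (s - 1))) t
      = a ^ s := by
  have fin : ∀ b : ℝ, 0 ≤ b → ∫⁻ t in Ioi (0:ℝ), {t : ℝ | ENNReal.ofReal t < ENNReal.ofReal b}.indicator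
      (fun t => ENNReal.ofReal (s * t ^ (s - 1))) t = ENNReal.ofReal b ^ s := by
    intro b hb
    have e : ∀ t ∈ Ioi (0:ℝ), {t : ℝ | ENNReal.ofReal t < ENNReal.ofReal b}.indicator
      (fun t => ENNReal.ofReal (s * t ^ (s - 1))) t = (Iio b).indicator (fun t => ENNReal.ofReal (s * t ^ (s - 1))) t := by
      intro t ht
      by_cases h : t < b
      · rw [indicator_of_mem (show t ∈ Iio b from h), indicator_of_mem]
        exact (ENNReal.ofReal_lt_ofReal_iff_of_nonneg (le_of_lt ht)).2 h
      · rw [indicator_of_notMem (show t ∉ Iio b from h), indicator_of_notMem]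
        intro h2
        exact h ((ENNReal.ofReal_lt_ofReal_iff_of_nonneg (le_of_lt ht)).1 h2)
    rw [setLIntegral_congr_fun measurableSet_Ioi e, setLIntegral_indicator measurableSet_Iio,
      Iio_inter_Ioi, setLIntegral_congr Ioo_ae_eq_Ioc]
    have hintg : IntervalIntegrable (fun t : ℝ => s * t ^ (s - 1)) volume 0 b :=
      (intervalIntegral.intervalIntegrable_rpow' (by linarith)).const_mul _
    rw [← ofReal_integral_eq_lintegral_ofReal ((intervalIntegrable_iff_integrableOn_Ioc_of_le hb).1 hintg),
      ← intervalIntegral.integral_of_le hb, intervalIntegral.integral_const_mul, integral_rpow (Or.inl (by linarith)),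
      ENNReal.ofReal_rpow_of_nonneg hb hs.le]
    · rw [sub_add_cancel, Real.zero_rpow hs.ne']; congr 1; field_simp; ring
    · refine (ae_restrict_mem measurableSet_Ioc).mono fun t ht => ?_
      have := ht.1
      simp only [Pi.zero_apply]; positivity
  rcases eq_or_ne a ∞ with rfl | ha
  · rw [ENNReal.top_rpow_of_pos hs]
    refine eq_top_iff.2 ?_
    have h2 : ∀ N : ℕ, (N : ℝ≥0∞) ≤ ∫⁻ t in Ioi (0:ℝ), {t : ℝ | ENNReal.ofReal t < ∞}.indicator
        (fun t => ENNReal.ofReal (s * t ^ (s - 1))) t := by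
      intro N
      have hb : (0:ℝ) ≤ (N:ℝ) ^ (1/s) := by positivity
      have := fin _ hb
      rw [ENNReal.ofReal_rpow_of_nonneg hb hs.le, ← Real.rpow_mul (by positivity), one_div,
        inv_mul_cancel₀ hs.ne', Real.rpow_one, ENNReal.ofReal_natCast] at this
      rw [← this]
      refine lintegral_mono fun t => ?_
      apply indicator_le_indicator_of_subset _ (fun _ => zero_le)
      intro t ht
      exact ENNReal.ofReal_lt_top
    refine ENNReal.le_of_forall_nnreal_lt fun r _ => ?_
    obtain ⟨N, hN⟩ := exists_nat_ge r
    exact le_trans (by exact_mod_cast hN) (h2 N)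
  · have := fin a.toReal ENNReal.toReal_nonneg
    rwa [ENNReal.ofReal_toReal ha] at this

lemma Mx_strong {n : ℕ} {μ : Measure (Eucl n)} [SFinite μ] {Cd : ℝ≥0∞} (hμ : Dbl μ Cd) {p : ℝ} (hp : 1 < p) :
    ∃ C : ℝ≥0∞, C ≠ ∞ ∧ ∀ g : Eucl n → ℝ≥0∞, Measurable g →
      ∫⁻ x, Mx μ g x ^ p ∂μ ≤ C * ∫⁻ x, g x ^ p ∂μ := by
  have hp0 : 0 < p := by linarith
  have hp1 : 0 < p - 1 := by linarith
  refine ⟨2 * Cd * (ENNReal.ofReal (p / (p - 1)) * 2 ^ (p - 1)), ?_, ?_⟩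
  · refine ENNReal.mul_ne_top (ENNReal.mul_ne_top (by simp) hμ.ct) (ENNReal.mul_ne_top (by simp) ?_)
    exact ENNReal.rpow_ne_top_of_nonneg hp1.le (by simp)
  intro g hg
  have hM := Mx_meas μ g
  have meas1 : ∀ (f : Eucl n → ℝ≥0∞) (s : ℝ) (k : Eucl n → ℝ≥0∞), Measurable f → Measurable k →
      Measurable (Function.uncurry fun (x : Eucl n) (t : ℝ) =>
        k x * {t : ℝ | ENNReal.ofReal t < f x}.indicator (fun t => ENNReal.ofReal (s * t ^ (s - 1))) t) := by
    intro f s k hf hk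
    have h1 : MeasurableSet {q : Eucl n × ℝ | ENNReal.ofReal q.2 < f q.1} :=
      measurableSet_lt (by fun_prop) (by fun_prop)
    have h2 : Measurable fun q : Eucl n × ℝ => ENNReal.ofReal (s * q.2 ^ (s - 1)) := by fun_prop
    exact (hk.comp measurable_fst).mul (h2.indicator h1)
  have hk1 : ∫⁻ x, Mx μ g x ^ p ∂μ = ∫⁻ t in Ioi (0:ℝ), ENNReal.ofReal (p * t ^ (p - 1)) *
      μ {x | ENNReal.ofReal t < Mx μ g x} := by
    calc _ = ∫⁻ x, (∫⁻ t in Ioi (0:ℝ), 1 * {t : ℝ | ENNReal.ofReal t < Mx μ g x}.indicator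
          (fun t => ENNReal.ofReal (p * t ^ (p - 1))) t) ∂μ := by
          simp_rw [one_mul, cake _ hp0]
      _ = ∫⁻ t in Ioi (0:ℝ), ∫⁻ x, 1 * {t : ℝ | ENNReal.ofReal t < Mx μ g x}.indicator
          (fun t => ENNReal.ofReal (p * t ^ (p - 1))) t ∂μ :=
          lintegral_lintegral_swap (meas1 _ _ (fun _ => 1) hM measurable_const).aemeasurable
      _ = _ := by
          refine lintegral_congr fun t => ?_
          rw [← lintegral_indicator_const (measurableSet_lt measurable_const hM)]
          refine lintegral_congr fun x => ?_
          rw [one_mul]; rfl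
  rw [hk1]
  calc _ ≤ ∫⁻ t in Ioi (0:ℝ), ∫⁻ x, (2 * Cd * ENNReal.ofReal (p / (p - 1)) * g x) *
          {t : ℝ | ENNReal.ofReal t < 2 * g x}.indicator
          (fun t => ENNReal.ofReal ((p - 1) * t ^ ((p - 1) - 1))) t ∂μ := by
        refine setLIntegral_mono' measurableSet_Ioi fun t ht => ?_
        have ht0 : 0 < t := ht
        have hw := Mx_weak2 hμ hg (ENNReal.ofReal t)
        have hset : MeasurableSet {y | ENNReal.ofReal t < 2 * g y} :=
          measurableSet_lt measurable_const (hg.const_mul _)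
        calc _ = ENNReal.ofReal (p * t ^ ((p - 1) - 1)) * (ENNReal.ofReal t * μ {x | ENNReal.ofReal t < Mx μ g x}) := by
              rw [← mul_assoc, ← ENNReal.ofReal_mul (by positivity), mul_assoc p,
                ← Real.rpow_add_one ht0.ne']
              congr 4; ring
          _ ≤ ENNReal.ofReal (p * t ^ ((p - 1) - 1)) * (2 * Cd * ∫⁻ y, {y | ENNReal.ofReal t < 2 * g y}.indicator g y ∂μ) := by
              gcongr
          _ = ∫⁻ y, (ENNReal.ofReal (p * t ^ ((p - 1) - 1)) * (2 * Cd)) * {y | ENNReal.ofReal t < 2 * g y}.indicator g y ∂μ := by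
              rw [lintegral_const_mul _ (hg.indicator hset)]; ring
          _ = _ := by
              refine lintegral_congr fun y => ?_
              by_cases hy : ENNReal.ofReal t < 2 * g y
              · rw [indicator_of_mem (show y ∈ {y | ENNReal.ofReal t < 2 * g y} from hy),
                  indicator_of_mem (show t ∈ {t | ENNReal.ofReal t < 2 * g y} from hy)]
                have : p * t ^ ((p - 1) - 1) = (p / (p - 1)) * ((p - 1) * t ^ ((p - 1) - 1)) := by
                  field_simp
                rw [this, ENNReal.ofReal_mul (by positivity)]
                ring
              · rw [indicator_of_notMem (show y ∉ {y | ENNReal.ofReal t < 2 * g y} from hy),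
                  indicator_of_notMem (show t ∉ {t | ENNReal.ofReal t < 2 * g y} from hy)]
                simp
    _ = ∫⁻ x, (∫⁻ t in Ioi (0:ℝ), (2 * Cd * ENNReal.ofReal (p / (p - 1)) * g x) *
          {t : ℝ | ENNReal.ofReal t < 2 * g x}.indicator
          (fun t => ENNReal.ofReal ((p - 1) * t ^ ((p - 1) - 1))) t) ∂μ := by
        exact (lintegral_lintegral_swap (meas1 (fun x => 2 * g x) (p - 1) (fun x => 2 * Cd * ENNReal.ofReal (p / (p - 1)) * g x)
          (by fun_prop) (by fun_prop)).aemeasurable).symm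
    _ = ∫⁻ x, (2 * Cd * (ENNReal.ofReal (p / (p - 1)) * 2 ^ (p - 1))) * g x ^ p ∂μ := by
        refine lintegral_congr fun x => ?_
        rw [lintegral_const_mul, cake _ hp1, ENNReal.mul_rpow_of_nonneg _ _ hp1.le]
        · have : g x ^ p = g x * g x ^ (p - 1) := by
            nth_rewrite 2 [← ENNReal.rpow_one (g x)]
            rw [← ENNReal.rpow_add_of_nonneg _ _ zero_le_one hp1.le]
            congr 1; ring
          rw [this]; ring
        · have h1 : MeasurableSet {t : ℝ | ENNReal.ofReal t < 2 * g x} :=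
            measurableSet_lt (by fun_prop) (by fun_prop)
          exact Measurable.indicator (by fun_prop) h1
    _ = _ := by rw [lintegral_const_mul _ (by fun_prop)]

lemma Dbl_volume (n : ℕ) : Dbl (volume : Measure (Eucl n)) (ENNReal.ofReal (6 ^ n)) where
  pos x r hr := (measure_ball_pos _ _ hr).ne'
  fin x r := measure_ball_lt_top.ne
  ct := ENNReal.ofReal_ne_top
  dbl x r hr := by
    rw [vol_ball _ (by positivity), vol_ball _ hr, mul_pow, ENNReal.ofReal_mul (by positivity), mul_assoc]

lemma Nl_conv {n : ℕ} {g : Eucl n → ℝ≥0∞} (hg : Measurable g) {l : ℝ} (hl : 0 < l) (x : Eucl n) :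
    ∫⁻ z, Nl n l (x - z) * g z ≤ 4 * om n * Mx volume g x := by
  have hgeo : ∑' j : ℕ, ENNReal.ofReal ((3 / 4 : ℝ) ^ j) = 4 := by
    rw [← ENNReal.ofReal_tsum_of_nonneg (by intro j; positivity) (summable_geometric_of_lt_one (by norm_num) (by norm_num)),
      tsum_geometric_of_lt_one (by norm_num) (by norm_num)]
    norm_num
  unfold Nl
  simp_rw [← ENNReal.tsum_mul_right]
  have hind : ∀ (j : ℕ) (z : Eucl n), (ball (0 : Eucl n) (2 ^ j * l)).indicator
    (fun _ => ENNReal.ofReal ((3 / 4) ^ j * ((2 ^ j * l) ^ n)⁻¹)) (x - z) * g z =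
    ENNReal.ofReal ((3 / 4) ^ j * ((2 ^ j * l) ^ n)⁻¹) * (ball x (2 ^ j * l)).indicator g z := by
    intro j z
    by_cases h : z ∈ ball x (2 ^ j * l)
    · rw [indicator_of_mem h, indicator_of_mem]
      rw [mem_ball_zero_iff, ← dist_eq_norm, dist_comm]; exact h
    · rw [indicator_of_notMem h, indicator_of_notMem]
      · simp
      · rw [mem_ball_zero_iff, ← dist_eq_norm, dist_comm]; exact h
  simp_rw [hind]
  rw [lintegral_tsum (fun j => ((hg.indicator measurableSet_ball).const_mul _).aemeasurable)]
  calc _ ≤ ∑' j : ℕ, ENNReal.ofReal ((3 / 4 : ℝ) ^ j) * (om n * Mx volume g x) := by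
        refine ENNReal.tsum_le_tsum fun j => ?_
        have hr : 0 < 2 ^ j * l := by positivity
        rw [lintegral_const_mul _ (hg.indicator measurableSet_ball), lintegral_indicator measurableSet_ball]
        have := lint_le_Mx (Dbl_volume n) g hr (mem_ball_self hr (x := x))
        rw [vol_ball _ hr] at this
        calc _ ≤ ENNReal.ofReal ((3 / 4) ^ j * ((2 ^ j * l) ^ n)⁻¹) *
              (ENNReal.ofReal ((2 ^ j * l) ^ n) * om n * Mx volume g x) := by gcongr
          _ = ENNReal.ofReal ((3 / 4) ^ j) * (ENNReal.ofReal (((2 ^ j * l) ^ n)⁻¹) * ENNReal.ofReal ((2 ^ j * l) ^ n)) *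
              (om n * Mx volume g x) := by rw [ENNReal.ofReal_mul (by positivity)]; ring
          _ = _ := by
              rw [← ENNReal.ofReal_mul (by positivity), inv_mul_cancel₀ (by positivity)]; simp
    _ = _ := by rw [ENNReal.tsum_mul_right, hgeo]; ring

lemma Nl_int {n : ℕ} {l : ℝ} (hl : 0 < l) (z : Eucl n) :
    ∫⁻ x, Nl n l (x - z) ≤ 4 * om n := by
  rw [lintegral_sub_right_eq_self (Nl n l)]
  rw [← lintegral_sub_left_eq_self (Nl n l) (0 : Eucl n)]
  have h := Nl_conv (g := fun _ => 1) measurable_const hl (0 : Eucl n)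
  simp only [mul_one] at h
  refine h.trans ?_
  calc _ ≤ 4 * om n * 1 := by
        gcongr
        unfold Mx
        refine iSup₂_le fun q hq => ?_
        simp only [lintegral_const, Measure.restrict_apply_univ, one_mul]
        exact ENNReal.inv_mul_le_one _
    _ = _ := mul_one _

/-- dyadic index -/
def idx {n : ℕ} (k : ℤ) (x : Eucl n) : Fin n → ℤ := fun i => ⌊x i * (2:ℝ) ^ (-k)⌋

/-- dyadic cube of scale `2^k` containing `x` -/
def Qd {n : ℕ} (k : ℤ) (x : Eucl n) : Set (Eucl n) := {y | idx k y = idx k x}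

lemma idx_meas {n : ℕ} (k : ℤ) : Measurable (idx k : Eucl n → Fin n → ℤ) := by
  unfold idx
  refine measurable_pi_lambda _ fun i => ?_
  have : Measurable fun x : Eucl n => x i * (2:ℝ) ^ (-k) := by fun_prop
  exact Int.measurable_floor.comp this

lemma idx_measSet {n : ℕ} (k : ℤ) (A : Set (Fin n → ℤ)) : MeasurableSet {y : Eucl n | idx k y ∈ A} :=
  idx_meas k (MeasurableSet.of_discrete)

lemma Qd_meas {n : ℕ} (k : ℤ) (x : Eucl n) : MeasurableSet (Qd k x) :=
  idx_measSet k {idx k x}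

lemma Qd_self {n : ℕ} (k : ℤ) (x : Eucl n) : x ∈ Qd k x := rfl

lemma idx_succ {n : ℕ} (k : ℤ) {x y : Eucl n} (h : idx k y = idx k x) : idx (k + 1) y = idx (k + 1) x := by
  funext i
  have hi := congrFun h i
  simp only [idx] at hi ⊢
  have key : ∀ a : ℝ, ⌊a * (2:ℝ) ^ (-(k+1))⌋ = ⌊a * (2:ℝ) ^ (-k)⌋ / 2 := by
    intro a
    have : a * (2:ℝ) ^ (-(k+1)) = (a * (2:ℝ) ^ (-k)) / (2:ℕ) := by
      rw [neg_add, zpow_add₀ two_ne_zero]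
      norm_num [div_eq_mul_inv]; ring
    rw [this, Int.floor_div_natCast]; norm_num
  rw [key, key, hi]

lemma idx_mono {n : ℕ} {k l : ℤ} (hkl : k ≤ l) {x y : Eucl n} (h : idx k y = idx k x) :
    idx l y = idx l x := by
  induction l, hkl using Int.le_induction with
  | base => exact h
  | succ m hm ih => exact idx_succ m ih

lemma Qd_mono {n : ℕ} {k l : ℤ} (hkl : k ≤ l) (x : Eucl n) : Qd k x ⊆ Qd l x :=
  fun _ hy => idx_mono hkl hy

lemma Qd_eq {n : ℕ} {k : ℤ} {x y : Eucl n} (h : idx k y = idx k x) : Qd k y = Qd k x := by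
  unfold Qd; rw [h]

lemma idx_dist {n : ℕ} {k : ℤ} {x y : Eucl n} (h : idx k y = idx k x) : ‖y - x‖ ≤ n * (2:ℝ) ^ k := by
  have h2 : (0:ℝ) < 2 ^ k := by positivity
  have hc : ∀ i, |y i - x i| ≤ (2:ℝ) ^ k := by
    intro i
    have hi := congrFun h i
    simp only [idx] at hi
    have := Int.abs_sub_lt_one_of_floor_eq_floor hi
    rw [← sub_mul, abs_mul, abs_of_pos (by positivity : (0:ℝ) < 2 ^ (-k)), zpow_neg, ← div_eq_mul_inv, div_lt_one h2] at this
    exact this.le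
  rw [EuclideanSpace.norm_eq]
  have h1 : ∑ i, ‖(y - x) i‖ ^ 2 ≤ (n * (2:ℝ) ^ k) ^ 2 := by
    calc _ ≤ ∑ i : Fin n, ((2:ℝ) ^ k) ^ 2 := by
          refine Finset.sum_le_sum fun i _ => ?_
          have := hc i
          rw [PiLp.sub_apply, Real.norm_eq_abs]
          gcongr
      _ = n * ((2:ℝ) ^ k) ^ 2 := by simp
      _ ≤ _ := by
        rw [mul_pow]
        gcongr
        rcases Nat.eq_zero_or_pos n with h | h
        · simp [h]
        · exact le_self_pow₀ (by exact_mod_cast h) two_ne_zero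
  calc _ ≤ √((n * (2:ℝ) ^ k) ^ 2) := Real.sqrt_le_sqrt h1
    _ = _ := Real.sqrt_sq (by positivity)

lemma Qd_sub_ball {n : ℕ} {k : ℤ} (x : Eucl n) {r : ℝ} (hr : n * (2:ℝ) ^ k < r) : Qd k x ⊆ ball x r := by
  intro y hy
  rw [mem_ball, dist_eq_norm]
  exact (idx_dist hy).trans_lt hr

/-- volume of a cube -/
lemma Qd_vol {n : ℕ} (k : ℤ) (x : Eucl n) : volume (Qd k x) = ENNReal.ofReal (((2:ℝ) ^ k) ^ n) := by
  have h2 : (0:ℝ) < 2 ^ k := by positivity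
  have hset : Qd k x = (MeasurableEquiv.toLp 2 (Fin n → ℝ)).symm ⁻¹'
      (Set.pi univ fun i => Ico ((idx k x i : ℝ) * 2 ^ k) ((idx k x i + 1) * 2 ^ k)) := by
    ext y
    simp only [Qd, mem_ofPred_eq, mem_preimage, Set.mem_pi, mem_univ, forall_true_left, mem_Ico, funext_iff]
    refine forall_congr' fun i => ?_
    generalize idx k x i = m
    unfold idx
    rw [Int.floor_eq_iff, zpow_neg, ← div_eq_mul_inv, le_div_iff₀ h2, div_lt_iff₀ h2]
    rfl
  rw [hset, (EuclideanSpace.volume_preserving_symm_measurableEquiv_toLp (Fin n)).measure_preimage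
    (MeasurableSet.univ_pi fun i => measurableSet_Ico).nullMeasurableSet, volume_pi_pi]
  simp only [Real.volume_Ico]
  have : ∀ i, ((idx k x i : ℝ) + 1) * 2 ^ k - idx k x i * 2 ^ k = 2 ^ k := by intro i; ring
  simp only [this, Finset.prod_const, Finset.card_univ, Fintype.card_fin]
  rw [ENNReal.ofReal_pow h2.le]

/-- lintegral comparison along a countable partition -/
lemma part_lintegral {n : ℕ} {ι : Type*} [Countable ι] [MeasurableSpace ι] [MeasurableSingletonClass ι]
    {L : Eucl n → ι} (hL : Measurable L) (μ : Measure (Eucl n)) (F : Eucl n → ℝ≥0∞) :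
    ∫⁻ x, F x ∂μ = ∑' i, ∫⁻ x in L ⁻¹' {i}, F x ∂μ := by
  rw [← lintegral_iUnion (fun i => hL (measurableSet_singleton i)) ?_]
  · have : ⋃ i, L ⁻¹' {i} = univ := by ext x; simp
    rw [this, Measure.restrict_univ]
  · intro i j hij
    refine Set.disjoint_left.2 fun x hi hj => hij ?_
    simp only [mem_preimage, mem_singleton_iff] at hi hj
    rw [← hi, hj]

lemma part_le {n : ℕ} {ι : Type*} [Countable ι] [MeasurableSpace ι] [MeasurableSingletonClass ι]
    {L : Eucl n → ι} (hL : Measurable L) (μ : Measure (Eucl n)) {F G : Eucl n → ℝ≥0∞}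
    (h : ∀ x, ∫⁻ y in {y | L y = L x}, F y ∂μ ≤ ∫⁻ y in {y | L y = L x}, G y ∂μ) :
    ∫⁻ x, F x ∂μ ≤ ∫⁻ x, G x ∂μ := by
  rw [part_lintegral hL μ F, part_lintegral hL μ G]
  refine ENNReal.tsum_le_tsum fun i => ?_
  by_cases hi : ∃ x, L x = i
  · obtain ⟨x, rfl⟩ := hi
    exact h x
  · have : L ⁻¹' {i} = ∅ := by
      ext x; simp only [mem_preimage, mem_singleton_iff, mem_empty_iff_false, iff_false]
      exact fun hx => hi ⟨x, hx⟩
    simp [this]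

lemma part_zero {n : ℕ} {ι : Type*} [Countable ι] [MeasurableSpace ι] [MeasurableSingletonClass ι]
    {L : Eucl n → ι} (hL : Measurable L) {F : Eucl n → ℝ} (hF : Integrable F volume)
    (h : ∀ x, ∫ y in {y | L y = L x}, F y = 0) :
    ∫ x, F x = 0 := by
  have hU : ⋃ i, L ⁻¹' {i} = univ := by ext x; simp
  rw [← setIntegral_univ, ← hU, integral_iUnion (fun i => hL (measurableSet_singleton i)) ?_ hF.integrableOn]
  · rw [← tsum_zero (β := ι)]
    congr 1; funext i
    by_cases hi : ∃ x, L x = i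
    · obtain ⟨x, rfl⟩ := hi
      exact h x
    · have : L ⁻¹' {i} = ∅ := by
        ext x; simp only [mem_preimage, mem_singleton_iff, mem_empty_iff_false, iff_false]
        exact fun hx => hi ⟨x, hx⟩
      simp [this]
  · intro i j hij
    refine Set.disjoint_left.2 fun x hi hj => hij ?_
    simp only [mem_preimage, mem_singleton_iff] at hi hj
    rw [← hi, hj]

/-- stopping level -/
def stp {n : ℕ} (a : ℤ) (P : ℤ → Eucl n → Prop) (x : Eucl n) : ℤ :=
  sSup {k | k = a ∨ (a < k ∧ P k x)}

section stp
variable {n : ℕ} {a : ℤ} {P : ℤ → Eucl n → Prop}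

lemma stp_mem (hb : ∀ x, BddAbove {k | P k x}) (x : Eucl n) :
    stp a P x = a ∨ (a < stp a P x ∧ P (stp a P x) x) := by
  have h := Int.csSup_mem (s := {k | k = a ∨ (a < k ∧ P k x)}) ⟨a, Or.inl rfl⟩ (by
    obtain ⟨B, hB⟩ := hb x
    refine ⟨max a B, ?_⟩
    rintro k (rfl | ⟨_, h⟩)
    · exact le_max_left _ _
    · exact (hB h).trans (le_max_right _ _))
  exact h

lemma stp_le (hb : ∀ x, BddAbove {k | P k x}) (x : Eucl n) {k : ℤ} (h : k = a ∨ (a < k ∧ P k x)) :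
    k ≤ stp a P x := by
  refine le_csSup ?_ h
  obtain ⟨B, hB⟩ := hb x
  refine ⟨max a B, ?_⟩
  rintro k (rfl | ⟨_, h⟩)
  · exact le_max_left _ _
  · exact (hB h).trans (le_max_right _ _)

lemma stp_ge (hb : ∀ x, BddAbove {k | P k x}) (x : Eucl n) : a ≤ stp a P x := stp_le hb x (Or.inl rfl)

lemma stp_not (hb : ∀ x, BddAbove {k | P k x}) (x : Eucl n) {k : ℤ} (h : stp a P x < k) : ¬ P k x := by
  intro hP
  have := stp_le (a := a) hb x (Or.inr ⟨(stp_ge hb x).trans_lt h, hP⟩)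
  omega

lemma stp_iff (hb : ∀ x, BddAbove {k | P k x}) (x : Eucl n) (k : ℤ) :
    stp a P x = k ↔ (k = a ∨ (a < k ∧ P k x)) ∧ ∀ j, k < j → a < j → ¬ P j x := by
  constructor
  · rintro rfl
    exact ⟨stp_mem hb x, fun j hj _ => stp_not hb x hj⟩
  · rintro ⟨h1, h2⟩
    have h3 := stp_le hb x h1
    rcases stp_mem (a := a) hb x with h | ⟨h, h'⟩
    · rcases h1 with h1 | h1 <;> omega
    · by_contra hne
      exact h2 _ (lt_of_le_of_ne h3 (Ne.symm hne)) h h'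

lemma stp_const (hb : ∀ x, BddAbove {k | P k x}) (hP : ∀ k x y, idx k y = idx k x → P k x → P k y)
    {x y : Eucl n} (h : idx (stp a P x) y = idx (stp a P x) x) : stp a P y = stp a P x := by
  rw [stp_iff hb]
  refine ⟨?_, ?_⟩
  · rcases stp_mem (a := a) hb x with h1 | ⟨h1, h2⟩
    · exact Or.inl h1
    · exact Or.inr ⟨h1, hP _ _ _ h h2⟩
  · intro j hj _ hPj
    exact stp_not hb x hj (hP _ _ _ (idx_mono hj.le h).symm hPj)

lemma stp_meas (hb : ∀ x, BddAbove {k | P k x}) (hP : ∀ k x y, idx k y = idx k x → P k x → P k y) :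
    Measurable (stp a P) := by
  have hm : ∀ k, MeasurableSet {x | P k x} := by
    intro k
    have : {x | P k x} = {y | idx k y ∈ idx k '' {x | P k x}} := by
      ext y
      constructor
      · intro hy; exact ⟨y, hy, rfl⟩
      · rintro ⟨x, hx, h⟩; exact hP _ _ _ h.symm hx
    rw [this]; exact idx_measSet k _
  refine measurable_to_countable' fun k => ?_
  have : stp a P ⁻¹' {k} = ({x | k = a} ∪ ({x | a < k} ∩ {x | P k x})) ∩
      ⋂ (j : ℤ) (_ : k < j) (_ : a < j), {x | P j x}ᶜ := by
    ext x
    simp only [mem_preimage, mem_singleton_iff, stp_iff hb]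
    simp
  rw [this]
  refine ((MeasurableSet.const _).union ((MeasurableSet.const _).inter (hm k))).inter ?_
  exact MeasurableSet.iInter fun j => MeasurableSet.iInter fun _ => MeasurableSet.iInter fun _ => (hm j).compl

/-- label of the stopping cube -/
def lab (a : ℤ) (P : ℤ → Eucl n → Prop) (x : Eucl n) : ℤ × (Fin n → ℤ) := (stp a P x, idx (stp a P x) x)

lemma lab_meas (hb : ∀ x, BddAbove {k | P k x}) (hP : ∀ k x y, idx k y = idx k x → P k x → P k y) :
    Measurable (lab a P) := by
  have h1 := stp_meas (a := a) hb hP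
  refine h1.prodMk ?_
  have h2 : Measurable fun q : ℤ × Eucl n => idx q.1 q.2 :=
    measurable_from_prod_countable_right fun k => idx_meas k
  exact h2.comp (h1.prodMk measurable_id)

lemma lab_eq (hb : ∀ x, BddAbove {k | P k x}) (hP : ∀ k x y, idx k y = idx k x → P k x → P k y)
    (x : Eucl n) : {y | lab a P y = lab a P x} = Qd (stp a P x) x := by
  ext y
  simp only [lab, mem_ofPred_eq, Prod.mk.injEq, Qd]
  constructor
  · rintro ⟨h1, h2⟩; rwa [h1] at h2
  · intro h
    have := stp_const hb hP h
    exact ⟨this, by rw [this, h]⟩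

end stp

section CZ
variable {n : ℕ} {G : Eucl n → ℝ} {l : ℝ} {a : ℤ}

/-- heavy cubes -/
def hvy (G : Eucl n → ℝ) (l : ℝ) (k : ℤ) (x : Eucl n) : Prop :=
  ENNReal.ofReal l * volume (Qd k x) < ∫⁻ y in Qd k x, ‖G y‖ₑ

lemma hvy_inv (G : Eucl n → ℝ) (l : ℝ) : ∀ k x y, idx k y = idx k x → hvy G l k x → hvy G l k y := by
  intro k x y h hx
  unfold hvy at *
  rwa [Qd_eq h]

lemma hvy_bdd (hn : 0 < n) (hG : Integrable G volume) (hl : 0 < l) (x : Eucl n) : BddAbove {k | hvy G l k x} := by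
  have hI : ∫⁻ y, ‖G y‖ₑ ≠ ∞ := hG.2.ne
  set I := (∫⁻ y, ‖G y‖ₑ).toReal with hIdef
  obtain ⟨N, hN⟩ := pow_unbounded_of_one_lt (I / l) (one_lt_two)
  refine ⟨N, fun k hk => ?_⟩
  by_contra hlt
  push Not at hlt
  have h1 : ENNReal.ofReal l * volume (Qd k x) < ∫⁻ y, ‖G y‖ₑ :=
    lt_of_lt_of_le hk (setLIntegral_le_lintegral _ _)
  rw [Qd_vol, ← ENNReal.ofReal_mul hl.le, ENNReal.ofReal_lt_iff_lt_toReal (by positivity) hI] at h1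
  have h2 : (2:ℝ) ^ N ≤ 2 ^ k := by
    rw [← zpow_natCast]; exact zpow_le_zpow_right₀ one_le_two hlt.le
  have h3 : (1:ℝ) ≤ 2 ^ k := le_trans (one_le_pow₀ one_le_two) h2
  have h4 : (2:ℝ) ^ k ≤ (2 ^ k) ^ n := le_self_pow₀ h3 hn.ne'
  rw [div_lt_iff₀ hl] at hN
  have : l * 2 ^ N ≤ l * (2 ^ k) ^ n := by gcongr; exact h2.trans h4
  rw [← hIdef] at h1
  linarith

/-- Calderon-Zygmund good part -/
def gCZ (a : ℤ) (G : Eucl n → ℝ) (l : ℝ) (z : Eucl n) : ℝ :=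
  (fun q : ℤ × (Fin n → ℤ) => (((2:ℝ) ^ q.1) ^ n)⁻¹ * ∫ y in {y | idx q.1 y = q.2}, G y) (lab a (hvy G l) z)

/-- corner of the stopping cube -/
def cCZ (a : ℤ) (G : Eucl n → ℝ) (l : ℝ) (z : Eucl n) : Eucl n :=
  (fun q : ℤ × (Fin n → ℤ) => WithLp.toLp 2 (fun i => (q.2 i : ℝ) * 2 ^ q.1)) (lab a (hvy G l) z)


lemma gCZ_meas (hn : 0 < n) (hG : Integrable G volume) (hl : 0 < l) : Measurable (gCZ a G l) :=
  (measurable_from_top (f := fun q : ℤ × (Fin n → ℤ) => (((2:ℝ) ^ q.1) ^ n)⁻¹ * ∫ y in {y | idx q.1 y = q.2}, G y)).fun_comp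
    (show @Measurable _ _ _ ⊤ (lab a (hvy G l)) from by
      have := lab_meas (a := a) (hvy_bdd hn hG hl) (hvy_inv G l)
      intro s _
      exact this (MeasurableSet.of_discrete))

lemma cCZ_meas (hn : 0 < n) (hG : Integrable G volume) (hl : 0 < l) : Measurable (cCZ a G l) :=
  (measurable_from_top (f := fun q : ℤ × (Fin n → ℤ) => (WithLp.toLp 2 (fun i => (q.2 i : ℝ) * 2 ^ q.1) : Eucl n))).fun_comp
    (show @Measurable _ _ _ ⊤ (lab a (hvy G l)) from by
      have := lab_meas (a := a) (hvy_bdd hn hG hl) (hvy_inv G l)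
      intro s _
      exact this (MeasurableSet.of_discrete))

lemma cCZ_idx (z : Eucl n) : idx (stp a (hvy G l) z) (cCZ a G l z) = idx (stp a (hvy G l) z) z := by
  generalize hk : stp a (hvy G l) z = k
  have : cCZ a G l z = WithLp.toLp 2 (fun i => (idx k z i : ℝ) * 2 ^ k) := by
    simp only [cCZ, lab, hk]
  rw [this]
  generalize idx k z = m
  funext i
  simp only [idx]
  rw [mul_assoc, ← zpow_add₀ two_ne_zero]; simp

lemma gCZ_bdd (hn : 0 < n) (hG : Integrable G volume) (hl : 0 < l) (z : Eucl n) : |gCZ a G l z| ≤ 2 ^ n * l := by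
  have h0 := stp_not (a := a) (hvy_bdd hn hG hl) z (lt_add_one (stp a (hvy G l) z))
  simp only [gCZ, lab]
  generalize stp a (hvy G l) z = k at h0
  unfold hvy at h0
  push Not at h0
  have h2 : (0:ℝ) < 2 ^ k := by positivity
  change |_ * ∫ y in Qd k z, G y| ≤ _
  rw [abs_mul, abs_of_pos (by positivity), inv_mul_le_iff₀ (by positivity)]
  have h3 : |∫ y in Qd k z, G y| ≤ (∫⁻ y in Qd (k+1) z, ‖G y‖ₑ).toReal := by
    rw [← Real.norm_eq_abs]
    refine (norm_integral_le_lintegral_norm _).trans ?_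
    refine ENNReal.toReal_mono ?_ ?_
    · exact ((setLIntegral_le_lintegral _ _).trans_lt hG.2).ne
    · simp only [ofReal_norm]
      exact lintegral_mono_set (Qd_mono (by omega) z)
  refine h3.trans ?_
  have h4 := ENNReal.toReal_mono (by rw [Qd_vol]; exact ENNReal.mul_ne_top (by simp) (by simp)) h0
  refine h4.trans (le_of_eq ?_)
  rw [Qd_vol, ← ENNReal.ofReal_mul hl.le, ENNReal.toReal_ofReal (by positivity), zpow_add₀ two_ne_zero]
  ring

lemma gCZ_part (hn : 0 < n) (hG : Integrable G volume) (hl : 0 < l) (x : Eucl n) : ∫⁻ y in {y | lab a (hvy G l) y = lab a (hvy G l) x}, ‖gCZ a G l y‖ₑ ≤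
    ∫⁻ y in {y | lab a (hvy G l) y = lab a (hvy G l) x}, ‖G y‖ₑ := by
  have e := lab_eq (a := a) (hvy_bdd hn hG hl) (hvy_inv G l) x
  have hm : MeasurableSet {y | lab a (hvy G l) y = lab a (hvy G l) x} := by rw [e]; exact Qd_meas _ _
  have h1 : ∫⁻ y in {y | lab a (hvy G l) y = lab a (hvy G l) x}, ‖gCZ a G l y‖ₑ =
     ∫⁻ y in {y | lab a (hvy G l) y = lab a (hvy G l) x}, ‖gCZ a G l x‖ₑ := by
    refine setLIntegral_congr_fun hm fun y hy => ?_
    have hy' : lab a (hvy G l) y = lab a (hvy G l) x := hy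
    simp only [gCZ, hy']
  rw [h1, e, setLIntegral_const, Qd_vol]
  simp only [gCZ, lab]
  generalize stp a (hvy G l) x = k
  have h2 : (0:ℝ) < 2 ^ k := by positivity
  change ‖_ * ∫ y in Qd k x, G y‖ₑ * _ ≤ _
  rw [enorm_mul, Real.enorm_eq_ofReal (by positivity), mul_comm, ← mul_assoc, ← ENNReal.ofReal_mul (by positivity),
    mul_inv_cancel₀ (by positivity), ENNReal.ofReal_one, one_mul]
  exact enorm_integral_le_lintegral_enorm _

lemma gCZ_l1 (hn : 0 < n) (hG : Integrable G volume) (hl : 0 < l) : ∫⁻ y, ‖gCZ a G l y‖ₑ ≤ ∫⁻ y, ‖G y‖ₑ :=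
  part_le (lab_meas (a := a) (hvy_bdd hn hG hl) (hvy_inv G l)) volume (gCZ_part hn hG hl)

lemma gCZ_int (hn : 0 < n) (hG : Integrable G volume) (hl : 0 < l) : Integrable (gCZ a G l) volume :=
  ⟨(gCZ_meas hn hG hl).aestronglyMeasurable, (gCZ_l1 hn hG hl).trans_lt hG.2⟩

lemma bCZ_zero (hn : 0 < n) (hG : Integrable G volume) (hl : 0 < l) (x : Eucl n) : ∫ y in {y | lab a (hvy G l) y = lab a (hvy G l) x}, (G y - gCZ a G l y) = 0 := by
  have e := lab_eq (a := a) (hvy_bdd hn hG hl) (hvy_inv G l) x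
  have hm : MeasurableSet {y | lab a (hvy G l) y = lab a (hvy G l) x} := by rw [e]; exact Qd_meas _ _
  rw [integral_sub hG.integrableOn (gCZ_int hn hG hl).integrableOn]
  have h1 : ∫ y in {y | lab a (hvy G l) y = lab a (hvy G l) x}, gCZ a G l y =
     ∫ y in {y | lab a (hvy G l) y = lab a (hvy G l) x}, gCZ a G l x := by
    refine setIntegral_congr_fun hm fun y hy => ?_
    have hy' : lab a (hvy G l) y = lab a (hvy G l) x := hy
    simp only [gCZ, hy']
  rw [h1, e, setIntegral_const, Measure.real, Qd_vol]
  simp only [gCZ, lab]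
  generalize stp a (hvy G l) x = k
  have h2 : (0:ℝ) < 2 ^ k := by positivity
  change _ - _ • (_ * ∫ y in Qd k x, G y) = _
  rw [ENNReal.toReal_ofReal (by positivity), smul_eq_mul, ← mul_assoc, mul_inv_cancel₀ (by positivity)]
  ring

end CZ

lemma cv_integrable {n : ℕ} {K : Eucl n → ℝ} {C : ℝ} (hK : CZK n K C) {t : ℝ} (ht : 0 < t)
    {G : Eucl n → ℝ} (hG : Integrable G volume) {c : Eucl n → Eucl n} (hc : Measurable c) (x : Eucl n) :
    Integrable (fun z => kd K t (x - c z) * G z) volume := by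
  refine hG.bdd_mul (c := C * (t ^ n)⁻¹) ?_ (Eventually.of_forall fun z => kd_bdd hK.bdd ht _)
  exact ((kd_meas1 hK.meas t).comp (measurable_const.sub hc)).aestronglyMeasurable

lemma cv_add {n : ℕ} {K : Eucl n → ℝ} {C : ℝ} (hK : CZK n K C) {t : ℝ} (ht : 0 < t)
    {G H : Eucl n → ℝ} (hG : Integrable G volume) (hH : Integrable H volume) (x : Eucl n) :
    cv K t (fun z => G z + H z) x = cv K t G x + cv K t H x := by
  unfold cv
  have h1 := cv_integrable hK ht hG measurable_id x
  have h2 := cv_integrable hK ht hH measurable_id x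
  simp only [id] at h1 h2
  rw [← integral_add h1 h2]
  simp only [mul_add]

lemma Asq_add {n : ℕ} {K : Eucl n → ℝ} {C : ℝ} (hK : CZK n K C) {I : Set ℝ} (hI : I ⊆ Ioi 0) (hIm : MeasurableSet I)
    {G H : Eucl n → ℝ} (hGm : Measurable G) (hG : Integrable G volume) (hH : Integrable H volume) (x : Eucl n) :
    Asq K I (fun z => G z + H z) x ≤ 2 * Asq K I G x + 2 * Asq K I H x := by
  unfold Asq
  have hm : Measurable fun t => 2 * ‖cv K t G x‖ₑ ^ 2 := ((cv_meas_t hK.meas hGm x).enorm.pow_const 2).const_mul 2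
  calc _ ≤ ∫⁻ t in I, (2 * ‖cv K t G x‖ₑ ^ 2 + 2 * ‖cv K t H x‖ₑ ^ 2) ∂mdt := by
        refine setLIntegral_mono' hIm fun t ht => ?_
        rw [cv_add hK (hI ht) hG hH]
        simp only [enorm_sq_eq]
        have h2 : (2 : ℝ≥0∞) = ENNReal.ofReal 2 := by norm_num
        rw [h2, ← ENNReal.ofReal_mul (by norm_num), ← ENNReal.ofReal_mul (by norm_num), ← ENNReal.ofReal_add (by positivity) (by positivity)]
        refine ENNReal.ofReal_le_ofReal ?_
        nlinarith [sq_nonneg (cv K t G x - cv K t H x)]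
    _ = _ := by
        rw [lintegral_add_left hm, lintegral_const_mul' _ _ (by simp), lintegral_const_mul' _ _ (by simp)]

lemma hvy_Mx {n : ℕ} (hn : 0 < n) {G : Eucl n → ℝ} {l : ℝ} {k : ℤ} {x z : Eucl n} (hz : hvy G l k z) (hl : 0 < l)
    (hx : Mx volume (fun y => ‖G y‖ₑ) x ≤ ENNReal.ofReal l * (ENNReal.ofReal ((n + 1 : ℝ) ^ n) * om n)⁻¹) :
    (n + 1) * (2:ℝ) ^ k ≤ ‖x - z‖ := by
  by_contra hlt
  push Not at hlt
  have h2 : (0:ℝ) < 2 ^ k := by positivity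
  have hr : (0:ℝ) < (n + 1) * 2 ^ k := by positivity
  have h1 := lint_le_Mx (Dbl_volume n) (fun y => ‖G y‖ₑ) (x := x) (c := z) hr (by rwa [mem_ball, dist_eq_norm])
  have h3 : ∫⁻ y in Qd k z, ‖G y‖ₑ ≤ ∫⁻ y in ball z ((n + 1) * 2 ^ k), ‖G y‖ₑ :=
    lintegral_mono_set (Qd_sub_ball z (by nlinarith))
  have h4 := (hz.trans_le h3).trans_le (h1.trans (mul_le_mul_right hx _))
  rw [vol_ball z hr, Qd_vol, mul_pow, ENNReal.ofReal_mul (by positivity)] at h4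
  refine absurd h4 (not_lt.2 (le_of_eq ?_))
  have h5 : ENNReal.ofReal ((n + 1 : ℝ) ^ n) * om n ≠ 0 := mul_ne_zero (by simp; positivity) (om_pos n)
  have h6 : ENNReal.ofReal ((n + 1 : ℝ) ^ n) * om n ≠ ∞ := ENNReal.mul_ne_top (by simp) (om_ne_top n)
  calc _ = ENNReal.ofReal l * ENNReal.ofReal ((2 ^ k) ^ n) * ((ENNReal.ofReal ((n + 1 : ℝ) ^ n) * om n) * (ENNReal.ofReal ((n + 1 : ℝ) ^ n) * om n)⁻¹) := by ring
    _ = _ := by rw [ENNReal.mul_inv_cancel h5 h6, mul_one]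

lemma bad_est {n : ℕ} (hn : 0 < n) {K : Eucl n → ℝ} {C : ℝ} (hK : CZK n K C) :
    ∃ C' : ℝ, 0 ≤ C' ∧ ∀ (a b : ℤ) (G : Eucl n → ℝ), Measurable G → Integrable G volume → ∀ l : ℝ, 0 < l →
      ∀ x, Mx volume (fun y => ‖G y‖ₑ) x ≤ ENNReal.ofReal l * (ENNReal.ofReal ((n + 1 : ℝ) ^ n) * om n)⁻¹ →
      Asq K (Ioo (2 ^ a) (2 ^ b)) (fun z => G z - gCZ a G l z) x ≤
        (∫⁻ z, ENNReal.ofReal C' * Nl n (2 ^ (stp a (hvy G l) z)) (x - z) * ‖G z - gCZ a G l z‖ₑ) ^ 2 := by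
  obtain ⟨C', hC', hsm⟩ := hK.smooth hn (D := n) (by exact_mod_cast hn)
  refine ⟨C', hC', fun a b G hGm hG l hl x hx => ?_⟩
  have hb := hvy_bdd (l := l) hn hG hl
  have hcm := cCZ_meas (a := a) hn hG hl
  have hgm := gCZ_meas (a := a) hn hG hl
  have hbi : Integrable (fun z => G z - gCZ a G l z) volume := hG.sub (gCZ_int hn hG hl)
  have hbm : Measurable (fun z => G z - gCZ a G l z) := hGm.sub hgm
  have hkm : Measurable (Function.uncurry fun (t : ℝ) (z : Eucl n) => ‖kd K t (x - z) - kd K t (x - cCZ a G l z)‖ₑ) := by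
    have h1 : Measurable fun q : ℝ × Eucl n => kd K q.1 (x - q.2) :=
      (kd_meas hK.meas).comp (by fun_prop : Measurable fun q : ℝ × Eucl n => (q.1, x - q.2))
    have h2 : Measurable fun q : ℝ × Eucl n => kd K q.1 (x - cCZ a G l q.2) :=
      (kd_meas hK.meas).comp (by fun_prop : Measurable fun q : ℝ × Eucl n => (q.1, x - cCZ a G l q.2))
    exact (h1.sub h2).enorm
  have hNm : Measurable fun z => ENNReal.ofReal C' * Nl n (2 ^ (stp a (hvy G l) z)) (x - z) := by
    have h0 : Measurable fun z : Eucl n => ((2:ℝ) ^ (stp a (hvy G l) z)) :=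
      (measurable_from_top (f := fun k : ℤ => (2:ℝ) ^ k)).comp (stp_meas hb (hvy_inv G l))
    have h1 : Measurable fun z : Eucl n => ((2:ℝ) ^ (stp a (hvy G l) z), x - z) :=
      h0.prodMk (by fun_prop)
    have h2 := Measurable.comp (g := fun q : ℝ × Eucl n => Nl n q.1 q.2) (Nl_meas n) h1
    exact Measurable.const_mul h2 _
  have key : ∀ t ∈ Ioo ((2:ℝ) ^ a) (2 ^ b), ‖cv K t (fun z => G z - gCZ a G l z) x‖ₑ ≤
      ∫⁻ z, ‖kd K t (x - z) - kd K t (x - cCZ a G l z)‖ₑ * ‖G z - gCZ a G l z‖ₑ := by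
    intro t ht
    have ht0 : 0 < t := lt_trans (by positivity) ht.1
    have i1 := cv_integrable hK ht0 hbi measurable_id x
    have i2 := cv_integrable hK ht0 hbi hcm x
    simp only [id] at i1
    have z2 : ∫ z, kd K t (x - cCZ a G l z) * (G z - gCZ a G l z) = 0 := by
      refine part_zero (lab_meas (a := a) hb (hvy_inv G l)) i2 fun y => ?_
      have hm : MeasurableSet {z | lab a (hvy G l) z = lab a (hvy G l) y} := by
        rw [lab_eq hb (hvy_inv G l)]; exact Qd_meas _ _
      rw [setIntegral_congr_fun (g := fun z => kd K t (x - cCZ a G l y) * (G z - gCZ a G l z)) hm ?_,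
        integral_const_mul, bCZ_zero hn hG hl, mul_zero]
      intro z hz
      have hz' : lab a (hvy G l) z = lab a (hvy G l) y := hz
      have : cCZ a G l z = cCZ a G l y := by simp only [cCZ, hz']
      simp only [this]
    have e : cv K t (fun z => G z - gCZ a G l z) x =
        ∫ z, (kd K t (x - z) - kd K t (x - cCZ a G l z)) * (G z - gCZ a G l z) := by
      unfold cv
      rw [← sub_zero (∫ z, kd K t (x - z) * _), ← z2, ← integral_sub i1 i2]
      simp only [sub_mul]
    rw [e]
    refine (enorm_integral_le_lintegral_enorm _).trans (le_of_eq ?_)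
    simp only [enorm_mul]
  unfold Asq
  calc _ ≤ ∫⁻ t in Ioo ((2:ℝ) ^ a) (2 ^ b), (∫⁻ z, ‖kd K t (x - z) - kd K t (x - cCZ a G l z)‖ₑ * ‖G z - gCZ a G l z‖ₑ) ^ 2 ∂mdt := by
        refine setLIntegral_mono' measurableSet_Ioo fun t ht => ?_
        gcongr
        exact key t ht
    _ ≤ _ := by
        refine mink (mdt.restrict _) volume hkm hbm.enorm hNm fun z => ?_
        set k := stp a (hvy G l) z with hk
        have h2 : (0:ℝ) < 2 ^ k := by positivity
        have hcz : ‖z - cCZ a G l z‖ ≤ n * 2 ^ k := by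
          rw [norm_sub_rev]
          exact idx_dist (cCZ_idx z)
        refine le_trans ?_ (hsm (2 ^ k) h2 (x - z) (x - cCZ a G l z) (by
          rw [sub_sub_sub_cancel_left, norm_sub_rev]; exact hcz))
        rcases stp_mem (a := a) hb z with h | ⟨h, h'⟩
        · rw [hk, h]; exact lintegral_mono_set Ioo_subset_Ioi_self
        · rw [← lintegral_indicator measurableSet_Ioo, ← lintegral_indicator measurableSet_Ioi]
          refine lintegral_mono fun t => ?_
          by_cases ht : t ∈ Ioo ((2:ℝ) ^ a) (2 ^ b)
          · by_cases ht2 : (2:ℝ) ^ k < t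
            · rw [indicator_of_mem ht, indicator_of_mem (show t ∈ Ioi ((2:ℝ) ^ k) from ht2)]
            · push Not at ht2
              have ht0 : 0 < t := lt_trans (by positivity) ht.1
              have h5 := hvy_Mx hn h' hl hx
              rw [← hk] at h5
              have h6 : ‖x - z‖ ≤ ‖x - cCZ a G l z‖ + ‖z - cCZ a G l z‖ := by
                calc _ = ‖(x - cCZ a G l z) - (z - cCZ a G l z)‖ := by congr 1; abel
                  _ ≤ _ := norm_sub_le _ _
              have hn0 : (0:ℝ) ≤ n * 2 ^ k := by positivity
              rw [indicator_of_mem ht, kd_supp hK.supp ht0 (x := x - z) (by nlinarith),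
                kd_supp hK.supp ht0 (x := x - cCZ a G l z) (by nlinarith)]
              simp
          · rw [indicator_of_notMem ht]; exact zero_le

lemma weak11 {n : ℕ} (hn : 0 < n) {K : Eucl n → ℝ} {C : ℝ} (hK : CZK n K C) :
    ∃ Cw : ℝ≥0∞, Cw ≠ ∞ ∧ ∀ (a b : ℤ) (G : Eucl n → ℝ), Measurable G → Integrable G volume → ∀ l : ℝ, 0 < l →
      ENNReal.ofReal l * volume {x | ENNReal.ofReal (l ^ 2) < Asq K (Ioo (2 ^ a) (2 ^ b)) G x} ≤ Cw * ∫⁻ z, ‖G z‖ₑ := by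
  obtain ⟨C', hC', hbad⟩ := bad_est hn hK
  set c0 : ℝ≥0∞ := (ENNReal.ofReal ((n + 1 : ℝ) ^ n) * om n) with hc0
  have h5 : c0 ≠ 0 := mul_ne_zero (by simp; positivity) (om_pos n)
  have h6 : c0 ≠ ∞ := ENNReal.mul_ne_top (by simp) (om_ne_top n)
  set C2 : ℝ≥0∞ := ENNReal.ofReal (C ^ 2 * (2 * n + 1)) * om n ^ 2 * 2 with hC2
  have hC2t : C2 ≠ ∞ := ENNReal.mul_ne_top (ENNReal.mul_ne_top (by simp) (ENNReal.pow_ne_top (om_ne_top n))) (by simp)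
  refine ⟨4 * C2 * ENNReal.ofReal (2 ^ n) + (c0 * ENNReal.ofReal (6 ^ n) + 2 * (ENNReal.ofReal C' * (4 * om n) * 2)), ?_, ?_⟩
  · have := om_ne_top n
    refine ENNReal.add_ne_top.2 ⟨ENNReal.mul_ne_top (ENNReal.mul_ne_top (by simp) hC2t) (by simp),
      ENNReal.add_ne_top.2 ⟨ENNReal.mul_ne_top h6 (by simp), ?_⟩⟩
    exact ENNReal.mul_ne_top (by simp) (ENNReal.mul_ne_top (ENNReal.mul_ne_top (by simp) (ENNReal.mul_ne_top (by simp) this)) (by simp))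
  intro a b G hGm hG l hl
  have hb := hvy_bdd (l := l) hn hG hl
  have hgm := gCZ_meas (a := a) hn hG hl
  have hgi := gCZ_int (a := a) hn hG hl
  have hgl := gCZ_l1 (a := a) hn hG hl
  have hbi : Integrable (fun z => G z - gCZ a G l z) volume := hG.sub hgi
  have hbm : Measurable (fun z => G z - gCZ a G l z) := hGm.sub hgm
  set N := ∫⁻ z, ‖G z‖ₑ with hN
  set I : Set ℝ := Ioo (2 ^ a) (2 ^ b) with hI
  have hbl : ∫⁻ z, ‖G z - gCZ a G l z‖ₑ ≤ 2 * N := by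
    calc _ ≤ ∫⁻ z, (‖G z‖ₑ + ‖gCZ a G l z‖ₑ) := lintegral_mono fun z => enorm_sub_le
      _ = N + ∫⁻ z, ‖gCZ a G l z‖ₑ := lintegral_add_left hGm.enorm _
      _ ≤ N + N := by gcongr
      _ = _ := by ring
  -- the three sets
  set E1 := {x | ENNReal.ofReal ((l / 2) ^ 2) < Asq K I (gCZ a G l) x} with hE1
  set E2 := {x | ENNReal.ofReal l * c0⁻¹ < Mx volume (fun y => ‖G y‖ₑ) x} with hE2
  set B : Eucl n → ℝ≥0∞ := fun x => ∫⁻ z, ENNReal.ofReal C' * Nl n (2 ^ (stp a (hvy G l) z)) (x - z) * ‖G z - gCZ a G l z‖ₑ with hB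
  set E3 := {x | ENNReal.ofReal (l / 2) ≤ B x} with hE3
  have hsub : {x | ENNReal.ofReal (l ^ 2) < Asq K I G x} ⊆ E1 ∪ (E2 ∪ E3) := by
    intro x hx
    by_contra hnot
    simp only [mem_union, not_or] at hnot
    obtain ⟨h1, h2, h3⟩ := hnot
    simp only [hE1, hE2, hE3, mem_ofPred_eq, not_lt, not_le] at h1 h2 h3
    have hb1 := hbad a b G hGm hG l hl x h2
    have hb2 : Asq K I (fun z => G z - gCZ a G l z) x ≤ ENNReal.ofReal ((l / 2) ^ 2) := by
      refine hb1.trans ?_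
      rw [ENNReal.ofReal_pow (by positivity)]
      gcongr
    have hs := Asq_add hK (I := I) (fun t ht => lt_trans (by positivity : (0:ℝ) < 2 ^ a) ht.1) measurableSet_Ioo hgm hgi hbi x
    simp only [add_sub_cancel] at hs
    have : Asq K I G x ≤ ENNReal.ofReal (l ^ 2) := by
      calc _ ≤ 2 * ENNReal.ofReal ((l / 2) ^ 2) + 2 * ENNReal.ofReal ((l / 2) ^ 2) := hs.trans (by gcongr)
        _ = 4 * ENNReal.ofReal ((l / 2) ^ 2) := by ring
        _ = ENNReal.ofReal (l ^ 2) := by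
          rw [show (4:ℝ≥0∞) = ENNReal.ofReal 4 by norm_num, ← ENNReal.ofReal_mul (by norm_num)]
          congr 1; ring
    exact absurd hx (not_lt.2 this)
  have e1 : ENNReal.ofReal l * volume E1 ≤ 4 * C2 * ENNReal.ofReal (2 ^ n) * N := by
    have hch := mul_meas_ge_le_lintegral₀ (μ := volume) (Asq_meas hK.meas hgm I).aemeasurable (ENNReal.ofReal ((l / 2) ^ 2))
    have hl2 := CZK.l2 hn hK (a := 2 ^ a) (b := 2 ^ b) (by positivity) hgm hgi (gCZ_bdd hn hG hl)
    have hsq : ∫⁻ z, ‖gCZ a G l z‖ₑ ^ 2 ≤ ENNReal.ofReal (2 ^ n * l) * N := by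
      calc _ ≤ ∫⁻ z, ENNReal.ofReal (2 ^ n * l) * ‖gCZ a G l z‖ₑ := by
            refine lintegral_mono fun z => ?_
            simp only
            rw [pow_two]
            gcongr
            rw [Real.enorm_eq_ofReal_abs]
            exact ENNReal.ofReal_le_ofReal (gCZ_bdd hn hG hl z)
        _ ≤ _ := by
            rw [lintegral_const_mul _ hgm.enorm]
            gcongr
    have h7 : ENNReal.ofReal ((l / 2) ^ 2) * volume E1 ≤ C2 * (ENNReal.ofReal (2 ^ n * l) * N) := by
      calc _ ≤ ENNReal.ofReal ((l / 2) ^ 2) * volume {x | ENNReal.ofReal ((l / 2) ^ 2) ≤ Asq K I (gCZ a G l) x} :=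
            by
            have hss : E1 ⊆ {x | ENNReal.ofReal ((l / 2) ^ 2) ≤ Asq K I (gCZ a G l) x} := by
              intro x hx
              have hx' : ENNReal.ofReal ((l / 2) ^ 2) < Asq K I (gCZ a G l) x := hx
              exact le_of_lt hx'
            exact mul_le_mul_right (measure_mono hss) _
        _ ≤ _ := hch
        _ ≤ _ := hl2
        _ ≤ _ := mul_le_mul_right hsq _
    have h8 : ENNReal.ofReal ((l / 2) ^ 2) = ENNReal.ofReal (l / 4) * ENNReal.ofReal l := by
      rw [← ENNReal.ofReal_mul (by positivity)]; congr 1; ring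
    have h9 : ENNReal.ofReal (4 / l) * ENNReal.ofReal (l / 4) = 1 := by
      rw [← ENNReal.ofReal_mul (by positivity)]; rw [div_mul_div_cancel₀ hl.ne']; norm_num
    calc _ = ENNReal.ofReal (4 / l) * (ENNReal.ofReal ((l / 2) ^ 2) * volume E1) := by
          rw [h8, ← mul_assoc, ← mul_assoc, h9, one_mul]
      _ ≤ ENNReal.ofReal (4 / l) * (C2 * (ENNReal.ofReal (2 ^ n * l) * N)) := by gcongr
      _ = (ENNReal.ofReal (4 / l) * ENNReal.ofReal (2 ^ n * l)) * C2 * N := by ring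
      _ = _ := by
          have : ENNReal.ofReal (4 / l) * ENNReal.ofReal (2 ^ n * l) = 4 * ENNReal.ofReal (2 ^ n) := by
            rw [show (4:ℝ≥0∞) = ENNReal.ofReal 4 by norm_num, ← ENNReal.ofReal_mul (by positivity), ← ENNReal.ofReal_mul (by positivity)]
            congr 1; field_simp
          rw [this]; ring
  have e2 : ENNReal.ofReal l * volume E2 ≤ c0 * ENNReal.ofReal (6 ^ n) * N := by
    have := Mx_weak (Dbl_volume n) (fun y => ‖G y‖ₑ) (ENNReal.ofReal l * c0⁻¹)
    calc _ = c0 * (ENNReal.ofReal l * c0⁻¹ * volume E2) := by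
          calc _ = (c0 * c0⁻¹) * (ENNReal.ofReal l * volume E2) := by rw [ENNReal.mul_inv_cancel h5 h6, one_mul]
            _ = _ := by ring
      _ ≤ c0 * (ENNReal.ofReal (6 ^ n) * N) := by gcongr
      _ = _ := by ring
  have hBm0 : Measurable (Function.uncurry fun (x z : Eucl n) => ENNReal.ofReal C' * Nl n (2 ^ (stp a (hvy G l) z)) (x - z) * ‖G z - gCZ a G l z‖ₑ) := by
    have h0 : Measurable fun z : Eucl n => ((2:ℝ) ^ (stp a (hvy G l) z)) :=
      (measurable_from_top (f := fun k : ℤ => (2:ℝ) ^ k)).comp (stp_meas hb (hvy_inv G l))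
    have h1 : Measurable fun q : Eucl n × Eucl n => ((2:ℝ) ^ (stp a (hvy G l) q.2), q.1 - q.2) :=
      (h0.comp measurable_snd).prodMk (by fun_prop)
    have h2 := Measurable.comp (g := fun q : ℝ × Eucl n => Nl n q.1 q.2) (Nl_meas n) h1
    exact (Measurable.const_mul h2 _).mul (hbm.enorm.comp measurable_snd)
  have e3 : ENNReal.ofReal l * volume E3 ≤ 2 * (ENNReal.ofReal C' * (4 * om n) * 2) * N := by
    have hBm : Measurable B := hBm0.lintegral_prod_right'
    have hch := mul_meas_ge_le_lintegral₀ (μ := volume) hBm.aemeasurable (ENNReal.ofReal (l / 2))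
    have hBi : ∫⁻ x, B x ≤ ENNReal.ofReal C' * (4 * om n) * (2 * N) := by
      calc _ = ∫⁻ z, ∫⁻ x, ENNReal.ofReal C' * Nl n (2 ^ (stp a (hvy G l) z)) (x - z) * ‖G z - gCZ a G l z‖ₑ := by
            exact lintegral_lintegral_swap hBm0.aemeasurable
        _ ≤ ∫⁻ z, ENNReal.ofReal C' * (4 * om n) * ‖G z - gCZ a G l z‖ₑ := by
            refine lintegral_mono fun z => ?_
            have hm1 : Measurable fun x => Nl n (2 ^ (stp a (hvy G l) z)) (x - z) :=
              Measurable.comp (g := Nl n (2 ^ (stp a (hvy G l) z))) (Nl_meas1 n _) (measurable_id.sub_const z)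
            have hm2 : Measurable fun x => ENNReal.ofReal C' * Nl n (2 ^ (stp a (hvy G l) z)) (x - z) := hm1.const_mul _
            simp only
            rw [lintegral_mul_const _ hm2, lintegral_const_mul _ hm1]
            gcongr
            exact Nl_int (by positivity) z
        _ ≤ _ := by
            rw [lintegral_const_mul _ hbm.enorm]
            gcongr
    have h8 : ENNReal.ofReal l = 2 * ENNReal.ofReal (l / 2) := by
      rw [show (2:ℝ≥0∞) = ENNReal.ofReal 2 by norm_num, ← ENNReal.ofReal_mul (by norm_num)]; congr 1; ring
    rw [h8, mul_assoc]
    calc _ ≤ 2 * (ENNReal.ofReal C' * (4 * om n) * (2 * N)) := mul_le_mul_right (hch.trans hBi) _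
      _ = _ := by ring
  calc _ ≤ ENNReal.ofReal l * (volume E1 + (volume E2 + volume E3)) := by
        gcongr
        exact (measure_mono hsub).trans ((measure_union_le _ _).trans (by gcongr; exact measure_union_le _ _))
    _ = ENNReal.ofReal l * volume E1 + (ENNReal.ofReal l * volume E2 + ENNReal.ofReal l * volume E3) := by ring
    _ ≤ _ := add_le_add e1 (add_le_add e2 e3)
    _ = _ := by ring

/-- a dual pair of Muckenhoupt weights -/
structure APair (n : ℕ) (p q : ℝ) (W V : Eucl n → ℝ≥0∞) (A : ℝ≥0∞) : Prop where
  hpq : p.HolderConjugate q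
  mW : Measurable W
  mV : Measurable V
  one : ∀ x, W x ^ (1 / p) * V x ^ (1 / q) = 1
  finW : ∀ x r, ∫⁻ y in ball x r, W y ≠ ∞
  finV : ∀ x r, ∫⁻ y in ball x r, V y ≠ ∞
  At : A ≠ ∞
  Ap : ∀ x r, 0 < r → (∫⁻ y in ball x r, W y) ^ (1 / p) * (∫⁻ y in ball x r, V y) ^ (1 / q) ≤ A * volume (ball x r)

namespace APair
variable {n : ℕ} {p q : ℝ} {W V : Eucl n → ℝ≥0∞} {A : ℝ≥0∞}

lemma symm (h : APair n p q W V A) : APair n q p V W A where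
  hpq := h.hpq.symm
  mW := h.mV
  mV := h.mW
  one x := by rw [mul_comm]; exact h.one x
  finW := h.finV
  finV := h.finW
  At := h.At
  Ap x r hr := by rw [mul_comm]; exact h.Ap x r hr

lemma W_ne_zero (h : APair n p q W V A) (x : Eucl n) : W x ≠ 0 := by
  intro h0
  have := h.one x
  have hp : 0 < 1 / p := by have := h.hpq.pos; positivity
  rw [h0, ENNReal.zero_rpow_of_pos hp, zero_mul] at this
  exact zero_ne_one this

lemma W_ne_top (h : APair n p q W V A) (x : Eucl n) : W x ≠ ∞ := by
  intro h0
  have h1 := h.one x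
  have hp : 0 < 1 / p := by have := h.hpq.pos; positivity
  have hq : 0 < 1 / q := by have := h.hpq.symm.pos; positivity
  rw [h0, ENNReal.top_rpow_of_pos hp, ENNReal.top_mul] at h1
  · exact ENNReal.one_ne_top h1.symm
  · have := h.symm.W_ne_zero x
    simp only [ne_eq, ENNReal.rpow_eq_zero_iff]
    rintro (⟨h2, _⟩ | ⟨_, h2⟩)
    · exact this h2
    · linarith

lemma posB (h : APair n p q W V A) (x : Eucl n) {r : ℝ} (hr : 0 < r) : ∫⁻ y in ball x r, W y ≠ 0 := by
  intro h0
  rw [lintegral_eq_zero_iff h.mW] at h0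
  have : volume.restrict (ball x r) univ = 0 := by
    refine measure_mono_null ?_ h0
    intro y _; exact h.W_ne_zero y
  rw [Measure.restrict_apply_univ] at this
  exact (measure_ball_pos volume x hr).ne' this

lemma holder (h : APair n p q W V A) (E : Set (Eucl n)) :
    volume E ≤ (∫⁻ y in E, W y) ^ (1 / p) * (∫⁻ y in E, V y) ^ (1 / q) := by
  have hp := h.hpq.pos
  have hq := h.hpq.symm.pos
  have := ENNReal.lintegral_mul_le_Lp_mul_Lq (volume.restrict E) h.hpq (f := fun y => W y ^ (1 / p)) (g := fun y => V y ^ (1 / q))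
    (h.mW.pow_const _).aemeasurable (h.mV.pow_const _).aemeasurable
  simp only [Pi.mul_apply, h.one, ← ENNReal.rpow_mul, one_div_mul_cancel hp.ne', one_div_mul_cancel hq.ne', ENNReal.rpow_one] at this
  simpa using this

lemma cmp (h : APair n p q W V A) {x : Eucl n} {r : ℝ} (hr : 0 < r) {E : Set (Eucl n)} (hE : E ⊆ ball x r)
    {c : ℝ≥0∞} (hc : volume (ball x r) ≤ c * volume E) :
    ∫⁻ y in ball x r, W y ≤ (A * c) ^ p * ∫⁻ y in E, W y := by
  have hp := h.hpq.pos
  have hq := h.hpq.symm.pos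
  have h1 := h.Ap x r hr
  have h2 := h.holder E
  have hV0 := h.symm.posB x hr
  have hVt := h.finV x r
  have hX0 : (∫⁻ y in ball x r, V y) ^ (1 / q) ≠ 0 := by
    simp only [ne_eq, ENNReal.rpow_eq_zero_iff]
    rintro (⟨h2, _⟩ | ⟨h2, _⟩)
    · exact hV0 h2
    · exact hVt h2
  have hXt : (∫⁻ y in ball x r, V y) ^ (1 / q) ≠ ∞ := ENNReal.rpow_ne_top_of_nonneg (by positivity) hVt
  have h3 : (∫⁻ y in ball x r, W y) ^ (1 / p) * (∫⁻ y in ball x r, V y) ^ (1 / q) ≤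
      (A * c) * (∫⁻ y in E, W y) ^ (1 / p) * (∫⁻ y in ball x r, V y) ^ (1 / q) := by
    calc _ ≤ A * (c * ((∫⁻ y in E, W y) ^ (1 / p) * (∫⁻ y in E, V y) ^ (1 / q))) := by
          refine h1.trans ?_
          gcongr
          refine hc.trans ?_
          gcongr
      _ ≤ A * (c * ((∫⁻ y in E, W y) ^ (1 / p) * (∫⁻ y in ball x r, V y) ^ (1 / q))) := by
          gcongr
      _ = _ := by ring
  have h4 := (ENNReal.mul_le_mul_iff_left hX0 hXt).1 h3
  have h5 := ENNReal.rpow_le_rpow h4 hp.le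
  rwa [ENNReal.mul_rpow_of_nonneg _ _ hp.le, ← ENNReal.rpow_mul, ← ENNReal.rpow_mul, one_div_mul_cancel hp.ne',
    ENNReal.rpow_one, ENNReal.rpow_one] at h5

lemma dbl (h : APair n p q W V A) : Dbl (volume.withDensity W) ((A * ENNReal.ofReal (6 ^ n)) ^ p) where
  pos x r hr := by rw [withDensity_apply _ measurableSet_ball]; exact h.posB x hr
  fin x r := by rw [withDensity_apply _ measurableSet_ball]; exact h.finW x r
  ct := ENNReal.rpow_ne_top_of_nonneg h.hpq.pos.le (ENNReal.mul_ne_top h.At (by simp))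
  dbl x r hr := by
    rw [withDensity_apply _ measurableSet_ball, withDensity_apply _ measurableSet_ball]
    exact h.cmp (by positivity) (ball_subset_ball (by linarith)) ((Dbl_volume n).dbl x r hr)

/-- the function `Ψ` -/
def Psi (p q : ℝ) (W V : Eucl n → ℝ≥0∞) (G h : Eucl n → ℝ≥0∞) (x : Eucl n) : ℝ≥0∞ :=
  Mx (volume.withDensity V) (fun y => G y * (V y)⁻¹) x ^ p * V x + Mx (volume.withDensity W) h x ^ q * W x

lemma Psi_meas (h : APair n p q W V A) (G g : Eucl n → ℝ≥0∞) : Measurable (Psi p q W V G g) := by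
  unfold Psi
  exact (((Mx_meas _ _).pow_const _).mul h.mV).add (((Mx_meas _ _).pow_const _).mul h.mW)

lemma locl (h : APair n p q W V A) {c : ℝ≥0∞} {G g : Eucl n → ℝ≥0∞} (hG : Measurable G) (hg : Measurable g)
    {x : Eucl n} {r : ℝ} (hr : 0 < r) {E : Set (Eucl n)} (hE : E ⊆ ball x r) (hEm : MeasurableSet E)
    (hc : volume (ball x r) ≤ c * volume E) :
    (∫⁻ y in ball x r, G y) * (∫⁻ y in ball x r, g y * W y) ≤
      (A * ((A * c) ^ q + (A * c) ^ p)) * volume (ball x r) * ∫⁻ y in E, Psi p q W V G g y := by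
  have hp := h.hpq.pos
  have hq := h.hpq.symm.pos
  set B := ball x r with hB
  set u := Mx (volume.withDensity V) (fun y => G y * (V y)⁻¹) with hu
  set v := Mx (volume.withDensity W) g with hv
  set mW := ∫⁻ y in B, W y with hmW
  set mV := ∫⁻ y in B, V y with hmV
  set α := mV⁻¹ * ∫⁻ y in B, G y with hα
  set β := mW⁻¹ * ∫⁻ y in B, g y * W y with hβ
  have hmW0 : mW ≠ 0 := h.posB x hr
  have hmV0 : mV ≠ 0 := h.symm.posB x hr
  have hmWt : mW ≠ ∞ := h.finW x r
  have hmVt : mV ≠ ∞ := h.finV x r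
  have hαu : ∀ y ∈ B, α ≤ u y := by
    intro y hy
    have := le_Mx (volume.withDensity V) (fun y => G y * (V y)⁻¹) hr hy
    rw [withDensity_apply _ measurableSet_ball, setLIntegral_withDensity_eq_setLIntegral_mul _ h.mV (g := fun y => G y * (V y)⁻¹) (hG.mul h.mV.inv) measurableSet_ball] at this
    refine le_trans (le_of_eq ?_) this
    rw [hα]
    congr 1
    refine lintegral_congr fun z => ?_
    simp only [Pi.mul_apply]
    rw [mul_comm, mul_assoc, ENNReal.inv_mul_cancel (h.symm.W_ne_zero z) (h.symm.W_ne_top z), mul_one]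
  have hβv : ∀ y ∈ B, β ≤ v y := by
    intro y hy
    have := le_Mx (volume.withDensity W) g hr hy
    rw [withDensity_apply _ measurableSet_ball, setLIntegral_withDensity_eq_setLIntegral_mul _ h.mW hg measurableSet_ball] at this
    refine le_trans (le_of_eq ?_) this
    rw [hβ]
    congr 1
    refine lintegral_congr fun z => ?_
    simp only [Pi.mul_apply]
    rw [mul_comm]
  have eα : ∫⁻ y in B, G y = mV * α := by
    rw [hα, ← mul_assoc, ENNReal.mul_inv_cancel hmV0 hmVt, one_mul]
  have eβ : ∫⁻ y in B, g y * W y = mW * β := by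
    rw [hβ, ← mul_assoc, ENNReal.mul_inv_cancel hmW0 hmWt, one_mul]
  have split : ∀ m : ℝ≥0∞, m ≠ 0 → m ≠ ∞ → m ^ (1 / p) * m ^ (1 / q) = m := by
    intro m h0 ht
    rw [← ENNReal.rpow_add _ _ h0 ht, one_div, one_div, h.hpq.inv_add_inv_eq_one, ENNReal.rpow_one]
  have hyoung : (mV ^ (1 / p) * α) * (mW ^ (1 / q) * β) ≤ mV * α ^ p + mW * β ^ q := by
    refine (ENNReal.young_inequality _ _ h.hpq).trans ?_
    rw [ENNReal.mul_rpow_of_nonneg _ _ hp.le, ENNReal.mul_rpow_of_nonneg _ _ hq.le, ← ENNReal.rpow_mul, ← ENNReal.rpow_mul,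
      one_div_mul_cancel hp.ne', one_div_mul_cancel hq.ne', ENNReal.rpow_one, ENNReal.rpow_one]
    have h1 : ∀ (s : ℝ) (m : ℝ≥0∞), 1 < s → m / ENNReal.ofReal s ≤ m := by
      intro s m hs
      refine ENNReal.div_le_of_le_mul ?_
      have : 1 ≤ ENNReal.ofReal s := by rw [← ENNReal.ofReal_one]; exact ENNReal.ofReal_le_ofReal hs.le
      calc m = m * 1 := (mul_one _).symm
        _ ≤ _ := by gcongr
    exact add_le_add (h1 _ _ h.hpq.lt) (h1 _ _ h.hpq.symm.lt)
  have hVc := h.symm.cmp hr hE hc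
  have hWc := h.cmp hr hE hc
  rw [← hB, ← hmV] at hVc
  rw [← hB, ← hmW] at hWc
  have hintg : mV * α ^ p + mW * β ^ q ≤ ((A * c) ^ q + (A * c) ^ p) * ∫⁻ y in E, Psi p q W V G g y := by
    have i1 : (∫⁻ y in E, V y) * α ^ p ≤ ∫⁻ y in E, Psi p q W V G g y := by
      rw [← lintegral_mul_const _ h.mV]
      refine setLIntegral_mono' hEm fun y hy => ?_
      unfold Psi
      refine le_trans ?_ le_self_add
      rw [mul_comm]
      gcongr
      exact hαu y (hE hy)
    have i2 : (∫⁻ y in E, W y) * β ^ q ≤ ∫⁻ y in E, Psi p q W V G g y := by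
      rw [← lintegral_mul_const _ h.mW]
      refine setLIntegral_mono' hEm fun y hy => ?_
      unfold Psi
      refine le_trans ?_ le_add_self
      rw [mul_comm]
      gcongr
      exact hβv y (hE hy)
    calc _ ≤ ((A * c) ^ q * ∫⁻ y in E, V y) * α ^ p + ((A * c) ^ p * ∫⁻ y in E, W y) * β ^ q := by gcongr
      _ = (A * c) ^ q * ((∫⁻ y in E, V y) * α ^ p) + (A * c) ^ p * ((∫⁻ y in E, W y) * β ^ q) := by ring
      _ ≤ (A * c) ^ q * (∫⁻ y in E, Psi p q W V G g y) + (A * c) ^ p * (∫⁻ y in E, Psi p q W V G g y) := by gcongr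
      _ = _ := by ring
  have hAp := h.Ap x r hr
  rw [eα, eβ]
  calc _ = (mV ^ (1 / p) * mV ^ (1 / q)) * α * ((mW ^ (1 / p) * mW ^ (1 / q)) * β) := by
        rw [split _ hmV0 hmVt, split _ hmW0 hmWt]
    _ = (mW ^ (1 / p) * mV ^ (1 / q)) * ((mV ^ (1 / p) * α) * (mW ^ (1 / q) * β)) := by ring
    _ ≤ (A * volume B) * (((A * c) ^ q + (A * c) ^ p) * ∫⁻ y in E, Psi p q W V G g y) :=
        mul_le_mul' hAp (hyoung.trans hintg)
    _ = _ := by ring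

lemma Psi_int (h : APair n p q W V A) : ∃ C : ℝ≥0∞, C ≠ ∞ ∧ ∀ G g : Eucl n → ℝ≥0∞, Measurable G → Measurable g →
    ∫⁻ y, Psi p q W V G g y ≤ C * (∫⁻ y, G y ^ p * W y) + C * ∫⁻ y, g y ^ q * W y := by
  have hp := h.hpq.pos
  have hq := h.hpq.symm.pos
  obtain ⟨C1, hC1, h1⟩ := Mx_strong h.symm.dbl h.hpq.lt
  obtain ⟨C2, hC2, h2⟩ := Mx_strong h.dbl h.hpq.symm.lt
  refine ⟨C1 + C2, ENNReal.add_ne_top.2 ⟨hC1, hC2⟩, fun G g hG hg => ?_⟩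
  have e : ∀ (f : Eucl n → ℝ≥0∞) (hf : Measurable f) {Z : Eucl n → ℝ≥0∞} (hZ : Measurable Z),
      ∫⁻ x, f x ∂(volume.withDensity Z) = ∫⁻ x, f x * Z x := by
    intro f hf Z hZ
    rw [lintegral_withDensity_eq_lintegral_mul _ hZ hf]
    exact lintegral_congr fun x => mul_comm _ _
  have a1 := h1 (fun y => G y * (V y)⁻¹) (hG.mul h.mV.inv)
  have a2 := h2 g hg
  rw [e _ ((Mx_meas _ _).pow_const _) h.mV, e (fun y => (G y * (V y)⁻¹) ^ p) ((hG.mul h.mV.inv).pow_const _) h.mV] at a1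
  rw [e _ ((Mx_meas _ _).pow_const _) h.mW, e _ (hg.pow_const _) h.mW] at a2
  have e2 : ∀ y, (G y * (V y)⁻¹) ^ p * V y = G y ^ p * W y := by
    intro y
    have hV0 := h.symm.W_ne_zero y
    have hVt := h.symm.W_ne_top y
    have hone := congrArg (fun z => z ^ p) (h.one y)
    simp only [ENNReal.one_rpow] at hone
    rw [ENNReal.mul_rpow_of_nonneg _ _ hp.le, ← ENNReal.rpow_mul, ← ENNReal.rpow_mul, one_div_mul_cancel hp.ne', ENNReal.rpow_one] at hone
    have hpq1 : 1 / q * p = p - 1 := by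
      have := h.hpq.inv_add_inv_eq_one
      field_simp at this ⊢; linarith
    rw [hpq1] at hone
    have e3 : V y ^ p = V y ^ (p - 1) * V y := by
      conv_rhs => rw [← ENNReal.rpow_one (V y), ← ENNReal.rpow_mul, one_mul]
      rw [← ENNReal.rpow_add _ _ hV0 hVt]; congr 1; ring
    rw [ENNReal.mul_rpow_of_nonneg _ _ hp.le, ENNReal.inv_rpow, mul_assoc]
    congr 1
    have hVp0 : V y ^ p ≠ 0 := by simp [ENNReal.rpow_eq_zero_iff, hV0, hVt]
    have hVpt : V y ^ p ≠ ∞ := ENNReal.rpow_ne_top_of_nonneg hp.le hVt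
    calc _ = (V y ^ p)⁻¹ * V y * (W y * V y ^ (p - 1)) := by rw [hone, mul_one]
      _ = (V y ^ p)⁻¹ * (V y ^ (p - 1) * V y) * W y := by ring
      _ = _ := by rw [← e3, ENNReal.inv_mul_cancel hVp0 hVpt, one_mul]
  simp only [e2] at a1
  unfold Psi
  have hmm : Measurable fun y => Mx (volume.withDensity V) (fun y => G y * (V y)⁻¹) y ^ p * V y :=
    ((Mx_meas _ _).pow_const _).mul h.mV
  rw [lintegral_add_left hmm]
  refine add_le_add (a1.trans ?_) (a2.trans ?_)
  · gcongr; exact le_self_add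
  · gcongr; exact le_add_self

end APair

lemma sq_add_le (a b : ℝ≥0∞) : (a + b) ^ 2 ≤ 2 * a ^ 2 + 2 * b ^ 2 := by
  rcases eq_or_ne a ∞ with ha | ha
  · simp [ha]
  rcases eq_or_ne b ∞ with hb | hb
  · simp [hb]
  lift a to ℝ≥0 using ha
  lift b to ℝ≥0 using hb
  norm_cast
  rw [← NNReal.coe_le_coe]
  push_cast
  nlinarith [sq_nonneg ((a:ℝ) - b)]

lemma Asq_cmp {n : ℕ} (hn : 0 < n) {K : Eucl n → ℝ} {C : ℝ} (hK : CZK n K C) :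
    ∃ C' : ℝ, 0 ≤ C' ∧ ∀ l : ℝ, 0 < l → ∀ I : Set ℝ, MeasurableSet I → I ⊆ Ioi l → ∀ G : Eucl n → ℝ,
      Measurable G → Integrable G volume → ∀ y y' : Eucl n, ‖y' - y‖ ≤ n * l →
      Asq K I G y ≤ 2 * Asq K I G y' + 2 * (ENNReal.ofReal C' * (4 * om n) * Mx volume (fun z => ‖G z‖ₑ) y') ^ 2 := by
  obtain ⟨C', hC', hsm⟩ := hK.smooth hn (D := n) (by exact_mod_cast hn)
  refine ⟨C', hC', fun l hl I hIm hI G hGm hG y y' hyy => ?_⟩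
  have hkm : Measurable (Function.uncurry fun (t : ℝ) (z : Eucl n) => ‖kd K t (y' - z) - kd K t (y - z)‖ₑ) := by
    have h1 : ∀ x, Measurable fun q : ℝ × Eucl n => kd K q.1 (x - q.2) := fun x =>
      (kd_meas hK.meas).comp (by fun_prop : Measurable fun q : ℝ × Eucl n => (q.1, x - q.2))
    exact ((h1 y').sub (h1 y)).enorm
  have hN1 : Measurable fun z => Nl n l (y' - z) :=
    Measurable.comp (g := Nl n l) (Nl_meas1 n _) (measurable_const.sub measurable_id)
  have hNm : Measurable fun z => ENNReal.ofReal C' * Nl n l (y' - z) := hN1.const_mul _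
  have hmc : Measurable fun t => 2 * ‖cv K t G y'‖ₑ ^ 2 := ((cv_meas_t hK.meas hGm y').enorm.pow_const 2).const_mul 2
  unfold Asq
  calc _ ≤ ∫⁻ t in I, (2 * ‖cv K t G y'‖ₑ ^ 2 + 2 * (∫⁻ z, ‖kd K t (y' - z) - kd K t (y - z)‖ₑ * ‖G z‖ₑ) ^ 2) ∂mdt := by
        refine setLIntegral_mono' hIm fun t ht => ?_
        have ht0 : 0 < t := hl.trans (hI ht)
        refine le_trans ?_ (sq_add_le _ _)
        gcongr
        have i1 := cv_integrable hK ht0 hG measurable_id y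
        have i2 := cv_integrable hK ht0 hG measurable_id y'
        simp only [id] at i1 i2
        have e : cv K t G y = cv K t G y' - ∫ z, (kd K t (y' - z) - kd K t (y - z)) * G z := by
          unfold cv
          simp only [sub_mul]
          rw [integral_sub i2 i1]; ring
        rw [e]
        refine enorm_sub_le.trans ?_
        gcongr
        refine (enorm_integral_le_lintegral_enorm _).trans (le_of_eq ?_)
        simp only [enorm_mul]
    _ = 2 * (∫⁻ t in I, ‖cv K t G y'‖ₑ ^ 2 ∂mdt) + 2 * ∫⁻ t in I, (∫⁻ z, ‖kd K t (y' - z) - kd K t (y - z)‖ₑ * ‖G z‖ₑ) ^ 2 ∂mdt := by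
        rw [lintegral_add_left hmc, lintegral_const_mul' _ _ (by simp), lintegral_const_mul' _ _ (by simp)]
    _ ≤ _ := by
        gcongr
        refine (mink (mdt.restrict I) volume hkm hGm.enorm hNm fun z => ?_).trans ?_
        · refine le_trans (lintegral_mono_set hI) (hsm l hl (y' - z) (y - z) ?_)
          rwa [sub_sub_sub_cancel_right]
        · gcongr
          simp only [mul_assoc]
          have hN2 : Measurable fun z => Nl n l (y' - z) * ‖G z‖ₑ := hN1.mul hGm.enorm
          rw [lintegral_const_mul _ hN2]
          gcongr
          have := Nl_conv hGm.enorm hl y'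
          rwa [mul_assoc] at this

lemma excep {n : ℕ} (hn : 0 < n) {K : Eucl n → ℝ} {C : ℝ} (hK : CZK n K C) :
    ∃ Ct : ℝ≥0∞, Ct ≠ ∞ ∧ ∀ (a b : ℤ) (G : Eucl n → ℝ), Measurable G → Integrable G volume → ∀ l : ℝ, 0 < l →
      ∃ E : Set (Eucl n), MeasurableSet E ∧ ENNReal.ofReal l * volume E ≤ Ct * ∫⁻ z, ‖G z‖ₑ ∧
        ∀ (k : ℤ) (y : Eucl n), a < k → ENNReal.ofReal (l ^ 2) < Asq K (Ioo (2 ^ (k - 1)) (2 ^ b)) G y →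
          Qd (k - 1) y ⊆ E := by
  obtain ⟨C', hC', hcmp⟩ := Asq_cmp hn hK
  obtain ⟨Cw, hCw, hweak⟩ := weak11 hn hK
  set c : ℝ≥0∞ := ENNReal.ofReal C' * (4 * om n) + 1 with hc
  have hct : c ≠ ∞ := ENNReal.add_ne_top.2 ⟨ENNReal.mul_ne_top (by simp) (ENNReal.mul_ne_top (by simp) (om_ne_top n)), by simp⟩
  have hc0 : c ≠ 0 := by rw [hc]; simp
  refine ⟨2 * Cw + 2 * (c * ENNReal.ofReal (6 ^ n)), ?_, fun a b G hGm hG l hl => ?_⟩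
  · exact ENNReal.add_ne_top.2 ⟨ENNReal.mul_ne_top (by simp) hCw, ENNReal.mul_ne_top (by simp) (ENNReal.mul_ne_top hct (by simp))⟩
  set E1 := {x | ENNReal.ofReal ((l / 2) ^ 2) < Asq K (Ioo (2 ^ a) (2 ^ b)) G x} with hE1
  set E2 := {x | ENNReal.ofReal (l / 2) * c⁻¹ < Mx volume (fun y => ‖G y‖ₑ) x} with hE2
  have h8 : ENNReal.ofReal l = 2 * ENNReal.ofReal (l / 2) := by
    rw [show (2:ℝ≥0∞) = ENNReal.ofReal 2 by norm_num, ← ENNReal.ofReal_mul (by norm_num)]; congr 1; ring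
  refine ⟨E1 ∪ E2, ?_, ?_, ?_⟩
  · exact (measurableSet_lt measurable_const (Asq_meas hK.meas hGm _)).union (measurableSet_lt measurable_const (Mx_meas _ _))
  · have e1 := hweak a b G hGm hG (l / 2) (by positivity)
    have e2 := Mx_weak (Dbl_volume n) (fun y => ‖G y‖ₑ) (ENNReal.ofReal (l / 2) * c⁻¹)
    have e2' : ENNReal.ofReal (l / 2) * volume E2 ≤ c * (ENNReal.ofReal (6 ^ n) * ∫⁻ z, ‖G z‖ₑ) := by
      calc _ = c * (ENNReal.ofReal (l / 2) * c⁻¹ * volume E2) := by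
            calc _ = (c * c⁻¹) * (ENNReal.ofReal (l / 2) * volume E2) := by rw [ENNReal.mul_inv_cancel hc0 hct, one_mul]
              _ = _ := by ring
        _ ≤ _ := mul_le_mul_right e2 _
    rw [h8]
    calc _ ≤ 2 * ENNReal.ofReal (l / 2) * (volume E1 + volume E2) := mul_le_mul_right (measure_union_le _ _) _
      _ = 2 * (ENNReal.ofReal (l / 2) * volume E1) + 2 * (ENNReal.ofReal (l / 2) * volume E2) := by ring
      _ ≤ 2 * (Cw * ∫⁻ z, ‖G z‖ₑ) + 2 * (c * (ENNReal.ofReal (6 ^ n) * ∫⁻ z, ‖G z‖ₑ)) := by gcongr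
      _ = _ := by ring
  · intro k y hak hy y' hy'
    by_contra hnot
    simp only [mem_union, not_or] at hnot
    obtain ⟨h1, h2⟩ := hnot
    simp only [hE1, hE2, mem_ofPred_eq, not_lt] at h1 h2
    have h2k : (0:ℝ) < 2 ^ (k - 1) := by positivity
    have := hcmp (2 ^ (k - 1)) h2k (Ioo (2 ^ (k - 1)) (2 ^ b)) measurableSet_Ioo Ioo_subset_Ioi_self G hGm hG y y' (idx_dist hy')
    have h3 : Asq K (Ioo (2 ^ (k - 1)) (2 ^ b)) G y' ≤ ENNReal.ofReal ((l / 2) ^ 2) := by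
      refine le_trans (lintegral_mono_set (Ioo_subset_Ioo_left ?_)) h1
      exact zpow_le_zpow_right₀ one_le_two (by omega)
    have h4 : (ENNReal.ofReal C' * (4 * om n) * Mx volume (fun z => ‖G z‖ₑ) y') ^ 2 ≤ ENNReal.ofReal ((l / 2) ^ 2) := by
      rw [ENNReal.ofReal_pow (by positivity)]
      gcongr
      calc _ ≤ c * (ENNReal.ofReal (l / 2) * c⁻¹) := by gcongr; exact le_self_add
        _ = ENNReal.ofReal (l / 2) * (c * c⁻¹) := by ring
        _ = _ := by rw [ENNReal.mul_inv_cancel hc0 hct, mul_one]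
    have : Asq K (Ioo (2 ^ (k - 1)) (2 ^ b)) G y ≤ ENNReal.ofReal (l ^ 2) := by
      calc _ ≤ 2 * ENNReal.ofReal ((l / 2) ^ 2) + 2 * ENNReal.ofReal ((l / 2) ^ 2) := this.trans (by gcongr)
        _ = 4 * ENNReal.ofReal ((l / 2) ^ 2) := by ring
        _ = ENNReal.ofReal (l ^ 2) := by
          rw [show (4:ℝ≥0∞) = ENNReal.ofReal 4 by norm_num, ← ENNReal.ofReal_mul (by norm_num)]
          congr 1; ring
    exact absurd hy (not_lt.2 this)

/-- bad cubes -/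
def badc {n : ℕ} (K G : Eucl n → ℝ) (b : ℤ) (l : ℝ) (k : ℤ) (x : Eucl n) : Prop :=
  k ≤ b ∧ ∃ y ∈ Qd k x, ENNReal.ofReal (l ^ 2) < Asq K (Ioo (2 ^ (k - 1)) (2 ^ b)) G y

lemma badc_inv {n : ℕ} (K G : Eucl n → ℝ) (b : ℤ) (l : ℝ) :
    ∀ k x y, idx k y = idx k x → badc K G b l k x → badc K G b l k y := by
  intro k x y h hx
  unfold badc at *
  rwa [Qd_eq h]

lemma badc_bdd {n : ℕ} (K G : Eucl n → ℝ) (b : ℤ) (l : ℝ) (x : Eucl n) : BddAbove {k | badc K G b l k x} :=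
  ⟨b, fun _ hk => hk.1⟩

lemma Asq_split {n : ℕ} (K G : Eucl n → ℝ) {r s t : ℝ} (x : Eucl n) :
    Asq K (Ioo r t) G x ≤ Asq K (Ioo r s) G x + Asq K (Ioo s t) G x := by
  have hsub : Ioo r t ⊆ Ioo r s ∪ ({s} ∪ Ioo s t) := by
    intro y hy
    rcases lt_trichotomy y s with h | h | h
    · exact Or.inl ⟨hy.1, h⟩
    · exact Or.inr (Or.inl h)
    · exact Or.inr (Or.inr ⟨h, hy.2⟩)
  have h0 : mdt {s} = 0 := mdt_ac (measure_singleton s)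
  unfold Asq
  refine (lintegral_mono_set hsub).trans ((lintegral_union_le _ _ _).trans ?_)
  refine add_le_add le_rfl ?_
  refine (lintegral_union_le _ _ _).trans ?_
  rw [Measure.restrict_eq_zero.2 h0]; simp

lemma stopping {n : ℕ} {K G : Eucl n → ℝ} {a b : ℤ} (hab : a < b) {l : ℝ} {E : Set (Eucl n)}
    (hE : MeasurableSet E) (x0 : Eucl n)
    (hEv : 2 * (2 ^ n * volume E) ≤ volume (Qd b x0))
    (hEs : ∀ (k : ℤ) (y : Eucl n), a < k → ENNReal.ofReal (l ^ 2) < Asq K (Ioo (2 ^ (k - 1)) (2 ^ b)) G y →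
          Qd (k - 1) y ⊆ E) :
    2 * volume (Qd b x0 ∩ {x | a < stp a (badc K G b l) x}) ≤ volume (Qd b x0) ∧
    (∀ x ∈ Qd b x0, stp a (badc K G b l) x < b) ∧
    (∀ x, Asq K (Ioo (2 ^ a) (2 ^ b)) G x ≤ Asq K (Ioo (2 ^ a) (2 ^ (stp a (badc K G b l) x))) G x + ENNReal.ofReal (l ^ 2)) := by
  set τ := stp a (badc K G b l) with hτ
  have hb := badc_bdd K G b l
  have hi := badc_inv K G b l
  have hτm : Measurable τ := stp_meas hb hi
  have hτb : ∀ x, τ x ≤ b := by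
    intro x
    rcases stp_mem (a := a) hb x with h | ⟨_, h⟩
    · rw [hτ, h]; exact hab.le
    · exact h.1
  set D := Qd b x0 ∩ {x | a < τ x} with hD
  have hDm : MeasurableSet D := (Qd_meas _ _).inter (measurableSet_lt measurable_const hτm)
  have cell : ∀ x, a < τ x → volume (Qd (τ x) x) ≤ 2 ^ n * volume (E ∩ Qd (τ x) x) := by
    intro x hx
    rcases stp_mem (a := a) hb x with h | ⟨_, h⟩
    · rw [← hτ] at h; omega
    rw [← hτ] at h
    obtain ⟨_, y, hy, hy2⟩ := h
    have h1 := hEs _ y hx hy2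
    have h2 : Qd (τ x - 1) y ⊆ E ∩ Qd (τ x) x := by
      refine subset_inter h1 ?_
      rw [← Qd_eq hy]
      exact Qd_mono (by omega) y
    calc volume (Qd (τ x) x) = 2 ^ n * volume (Qd (τ x - 1) y) := by
          rw [Qd_vol, Qd_vol, show (2:ℝ≥0∞) ^ n = ENNReal.ofReal (2 ^ n) by
            rw [ENNReal.ofReal_pow (by norm_num)]; norm_num, ← ENNReal.ofReal_mul (by positivity), ← mul_pow]
          congr 2
          rw [zpow_sub_one₀ two_ne_zero]; ring
      _ ≤ _ := by gcongr
  have hDE : volume D ≤ 2 ^ n * volume E := by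
    have h1 := part_le (lab_meas (a := a) hb hi) volume (F := D.indicator 1) (G := fun x => 2 ^ n * E.indicator 1 x) (by
      intro x
      have hlm : MeasurableSet {y | lab a (badc K G b l) y = lab a (badc K G b l) x} := by
        rw [lab_eq hb hi]; exact Qd_meas _ _
      rw [lintegral_indicator_one₀ hDm.nullMeasurableSet, lintegral_const_mul' _ _ (by simp),
        lintegral_indicator_one₀ hE.nullMeasurableSet, Measure.restrict_apply hDm, Measure.restrict_apply hE, lab_eq hb hi]
      by_cases hx : x ∈ D
      · exact (measure_mono inter_subset_right).trans (cell x hx.2)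
      · have : D ∩ Qd (stp a (badc K G b l) x) x = ∅ := by
          ext y
          simp only [mem_inter_iff, mem_empty_iff_false, iff_false, not_and]
          intro hy hy2
          have e : τ y = τ x := stp_const hb hi hy2
          have hyQ : idx b y = idx b x0 := hy.1
          have hxQ : idx b y = idx b x := idx_mono (hτb x) hy2
          have hyt : a < τ y := hy.2
          exact hx ⟨show idx b x = idx b x0 by rw [← hxQ, hyQ], show a < τ x by rw [← e]; exact hyt⟩
        rw [this]; simp)
    rw [lintegral_indicator_one hDm, lintegral_const_mul' _ _ (by simp), lintegral_indicator_one hE] at h1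
    exact h1
  have hQ0 : volume (Qd b x0) ≠ 0 := by rw [Qd_vol]; simp; positivity
  have hQt : volume (Qd b x0) ≠ ∞ := by rw [Qd_vol]; simp
  refine ⟨(mul_le_mul_right hDE _).trans hEv, ?_, ?_⟩
  · intro x hx
    refine lt_of_le_of_ne (hτb x) fun heq => ?_
    have h1 := cell x (by rw [heq]; exact hab)
    rw [heq, Qd_eq hx] at h1
    have h2 : 2 * volume (Qd b x0) ≤ volume (Qd b x0) := by
      refine le_trans ?_ hEv
      gcongr
      refine h1.trans ?_
      gcongr
      exact inter_subset_left
    rw [two_mul] at h2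
    exact absurd h2 (not_le.2 (ENNReal.lt_add_right hQt hQ0))
  · intro x
    refine (Asq_split K G (s := 2 ^ (τ x)) x).trans ?_
    gcongr
    rcases eq_or_lt_of_le (hτb x) with h | h
    · rw [h]; unfold Asq; simp
    · have := stp_not (a := a) hb x (lt_add_one (τ x))
      unfold badc at this
      push Not at this
      have h3 := this (by omega) x rfl
      rwa [add_sub_cancel_right] at h3

lemma Asq_loc {n : ℕ} {K : Eucl n → ℝ} {C : ℝ} (hK : CZK n K C) (G : Eucl n → ℝ) {b k a : ℤ} (hk : k ≤ b)
    {x0 x : Eucl n} (hx : x ∈ Qd b x0) :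
    Asq K (Ioo (2 ^ a) (2 ^ k)) ((ball x0 ((n + 1) * 2 ^ b)).indicator G) x = Asq K (Ioo (2 ^ a) (2 ^ k)) G x := by
  unfold Asq
  refine setLIntegral_congr_fun measurableSet_Ioo fun t ht => ?_
  congr 2
  unfold cv
  congr 1; ext z
  have ht0 : 0 < t := lt_trans (by positivity) ht.1
  by_cases hz : z ∈ ball x0 ((n + 1) * 2 ^ b)
  · rw [indicator_of_mem hz]
  · rw [indicator_of_notMem hz, kd_supp hK.supp ht0, zero_mul, zero_mul]
    have h1 := idx_dist hx
    rw [mem_ball, not_lt, dist_eq_norm] at hz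
    have h2 : t < 2 ^ b := ht.2.trans_le (zpow_le_zpow_right₀ (by norm_num) hk)
    have h3 : ‖z - x0‖ ≤ ‖x - z‖ + ‖x - x0‖ := by
      calc ‖z - x0‖ = ‖(x - x0) - (x - z)‖ := by congr 1; abel
        _ ≤ _ := (norm_sub_le _ _).trans (by linarith)
    nlinarith

lemma Asq_zero {n : ℕ} {K : Eucl n → ℝ} {G : Eucl n → ℝ} (hG : G =ᵐ[volume] 0) (I : Set ℝ) (x : Eucl n) :
    Asq K I G x = 0 := by
  unfold Asq
  have : ∀ t, cv K t G x = 0 := by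
    intro t
    unfold cv
    rw [integral_eq_zero_of_ae]
    filter_upwards [hG] with z hz
    simp [hz]
  simp [this]

lemma sqrt_add_le (x y : ℝ≥0∞) : (x + y ^ 2) ^ (1/2 : ℝ) ≤ x ^ (1/2 : ℝ) + y := by
  refine (ENNReal.rpow_add_le_add_rpow _ _ (by norm_num) (by norm_num)).trans ?_
  refine add_le_add le_rfl (le_of_eq ?_)
  rw [← ENNReal.rpow_natCast, ← ENNReal.rpow_mul]; norm_num

lemma loc_step {n : ℕ} (hn : 0 < n) {K : Eucl n → ℝ} {CK : ℝ} (hK : CZK n K CK) {p q : ℝ} {W V : Eucl n → ℝ≥0∞}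
    {A : ℝ≥0∞} (hA : APair n p q W V A) :
    ∃ C : ℝ≥0∞, C ≠ ∞ ∧ ∀ (G : Eucl n → ℝ) (g : Eucl n → ℝ≥0∞), Measurable G →
      (∀ x r, IntegrableOn G (ball x r) volume) → Measurable g → ∀ a b : ℤ, a < b →
      (∀ k, a ≤ k → k < b → ∀ x, ∫⁻ y in Qd k x, (Asq K (Ioo (2 ^ a) (2 ^ k)) G y) ^ (1/2 : ℝ) * (g y * W y) ≤
        C * ∫⁻ y in Qd k x, APair.Psi p q W V (fun z => ‖G z‖ₑ) g y) →
      ∀ x, ∫⁻ y in Qd b x, (Asq K (Ioo (2 ^ a) (2 ^ b)) G y) ^ (1/2 : ℝ) * (g y * W y) ≤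
        C * ∫⁻ y in Qd b x, APair.Psi p q W V (fun z => ‖G z‖ₑ) g y := by
  obtain ⟨Ct, hCt, hex⟩ := excep hn hK
  set cB : ℝ≥0∞ := ENNReal.ofReal ((n + 1) ^ n) * om n with hcB
  have hcBt : cB ≠ ∞ := ENNReal.mul_ne_top ENNReal.ofReal_ne_top (om_ne_top n)
  set l0 : ℝ≥0∞ := 2 * 2 ^ n * (Ct + 1) with hl0
  have hl0t : l0 ≠ ∞ := by rw [hl0]; finiteness
  have hl00 : l0 ≠ 0 := by rw [hl0]; positivity
  set M : ℝ≥0∞ := A * ((A * (2 * cB)) ^ q + (A * (2 * cB)) ^ p) with hM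
  have hMt : M ≠ ∞ := by
    have h1 : A * (2 * cB) ≠ ∞ := ENNReal.mul_ne_top hA.At (ENNReal.mul_ne_top (by norm_num) hcBt)
    refine ENNReal.mul_ne_top hA.At (ENNReal.add_ne_top.2 ⟨?_, ?_⟩)
    · exact ENNReal.rpow_ne_top_of_nonneg hA.hpq.symm.pos.le h1
    · exact ENNReal.rpow_ne_top_of_nonneg hA.hpq.pos.le h1
  refine ⟨l0 * M * cB, ENNReal.mul_ne_top (ENNReal.mul_ne_top hl0t hMt) hcBt, fun G g hGm hGi hgm a b hab ih x0 => ?_⟩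
  set C := l0 * M * cB with hC
  set P := APair.Psi p q W V (fun z => ‖G z‖ₑ) g with hP
  have hPm : Measurable P := hA.Psi_meas _ _
  set Q := Qd b x0 with hQ
  set R : ℝ := (n + 1) * 2 ^ b with hR
  have hR0 : 0 < R := by positivity
  set G' := (ball x0 R).indicator G with hG'
  have hG'm : Measurable G' := hGm.indicator measurableSet_ball
  have hG'i : Integrable G' volume := (hGi x0 R).integrable_indicator measurableSet_ball
  have hloc : ∀ x ∈ Q, ∀ k ≤ b, Asq K (Ioo (2 ^ a) (2 ^ k)) G' x = Asq K (Ioo (2 ^ a) (2 ^ k)) G x :=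
    fun x hx k hk => Asq_loc hK G hk hx
  have hQm : MeasurableSet Q := Qd_meas b x0
  set L0 := ∫⁻ z, ‖G' z‖ₑ with hL0
  have hL0t : L0 ≠ ∞ := hG'i.2.ne
  by_cases hz : L0 = 0
  · have hz' : G' =ᵐ[volume] 0 := by
      rw [hL0, lintegral_eq_zero_iff hG'm.enorm] at hz
      filter_upwards [hz] with x hx
      simpa using hx
    have : ∫⁻ y in Q, (Asq K (Ioo (2 ^ a) (2 ^ b)) G y) ^ (1/2 : ℝ) * (g y * W y) = ∫⁻ y in Q, 0 := by
      refine setLIntegral_congr_fun hQm fun y hy => ?_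
      rw [← hloc y hy b le_rfl, Asq_zero hz']
      simp
    rw [this]; simp
  have hvQ : volume Q = ENNReal.ofReal ((2 ^ b) ^ n) := Qd_vol b x0
  have hvQ0 : volume Q ≠ 0 := by rw [hvQ]; simp only [ne_eq, ENNReal.ofReal_eq_zero, not_le]; positivity
  have hvQt : volume Q ≠ ∞ := by rw [hvQ]; exact ENNReal.ofReal_ne_top
  have hvB : volume (ball x0 R) = cB * volume Q := by
    rw [vol_ball _ hR0, hcB, hvQ, hR, mul_pow, ENNReal.ofReal_mul (by positivity)]; ring
  set lam : ℝ≥0∞ := l0 * L0 / volume Q with hlam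
  have hlamt : lam ≠ ∞ := ENNReal.div_ne_top (ENNReal.mul_ne_top hl0t hL0t) hvQ0
  have hlam0 : lam ≠ 0 := by
    rw [hlam]; exact ENNReal.div_ne_zero.2 ⟨mul_ne_zero hl00 hz, hvQt⟩
  have hlp : 0 < lam.toReal := ENNReal.toReal_pos hlam0 hlamt
  have hlamQ : lam * volume Q = l0 * L0 := ENNReal.div_mul_cancel hvQ0 hvQt
  have hlsq : ENNReal.ofReal (lam.toReal ^ 2) = lam ^ 2 := by
    rw [ENNReal.ofReal_pow hlp.le, ENNReal.ofReal_toReal hlamt]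
  obtain ⟨E, hEm, hEv, hEs⟩ := hex a b G' hG'm hG'i lam.toReal hlp
  rw [ENNReal.ofReal_toReal hlamt] at hEv
  have hEv' : 2 * (2 ^ n * volume E) ≤ volume Q := by
    have hne : (Ct + 1) * L0 ≠ 0 := mul_ne_zero (by positivity) hz
    have hnt : (Ct + 1) * L0 ≠ ∞ := ENNReal.mul_ne_top (by finiteness) hL0t
    rw [← ENNReal.mul_le_mul_iff_left hne hnt]
    calc 2 * (2 ^ n * volume E) * ((Ct + 1) * L0) = (l0 * L0) * volume E := by rw [hl0]; ring
      _ = (lam * volume E) * volume Q := by rw [← hlamQ]; ring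
      _ ≤ (Ct * L0) * volume Q := mul_le_mul_left hEv _
      _ ≤ ((Ct + 1) * L0) * volume Q := by gcongr; exact le_self_add
      _ = _ := mul_comm _ _
  obtain ⟨s1, s2, s3⟩ := stopping hab hEm x0 hEv' hEs
  set τ := stp a (badc K G' b lam.toReal) with hτ
  have hb := badc_bdd K G' b lam.toReal
  have hi := badc_inv K G' b lam.toReal
  have hτm : Measurable τ := stp_meas hb hi
  have hDm : MeasurableSet {x | a < τ x} := measurableSet_lt measurable_const hτm
  set D := {x | a < τ x} with hD
  have hτa : ∀ x, a ≤ τ x := fun x => stp_ge hb x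
  have hτb : ∀ x, τ x ≤ b := by
    intro x
    rcases stp_mem (a := a) hb x with h | h
    · exact h.trans_le hab.le
    · exact h.2.1
  -- first part
  have f1 : ∫⁻ y in Q, (Asq K (Ioo (2 ^ a) (2 ^ (τ y))) G' y) ^ (1/2 : ℝ) * (g y * W y) ≤
      ∫⁻ y in Q, D.indicator (fun y => C * P y) y := by
    refine part_le (lab_meas (a := a) hb hi) _ fun x => ?_
    rw [lab_eq hb hi x, Measure.restrict_restrict (Qd_meas _ _)]
    by_cases hx : x ∈ Q
    · have hsub : Qd (τ x) x ⊆ Q := by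
        rw [hQ, ← Qd_eq hx]; exact Qd_mono (hτb x) x
      rw [inter_eq_left.2 hsub]
      have e1 : ∫⁻ y in Qd (τ x) x, (Asq K (Ioo (2 ^ a) (2 ^ (τ y))) G' y) ^ (1/2 : ℝ) * (g y * W y) =
          ∫⁻ y in Qd (τ x) x, (Asq K (Ioo (2 ^ a) (2 ^ (τ x))) G y) ^ (1/2 : ℝ) * (g y * W y) := by
        refine setLIntegral_congr_fun (Qd_meas _ _) fun y hy => ?_
        rw [hloc y (hsub hy) _ (hτb y), show τ y = τ x from stp_const hb hi hy]
      rw [e1]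
      by_cases hxa : a < τ x
      · refine (ih _ (hτa x) (s2 x hx) x).trans (le_of_eq ?_)
        rw [← lintegral_const_mul _ hPm]
        refine setLIntegral_congr_fun (Qd_meas _ _) fun y hy => ?_
        rw [indicator_of_mem]
        show a < τ y
        rwa [show τ y = τ x from stp_const hb hi hy]
      · have : τ x = a := le_antisymm (not_lt.1 hxa) (hτa x)
        rw [this]
        simp [Asq]
    · have : Qd (τ x) x ∩ Q = ∅ := by
        rw [Set.eq_empty_iff_forall_notMem]
        rintro y ⟨h1, h2⟩
        apply hx
        have h3 : idx b y = idx b x := idx_mono (hτb x) h1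
        have h4 : idx b y = idx b x0 := h2
        show idx b x = idx b x0
        rw [← h3, h4]
      have h' : Qd (stp a (badc K G' b lam.toReal) x) x ∩ Q = ∅ := this
      rw [h']; simp
  have f1' : ∫⁻ y in Q, D.indicator (fun y => C * P y) y = C * ∫⁻ y in Q ∩ D, P y := by
    rw [lintegral_indicator hDm, Measure.restrict_restrict hDm, lintegral_const_mul _ hPm, inter_comm]
  -- second part
  have f2 : lam * ∫⁻ y in Q, g y * W y ≤ C * ∫⁻ y in Q \ D, P y := by
    have hQB : Q ⊆ ball x0 R := Qd_sub_ball x0 (by rw [hR]; nlinarith [show (0:ℝ) < 2 ^ b by positivity])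
    have hvol : volume (ball x0 R) ≤ 2 * cB * volume (Q \ D) := by
      rw [hvB]
      have h1 : volume Q ≤ volume (Q ∩ D) + volume (Q \ D) := measure_le_inter_add_sdiff _ _ _
      have h2 : volume Q + volume Q ≤ volume Q + 2 * volume (Q \ D) := by
        calc volume Q + volume Q ≤ 2 * volume (Q ∩ D) + 2 * volume (Q \ D) := by
              rw [← two_mul, ← mul_add]; exact mul_le_mul_right h1 _
          _ ≤ _ := add_le_add s1 le_rfl
      have h3 := (ENNReal.add_le_add_iff_left hvQt).1 h2
      calc cB * volume Q ≤ cB * (2 * volume (Q \ D)) := mul_le_mul_right h3 _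
        _ = _ := by ring
    have h1 := hA.locl (c := 2 * cB) (hGm.enorm) hgm hR0 (sdiff_subset.trans hQB : Q \ D ⊆ ball x0 R) (hQm.diff hDm) hvol
    rw [← hM] at h1
    have hL : L0 = ∫⁻ y in ball x0 R, ‖G y‖ₑ := by
      rw [hL0, ← lintegral_indicator measurableSet_ball]
      refine lintegral_congr fun y => ?_
      rw [hG', enorm_indicator_eq_indicator_enorm]
    rw [← hL] at h1
    rw [← ENNReal.mul_le_mul_iff_left hvQ0 hvQt]
    calc (lam * ∫⁻ y in Q, g y * W y) * volume Q = l0 * (L0 * ∫⁻ y in Q, g y * W y) := by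
          rw [mul_right_comm, hlamQ]; ring
      _ ≤ l0 * (L0 * ∫⁻ y in ball x0 R, g y * W y) := by
          refine mul_le_mul_right (mul_le_mul_right (lintegral_mono_set hQB) _) _
      _ ≤ l0 * (M * volume (ball x0 R) * ∫⁻ y in Q \ D, P y) := mul_le_mul_right h1 _
      _ = _ := by rw [hvB, hC]; ring
  calc ∫⁻ y in Q, (Asq K (Ioo (2 ^ a) (2 ^ b)) G y) ^ (1/2 : ℝ) * (g y * W y)
      ≤ ∫⁻ y in Q, ((Asq K (Ioo (2 ^ a) (2 ^ (τ y))) G' y) ^ (1/2 : ℝ) * (g y * W y) + lam * (g y * W y)) := by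
        refine setLIntegral_mono' hQm fun y hy => ?_
        rw [← hloc y hy b le_rfl, ← add_mul]
        refine mul_le_mul_left ?_ _
        have := s3 y
        rw [hlsq] at this
        exact (ENNReal.rpow_le_rpow this (by norm_num)).trans (sqrt_add_le _ _)
    _ = (∫⁻ y in Q, (Asq K (Ioo (2 ^ a) (2 ^ (τ y))) G' y) ^ (1/2 : ℝ) * (g y * W y)) + lam * ∫⁻ y in Q, g y * W y := by
        have hm : Measurable fun y => g y * W y := hgm.mul hA.mW
        have hm2 : Measurable fun y => lam * (g y * W y) := hm.const_mul lam
        rw [lintegral_add_right _ hm2, lintegral_const_mul _ hm]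
    _ ≤ C * (∫⁻ y in Q ∩ D, P y) + C * ∫⁻ y in Q \ D, P y := add_le_add (f1.trans f1'.le) f2
    _ = C * ∫⁻ y in Q, P y := by rw [← mul_add, lintegral_inter_add_sdiff _ _ hDm]

lemma loc_est {n : ℕ} (hn : 0 < n) {K : Eucl n → ℝ} {CK : ℝ} (hK : CZK n K CK) {p q : ℝ} {W V : Eucl n → ℝ≥0∞}
    {A : ℝ≥0∞} (hA : APair n p q W V A) :
    ∃ C : ℝ≥0∞, C ≠ ∞ ∧ ∀ (G : Eucl n → ℝ) (g : Eucl n → ℝ≥0∞), Measurable G →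
      (∀ x r, IntegrableOn G (ball x r) volume) → Measurable g → ∀ a b : ℤ, a ≤ b →
      ∀ x, ∫⁻ y in Qd b x, (Asq K (Ioo (2 ^ a) (2 ^ b)) G y) ^ (1/2 : ℝ) * (g y * W y) ≤
        C * ∫⁻ y in Qd b x, APair.Psi p q W V (fun z => ‖G z‖ₑ) g y := by
  obtain ⟨C, hC, h⟩ := loc_step hn hK hA
  refine ⟨C, hC, fun G g hG hGi hg a => ?_⟩
  have key : ∀ m : ℕ, ∀ b : ℤ, a ≤ b → b ≤ a + m → 
      ∀ x, ∫⁻ y in Qd b x, (Asq K (Ioo (2 ^ a) (2 ^ b)) G y) ^ (1/2 : ℝ) * (g y * W y) ≤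
        C * ∫⁻ y in Qd b x, APair.Psi p q W V (fun z => ‖G z‖ₑ) g y := by
    intro m
    induction m with
    | zero =>
      intro b hab hb x
      have : b = a := by push_cast at hb; omega
      subst this
      simp [Asq]
    | succ m ih =>
      intro b hab hb x
      rcases hab.eq_or_lt with rfl | hab'
      · simp [Asq]
      · refine h G g hG hGi hg a b hab' (fun k h1 h2 x => ih k h1 (by push_cast at hb; omega) x) x
  intro b hab
  exact key (b - a).toNat b hab (by omega)

lemma glob_est {n : ℕ} (hn : 0 < n) {K : Eucl n → ℝ} {CK : ℝ} (hK : CZK n K CK) {p q : ℝ} {W V : Eucl n → ℝ≥0∞}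
    {A : ℝ≥0∞} (hA : APair n p q W V A) :
    ∃ C : ℝ≥0∞, C ≠ ∞ ∧ ∀ (G : Eucl n → ℝ) (g : Eucl n → ℝ≥0∞), Measurable G →
      (∀ x r, IntegrableOn G (ball x r) volume) → Measurable g → ∀ a b : ℤ, a ≤ b →
      ∫⁻ y, (Asq K (Ioo (2 ^ a) (2 ^ b)) G y) ^ (1/2 : ℝ) * (g y * W y) ≤
        C * (∫⁻ y, ‖G y‖ₑ ^ p * W y) + C * ∫⁻ y, g y ^ q * W y := by
  obtain ⟨C, hC, h⟩ := loc_est hn hK hA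
  obtain ⟨C2, hC2, h2⟩ := hA.Psi_int
  refine ⟨C * C2, ENNReal.mul_ne_top hC hC2, fun G g hG hGi hg a b hab => ?_⟩
  have hPm : Measurable (APair.Psi p q W V (fun z => ‖G z‖ₑ) g) := hA.Psi_meas _ _
  calc ∫⁻ y, (Asq K (Ioo (2 ^ a) (2 ^ b)) G y) ^ (1/2 : ℝ) * (g y * W y)
      ≤ ∫⁻ y, C * APair.Psi p q W V (fun z => ‖G z‖ₑ) g y := by
        refine part_le (idx_meas b) _ fun x => ?_
        rw [lintegral_const_mul _ hPm]
        exact h G g hG hGi hg a b hab x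
    _ = C * ∫⁻ y, APair.Psi p q W V (fun z => ‖G z‖ₑ) g y := lintegral_const_mul _ hPm
    _ ≤ C * (C2 * (∫⁻ y, ‖G y‖ₑ ^ p * W y) + C2 * ∫⁻ y, g y ^ q * W y) := mul_le_mul_right (h2 _ _ hG.enorm hg) _
    _ = _ := by ring

lemma trunc_le {n : ℕ} {p : ℝ} (hp : 0 < p) {X W : Eucl n → ℝ≥0∞} (hX : Measurable X) (hW : Measurable W)
    (hWt : ∀ x, W x ≠ ∞) {c : ℝ≥0∞}
    (h : ∀ m : ℕ, ∫⁻ x, ((ball 0 m).indicator (fun x => min (X x) m) x) ^ p * W x ≤ c) :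
    ∫⁻ x, X x ^ p * W x ≤ c := by
  have hm : ∀ m : ℕ, Measurable fun x => ((ball (0 : Eucl n) m).indicator (fun x => min (X x) m) x) ^ p * W x := fun m =>
    (((hX.min measurable_const).indicator measurableSet_ball).pow_const p).mul hW
  refine le_of_tendsto' (lintegral_tendsto_of_tendsto_of_monotone (fun m => (hm m).aemeasurable) ?_ ?_) h
  · refine Eventually.of_forall fun x => ?_
    intro m k hmk
    simp only
    refine mul_le_mul_left (ENNReal.rpow_le_rpow ?_ hp.le) _
    have hmk' : (m : ℝ) ≤ k := by exact_mod_cast hmk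
    have hmk2 : (m : ℝ≥0∞) ≤ k := by exact_mod_cast hmk
    by_cases hx : x ∈ ball (0 : Eucl n) m
    · rw [indicator_of_mem hx, indicator_of_mem (ball_subset_ball hmk' hx)]
      exact min_le_min le_rfl hmk2
    · rw [indicator_of_notMem hx]; exact zero_le
  · refine Eventually.of_forall fun x => ?_
    refine ENNReal.Tendsto.mul_const ?_ (Or.inr (hWt x))
    refine ((ENNReal.continuous_rpow_const (y := p)).tendsto _).comp ?_
    have h1 : Tendsto (fun m : ℕ => min (X x) (m : ℝ≥0∞)) atTop (𝓝 (min (X x) ∞)) :=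
      Tendsto.min tendsto_const_nhds ENNReal.tendsto_nat_nhds_top
    rw [min_eq_left le_top] at h1
    refine h1.congr' ?_
    obtain ⟨k, hk⟩ := exists_nat_gt ‖x‖
    filter_upwards [eventually_ge_atTop k] with m hm
    have : x ∈ ball (0 : Eucl n) m := by
      rw [mem_ball_zero_iff]
      exact hk.trans_le (by exact_mod_cast hm)
    rw [indicator_of_mem this]

lemma absorb {n : ℕ} {p q : ℝ} {W V : Eucl n → ℝ≥0∞} {A : ℝ≥0∞} (hA : APair n p q W V A) {C : ℝ≥0∞} (hC : C ≠ ∞) :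
    ∃ C' : ℝ≥0∞, C' ≠ ∞ ∧ ∀ (X : Eucl n → ℝ≥0∞) (N : ℝ≥0∞), Measurable X →
      (∀ g : Eucl n → ℝ≥0∞, Measurable g → (∃ M : ℝ≥0∞, M ≠ ∞ ∧ ∀ x, g x ≤ M) →
        (∃ m : ℕ, ∀ x, x ∉ ball (0 : Eucl n) m → g x = 0) →
        ∫⁻ x, X x * (g x * W x) ≤ C * N + C * ∫⁻ x, g x ^ q * W x) →
      ∫⁻ x, X x ^ p * W x ≤ C' * N := by
  have hp := hA.hpq.pos
  have hp1 := hA.hpq.sub_one_pos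
  have hq := hA.hpq.symm.pos
  have hq1 := hA.hpq.symm.sub_one_pos
  set D : ℝ≥0∞ := (2 * (C + 1))⁻¹ with hD
  have hD0 : D ≠ 0 := by rw [hD]; simp; finiteness
  have hDt : D ≠ ∞ := by rw [hD]; simp
  set ε : ℝ≥0∞ := D ^ (1 / (q - 1)) with hε
  have hεt : ε ≠ ∞ := ENNReal.rpow_ne_top_of_nonneg (by positivity) hDt
  have hε0 : ε ≠ 0 := by
    rw [hε]; exact (ENNReal.rpow_pos (pos_iff_ne_zero.2 hD0) hDt).ne'
  have hεq : ε ^ q = D * ε := by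
    rw [hε, ← ENNReal.rpow_mul]
    nth_rewrite 2 [← ENNReal.rpow_one D]
    rw [← ENNReal.rpow_add _ _ hD0 hDt]
    congr 1; field_simp; ring
  have hCD : C * D ≤ 2⁻¹ := by
    have hc : C + 1 ≠ 0 := by positivity
    rw [hD, ENNReal.mul_inv (by simp) (by simp)]
    calc C * (2⁻¹ * (C + 1)⁻¹) = 2⁻¹ * (C * (C + 1)⁻¹) := by ring
      _ ≤ 2⁻¹ * 1 := by
        refine mul_le_mul_right ?_ _
        rw [← div_eq_mul_inv]
        exact ENNReal.div_le_of_le_mul (by rw [one_mul]; exact le_self_add)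
      _ = _ := mul_one _
  refine ⟨ε⁻¹ * 2 * C, ENNReal.mul_ne_top (ENNReal.mul_ne_top (ENNReal.inv_ne_top.2 hε0) (by norm_num)) hC,
    fun X N hX h => ?_⟩
  refine trunc_le hp hX hA.mW hA.W_ne_top fun m => ?_
  set Y : Eucl n → ℝ≥0∞ := (ball 0 m).indicator (fun x => min (X x) m) with hY
  have hYm : Measurable Y := (hX.min measurable_const).indicator measurableSet_ball
  have hYX : ∀ x, Y x ≤ X x := fun x => by
    rw [hY]; exact (indicator_le_self' (fun _ _ => zero_le) x).trans (min_le_left _ _)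
  have hYt : ∀ x, Y x ≤ m := fun x => by
    rw [hY]; exact (indicator_le_self' (fun _ _ => zero_le) x).trans (min_le_right _ _)
  set Z := ∫⁻ x, Y x ^ p * W x with hZ
  have hZt : Z ≠ ∞ := by
    have h1 : Z ≤ ∫⁻ x in ball 0 m, (m : ℝ≥0∞) ^ p * W x := by
      rw [hZ, ← lintegral_indicator measurableSet_ball]
      refine lintegral_mono fun x => ?_
      by_cases hx : x ∈ ball (0 : Eucl n) m
      · rw [indicator_of_mem hx]; exact mul_le_mul_left (ENNReal.rpow_le_rpow (hYt x) hp.le) _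
      · rw [hY]; simp only; rw [indicator_of_notMem hx, indicator_of_notMem hx, ENNReal.zero_rpow_of_pos hp, zero_mul]
    rw [lintegral_const_mul _ hA.mW] at h1
    exact (h1.trans_lt (ENNReal.mul_lt_top (ENNReal.rpow_lt_top_of_nonneg hp.le (by simp)) (hA.finW _ _).lt_top)).ne
  have hg := h (fun x => ε * Y x ^ (p - 1)) ((hYm.pow_const _).const_mul ε)
    ⟨ε * (m : ℝ≥0∞) ^ (p - 1), ENNReal.mul_ne_top hεt (ENNReal.rpow_ne_top_of_nonneg hp1.le (by simp)),
      fun x => mul_le_mul_right (ENNReal.rpow_le_rpow (hYt x) hp1.le) _⟩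
    ⟨m, fun x hx => by rw [hY]; rw [indicator_of_notMem hx, ENNReal.zero_rpow_of_pos hp1, mul_zero]⟩
  have hYW : Measurable fun x => Y x ^ p * W x := (hYm.pow_const _).mul hA.mW
  have e1 : ∫⁻ x, (ε * Y x ^ (p - 1)) ^ q * W x = ε ^ q * Z := by
    rw [hZ, ← lintegral_const_mul _ hYW]
    refine lintegral_congr fun x => ?_
    rw [ENNReal.mul_rpow_of_nonneg _ _ hq.le, ← ENNReal.rpow_mul (Y x), hA.hpq.sub_one_mul_conj, mul_assoc]
  have e2 : ε * Z ≤ ∫⁻ x, X x * ((ε * Y x ^ (p - 1)) * W x) := by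
    rw [hZ, ← lintegral_const_mul _ hYW]
    refine lintegral_mono fun x => ?_
    simp only
    calc ε * (Y x ^ p * W x) = Y x * ((ε * Y x ^ (p - 1)) * W x) := by
          have : Y x ^ p = Y x * Y x ^ (p - 1) := by
            nth_rewrite 2 [← ENNReal.rpow_one (Y x)]
            rw [← ENNReal.rpow_add_of_nonneg _ _ zero_le_one hp1.le]; congr 1; ring
          rw [this]; ring
      _ ≤ _ := mul_le_mul_left (hYX x) _
  rw [e1] at hg
  have h3 : C * (ε ^ q * Z) ≤ 2⁻¹ * (ε * Z) := by
    rw [hεq]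
    calc C * (D * ε * Z) = (C * D) * (ε * Z) := by ring
      _ ≤ _ := mul_le_mul_left hCD _
  have h4 : 2⁻¹ * (ε * Z) + 2⁻¹ * (ε * Z) ≤ C * N + 2⁻¹ * (ε * Z) := by
    rw [← add_mul, ENNReal.inv_two_add_inv_two, one_mul]
    exact e2.trans (hg.trans (add_le_add le_rfl h3))
  have h5 := (ENNReal.add_le_add_iff_right (by finiteness)).1 h4
  calc Z = ε⁻¹ * 2 * (2⁻¹ * (ε * Z)) := by
        rw [show ε⁻¹ * 2 * (2⁻¹ * (ε * Z)) = (ε⁻¹ * ε) * (2 * 2⁻¹) * Z by ring, ENNReal.inv_mul_cancel hε0 hεt,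
          ENNReal.mul_inv_cancel (by norm_num) (by norm_num)]; simp
    _ ≤ ε⁻¹ * 2 * (C * N) := mul_le_mul_right h5 _
    _ = _ := by ring

/-- the weighted square function bound -/
theorem thmU {n : ℕ} (hn : 0 < n) {K : Eucl n → ℝ} {CK : ℝ} (hK : CZK n K CK) {p q : ℝ} {W V : Eucl n → ℝ≥0∞}
    {A : ℝ≥0∞} (hA : APair n p q W V A) :
    ∃ C : ℝ≥0∞, C ≠ ∞ ∧ ∀ (G : Eucl n → ℝ), Measurable G → (∀ x r, IntegrableOn G (ball x r) volume) →
      ∫⁻ y, (Asq K (Ioi 0) G y) ^ (p / 2) * W y ≤ C * ∫⁻ y, ‖G y‖ₑ ^ p * W y := by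
  obtain ⟨C, hC, h⟩ := glob_est hn hK hA
  obtain ⟨C', hC', h'⟩ := absorb hA hC
  refine ⟨C', hC', fun G hG hGi => ?_⟩
  have hp := hA.hpq.pos
  have key : ∀ m : ℕ, ∫⁻ y, (Asq K (Ioo (2 ^ (-(m:ℤ))) (2 ^ (m:ℤ))) G y) ^ (p / 2) * W y ≤ C' * ∫⁻ y, ‖G y‖ₑ ^ p * W y := by
    intro m
    have := h' (fun y => (Asq K (Ioo (2 ^ (-(m:ℤ))) (2 ^ (m:ℤ))) G y) ^ (1/2 : ℝ)) (∫⁻ y, ‖G y‖ₑ ^ p * W y)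
      ((Asq_meas hK.meas hG _).pow_const _) (fun g hg _ _ => h G g hG hGi hg _ _ (by omega))
    refine le_trans (le_of_eq (lintegral_congr fun y => ?_)) this
    rw [← ENNReal.rpow_mul]; congr 2; ring
  have hU : ⋃ m : ℕ, Ioo ((2:ℝ) ^ (-(m:ℤ))) (2 ^ (m:ℤ)) = Ioi 0 := by
    ext t
    simp only [mem_iUnion, mem_Ioo, mem_Ioi]
    constructor
    · rintro ⟨m, h1, _⟩; exact lt_trans (by positivity) h1
    · intro ht
      obtain ⟨k, hk⟩ := pow_unbounded_of_one_lt (max t t⁻¹) (one_lt_two)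
      refine ⟨k, ?_, ?_⟩
      · rw [zpow_neg, zpow_natCast, inv_lt_comm₀ (by positivity) ht]
        exact (le_max_right _ _).trans_lt hk
      · rw [zpow_natCast]; exact (le_max_left _ _).trans_lt hk
  have hmono : Monotone fun m : ℕ => Ioo ((2:ℝ) ^ (-(m:ℤ))) (2 ^ (m:ℤ)) := by
    intro m k hmk
    refine Ioo_subset_Ioo ?_ ?_
    · exact zpow_le_zpow_right₀ (by norm_num) (by omega)
    · exact zpow_le_zpow_right₀ (by norm_num) (by omega)
  refine le_of_tendsto' (lintegral_tendsto_of_tendsto_of_monotone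
    (fun m => (((Asq_meas hK.meas hG _).pow_const _).mul hA.mW).aemeasurable) ?_ ?_) key
  · refine Eventually.of_forall fun x => ?_
    intro m k hmk
    refine mul_le_mul_left (ENNReal.rpow_le_rpow ?_ (by positivity)) _
    exact lintegral_mono_set (hmono hmk)
  · refine Eventually.of_forall fun x => ?_
    refine ENNReal.Tendsto.mul_const ?_ (Or.inr (hA.W_ne_top x))
    refine ((ENNReal.continuous_rpow_const (y := p / 2)).tendsto _).comp ?_
    unfold Asq
    rw [← hU, setLIntegral_iUnion_of_directed _ hmono.directed_le]
    exact tendsto_atTop_iSup fun m k hmk => lintegral_mono_set (hmono hmk)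

lemma IsApWeight.pair {n : ℕ} {p : ℝ} (hp : 1 < p) {w : Eucl n → ℝ} (hw : IsApWeight n p w) :
    ∃ q V A, APair n p q (fun x => ENNReal.ofReal (w x)) V A := by
  obtain ⟨hm, hpos, hi, hi', A0, hA0⟩ := hw
  have hpq := Real.HolderConjugate.conjExponent hp
  set q := p.conjExponent with hq
  have hqe : 1 / q = (p - 1) / p := by rw [hq, Real.conjExponent, one_div_div]
  have hp1 : 0 < p - 1 := by linarith
  have hp0 : 0 < p := by linarith
  set v : Eucl n → ℝ := fun y => w y ^ (-1 / (p - 1) : ℝ) with hv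
  have hvpos : ∀ y, 0 < v y := fun y => Real.rpow_pos_of_pos (hpos y) _
  have hfin : ∀ (u : Eucl n → ℝ), (∀ y, 0 < u y) → (∀ (x : Eucl n) (r : ℝ), 0 < r → IntegrableOn u (ball x r) volume) →
      ∀ x r, ∫⁻ y in ball x r, ENNReal.ofReal (u y) = ENNReal.ofReal (∫ y in ball x r, u y) := by
    intro u hu hui x r
    by_cases hr : 0 < r
    · rw [MeasureTheory.ofReal_integral_eq_lintegral_ofReal (hui x r hr) (Eventually.of_forall fun y => (hu y).le)]
    · rw [ball_eq_empty.2 (not_lt.1 hr)]; simp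
  refine ⟨q, fun y => ENNReal.ofReal (v y), ENNReal.ofReal (max A0 0 ^ (1 / p)), hpq, hm.ennreal_ofReal, ?_, ?_, ?_, ?_, by simp, ?_⟩
  · exact (hm.pow_const _).ennreal_ofReal
  · intro x
    rw [ENNReal.ofReal_rpow_of_pos (hpos x), ENNReal.ofReal_rpow_of_pos (hvpos x), ← ENNReal.ofReal_mul (Real.rpow_nonneg (hpos x).le _),
      ← ENNReal.ofReal_one]
    congr 1
    rw [hv]; simp only
    rw [← Real.rpow_mul (hpos x).le, ← Real.rpow_add (hpos x), hqe]
    rw [show 1 / p + -1 / (p - 1) * ((p - 1) / p) = 0 by field_simp; ring, Real.rpow_zero]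
  · intro x r; rw [hfin w hpos hi]; simp
  · intro x r; rw [hfin v hvpos hi']; simp
  · intro x r hr
    rw [hfin w hpos hi, hfin v hvpos hi']
    have h := hA0 x r hr
    have hB : 0 < volume.real (ball x r) := ENNReal.toReal_pos (measure_ball_pos _ _ hr).ne' measure_ball_lt_top.ne
    rw [MeasureTheory.setAverage_eq, MeasureTheory.setAverage_eq, smul_eq_mul, smul_eq_mul] at h
    have hI : 0 ≤ ∫ y in ball x r, w y := integral_nonneg fun y => (hpos y).le
    have hJ : 0 ≤ ∫ y in ball x r, v y := integral_nonneg fun y => (hvpos y).le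
    set I := ∫ y in ball x r, w y
    change _ * ((volume.real (ball x r))⁻¹ * ∫ y in ball x r, v y) ^ (p - 1) ≤ _ at h
    set J := ∫ y in ball x r, v y
    set b := volume.real (ball x r) with hb
    have hvb : volume (ball x r) = ENNReal.ofReal b := (ofReal_measureReal measure_ball_lt_top.ne).symm
    rw [hvb, ENNReal.ofReal_rpow_of_nonneg hI (by positivity), ENNReal.ofReal_rpow_of_nonneg hJ (by rw [hqe]; positivity),
      ← ENNReal.ofReal_mul (by positivity), ← ENNReal.ofReal_mul (by positivity)]
    refine ENNReal.ofReal_le_ofReal ?_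
    have h2 : I * J ^ (p - 1) ≤ max A0 0 * b ^ p := by
      rw [Real.mul_rpow (by positivity) hJ, Real.inv_rpow hB.le] at h
      have e : b ^ p = b * b ^ (p - 1) := by
        nth_rewrite 2 [← Real.rpow_one b]; rw [← Real.rpow_add hB]; congr 1; ring
      have hbp : 0 < b ^ (p - 1) := Real.rpow_pos_of_pos hB _
      rw [e]
      have : I * J ^ (p - 1) = (b⁻¹ * I * ((b ^ (p - 1))⁻¹ * J ^ (p - 1))) * (b * b ^ (p - 1)) := by
        field_simp
      rw [this]
      refine mul_le_mul_of_nonneg_right (h.trans (le_max_left _ _)) (by positivity)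
    have h3 := Real.rpow_le_rpow (by positivity) h2 (show 0 ≤ 1 / p by positivity)
    rw [Real.mul_rpow hI (by positivity), Real.mul_rpow (le_max_right _ _) (by positivity), ← Real.rpow_mul hJ, ← Real.rpow_mul hB.le,
      mul_one_div_cancel hp0.ne', Real.rpow_one, mul_one_div, ← hqe] at h3
    exact h3

namespace APair
variable {n : ℕ} {p q : ℝ} {W V : Eucl n → ℝ≥0∞} {A : ℝ≥0∞}

lemma V_eq (h : APair n p q W V A) (x : Eucl n) : W x ^ q * V x = W x := by
  have h1 := h.one x
  have hq := h.hpq.symm.pos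
  have hp := h.hpq.pos
  have h2 : (W x ^ (1 / p) * V x ^ (1 / q)) ^ q = 1 := by rw [h1, ENNReal.one_rpow]
  rw [ENNReal.mul_rpow_of_nonneg _ _ hq.le, ← ENNReal.rpow_mul, ← ENNReal.rpow_mul, one_div_mul_cancel hq.ne', ENNReal.rpow_one] at h2
  have e : q = 1 + 1 / p * q := by
    have := h.hpq.inv_add_inv_eq_one
    have hq' := hq.ne'
    have hp' := hp.ne'
    field_simp at this ⊢
    linarith
  nth_rewrite 1 [e]
  rw [ENNReal.rpow_add _ _ (h.W_ne_zero x) (h.W_ne_top x), mul_assoc, h2, ENNReal.rpow_one, mul_one]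

lemma hold (h : APair n p q W V A) {f g : Eucl n → ℝ≥0∞} (hf : AEMeasurable f) (hg : AEMeasurable g) :
    ∫⁻ x, f x * g x ≤ (∫⁻ x, f x ^ p * W x) ^ (1 / p) * (∫⁻ x, g x ^ q * V x) ^ (1 / q) := by
  have hp := h.hpq.pos
  have hq := h.hpq.symm.pos
  have := ENNReal.lintegral_mul_le_Lp_mul_Lq volume h.hpq (f := fun y => f y * W y ^ (1 / p)) (g := fun y => g y * V y ^ (1 / q))
    (hf.mul (h.mW.pow_const _).aemeasurable) (hg.mul (h.mV.pow_const _).aemeasurable)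
  simp only [Pi.mul_apply, ENNReal.mul_rpow_of_nonneg _ _ hp.le, ENNReal.mul_rpow_of_nonneg _ _ hq.le, ← ENNReal.rpow_mul, one_div_mul_cancel hp.ne', one_div_mul_cancel hq.ne', ENNReal.rpow_one] at this
  refine le_trans (le_of_eq (lintegral_congr fun x => ?_)) this
  rw [mul_mul_mul_comm, h.one, mul_one]

lemma young (h : APair n p q W V A) {f g : Eucl n → ℝ≥0∞} (hf : AEMeasurable f) :
    ∫⁻ x, f x * g x ≤ (∫⁻ x, f x ^ p * W x) + ∫⁻ x, g x ^ q * V x := by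
  have hp := h.hpq.pos
  have hq := h.hpq.symm.pos
  have hm : AEMeasurable fun x => f x ^ p * W x := (hf.pow_const _).mul h.mW.aemeasurable
  rw [← lintegral_add_left' hm]
  refine lintegral_mono fun x => ?_
  have := ENNReal.young_inequality (f x * W x ^ (1 / p)) (g x * V x ^ (1 / q)) h.hpq
  rw [mul_mul_mul_comm, h.one, mul_one, ENNReal.mul_rpow_of_nonneg _ _ hp.le, ENNReal.mul_rpow_of_nonneg _ _ hq.le,
    ← ENNReal.rpow_mul, ← ENNReal.rpow_mul, one_div_mul_cancel hp.ne', one_div_mul_cancel hq.ne', ENNReal.rpow_one, ENNReal.rpow_one] at this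
  refine this.trans (add_le_add ?_ ?_)
  · refine ENNReal.div_le_of_le_mul ?_
    nth_rewrite 1 [← mul_one (f x ^ p * W x)]
    exact mul_le_mul_right (ENNReal.one_le_ofReal.2 h.hpq.lt.le) _
  · refine ENNReal.div_le_of_le_mul ?_
    nth_rewrite 1 [← mul_one (g x ^ q * V x)]
    exact mul_le_mul_right (ENNReal.one_le_ofReal.2 h.hpq.symm.lt.le) _

lemma l1ball (h : APair n p q W V A) {f : Eucl n → ℝ≥0∞} (hf : AEMeasurable f) (x : Eucl n) (r : ℝ) :
    ∫⁻ y in ball x r, f y ≤ (∫⁻ x, f x ^ p * W x) ^ (1 / p) * (∫⁻ y in ball x r, V y) ^ (1 / q) := by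
  have hq := h.hpq.symm.pos
  have := h.hold hf (g := (ball x r).indicator 1) (measurable_one.indicator measurableSet_ball).aemeasurable
  refine le_trans (le_of_eq ?_) (this.trans (le_of_eq ?_))
  · rw [← lintegral_indicator measurableSet_ball]
    refine lintegral_congr fun y => ?_
    by_cases hy : y ∈ ball x r <;> simp [hy]
  · congr 2
    rw [← lintegral_indicator measurableSet_ball]
    refine lintegral_congr fun y => ?_
    by_cases hy : y ∈ ball x r <;> simp [hy, ENNReal.zero_rpow_of_pos hq]

lemma l1fin (h : APair n p q W V A) {f : Eucl n → ℝ≥0∞} (hf : AEMeasurable f) (hfp : ∫⁻ x, f x ^ p * W x ≠ ∞) (x : Eucl n) (r : ℝ) :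
    ∫⁻ y in ball x r, f y ≠ ∞ := by
  have hp := h.hpq.pos
  have hq := h.hpq.symm.pos
  refine ((h.l1ball hf x r).trans_lt (ENNReal.mul_lt_top ?_ ?_)).ne
  · exact ENNReal.rpow_lt_top_of_nonneg (by positivity) hfp
  · exact ENNReal.rpow_lt_top_of_nonneg (by positivity) (h.finV x r)

lemma l1on {E : Type*} [NormedAddCommGroup E] (h : APair n p q W V A) {f : Eucl n → E} (hf : AEStronglyMeasurable f volume)
    (hfp : ∫⁻ x, ‖f x‖ₑ ^ p * W x ≠ ∞) (x : Eucl n) (r : ℝ) : IntegrableOn f (ball x r) volume :=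
  ⟨hf.restrict, (h.l1fin hf.enorm hfp x r).lt_top⟩

lemma locint {E : Type*} [NormedAddCommGroup E] {f : Eucl n → E} (hf : ∀ x r, IntegrableOn f (ball x r) volume) :
    LocallyIntegrable f volume := fun x => ⟨ball x 1, ball_mem_nhds x one_pos, hf x 1⟩

lemma of_locint {E : Type*} [NormedAddCommGroup E] {f : Eucl n → E} (hf : LocallyIntegrable f volume) (x : Eucl n) (r : ℝ) :
    IntegrableOn f (ball x r) volume :=
  (hf.integrableOn_isCompact (isCompact_closedBall x r)).mono_set ball_subset_closedBall

/-- growth of the averages -/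
lemma growth (h : APair n p q W V A) {f : Eucl n → ℝ≥0∞} (hf : AEMeasurable f) (hfp : ∫⁻ x, f x ^ p * W x ≠ ∞) :
    ∃ c : ℝ≥0∞, c ≠ ∞ ∧ ∀ R : ℝ, 1 ≤ R → ∫⁻ y in ball 0 R, f y ≤ c * ENNReal.ofReal (R ^ n) := by
  have hp := h.hpq.pos
  have hq := h.hpq.symm.pos
  set N := (∫⁻ x, f x ^ p * W x) ^ (1 / p) with hN
  have hNt : N ≠ ∞ := ENNReal.rpow_ne_top_of_nonneg (by positivity) hfp
  set m := (∫⁻ y in ball 0 1, W y) ^ (1 / p) with hm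
  have hm0 : m ≠ 0 := (ENNReal.rpow_pos (pos_iff_ne_zero.2 (h.posB 0 one_pos)) (h.finW 0 1)).ne'
  have hmt : m ≠ ∞ := ENNReal.rpow_ne_top_of_nonneg (by positivity) (h.finW 0 1)
  refine ⟨N * (m⁻¹ * (A * om n)), ENNReal.mul_ne_top hNt (ENNReal.mul_ne_top (ENNReal.inv_ne_top.2 hm0) (ENNReal.mul_ne_top h.At (om_ne_top n))), fun R hR => ?_⟩
  refine (h.l1ball hf 0 R).trans ?_
  rw [mul_assoc N]
  refine mul_le_mul_right ?_ _
  have h1 := h.Ap 0 R (by linarith)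
  rw [vol_ball _ (by linarith)] at h1
  have h2 : m ≤ (∫⁻ y in ball 0 R, W y) ^ (1 / p) :=
    ENNReal.rpow_le_rpow (lintegral_mono_set (ball_subset_ball hR)) (by positivity)
  calc (∫⁻ y in ball 0 R, V y) ^ (1 / q) = m⁻¹ * (m * (∫⁻ y in ball 0 R, V y) ^ (1 / q)) := by
        rw [← mul_assoc, ENNReal.inv_mul_cancel hm0 hmt, one_mul]
    _ ≤ m⁻¹ * (A * (ENNReal.ofReal (R ^ n) * om n)) := mul_le_mul_right ((mul_le_mul_left h2 _).trans h1) _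
    _ = _ := by ring
end APair

/-- the basic kernel -/
def etc (n : ℕ) (i : Fin n) (x : Eucl n) : ℝ := if ‖x‖ < 1 then x i else 0

lemma abs_coord_le {n : ℕ} (x : Eucl n) (i : Fin n) : |x i| ≤ ‖x‖ := by
  have := EuclideanSpace.norm_sq_eq x
  have h2 : ‖x i‖ ^ 2 ≤ ‖x‖ ^ 2 := by
    rw [this]; exact Finset.single_le_sum (f := fun j => ‖x j‖ ^ 2) (fun j _ => by positivity) (Finset.mem_univ i)
  exact abs_le_of_sq_le_sq' (by simpa using h2) (norm_nonneg _) |> abs_le.2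

lemma etc_CZK (n : ℕ) (i : Fin n) : CZK n (etc n i) 1 where
  meas := by
    unfold etc
    exact Measurable.ite (measurableSet_lt measurable_norm measurable_const) (by fun_prop) measurable_const
  supp x hx := by unfold etc; rw [if_neg (not_lt.2 hx)]
  bdd x := by
    unfold etc
    split_ifs with h
    · exact (abs_coord_le x i).trans h.le
    · simp
  lip x y hx hy := by
    unfold etc
    rw [if_pos hx, if_pos hy, one_mul]
    exact abs_coord_le (x - y) i
  mean := by
    have h : ∫ x, etc n i x = ∫ x, etc n i (-x) := (integral_neg_eq_self _ _).symm
    have h2 : ∀ x, etc n i (-x) = - etc n i x := by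
      intro x; unfold etc; rw [norm_neg]; split_ifs <;> simp
    simp_rw [h2] at h
    rw [integral_neg] at h
    linarith

lemma shift_lint {n : ℕ} {α : Type*} [MeasurableSpace α] (ν : Measure α) [SFinite ν] {g : Eucl n → ℝ≥0∞} (hg : Measurable g)
    {c : α → Eucl n} (hc : Measurable c) {M : ℝ} (hM : ∀ a, ‖c a‖ ≤ M) (r : ℝ) :
    ∫⁻ x in ball 0 r, ∫⁻ a, g (x + c a) ∂ν ≤ ν univ * ∫⁻ x in ball 0 (r + M), g x := by
  have hm : Measurable fun q : Eucl n × α => g (q.1 + c q.2) := hg.comp (measurable_fst.add (hc.comp measurable_snd))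
  rw [lintegral_lintegral_swap hm.aemeasurable]
  have : ∀ a, ∫⁻ x in ball 0 r, g (x + c a) ≤ ∫⁻ x in ball 0 (r + M), g x := by
    intro a
    rw [← lintegral_indicator measurableSet_ball, ← lintegral_indicator measurableSet_ball,
      ← lintegral_add_right_eq_self (μ := volume) ((ball 0 (r + M)).indicator g) (c a)]
    refine lintegral_mono fun x => ?_
    by_cases hx : x ∈ ball (0 : Eucl n) r
    · have : x + c a ∈ ball (0 : Eucl n) (r + M) := by
        rw [mem_ball_zero_iff] at hx ⊢
        linarith [norm_add_le x (c a), hM a]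
      rw [indicator_of_mem hx, indicator_of_mem this]
    · rw [indicator_of_notMem hx]; exact zero_le
  refine (lintegral_mono fun a => this a).trans ?_
  rw [lintegral_const, mul_comm]

lemma shift_int {n : ℕ} {α : Type*} [MeasurableSpace α] (ν : Measure α) [IsFiniteMeasure ν] {G : Eucl n → ℝ} (hG : Measurable G)
    (hGi : ∀ x r, IntegrableOn G (ball x r) volume)
    {c : α → Eucl n} (hc : Measurable c) {M : ℝ} (hM : ∀ a, ‖c a‖ ≤ M) {k : Eucl n → α → ℝ}
    (hk : Measurable fun q : Eucl n × α => k q.1 q.2) {Mk : ℝ} (hMk : ∀ x a, |k x a| ≤ Mk) {r : ℝ}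
    (hr : ∀ x a, x ∉ ball (0 : Eucl n) r → k x a = 0) :
    Integrable (fun q : Eucl n × α => G (q.1 + c q.2) * k q.1 q.2) (volume.prod ν) := by
  have hm : Measurable fun q : Eucl n × α => G (q.1 + c q.2) * k q.1 q.2 :=
    (hG.comp (measurable_fst.add (hc.comp measurable_snd))).mul hk
  refine ⟨hm.aestronglyMeasurable, ?_⟩
  rw [hasFiniteIntegral_iff_enorm, lintegral_prod _ hm.enorm.aemeasurable]
  have h1 := shift_lint ν hG.enorm hc hM r
  have h2 : ∫⁻ x in ball 0 (r + M), ‖G x‖ₑ < ∞ := (hGi 0 (r + M)).2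
  have hmm : Measurable fun x : Eucl n => ∫⁻ a, ‖G (x + c a)‖ₑ ∂ν := by
    have : Measurable fun q : Eucl n × α => ‖G (q.1 + c q.2)‖ₑ := (hG.comp (measurable_fst.add (hc.comp measurable_snd))).enorm
    exact this.lintegral_prod_right'
  calc ∫⁻ x, ∫⁻ a, ‖G (x + c a) * k x a‖ₑ ∂ν
      ≤ ∫⁻ x in ball 0 r, ENNReal.ofReal Mk * ∫⁻ a, ‖G (x + c a)‖ₑ ∂ν := by
        rw [← lintegral_indicator measurableSet_ball]
        refine lintegral_mono fun x => ?_
        by_cases hx : x ∈ ball (0 : Eucl n) r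
        · have hmx : Measurable fun a => ‖G (x + c a)‖ₑ := (hG.comp (measurable_const.add hc)).enorm
          rw [indicator_of_mem hx, ← lintegral_const_mul _ hmx]
          refine lintegral_mono fun a => ?_
          rw [enorm_mul, mul_comm]
          refine mul_le_mul_left ?_ _
          rw [Real.enorm_eq_ofReal_abs]; exact ENNReal.ofReal_le_ofReal (hMk x a)
        · simp [hr x _ hx]
    _ = ENNReal.ofReal Mk * ∫⁻ x in ball 0 r, ∫⁻ a, ‖G (x + c a)‖ₑ ∂ν := lintegral_const_mul _ hmm
    _ ≤ ENNReal.ofReal Mk * (ν univ * ∫⁻ x in ball 0 (r + M), ‖G x‖ₑ) := mul_le_mul_right h1 _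
    _ < ∞ := ENNReal.mul_lt_top ENNReal.ofReal_lt_top (ENNReal.mul_lt_top (measure_lt_top _ _) h2)

lemma supp_ball {n : ℕ} {g : Eucl n → ℝ} (hg : HasCompactSupport g) : ∃ r : ℝ, 0 < r ∧ ∀ x, x ∉ ball (0 : Eucl n) r → g x = 0 := by
  obtain ⟨r, hr⟩ := hg.isCompact.isBounded.subset_ball (0 : Eucl n)
  refine ⟨max r 1, by positivity, fun x hx => ?_⟩
  by_contra h
  exact hx (ball_subset_ball (le_max_left _ _) (hr (subset_tsupport _ h)))

lemma bdd_of_cs {n : ℕ} {g : Eucl n → ℝ} (hc : Continuous g) (hg : HasCompactSupport g) : ∃ M : ℝ, 0 ≤ M ∧ ∀ x, |g x| ≤ M := by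
  obtain ⟨M, hM⟩ := hc.bounded_above_of_compact_support hg
  exact ⟨M, (norm_nonneg _).trans (hM 0), hM⟩

/-- difference of a weakly differentiable function along a vector -/
lemma trans_diff {n : ℕ} {f : Eucl n → ℝ} {F : Eucl n → Eucl n} (hfm : Measurable f) (hFm : Measurable F)
    (hf : ∀ x r, IntegrableOn f (ball x r) volume) (hF : ∀ x r, IntegrableOn F (ball x r) volume)
    (h : HasWeakGradient n f F) (v : Eucl n) :
    ∀ᵐ x, f (x + v) - f x = ∫ s in Ioc (0:ℝ) 1, ⟪F (x + s • v), v⟫ := by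
  set ν : Measure ℝ := volume.restrict (Ioc (0:ℝ) 1) with hν
  set G : Eucl n → ℝ := fun x => ⟪F x, v⟫ with hG
  have hGm : Measurable G := by fun_prop
  have hGi : ∀ x r, IntegrableOn G (ball x r) volume := by
    intro x r
    exact (hF x r).inner_const v
  set c : ℝ → Eucl n := fun s => (max 0 (min s 1)) • v with hc
  have hcm : Measurable c := by rw [hc]; fun_prop
  have hcb : ∀ s, ‖c s‖ ≤ ‖v‖ := by
    intro s
    simp only [hc]
    rw [norm_smul, Real.norm_of_nonneg (le_max_left _ _)]
    have : max 0 (min s 1) ≤ (1:ℝ) := max_le zero_le_one (min_le_right _ _)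
    nlinarith [norm_nonneg v]
  have hcs : ∀ s ∈ Ioc (0:ℝ) 1, c s = s • v := by
    intro s hs
    simp only [hc]
    rw [min_eq_left hs.2, max_eq_right hs.1.le]
  have hrw : ∀ x, ∫ s in Ioc (0:ℝ) 1, ⟪F (x + s • v), v⟫ = ∫ s, G (x + c s) ∂ν := by
    intro x
    refine setIntegral_congr_fun measurableSet_Ioc fun s hs => ?_
    simp only [hG]; rw [hcs s hs]
  suffices H : ∀ᵐ x, f (x + v) - f x = ∫ s, G (x + c s) ∂ν by
    filter_upwards [H] with x hx
    rw [hx]; exact (hrw x).symm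
  set u : Eucl n → ℝ := fun x => f (x + v) - f x - ∫ s, G (x + c s) ∂ν with hu
  have hui1 : LocallyIntegrable (fun x => f (x + v)) volume := by
    refine APair.locint fun x r => ?_
    refine ⟨(hfm.comp (measurable_id.add_const v)).aestronglyMeasurable, ?_⟩
    have := shift_lint (Measure.dirac (0:ℝ)) hfm.enorm (c := fun _ => v) measurable_const (M := ‖v‖) (fun _ => le_rfl) (r + ‖x‖)
    simp only [lintegral_const, measure_univ, mul_one, one_mul] at this
    rw [hasFiniteIntegral_iff_enorm]
    refine (lintegral_mono_set ?_).trans_lt (this.trans_lt (hf 0 _).2)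
    refine ball_subset_ball' ?_
    rw [dist_zero_right]
  have hui2 : ∀ x r, IntegrableOn (fun x => ∫ s, G (x + c s) ∂ν) (ball x r) volume := by
    intro x r
    have := shift_int ν hGm hGi hcm hcb (k := fun y _ => (ball x r).indicator 1 y) (Mk := 1) (r := r + ‖x‖)
      ((measurable_one.indicator measurableSet_ball).comp measurable_fst) ?_ ?_
    · have h2 := this.integral_prod_left
      rw [← integrable_indicator_iff measurableSet_ball]
      refine h2.congr (Eventually.of_forall fun y => ?_)
      by_cases hy : y ∈ ball x r <;> simp only [indicator_of_mem, indicator_of_notMem, hy, Pi.one_apply, mul_one, mul_zero, integral_zero, not_false_eq_true]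
    · intro y _
      by_cases hy : y ∈ ball x r <;> simp [hy]
    · intro y _ hy
      rw [indicator_of_notMem]
      intro hy'
      exact hy (ball_subset_ball' (by rw [dist_zero_right]) hy')
  have hui3 : LocallyIntegrable (fun x => ∫ s, G (x + c s) ∂ν) volume := APair.locint hui2
  have huL : LocallyIntegrable u volume := (hui1.sub (APair.locint hf)).sub hui3
  have key : ∀ g : Eucl n → ℝ, ContDiff ℝ (⊤ : ℕ∞) g → HasCompactSupport g → ∫ x, g x • u x = 0 := by
    intro g hg hgs
    have hgc := hg.continuous
    have hg1 : ContDiff ℝ 1 g := hg.of_le (by exact_mod_cast le_top)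
    obtain ⟨r, hr0, hr⟩ := supp_ball hgs
    obtain ⟨M, hM0, hM⟩ := bdd_of_cs hgc hgs
    have hdc : Continuous fun x => fderiv ℝ g x v := (hg1.continuous_fderiv (by norm_num)).clm_apply continuous_const
    have hds : HasCompactSupport fun x => fderiv ℝ g x v := hgs.fderiv_apply (𝕜 := ℝ) v
    obtain ⟨M', hM'0, hM'⟩ := bdd_of_cs hdc hds
    obtain ⟨r', hr'0, hr'⟩ := supp_ball hds
    have i1 : Integrable (fun x => f (x + v) * g x) := by
      have := hui1.integrable_smul_left_of_hasCompactSupport hgc hgs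
      refine this.congr (Eventually.of_forall fun x => ?_); simp [mul_comm]
    have i2 : Integrable (fun x => f x * g x) := by
      have := (APair.locint hf).integrable_smul_left_of_hasCompactSupport hgc hgs
      refine this.congr (Eventually.of_forall fun x => ?_); simp [mul_comm]
    have i3 : Integrable (fun x => (∫ s, G (x + c s) ∂ν) * g x) := by
      have := hui3.integrable_smul_left_of_hasCompactSupport hgc hgs
      refine this.congr (Eventually.of_forall fun x => ?_); simp [mul_comm]
    have i4 : Integrable (fun x => f x * g (x - v)) := by
      have := (APair.locint hf).integrable_smul_left_of_hasCompactSupport (g := fun x => g (x - v)) (by fun_prop)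
        (hgs.comp_homeomorph (Homeomorph.subRight v))
      refine this.congr (Eventually.of_forall fun x => ?_); simp [mul_comm]
    have e1 : ∫ x, f (x + v) * g x = ∫ x, f x * g (x - v) := by
      rw [← integral_add_right_eq_self (fun x => f x * g (x - v)) v]
      simp
    have e3 : ∫ x, (∫ s, G (x + c s) ∂ν) * g x = ∫ x, f x * (g (x - v) - g x) := by
      have hsw : ∫ x, (∫ s, G (x + c s) ∂ν) * g x = ∫ s, (∫ x, G (x + c s) * g x) ∂ν := by
        rw [← integral_integral_swap]
        · congr 1; ext x; rw [integral_mul_const]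
        · exact shift_int ν hGm hGi hcm hcb (k := fun y _ => g y) (hgc.measurable.comp measurable_fst) (fun x _ => hM x) (fun x _ hx => hr x hx)
      rw [hsw]
      have hs : ∀ s, ∫ x, G (x + c s) * g x = - ∫ x, f x * fderiv ℝ g (x - c s) v := by
        intro s
        have h1 := h (fun x => g (x - c s)) (hg.comp (contDiff_id.sub contDiff_const)) (hgs.comp_homeomorph (Homeomorph.subRight (c s))) v
        have h2 : ∀ x, fderiv ℝ (fun x => g (x - c s)) x v = fderiv ℝ g (x - c s) v := by
          intro x; rw [fderiv_comp_sub]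
        simp_rw [h2] at h1
        rw [h1, neg_neg, ← integral_add_right_eq_self (fun x => ⟪F x, v⟫ * g (x - c s)) (c s)]
        simp [hG]
      simp_rw [hs]
      rw [integral_neg]
      have hsw2 : ∫ s, (∫ x, f x * fderiv ℝ g (x - c s) v) ∂ν = ∫ x, f x * ∫ s, fderiv ℝ g (x - c s) v ∂ν := by
        rw [← integral_integral_swap]
        · congr 1; ext x; rw [integral_const_mul]
        · have := shift_int ν hfm hf (c := fun _ => 0) measurable_const (M := 0) (by simp) (k := fun x s => fderiv ℝ g (x - c s) v)
            (Mk := M') (r := r' + ‖v‖) (hdc.measurable.comp (measurable_fst.sub (hcm.comp measurable_snd))) (fun x s => hM' _) ?_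
          · simp only [add_zero] at this; exact this
          · intro x s hx
            refine hr' _ fun hx' => hx ?_
            rw [mem_ball_zero_iff] at hx' ⊢
            have : ‖x‖ ≤ ‖x - c s‖ + ‖c s‖ := by
              calc ‖x‖ = ‖(x - c s) + c s‖ := by rw [sub_add_cancel]
                _ ≤ _ := norm_add_le _ _
            linarith [hcb s]
      rw [hsw2, ← integral_neg]
      congr 1; ext x
      have hftc : ∫ s, fderiv ℝ g (x - c s) v ∂ν = g x - g (x - v) := by
        have h1 : ∫ s, fderiv ℝ g (x - c s) v ∂ν = ∫ s in (0:ℝ)..1, fderiv ℝ g (x - s • v) v := by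
          rw [intervalIntegral.integral_of_le zero_le_one]
          refine setIntegral_congr_fun measurableSet_Ioc fun s hs => ?_
          rw [hcs s hs]
        rw [h1]
        have h2 : ∀ s ∈ uIcc (0:ℝ) 1, HasDerivAt (fun s : ℝ => - g (x - s • v)) (fderiv ℝ g (x - s • v) v) s := by
          intro s _
          have hd : HasFDerivAt g (fderiv ℝ g (x - s • v)) (x - s • v) := (hg1.differentiable (by norm_num)).differentiableAt.hasFDerivAt
          have hl : HasDerivAt (fun s : ℝ => x - s • v) (- v) s := by
            have := ((hasDerivAt_id s).smul_const v).const_sub x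
            simpa using this
          have := (hd.comp_hasDerivAt s hl).neg
          simp only [map_neg, neg_neg] at this
          exact this
        rw [intervalIntegral.integral_eq_sub_of_hasDerivAt h2]
        · simp; ring
        · exact (hdc.comp (by fun_prop : Continuous fun s : ℝ => x - s • v)).intervalIntegrable _ _
      rw [hftc]; ring
    have : ∀ x, g x • u x = f (x + v) * g x - f x * g x - (∫ s, G (x + c s) ∂ν) * g x := by
      intro x; simp only [hu, smul_eq_mul]; ring
    simp_rw [this]
    have i12 : Integrable (fun x => f (x + v) * g x - f x * g x) := i1.sub i2
    rw [integral_sub i12 i3, integral_sub i1 i2, e1, e3, ← integral_sub i4 i2, sub_eq_zero]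
    congr 1; ext x; ring
  have := ae_eq_zero_of_integral_contDiff_smul_eq_zero huL (fun g hg hgs => key g hg hgs)
  filter_upwards [this] with x hx
  simp only [hu] at hx
  linarith

lemma mdt_pow_eq {m : ℕ} (hm : 0 < m) {l : ℝ} (hl : 0 < l) :
    ∫⁻ t in Ioi l, ENNReal.ofReal (m * (t ^ m)⁻¹) ∂mdt = ENNReal.ofReal ((l ^ m)⁻¹) := by
  rw [mdt_restrict_lintegral measurableSet_Ioi (fun t ht => hl.trans ht) (by fun_prop)]
  have hd : ∀ t ∈ Ici l, HasDerivAt (fun t : ℝ => - (t ^ m)⁻¹) (t⁻¹ * (m * (t ^ m)⁻¹)) t := by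
    intro t ht
    have ht0 : 0 < t := hl.trans_le ht
    have h1 := ((hasDerivAt_pow m t).inv (by positivity)).neg
    refine h1.congr_deriv ?_
    obtain ⟨k, rfl⟩ : ∃ k, m = k + 1 := ⟨m - 1, by omega⟩
    simp only [Nat.add_sub_cancel]
    field_simp
    ring
  have hnn : ∀ t ∈ Ioi l, 0 ≤ t⁻¹ * (m * (t ^ m)⁻¹) := by
    intro t ht
    have ht0 : 0 < t := hl.trans ht
    positivity
  have hlim : Tendsto (fun t : ℝ => - (t ^ m)⁻¹) atTop (𝓝 0) := by
    have := (tendsto_inv_atTop_zero.comp (tendsto_pow_atTop (α := ℝ) hm.ne')).neg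
    rw [neg_zero] at this
    exact this
  have h1 := integral_Ioi_of_hasDerivAt_of_nonneg' hd hnn hlim
  have h2 := integrableOn_Ioi_deriv_of_nonneg' hd hnn hlim
  have h3 := ofReal_integral_eq_lintegral_ofReal h2 ((ae_restrict_iff' measurableSet_Ioi).2 (Eventually.of_forall hnn))
  rw [h1] at h3
  rw [show (l ^ m)⁻¹ = 0 - -(l ^ m)⁻¹ by ring, h3]
  refine setLIntegral_congr_fun measurableSet_Ioi fun t ht => ?_
  have ht0 : 0 < t := hl.trans ht
  rw [← ENNReal.ofReal_mul (by positivity)]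

/-- normalization of a vector -/
def Nv {n : ℕ} (y : Eucl n) : Eucl n := ‖y‖⁻¹ • y

@[fun_prop]
lemma Nv_meas {n : ℕ} : Measurable (Nv : Eucl n → Eucl n) := by unfold Nv; fun_prop

lemma norm_Nv {n : ℕ} {y : Eucl n} (hy : y ≠ 0) : ‖Nv y‖ = 1 := by
  unfold Nv
  rw [norm_smul, norm_inv, norm_norm, inv_mul_cancel₀ (norm_ne_zero_iff.2 hy)]

lemma norm_Nv_le {n : ℕ} (y : Eucl n) : ‖Nv y‖ ≤ 1 := by
  by_cases hy : y = 0
  · simp [hy, Nv]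
  · exact (norm_Nv hy).le

lemma ae_ne0 {n : ℕ} (hn : 0 < n) : ∀ᵐ y : Eucl n, y ≠ 0 := by
  have : Nonempty (Fin n) := ⟨⟨0, hn⟩⟩
  rw [ae_iff]; simp

/-- polar coordinates -/
lemma polar {n : ℕ} (hn : 0 < n) {g : Eucl n → ℝ≥0∞} (hg : Measurable g) :
    ∫⁻ y in ball (0 : Eucl n) 1, ∫⁻ r, ENNReal.ofReal (n * r ^ n) * g (r • Nv y) ∂mdt = ∫⁻ z, g z := by
  have h1 : ∫⁻ y in ball (0 : Eucl n) 1, ∫⁻ r, ENNReal.ofReal (n * r ^ n) * g (r • Nv y) ∂mdt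
      = ∫⁻ y in ball (0 : Eucl n) 1, ∫⁻ r, ENNReal.ofReal (n * (‖y‖ * r) ^ n) * g (r • y) ∂mdt := by
    refine lintegral_congr_ae (ae_restrict_of_ae ?_)
    filter_upwards [ae_ne0 hn] with y hy
    have hm : Measurable fun r : ℝ => ENNReal.ofReal (n * r ^ n) * g (r • Nv y) := by fun_prop
    rw [← mdt_scale hm (norm_pos_iff.2 hy)]
    congr 1; ext r
    congr 2
    unfold Nv
    rw [smul_smul, mul_right_comm, mul_inv_cancel₀ (norm_ne_zero_iff.2 hy), one_mul]
  have hs1 : Measurable (Function.uncurry fun (y : Eucl n) (r : ℝ) => ENNReal.ofReal (n * (‖y‖ * r) ^ n) * g (r • y)) := by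
    unfold Function.uncurry
    fun_prop
  rw [h1, lintegral_lintegral_swap hs1.aemeasurable]
  have h2 : ∀ᵐ r ∂mdt, ∫⁻ y in ball (0 : Eucl n) 1, ENNReal.ofReal (n * (‖y‖ * r) ^ n) * g (r • y)
      = ∫⁻ z, (ENNReal.ofReal (‖z‖ ^ n) * g z) * ((Ioi ‖z‖).indicator (fun r => ENNReal.ofReal (n * (r ^ n)⁻¹)) r) := by
    filter_upwards [mdt_ae_pos] with r hr
    have hm : Measurable fun z : Eucl n => (ball (0 : Eucl n) 1).indicator (fun y => ENNReal.ofReal (n * (‖y‖ * r) ^ n) * g (r • y)) z :=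
      Measurable.indicator (by fun_prop) measurableSet_ball
    rw [← lintegral_indicator measurableSet_ball, ← lint_smul hm hr]
    congr 1; ext z
    have hz : r⁻¹ • z ∈ ball (0 : Eucl n) 1 ↔ r ∈ Ioi ‖z‖ := by
      rw [mem_ball_zero_iff, norm_smul, Real.norm_of_nonneg (by positivity), ← div_eq_inv_mul, div_lt_one hr, mem_Ioi]
    by_cases h : r ∈ Ioi ‖z‖
    · rw [indicator_of_mem (hz.2 h), indicator_of_mem h, smul_smul, mul_inv_cancel₀ hr.ne', one_smul,
        norm_smul, Real.norm_of_nonneg (by positivity), mul_right_comm, inv_mul_cancel₀ hr.ne', one_mul,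
        mul_comm (n:ℝ) (‖z‖ ^ n), mul_comm (n:ℝ) ((r ^ n)⁻¹), ENNReal.ofReal_mul (by positivity), ENNReal.ofReal_mul (by positivity)]
      ring
    · rw [indicator_of_notMem (fun h' => h (hz.1 h')), indicator_of_notMem h, mul_zero, mul_zero]
  have hmi : Measurable fun q : ℝ × Eucl n => (Ioi ‖q.2‖).indicator (fun r => ENNReal.ofReal (n * (r ^ n)⁻¹)) q.1 := by
    have : (fun q : ℝ × Eucl n => (Ioi ‖q.2‖).indicator (fun r => ENNReal.ofReal (n * (r ^ n)⁻¹)) q.1)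
      = fun q : ℝ × Eucl n => if ‖q.2‖ < q.1 then ENNReal.ofReal (n * (q.1 ^ n)⁻¹) else 0 := by
      ext q; simp [indicator]
    rw [this]
    exact Measurable.ite (measurableSet_lt (by fun_prop) (by fun_prop)) (by fun_prop) measurable_const
  have hs2 : Measurable (Function.uncurry fun (r : ℝ) (z : Eucl n) => (ENNReal.ofReal (‖z‖ ^ n) * g z) * ((Ioi ‖z‖).indicator (fun r => ENNReal.ofReal (n * (r ^ n)⁻¹)) r)) := by
    have : Measurable fun q : ℝ × Eucl n => ENNReal.ofReal (‖q.2‖ ^ n) * g q.2 := by fun_prop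
    exact this.mul hmi
  have h4 : ∀ z : Eucl n, z ≠ 0 → ∫⁻ r, (ENNReal.ofReal (‖z‖ ^ n) * g z) * ((Ioi ‖z‖).indicator (fun r => ENNReal.ofReal (n * (r ^ n)⁻¹)) r) ∂mdt = g z := by
    intro z hz
    have hz0 := norm_pos_iff.2 hz
    have hmz : Measurable ((Ioi ‖z‖).indicator (fun r : ℝ => ENNReal.ofReal (n * (r ^ n)⁻¹))) :=
      Measurable.indicator (by fun_prop) measurableSet_Ioi
    have e1 : ENNReal.ofReal (‖z‖ ^ n) * ENNReal.ofReal ((‖z‖ ^ n)⁻¹) = 1 := by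
      have h3 : ‖z‖ ^ n * (‖z‖ ^ n)⁻¹ = 1 := mul_inv_cancel₀ (pow_pos hz0 n).ne'
      rw [← ENNReal.ofReal_mul (pow_pos hz0 n).le, h3, ENNReal.ofReal_one]
    have e2 : ∫⁻ r, (Ioi ‖z‖).indicator (fun r => ENNReal.ofReal (n * (r ^ n)⁻¹)) r ∂mdt = ENNReal.ofReal ((‖z‖ ^ n)⁻¹) := by
      rw [lintegral_indicator measurableSet_Ioi]
      exact mdt_pow_eq hn hz0
    rw [lintegral_const_mul _ hmz, e2, mul_right_comm, e1, one_mul]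
  have h5 : ∀ᵐ z : Eucl n, ∫⁻ r, (ENNReal.ofReal (‖z‖ ^ n) * g z) * ((Ioi ‖z‖).indicator (fun r => ENNReal.ofReal (n * (r ^ n)⁻¹)) r) ∂mdt = g z := by
    filter_upwards [ae_ne0 hn] with z hz using h4 z hz
  rw [lintegral_congr_ae h2, lintegral_lintegral_swap hs2.aemeasurable]
  exact lintegral_congr_ae h5

/-- the measure `n rⁿ dr/r` on `(0,1)` -/
def rad (n : ℕ) : Measure ℝ := (mdt.restrict (Ioo 0 1)).withDensity fun r => ENNReal.ofReal (n * r ^ n)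

instance (n : ℕ) : SFinite (rad n) := by unfold rad; infer_instance

lemma polar_map {n : ℕ} (hn : 0 < n) :
    Measure.map (fun q : Eucl n × ℝ => q.2 • Nv q.1) ((volume.restrict (ball (0 : Eucl n) 1)).prod (rad n))
      = volume.restrict (ball (0 : Eucl n) 1) := by
  have hm : Measurable fun q : Eucl n × ℝ => q.2 • Nv q.1 := measurable_snd.smul (Nv_meas.comp measurable_fst)
  refine Measure.ext_of_lintegral _ fun g hg => ?_
  have hgm : Measurable fun q : Eucl n × ℝ => g (q.2 • Nv q.1) := hg.comp hm
  rw [lintegral_map hg hm, lintegral_prod _ hgm.aemeasurable, ← lintegral_indicator measurableSet_ball g, ← polar hn (hg.indicator measurableSet_ball)]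
  refine lintegral_congr_ae (ae_restrict_of_ae ?_)
  filter_upwards [ae_ne0 hn] with y hy
  unfold rad
  rw [lintegral_withDensity_eq_lintegral_mul _ (by fun_prop) (by fun_prop), ← lintegral_indicator measurableSet_Ioo]
  refine lintegral_congr_ae ?_
  filter_upwards [mdt_ae_pos] with r hr
  have hz : r • Nv y ∈ ball (0 : Eucl n) 1 ↔ r ∈ Ioo (0:ℝ) 1 := by
    rw [mem_ball_zero_iff, norm_smul, norm_Nv hy, mul_one, Real.norm_of_nonneg hr.le]
    exact ⟨fun h => ⟨hr, h⟩, fun h => h.2⟩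
  by_cases h : r ∈ Ioo (0:ℝ) 1
  · rw [indicator_of_mem h, indicator_of_mem (hz.2 h)]; rfl
  · rw [indicator_of_notMem h, indicator_of_notMem (fun h' => h (hz.1 h')), mul_zero]

lemma sph_eq {n : ℕ} (hn : 0 < n) {f : Eucl n → ℝ} (hf : Measurable f) (x : Eucl n) (t : ℝ) :
    sphereAvg n f x t = (om n).toReal⁻¹ * ∫ y in ball (0 : Eucl n) 1, f (x + t • Nv y) := by
  have hN : Measurable fun x : Eucl n => ‖x‖⁻¹ • x := Nv_meas
  have hr : (volume : Measure (Eucl n)).restrict (ball 0 1 \ {0}) = volume.restrict (ball 0 1) := by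
    refine Measure.restrict_congr_set ?_
    filter_upwards [ae_ne0 hn] with y hy
    apply propext
    exact ⟨fun h => h.1, fun h => ⟨h, hy⟩⟩
  have hfx : Measurable fun z => f (x + t • z) := by fun_prop
  unfold sphereAvg sphereMeasure
  rw [average_eq, hr, smul_eq_mul, integral_map hN.aemeasurable hfx.aestronglyMeasurable, measureReal_def, Measure.map_apply hN MeasurableSet.univ]
  simp only [preimage_univ, Measure.restrict_apply_univ]
  rfl

lemma shift_ae {n : ℕ} {α : Type*} [MeasurableSpace α] (ν : Measure α) [IsFiniteMeasure ν] {g : Eucl n → ℝ≥0∞} (hg : Measurable g)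
    (hgi : ∀ x r, ∫⁻ y in ball x r, g y < ∞)
    {c : α → Eucl n} (hc : Measurable c) {M : ℝ} (hM : ∀ᵐ a ∂ν, ‖c a‖ ≤ M) :
    ∀ᵐ x, ∫⁻ a, g (x + c a) ∂ν < ∞ := by
  set c' : α → Eucl n := fun a => if ‖c a‖ ≤ M then c a else 0 with hc'
  have hc'm : Measurable c' := Measurable.ite (measurableSet_le hc.norm measurable_const) hc measurable_const
  have hb : ∀ a, ‖c' a‖ ≤ max M 0 := by
    intro a
    simp only [hc']
    split_ifs with h
    · exact h.trans (le_max_left _ _)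
    · simp
  have he : ∀ x, ∫⁻ a, g (x + c a) ∂ν = ∫⁻ a, g (x + c' a) ∂ν := by
    intro x
    refine lintegral_congr_ae ?_
    filter_upwards [hM] with a ha
    simp only [hc', if_pos ha]
  simp_rw [he]
  have hmm : Measurable fun x : Eucl n => ∫⁻ a, g (x + c' a) ∂ν := by
    have : Measurable fun q : Eucl n × α => g (q.1 + c' q.2) := hg.comp (measurable_fst.add (hc'm.comp measurable_snd))
    exact this.lintegral_prod_right'
  have h1 : ∀ k : ℕ, ∀ᵐ x, x ∈ ball (0 : Eucl n) k → ∫⁻ a, g (x + c' a) ∂ν < ∞ := by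
    intro k
    rw [← ae_restrict_iff' measurableSet_ball]
    refine ae_lt_top hmm ?_
    exact ((shift_lint ν hg hc'm hb k).trans_lt (ENNReal.mul_lt_top (measure_lt_top _ _) (hgi _ _))).ne
  filter_upwards [ae_all_iff.2 h1] with x hx
  obtain ⟨k, hk⟩ := exists_nat_gt ‖x‖
  exact hx k (by rwa [mem_ball_zero_iff])

lemma rad_eq (n : ℕ) : rad n = (volume.restrict (Ioo (0:ℝ) 1)).withDensity fun r => ENNReal.ofReal (r⁻¹ * (n * r ^ n)) := by
  refine Measure.ext_of_lintegral _ fun g hg => ?_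
  unfold rad
  rw [lintegral_withDensity_eq_lintegral_mul _ (by fun_prop) hg, lintegral_withDensity_eq_lintegral_mul _ (by fun_prop) hg,
    mdt_restrict_lintegral measurableSet_Ioo (fun t ht => ht.1) (by fun_prop)]
  refine setLIntegral_congr_fun measurableSet_Ioo fun r hr => ?_
  have := hr.1
  simp only [Pi.mul_apply]
  rw [ENNReal.ofReal_mul (p := r⁻¹) (by positivity)]
  ac_rfl

lemma rad_lint {n : ℕ} {g : ℝ → ℝ≥0∞} (hg : Measurable g) :
    ∫⁻ r, g r ∂rad n = ∫⁻ r in Ioo (0:ℝ) 1, ENNReal.ofReal (r⁻¹ * (n * r ^ n)) * g r := by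
  rw [rad_eq, lintegral_withDensity_eq_lintegral_mul _ (by fun_prop) hg]
  rfl

lemma rad_integral {n : ℕ} (g : ℝ → ℝ) :
    ∫ r, g r ∂rad n = ∫ r in Ioo (0:ℝ) 1, (r⁻¹ * (n * r ^ n)) * g r := by
  rw [rad_eq, integral_withDensity_eq_integral_toReal_smul (by fun_prop) (by simp)]
  refine setIntegral_congr_fun measurableSet_Ioo fun r hr => ?_
  have := hr.1
  simp only [smul_eq_mul]
  rw [ENNReal.toReal_ofReal (by positivity)]

lemma ball_int {n : ℕ} {E : Type*} [NormedAddCommGroup E] {G : Eucl n → E} {x : Eucl n} {r : ℝ} (hr : 0 < r)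
    (h : IntegrableOn G (ball x r) volume) : IntegrableOn (fun y => G (x + r • y)) (ball (0 : Eucl n) 1) volume := by
  rw [← integrable_indicator_iff measurableSet_ball] at h ⊢
  have h1 := (integrable_comp_smul_iff volume (fun z => (ball x r).indicator G (x + z)) hr.ne').2 (h.comp_add_left x)
  refine h1.congr (Eventually.of_forall fun y => ?_)
  have hz : x + r • y ∈ ball x r ↔ y ∈ ball (0 : Eucl n) 1 := by
    rw [mem_ball_zero_iff, mem_ball_iff_norm, add_sub_cancel_left, norm_smul, Real.norm_of_nonneg hr.le]
    exact ⟨fun h => by nlinarith, fun h => by nlinarith⟩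
  by_cases hy : y ∈ ball (0 : Eucl n) 1
  · simp only [indicator_of_mem hy, indicator_of_mem (hz.2 hy)]
  · simp only [indicator_of_notMem hy, indicator_of_notMem (fun h' => hy (hz.1 h'))]

/-- the ball integral in terms of the convolutions -/
lemma cv_etc {n : ℕ} {F : Eucl n → Eucl n} (hFm : Measurable F) (hF : ∀ x r, IntegrableOn F (ball x r) volume)
    (x : Eucl n) {r : ℝ} (hr : 0 < r) :
    ∫ y in ball (0 : Eucl n) 1, ⟪F (x + r • y), y⟫ = - ∑ i, cv (etc n i) r (fun z => F z i) x := by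
  have hc : ∀ i, cv (etc n i) r (fun z => F z i) x = - ∫ y in ball (0 : Eucl n) 1, F (x + r • y) i * y i := by
    intro i
    have h1 : cv (etc n i) r (fun z => F z i) x = ∫ z, (r ^ n)⁻¹ * (etc n i (r⁻¹ • (-z)) * F (x + z) i) := by
      unfold cv
      rw [← integral_add_left_eq_self _ x]
      congr 1; ext z
      unfold kd
      rw [sub_add_cancel_left, mul_assoc]
    have h2 := Measure.integral_comp_smul (volume : Measure (Eucl n)) (fun z => etc n i (- z) * F (x + r • z) i) r⁻¹
    rw [h1, integral_const_mul]
    have h3 : ∀ z, etc n i (r⁻¹ • (-z)) * F (x + z) i = etc n i (- (r⁻¹ • z)) * F (x + r • r⁻¹ • z) i := by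
      intro z; rw [smul_neg, smul_inv_smul₀ hr.ne']
    simp_rw [h3]
    rw [h2, finrank_euclideanSpace_fin, inv_pow, inv_inv, abs_of_pos (by positivity), smul_eq_mul, ← mul_assoc, inv_mul_cancel₀ (by positivity), one_mul,
      ← integral_neg, ← integral_indicator measurableSet_ball]
    congr 1; ext y
    unfold etc
    rw [norm_neg]
    by_cases hy : ‖y‖ < 1
    · rw [if_pos hy, indicator_of_mem (by rwa [mem_ball_zero_iff])]; simp; ring
    · rw [if_neg hy, indicator_of_notMem (by rwa [mem_ball_zero_iff]), zero_mul]
  simp_rw [hc]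
  rw [Finset.sum_neg_distrib, neg_neg, ← integral_finsetSum]
  · congr 1; ext y
    rw [EuclideanSpace.inner_eq_star_dotProduct]
    simp [dotProduct, mul_comm]
  · intro i _
    have hi : IntegrableOn (fun y => F (x + r • y)) (ball (0 : Eucl n) 1) volume := ball_int hr (hF x r)
    have hmy : Measurable fun y => F (x + r • y) i * y i := by fun_prop
    refine hi.norm.mono' hmy.aestronglyMeasurable ?_
    filter_upwards [ae_restrict_mem measurableSet_ball] with y hy
    rw [mem_ball_zero_iff] at hy
    rw [norm_mul]
    have h1 := abs_coord_le (F (x + r • y)) i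
    have h2 := (abs_coord_le y i).trans hy.le
    calc _ ≤ ‖F (x + r • y)‖ * 1 := mul_le_mul h1 h2 (abs_nonneg _) (norm_nonneg _)
      _ = _ := mul_one _

lemma pow_ftc {n : ℕ} (hn : 0 < n) {l : ℝ} (hl : 0 < l) (hl1 : l ≤ 1) :
    ∫ s in Ioo (0:ℝ) 1, (if l < s then n * (s ^ (n + 1))⁻¹ else 0) = (l ^ n)⁻¹ - 1 := by
  have h0 : ∫ s in Ioo (0:ℝ) 1, (if l < s then n * (s ^ (n + 1))⁻¹ else 0) = ∫ s in Ioo l 1, n * (s ^ (n + 1))⁻¹ := by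
    rw [← integral_indicator measurableSet_Ioo, ← integral_indicator measurableSet_Ioo]
    congr 1; ext s
    simp only [indicator, mem_Ioo]
    by_cases h1 : l < s
    · have : 0 < s := hl.trans h1
      simp [h1, this]
    · simp [h1]
  rw [h0, ← integral_Ioc_eq_integral_Ioo, ← intervalIntegral.integral_of_le hl1]
  have hd : ∀ t ∈ uIcc l 1, HasDerivAt (fun t : ℝ => - (t ^ n)⁻¹) (n * (t ^ (n + 1))⁻¹) t := by
    intro t ht
    rw [uIcc_of_le hl1] at ht
    have ht0 : 0 < t := hl.trans_le ht.1
    have h1 := ((hasDerivAt_pow n t).inv (by positivity)).neg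
    refine h1.congr_deriv ?_
    obtain ⟨k, rfl⟩ : ∃ k, n = k + 1 := ⟨n - 1, by omega⟩
    simp only [Nat.add_sub_cancel]
    field_simp
    ring
  rw [intervalIntegral.integral_eq_sub_of_hasDerivAt hd]
  · simp; ring
  · refine ContinuousOn.intervalIntegrable ?_
    intro t ht
    rw [uIcc_of_le hl1] at ht
    have ht0 : 0 < t := hl.trans_le ht.1
    exact (ContinuousAt.mul continuousAt_const (ContinuousAt.inv₀ (by fun_prop) (by positivity))).continuousWithinAt

/-- expansion of a singular integral -/
lemma sing_exp {n : ℕ} (hn : 0 < n) {e : Eucl n → ℝ} (he : Measurable e)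
    (hi : IntegrableOn (fun z => (‖z‖ ^ n)⁻¹ * e z) (ball 0 1) volume) :
    ∫ z in ball (0 : Eucl n) 1, (‖z‖ ^ n)⁻¹ * e z
      = (∫ z in ball (0 : Eucl n) 1, e z) + ∫ s in Ioo (0:ℝ) 1, n * (s ^ (n + 1))⁻¹ * ∫ z in ball (0 : Eucl n) s, e z := by
  set τ := (volume : Measure (Eucl n)).restrict (ball 0 1) with hτ
  set ν := (volume : Measure ℝ).restrict (Ioo 0 1) with hν
  set J : Eucl n × ℝ → ℝ := fun q => (if ‖q.1‖ < q.2 then n * (q.2 ^ (n + 1))⁻¹ else 0) * e q.1 with hJ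
  have hne : ∀ᵐ z ∂τ, z ≠ 0 := ae_restrict_of_ae (ae_ne0 hn)
  have hmem : ∀ᵐ z ∂τ, z ∈ ball (0 : Eucl n) 1 := ae_restrict_mem measurableSet_ball
  have hkm : Measurable fun q : Eucl n × ℝ => (if ‖q.1‖ < q.2 then n * (q.2 ^ (n + 1))⁻¹ else 0 : ℝ) :=
    Measurable.ite (measurableSet_lt (by fun_prop) (by fun_prop)) (by fun_prop) measurable_const
  have hJm : Measurable J := hkm.mul (he.comp measurable_fst)
  have hJi : Integrable J (τ.prod ν) := by
    refine ⟨hJm.aestronglyMeasurable, ?_⟩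
    rw [hasFiniteIntegral_iff_enorm, lintegral_prod _ hJm.enorm.aemeasurable]
    refine lt_of_le_of_lt ?_ hi.2
    refine lintegral_mono_ae ?_
    filter_upwards [hne] with z hz
    have hz0 := norm_pos_iff.2 hz
    have hm1 : Measurable fun s : ℝ => ‖(if ‖z‖ < s then n * (s ^ (n + 1))⁻¹ else 0 : ℝ)‖ₑ :=
      (hkm.comp (measurable_const.prodMk measurable_id)).enorm
    simp only [hJ, enorm_mul]
    rw [lintegral_mul_const _ hm1]
    refine mul_le_mul_left ?_ _
    rw [Real.enorm_of_nonneg (by positivity), ← mdt_pow_eq hn hz0, mdt_restrict_lintegral measurableSet_Ioi (fun t ht => hz0.trans ht) (by fun_prop),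
      ← lintegral_indicator measurableSet_Ioi]
    refine (setLIntegral_le_lintegral _ _).trans (lintegral_mono fun s => ?_)
    by_cases hs : ‖z‖ < s
    · have hs0 := hz0.trans hs
      simp only [if_pos hs, indicator_of_mem (show s ∈ Ioi ‖z‖ from hs)]
      rw [Real.enorm_of_nonneg (by positivity), ← ENNReal.ofReal_mul (by positivity)]
      refine ENNReal.ofReal_le_ofReal (le_of_eq ?_)
      field_simp
      ring
    · simp [if_neg hs]
  have hei : Integrable e τ := by
    refine hi.norm.mono' he.aestronglyMeasurable ?_
    filter_upwards [hne, hmem] with z hz hz1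
    have hz0 := norm_pos_iff.2 hz
    rw [mem_ball_zero_iff] at hz1
    have hp : 0 ≤ (‖z‖ ^ n)⁻¹ := by positivity
    rw [norm_mul, Real.norm_of_nonneg hp]
    refine le_mul_of_one_le_left (norm_nonneg _) ?_
    exact (one_le_inv₀ (by positivity)).2 (pow_le_one₀ hz0.le hz1.le)
  have hsw := integral_integral_swap (f := fun z s => J (z, s)) hJi
  have hL : ∫ z, (∫ s, J (z, s) ∂ν) ∂τ = ∫ z, ((‖z‖ ^ n)⁻¹ * e z - e z) ∂τ := by
    refine integral_congr_ae ?_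
    filter_upwards [hne, hmem] with z hz hz1
    have hz0 := norm_pos_iff.2 hz
    rw [mem_ball_zero_iff] at hz1
    simp only [hJ]
    rw [integral_mul_const, pow_ftc hn hz0 hz1.le]
    ring
  have hR : ∫ s, (∫ z, J (z, s) ∂τ) ∂ν = ∫ s in Ioo (0:ℝ) 1, n * (s ^ (n + 1))⁻¹ * ∫ z in ball (0 : Eucl n) s, e z := by
    refine setIntegral_congr_fun measurableSet_Ioo fun s hs => ?_
    rw [hτ, ← integral_indicator measurableSet_ball, ← integral_indicator measurableSet_ball, ← integral_const_mul]
    congr 1; ext z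
    simp only [hJ, indicator, mem_ball_zero_iff]
    by_cases h : ‖z‖ < s
    · simp [h, h.trans hs.2]
    · simp [h]
  rw [hL, hR, integral_sub hi hei] at hsw
  linarith

set_option maxHeartbeats 400000 in
lemma T_formula {n : ℕ} (hn : 0 < n) {f : Eucl n → ℝ} {F : Eucl n → Eucl n} (hfm : Measurable f) (hFm : Measurable F)
    (hf : ∀ x r, IntegrableOn f (ball x r) volume) (hF : ∀ x r, IntegrableOn F (ball x r) volume)
    (h : HasWeakGradient n f F) {t : ℝ} (ht : 0 < t) :
    ∀ᵐ x, f x - sphereAvg n f x t = (om n).toReal⁻¹ * t * ((n : ℝ)⁻¹ * (∑ i, cv (etc n i) t (fun z => F z i) x)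
      + ∫ s in Ioo (0:ℝ) 1, ∑ i, cv (etc n i) (t * s) (fun z => F z i) x) := by
  set τ := (volume : Measure (Eucl n)).restrict (ball 0 1) with hτ
  set ν := (volume : Measure ℝ).restrict (Ioo 0 1) with hν
  have hτf : IsFiniteMeasure τ := ⟨by rw [hτ, Measure.restrict_apply_univ]; exact measure_ball_lt_top⟩
  have hτr : τ.real univ = (om n).toReal := by
    rw [hτ, measureReal_def, Measure.restrict_apply_univ]; rfl
  have hω : (om n).toReal ≠ 0 := (ENNReal.toReal_pos (om_pos n) (om_ne_top n)).ne'
  have hn' : (n : ℝ) ≠ 0 := by exact_mod_cast hn.ne'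
  have hne : ∀ᵐ z ∂τ, z ≠ 0 := ae_restrict_of_ae (ae_ne0 hn)
  have hJm : Measurable fun q : (Eucl n × Eucl n) × ℝ => ⟪F (q.1.1 + q.2 • (t • Nv q.1.2)), t • Nv q.1.2⟫ := by fun_prop
  have E1 : ∀ᵐ x, ∀ᵐ y ∂τ, f (x + t • Nv y) - f x = ∫ s in Ioc (0:ℝ) 1, ⟪F (x + s • (t • Nv y)), t • Nv y⟫ := by
    rw [Measure.ae_ae_comm]
    · exact Eventually.of_forall fun y => trans_diff hfm hFm hf hF h (t • Nv y)
    · refine measurableSet_eq_fun (by fun_prop) ?_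
      exact (hJm.stronglyMeasurable.integral_prod_right' (ν := volume.restrict (Ioc (0:ℝ) 1))).measurable
  have E2 : ∀ᵐ x, ∫⁻ y, ‖f (x + t • Nv y)‖ₑ ∂τ < ∞ := by
    refine shift_ae τ hfm.enorm (fun x r => (hf x r).2) (c := fun y => t • Nv y) (by fun_prop) (M := t) (Eventually.of_forall fun y => ?_)
    rw [norm_smul, Real.norm_of_nonneg ht.le]
    nlinarith [norm_Nv_le y]
  have E3 : ∀ᵐ x, ∫⁻ q, ‖F (x + (t * q.2) • Nv q.1)‖ₑ ∂(τ.prod ν) < ∞ := by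
    refine shift_ae (τ.prod ν) hFm.enorm (fun x r => (hF x r).2) (c := fun q => (t * q.2) • Nv q.1) (by fun_prop) (M := t) ?_
    have : ∀ᵐ q ∂(τ.prod ν), q.2 ∈ Ioo (0:ℝ) 1 := by
      refine Measure.quasiMeasurePreserving_snd.ae (p := fun s => s ∈ Ioo (0:ℝ) 1) ?_
      exact ae_restrict_mem measurableSet_Ioo
    filter_upwards [this] with q hq
    rw [norm_smul, Real.norm_of_nonneg (mul_pos ht hq.1).le]
    have := norm_Nv_le q.1
    have h2 : t * q.2 ≤ t := by nlinarith [hq.2]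
    calc t * q.2 * ‖Nv q.1‖ ≤ t * 1 := mul_le_mul h2 this (norm_nonneg _) ht.le
      _ = t := mul_one _
  filter_upwards [E1, E2, E3] with x e1 e2 e3
  set e : Eucl n → ℝ := fun z => ⟪F (x + t • z), z⟫ with he
  have hem : Measurable e := by fun_prop
  set k : Eucl n → ℝ := fun z => (‖z‖ ^ n)⁻¹ * e z with hk
  have hkm : Measurable k := by fun_prop
  have hPm : Measurable fun q : Eucl n × ℝ => q.2 • Nv q.1 := by fun_prop
  have hkP : ∀ y : Eucl n, y ≠ 0 → ∀ s ∈ Ioo (0:ℝ) 1, (s⁻¹ * (n * s ^ n)) * k (s • Nv y) = n * ⟪F (x + (t * s) • Nv y), Nv y⟫ := by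
    intro y hy s hs
    have := hs.1
    simp only [hk, he]
    rw [norm_smul, norm_Nv hy, mul_one, Real.norm_of_nonneg this.le, smul_smul, inner_smul_right]
    field_simp
  have hkPi : Integrable (fun q : Eucl n × ℝ => k (q.2 • Nv q.1)) (τ.prod (rad n)) := by
    have hm2 : Measurable fun q : Eucl n × ℝ => k (q.2 • Nv q.1) := hkm.comp hPm
    refine ⟨hm2.aestronglyMeasurable, ?_⟩
    rw [hasFiniteIntegral_iff_enorm, lintegral_prod _ hm2.enorm.aemeasurable]
    have hm3 : Measurable fun q : Eucl n × ℝ => ‖F (x + (t * q.2) • Nv q.1)‖ₑ := by fun_prop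
    rw [lintegral_prod _ hm3.aemeasurable] at e3
    have hm4 : Measurable fun y : Eucl n => ∫⁻ s, ‖F (x + (t * s) • Nv y)‖ₑ ∂ν := hm3.lintegral_prod_right'
    refine lt_of_le_of_lt ?_ (ENNReal.mul_lt_top (ENNReal.natCast_lt_top n) e3)
    rw [← lintegral_const_mul _ hm4]
    refine lintegral_mono_ae ?_
    filter_upwards [hne] with y hy
    have hm5 : Measurable fun s : ℝ => ‖k (s • Nv y)‖ₑ := by fun_prop
    have hm6 : Measurable fun s : ℝ => ‖F (x + (t * s) • Nv y)‖ₑ := by fun_prop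
    rw [rad_lint hm5, ← lintegral_const_mul _ hm6]
    refine setLIntegral_mono' measurableSet_Ioo fun s hs => ?_
    have hs0 := hs.1
    rw [← Real.enorm_of_nonneg (show 0 ≤ s⁻¹ * (n * s ^ n) by positivity), ← enorm_mul, hkP y hy s hs, enorm_mul]
    have h1 : ‖(n : ℝ)‖ₑ = n := by rw [Real.enorm_of_nonneg (by positivity), ENNReal.ofReal_natCast]
    rw [h1]
    refine mul_le_mul_right ?_ _
    rw [← ofReal_norm, ← ofReal_norm]
    refine ENNReal.ofReal_le_ofReal ((norm_inner_le_norm _ _).trans ?_)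
    rw [norm_Nv hy, mul_one]
  have hki : Integrable k τ := by
    rw [hτ, ← polar_map hn, integrable_map_measure hkm.aestronglyMeasurable hPm.aemeasurable]
    exact hkPi
  have hkint : ∫ z, k z ∂τ = ∫ y, (∫ s, n * ⟪F (x + (t * s) • Nv y), Nv y⟫ ∂ν) ∂τ := by
    rw [hτ]
    nth_rw 1 [← polar_map hn]
    rw [integral_map hPm.aemeasurable hkm.aestronglyMeasurable, integral_prod _ hkPi]
    refine integral_congr_ae ?_
    filter_upwards [hne] with y hy
    rw [rad_integral]
    exact setIntegral_congr_fun measurableSet_Ioo fun s hs => hkP y hy s hs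
  have hAf : (om n).toReal * (sphereAvg n f x t - f x) = t * (n : ℝ)⁻¹ * ∫ z, k z ∂τ := by
    have hi2 : Integrable (fun y => f (x + t • Nv y)) τ := by
      have : Measurable fun y : Eucl n => f (x + t • Nv y) := by fun_prop
      exact ⟨this.aestronglyMeasurable, e2⟩
    have h1 : ∫ y, (f (x + t • Nv y) - f x) ∂τ = (om n).toReal * (sphereAvg n f x t - f x) := by
      rw [integral_sub hi2 (integrable_const _), integral_const, hτr, sph_eq hn hfm, smul_eq_mul, mul_sub, ← mul_assoc, mul_inv_cancel₀ hω, one_mul]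
    rw [← h1, hkint, ← integral_const_mul]
    refine integral_congr_ae ?_
    filter_upwards [e1] with y hy
    rw [hy, integral_Ioc_eq_integral_Ioo, ← integral_const_mul]
    refine setIntegral_congr_fun measurableSet_Ioo fun s hs => ?_
    rw [inner_smul_right, smul_smul, mul_comm s t]
    field_simp
  have hexp := sing_exp hn hem hki
  have hE1 : ∫ z in ball (0 : Eucl n) 1, e z = - ∑ i, cv (etc n i) t (fun z => F z i) x := cv_etc hFm hF x ht
  have hE2 : ∫ s in Ioo (0:ℝ) 1, n * (s ^ (n + 1))⁻¹ * ∫ z in ball (0 : Eucl n) s, e z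
      = ∫ s in Ioo (0:ℝ) 1, n * (- ∑ i, cv (etc n i) (t * s) (fun z => F z i) x) := by
    refine setIntegral_congr_fun measurableSet_Ioo fun s hs => ?_
    have hs0 := hs.1
    rw [← cv_etc hFm hF x (mul_pos ht hs0), mul_assoc]
    congr 1
    have h2 := Measure.integral_comp_smul (volume : Measure (Eucl n)) ((ball 0 s).indicator e) s
    rw [finrank_euclideanSpace_fin, abs_of_pos (by positivity), smul_eq_mul, integral_indicator measurableSet_ball] at h2
    rw [pow_succ, mul_inv, mul_comm (s ^ n)⁻¹, mul_assoc, ← h2, ← integral_const_mul, ← integral_indicator measurableSet_ball]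
    congr 1; ext y
    have hz : s • y ∈ ball (0 : Eucl n) s ↔ y ∈ ball (0 : Eucl n) 1 := by
      rw [mem_ball_zero_iff, mem_ball_zero_iff, norm_smul, Real.norm_of_nonneg hs0.le]
      exact ⟨fun h => by nlinarith, fun h => by nlinarith⟩
    by_cases hy : y ∈ ball (0 : Eucl n) 1
    · rw [indicator_of_mem hy, indicator_of_mem (hz.2 hy)]
      simp only [he]
      rw [inner_smul_right, smul_smul]
      field_simp
    · rw [indicator_of_notMem hy, indicator_of_notMem (fun h' => hy (hz.1 h')), mul_zero]
  rw [hE1, hE2, integral_const_mul, integral_neg] at hexp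
  rw [show ∫ z, k z ∂τ = _ from hexp] at hAf
  have : f x - sphereAvg n f x t = - ((om n).toReal⁻¹ * ((om n).toReal * (sphereAvg n f x t - f x))) := by
    field_simp; ring
  rw [this, hAf]
  field_simp
  ring

lemma sum_rpow_le {n : ℕ} (a : Fin n → ℝ≥0∞) {r : ℝ} (hr : 0 < r) :
    (∑ i, a i) ^ r ≤ (n : ℝ≥0∞) ^ r * ∑ i, a i ^ r := by
  rcases Nat.eq_zero_or_pos n with rfl | hn
  · simp [hr]
  have : Nonempty (Fin n) := ⟨⟨0, hn⟩⟩
  obtain ⟨j, _, hj⟩ := Finset.exists_max_image (Finset.univ : Finset (Fin n)) a Finset.univ_nonempty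
  have h1 : ∑ i, a i ≤ n * a j := by
    calc ∑ i, a i ≤ ∑ _i : Fin n, a j := Finset.sum_le_sum fun i hi => hj i hi
      _ = n * a j := by simp
  calc (∑ i, a i) ^ r ≤ (n * a j) ^ r := ENNReal.rpow_le_rpow h1 hr.le
    _ = (n : ℝ≥0∞) ^ r * a j ^ r := ENNReal.mul_rpow_of_nonneg _ _ hr.le
    _ ≤ _ := mul_le_mul_right (Finset.single_le_sum (f := fun i => a i ^ r) (fun _ _ => zero_le) (Finset.mem_univ j)) _

lemma sphereAvg_meas {n : ℕ} (hn : 0 < n) {f : Eucl n → ℝ} (hf : Measurable f) :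
    Measurable fun q : Eucl n × ℝ => sphereAvg n f q.1 q.2 := by
  simp_rw [sph_eq hn hf]
  refine Measurable.const_mul ?_ _
  have : Measurable fun q : (Eucl n × ℝ) × Eucl n => f (q.1.1 + q.1.2 • Nv q.2) := by fun_prop
  exact this.stronglyMeasurable.integral_prod_right'.measurable

lemma sq_div_cube {a t : ℝ} (ht : 0 < t) : ENNReal.ofReal (a ^ 2 / t ^ 3) = ENNReal.ofReal t⁻¹ * ‖t⁻¹ * a‖ₑ ^ 2 := by
  rw [enorm_sq_eq, ← ENNReal.ofReal_mul (by positivity)]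
  congr 1
  field_simp

lemma sq_int_eq {g : ℝ → ℝ} (hg : Measurable g) :
    ∫⁻ t in Ioi (0:ℝ), ENNReal.ofReal (g t ^ 2 / t ^ 3) = ∫⁻ t, ‖t⁻¹ * g t‖ₑ ^ 2 ∂mdt := by
  rw [mdt_lintegral (by fun_prop)]
  exact setLIntegral_congr_fun measurableSet_Ioi fun t ht => sq_div_cube ht

lemma mdt_restrict_Ioi : mdt.restrict (Ioi 0) = mdt := by
  rw [Measure.restrict_eq_self_of_ae_mem]
  exact mdt_ae_pos

lemma T_point {n : ℕ} (hn : 0 < n) {f : Eucl n → ℝ} {F : Eucl n → Eucl n} (hfm : Measurable f) (hFm : Measurable F)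
    (hf : ∀ x r, IntegrableOn f (ball x r) volume) (hF : ∀ x r, IntegrableOn F (ball x r) volume)
    (h : HasWeakGradient n f F) :
    ∀ᵐ x, ∫⁻ t in Ioi (0:ℝ), ENNReal.ofReal ((f x - sphereAvg n f x t) ^ 2 / t ^ 3)
      ≤ (ENNReal.ofReal (om n).toReal⁻¹ ^ 2 * 4 * n ^ (2:ℝ)) * ∑ i, Asq (etc n i) (Ioi 0) (fun z => F z i) x := by
  set Cs : ℝ → Eucl n → ℝ := fun t x => ∑ i, cv (etc n i) t (fun z => F z i) x with hCs
  have hFi : ∀ i, Measurable fun z => F z i := fun i => by fun_prop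
  have hCm : Measurable fun q : ℝ × Eucl n => Cs q.1 q.2 := by
    simp only [hCs]
    exact Finset.measurable_sum _ fun i _ => cv_meas (etc_CZK n i).meas (hFi i)
  have hae : ∀ᵐ x, ∀ᵐ t ∂mdt, f x - sphereAvg n f x t = (om n).toReal⁻¹ * t * ((n : ℝ)⁻¹ * Cs t x
      + ∫ s in Ioo (0:ℝ) 1, Cs (t * s) x) := by
    rw [Measure.ae_ae_comm]
    · filter_upwards [mdt_ae_pos] with t ht using T_formula hn hfm hFm hf hF h ht
    · refine measurableSet_eq_fun ((hfm.comp measurable_fst).sub (sphereAvg_meas hn hfm)) ?_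
      have h1 : Measurable fun q : Eucl n × ℝ => Cs q.2 q.1 := hCm.comp measurable_swap
      have h2 : Measurable fun q : (Eucl n × ℝ) × ℝ => Cs (q.1.2 * q.2) q.1.1 :=
        hCm.comp (by fun_prop : Measurable fun q : (Eucl n × ℝ) × ℝ => (q.1.2 * q.2, q.1.1))
      have h3 : Measurable fun q : Eucl n × ℝ => ∫ s in Ioo (0:ℝ) 1, Cs (q.2 * s) q.1 :=
        h2.stronglyMeasurable.integral_prod_right'.measurable
      fun_prop
  filter_upwards [hae] with x hx
  have hCx : Measurable fun t => Cs t x := hCm.comp (by fun_prop : Measurable fun t : ℝ => (t, x))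
  have hsx : Measurable fun t => f x - sphereAvg n f x t :=
    measurable_const.sub ((sphereAvg_meas hn hfm).comp (by fun_prop : Measurable fun t : ℝ => (x, t)))
  rw [sq_int_eq hsx]
  set c : ℝ → ℝ≥0∞ := fun t => ‖Cs t x‖ₑ with hc
  have hcm : Measurable c := hCx.enorm
  set κ := ENNReal.ofReal (om n).toReal⁻¹ with hκ
  have hb : ∀ᵐ t ∂mdt, ‖t⁻¹ * (f x - sphereAvg n f x t)‖ₑ ^ 2 ≤ κ ^ 2 * 2 * (c t ^ 2 + ∫⁻ s in Ioo (0:ℝ) 1, c (s * t) ^ 2) := by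
    filter_upwards [hx, mdt_ae_pos] with t ht ht0
    have e1 : t⁻¹ * (f x - sphereAvg n f x t) = (om n).toReal⁻¹ * ((n : ℝ)⁻¹ * Cs t x + ∫ s in Ioo (0:ℝ) 1, Cs (t * s) x) := by
      rw [ht]; field_simp
    have e2 : ‖t⁻¹ * (f x - sphereAvg n f x t)‖ₑ ≤ κ * (c t + ∫⁻ s in Ioo (0:ℝ) 1, c (s * t)) := by
      rw [e1, enorm_mul, Real.enorm_of_nonneg (by positivity)]
      refine mul_le_mul_right ((enorm_add_le _ _).trans (add_le_add ?_ ?_)) _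
      · rw [enorm_mul]
        have : ‖(n : ℝ)⁻¹‖ₑ ≤ 1 := by
          rw [Real.enorm_of_nonneg (by positivity), ENNReal.ofReal_le_one]
          exact inv_le_one_of_one_le₀ (by exact_mod_cast hn)
        exact mul_le_of_le_one_left zero_le this
      · refine (enorm_integral_le_lintegral_enorm _).trans (le_of_eq ?_)
        simp only [hc, mul_comm t]
    have e3 : (∫⁻ s in Ioo (0:ℝ) 1, c (s * t)) ^ 2 ≤ ∫⁻ s in Ioo (0:ℝ) 1, c (s * t) ^ 2 := by
      have := lint_cs (volume.restrict (Ioo (0:ℝ) 1)) (f := fun s => c (s * t)) (g := fun _ => 1) (by fun_prop) (by fun_prop)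
      simpa using this
    calc _ ≤ (κ * (c t + ∫⁻ s in Ioo (0:ℝ) 1, c (s * t))) ^ 2 := by gcongr
      _ = κ ^ 2 * (c t + ∫⁻ s in Ioo (0:ℝ) 1, c (s * t)) ^ 2 := mul_pow _ _ _
      _ ≤ κ ^ 2 * (2 * (c t ^ 2 + (∫⁻ s in Ioo (0:ℝ) 1, c (s * t)) ^ 2)) := by
        refine mul_le_mul_right ?_ _
        exact (sq_add_le _ _).trans (le_of_eq (by ring))
      _ ≤ κ ^ 2 * (2 * (c t ^ 2 + ∫⁻ s in Ioo (0:ℝ) 1, c (s * t) ^ 2)) := by gcongr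
      _ = _ := by ring
  have hm1 : Measurable fun q : ℝ × ℝ => c (q.2 * q.1) ^ 2 := by fun_prop
  have hm2 : Measurable fun t => ∫⁻ s in Ioo (0:ℝ) 1, c (s * t) ^ 2 := hm1.lintegral_prod_right'
  have hm3 : Measurable fun t => c t ^ 2 + ∫⁻ s in Ioo (0:ℝ) 1, c (s * t) ^ 2 := by fun_prop
  have hcsq : ∀ t, c t ^ 2 ≤ (n : ℝ≥0∞) ^ (2:ℝ) * ∑ i, ‖cv (etc n i) t (fun z => F z i) x‖ₑ ^ 2 := by
    intro t
    have h1 := sum_rpow_le (fun i => ‖cv (etc n i) t (fun z => F z i) x‖ₑ) (r := 2) two_pos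
    simp only [ENNReal.rpow_two] at h1 ⊢
    refine le_trans ?_ h1
    have := enorm_sum_le (Finset.univ : Finset (Fin n)) fun i => cv (etc n i) t (fun z => F z i) x
    simp only [hc, hCs]
    gcongr
  calc ∫⁻ t, ‖t⁻¹ * (f x - sphereAvg n f x t)‖ₑ ^ 2 ∂mdt
      ≤ ∫⁻ t, κ ^ 2 * 2 * (c t ^ 2 + ∫⁻ s in Ioo (0:ℝ) 1, c (s * t) ^ 2) ∂mdt := lintegral_mono_ae hb
    _ = κ ^ 2 * 2 * ((∫⁻ t, c t ^ 2 ∂mdt) + ∫⁻ t, (∫⁻ s in Ioo (0:ℝ) 1, c (s * t) ^ 2) ∂mdt) := by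
      rw [lintegral_const_mul _ hm3, lintegral_add_right _ hm2]
    _ = κ ^ 2 * 2 * ((∫⁻ t, c t ^ 2 ∂mdt) + ∫⁻ t, c t ^ 2 ∂mdt) := by
      rw [lintegral_lintegral_swap hm1.aemeasurable]
      congr 2
      have : ∀ s ∈ Ioo (0:ℝ) 1, ∫⁻ t, c (s * t) ^ 2 ∂mdt = ∫⁻ t, c t ^ 2 ∂mdt := fun s hs =>
        mdt_scale (g := fun t => c t ^ 2) (by fun_prop) hs.1
      rw [setLIntegral_congr_fun measurableSet_Ioo this]
      simp
    _ = κ ^ 2 * 4 * ∫⁻ t, c t ^ 2 ∂mdt := by ring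
    _ ≤ κ ^ 2 * 4 * ∫⁻ t, (n : ℝ≥0∞) ^ (2:ℝ) * ∑ i, ‖cv (etc n i) t (fun z => F z i) x‖ₑ ^ 2 ∂mdt :=
      mul_le_mul_right (lintegral_mono hcsq) _
    _ = _ := by
      have hmi : ∀ i, Measurable fun t => ‖cv (etc n i) t (fun z => F z i) x‖ₑ ^ 2 := fun i =>
        ((cv_meas_t (etc_CZK n i).meas (hFi i) x).enorm).pow_const 2
      rw [lintegral_const_mul _ (Finset.measurable_sum _ fun i _ => hmi i), lintegral_finsetSum _ fun i _ => hmi i, mul_assoc _ ((n : ℝ≥0∞) ^ (2:ℝ))]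
      simp only [Asq, mdt_restrict_Ioi]

lemma T_upper {n : ℕ} (hn : 0 < n) {p q : ℝ} {W V : Eucl n → ℝ≥0∞} {A : ℝ≥0∞} (hA : APair n p q W V A) :
    ∃ C : ℝ≥0∞, C ≠ ∞ ∧ ∀ (f : Eucl n → ℝ) (F : Eucl n → Eucl n), Measurable f → Measurable F →
      (∀ x r, IntegrableOn f (ball x r) volume) → (∀ x r, IntegrableOn F (ball x r) volume) → HasWeakGradient n f F →
      ∫⁻ x, Tsq n f x ^ p * W x ≤ C * ∫⁻ x, ‖F x‖ₑ ^ p * W x := by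
  have hp := hA.hpq.pos
  choose C hC hU using fun i : Fin n => thmU hn (etc_CZK n i) hA
  set K : ℝ≥0∞ := (ENNReal.ofReal (om n).toReal⁻¹ ^ 2 * 4 * n ^ (2:ℝ)) with hK
  have hKt : K ≠ ∞ := by
    rw [hK]
    refine ENNReal.mul_ne_top (ENNReal.mul_ne_top (ENNReal.pow_ne_top ENNReal.ofReal_ne_top) (by norm_num)) (ENNReal.rpow_ne_top_of_nonneg (by norm_num) (by simp))
  clear_value K
  set K' : ℝ≥0∞ := K ^ (p / 2) * (n : ℝ≥0∞) ^ (p / 2) with hK'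
  have hKt' : K' ≠ ∞ := ENNReal.mul_ne_top (ENNReal.rpow_ne_top_of_nonneg (by positivity) hKt) (ENNReal.rpow_ne_top_of_nonneg (by positivity) (by simp))
  clear_value K'
  refine ⟨K' * ∑ i, C i, ENNReal.mul_ne_top hKt' (ENNReal.sum_ne_top.2 fun i _ => hC i), ?_⟩
  intro f F hfm hFm hf hF h
  have hFi : ∀ i, Measurable fun z => F z i := fun i => by fun_prop
  have hm : ∀ i, Measurable fun x => Asq (etc n i) (Ioi 0) (fun z => F z i) x ^ (p / 2) * W x := fun i =>
    ((Asq_meas (etc_CZK n i).meas (hFi i) _).pow_const _).mul hA.mW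
  calc ∫⁻ x, Tsq n f x ^ p * W x
      ≤ ∫⁻ x, K' * ∑ i, Asq (etc n i) (Ioi 0) (fun z => F z i) x ^ (p / 2) * W x := by
        refine lintegral_mono_ae ?_
        filter_upwards [T_point hn hfm hFm hf hF h] with x hx
        unfold Tsq
        rw [← ENNReal.rpow_mul, ← Finset.sum_mul, ← mul_assoc, show 1 / 2 * p = p / 2 by ring]
        refine mul_le_mul_left ?_ _
        refine (ENNReal.rpow_le_rpow hx (by positivity)).trans ?_
        have hx' : (K * ∑ i, Asq (etc n i) (Ioi 0) (fun z => F z i) x) ^ (p / 2) = K ^ (p / 2) * (∑ i, Asq (etc n i) (Ioi 0) (fun z => F z i) x) ^ (p / 2) := ENNReal.mul_rpow_of_nonneg _ _ (by positivity)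
        rw [← hK, hx', hK', mul_assoc (K ^ (p/2))]
        exact mul_le_mul_right (sum_rpow_le _ (r := p / 2) (by positivity)) _
    _ = K' * ∑ i, ∫⁻ x, Asq (etc n i) (Ioi 0) (fun z => F z i) x ^ (p / 2) * W x := by
        rw [lintegral_const_mul _ (Finset.measurable_sum _ fun i _ => hm i), lintegral_finsetSum _ fun i _ => hm i]
    _ ≤ K' * ∑ i, C i * ∫⁻ x, ‖F x‖ₑ ^ p * W x := by
        refine mul_le_mul_right (Finset.sum_le_sum fun i _ => ?_) _
        have hle : ∀ z, ‖F z i‖ ≤ ‖F z‖ := fun z => abs_coord_le (F z) i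
        refine (hU i _ (hFi i) fun x r => ?_).trans ?_
        · exact (hF x r).norm.mono' (hFi i).aestronglyMeasurable (Eventually.of_forall hle)
        · refine mul_le_mul_right (lintegral_mono fun x => ?_) _
          refine mul_le_mul_left (ENNReal.rpow_le_rpow ?_ hp.le) _
          rw [← ofReal_norm, ← ofReal_norm]
          exact ENNReal.ofReal_le_ofReal (hle x)
    _ = _ := by rw [← Finset.sum_mul, ← mul_assoc]

lemma rad_univ {n : ℕ} (hn : 0 < n) : rad n univ = 1 := by
  have hm : Measurable fun q : Eucl n × ℝ => q.2 • Nv q.1 := measurable_snd.smul (Nv_meas.comp measurable_fst)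
  have h := congrArg (fun μ : Measure (Eucl n) => μ univ) (polar_map hn)
  simp only [Measure.map_apply hm MeasurableSet.univ, preimage_univ, Measure.restrict_apply_univ] at h
  rw [← univ_prod_univ, Measure.prod_prod, Measure.restrict_apply_univ] at h
  change om n * rad n univ = om n at h
  have := om_ne_top n
  have h0 := om_pos n
  calc rad n univ = (om n)⁻¹ * (om n * rad n univ) := by
        rw [← mul_assoc, ENNReal.inv_mul_cancel h0 this, one_mul]
    _ = 1 := by rw [h, ENNReal.inv_mul_cancel h0 this]

lemma ballAvg_eq {n : ℕ} (f : Eucl n → ℝ) (x : Eucl n) {t : ℝ} (ht : 0 < t) :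
    ballAvg n f x t = (om n).toReal⁻¹ * ∫ y in ball (0 : Eucl n) 1, f (x + t • y) := by
  have h1 : ∫ y in ball (0 : Eucl n) 1, f (x + t • y) = (t ^ n)⁻¹ * ∫ y in ball x t, f y := by
    rw [← integral_indicator measurableSet_ball, ← integral_indicator measurableSet_ball]
    have hz : ∀ y, x + t • y ∈ ball x t ↔ y ∈ ball (0 : Eucl n) 1 := by
      intro y
      rw [mem_ball_zero_iff, mem_ball_iff_norm, add_sub_cancel_left, norm_smul, Real.norm_of_nonneg ht.le]
      exact ⟨fun h => by nlinarith, fun h => by nlinarith⟩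
    have h2 : ∀ y, (ball (0 : Eucl n) 1).indicator (fun y => f (x + t • y)) y = (ball x t).indicator f (x + t • y) := by
      intro y
      by_cases hy : y ∈ ball (0 : Eucl n) 1
      · simp only [indicator_of_mem hy, indicator_of_mem ((hz y).2 hy)]
      · simp only [indicator_of_notMem hy, indicator_of_notMem (fun h' => hy ((hz y).1 h'))]
    simp_rw [h2]
    have h3 := Measure.integral_comp_smul (volume : Measure (Eucl n)) (fun z => (ball x t).indicator f (x + z)) t
    rw [h3, integral_add_left_eq_self (fun z => (ball x t).indicator f z) x, finrank_euclideanSpace_fin, abs_of_pos (by positivity), smul_eq_mul]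
  unfold ballAvg
  rw [h1, setAverage_eq, measureReal_def, vol_ball x ht, ENNReal.toReal_mul, ENNReal.toReal_ofReal (by positivity), smul_eq_mul, mul_inv]
  ring

lemma ball_sph {n : ℕ} (hn : 0 < n) {f : Eucl n → ℝ} (hfm : Measurable f) (x : Eucl n) {t : ℝ} (ht : 0 < t)
    (hf : IntegrableOn f (ball x t) volume) :
    Integrable (fun r => sphereAvg n f x (r * t)) (rad n) ∧ ballAvg n f x t = ∫ r, sphereAvg n f x (r * t) ∂rad n := by
  have hm : Measurable fun q : Eucl n × ℝ => q.2 • Nv q.1 := measurable_snd.smul (Nv_meas.comp measurable_fst)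
  have hi := ball_int ht hf
  have hgm : Measurable fun y => f (x + t • y) := by fun_prop
  unfold IntegrableOn at hi
  rw [← polar_map hn, integrable_map_measure hgm.aestronglyMeasurable hm.aemeasurable] at hi
  have hs : ∀ r, sphereAvg n f x (r * t) = (om n).toReal⁻¹ * ∫ y in ball (0 : Eucl n) 1, f (x + t • r • Nv y) := by
    intro r
    rw [sph_eq hn hfm]
    simp only [smul_smul, mul_comm]
  simp_rw [hs]
  constructor
  · exact hi.integral_prod_right.const_mul _
  · rw [ballAvg_eq f x ht, integral_const_mul]
    congr 1
    conv_lhs => rw [← polar_map hn]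
    rw [integral_map hm.aemeasurable hgm.aestronglyMeasurable]
    exact integral_prod_symm _ hi

lemma ballAvg_meas {n : ℕ} {f : Eucl n → ℝ} (hfm : Measurable f) :
    ∃ g : Eucl n × ℝ → ℝ, Measurable g ∧ ∀ x, ∀ t > 0, g (x, t) = ballAvg n f x t := by
  refine ⟨fun q => (om n).toReal⁻¹ * ∫ y in ball (0 : Eucl n) 1, f (q.1 + q.2 • y), ?_, fun x t ht => (ballAvg_eq f x ht).symm⟩
  have : Measurable fun q : (Eucl n × ℝ) × Eucl n => f (q.1.1 + q.1.2 • q.2) := by fun_prop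
  exact (this.stronglyMeasurable.integral_prod_right'.measurable).const_mul _

lemma S_le_T {n : ℕ} (hn : 0 < n) {f : Eucl n → ℝ} (hfm : Measurable f)
    (hf : ∀ x r, IntegrableOn f (ball x r) volume) (x : Eucl n) : Ssq n f x ≤ Tsq n f x := by
  unfold Ssq Tsq
  refine ENNReal.rpow_le_rpow ?_ (by norm_num)
  have hsm : Measurable fun t => f x - sphereAvg n f x t :=
    measurable_const.sub ((sphereAvg_meas hn hfm).comp (by fun_prop : Measurable fun t : ℝ => (x, t)))
  set a : ℝ → ℝ≥0∞ := fun t => ‖t⁻¹ * (f x - sphereAvg n f x t)‖ₑ with ha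
  have ham : Measurable a := (measurable_inv.mul hsm).enorm
  have : IsProbabilityMeasure (rad n) := ⟨rad_univ hn⟩
  have hr01 : ∀ᵐ r ∂rad n, r ∈ Ioo (0:ℝ) 1 := by
    rw [rad_eq]
    exact (withDensity_absolutelyContinuous _ _).ae_le (ae_restrict_mem measurableSet_Ioo)
  rw [sq_int_eq hsm]
  calc ∫⁻ t in Ioi (0:ℝ), ENNReal.ofReal ((f x - ballAvg n f x t) ^ 2 / t ^ 3)
      ≤ ∫⁻ t in Ioi (0:ℝ), ENNReal.ofReal t⁻¹ * ∫⁻ r, a (r * t) ^ 2 ∂rad n := by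
        refine setLIntegral_mono' measurableSet_Ioi fun t ht => ?_
        have ht : 0 < t := ht
        rw [sq_div_cube ht]
        refine mul_le_mul_right ?_ _
        obtain ⟨hi, he⟩ := ball_sph hn hfm x ht (hf x t)
        have e1 : t⁻¹ * (f x - ballAvg n f x t) = ∫ r, t⁻¹ * (f x - sphereAvg n f x (r * t)) ∂rad n := by
          rw [integral_const_mul, integral_sub (integrable_const _) hi, he]; simp
        have e2 : ‖t⁻¹ * (f x - ballAvg n f x t)‖ₑ ≤ ∫⁻ r, a (r * t) ∂rad n := by
          rw [e1]
          refine (enorm_integral_le_lintegral_enorm _).trans (lintegral_mono_ae ?_)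
          filter_upwards [hr01] with r hr
          simp only [ha]
          rw [enorm_mul, enorm_mul]
          refine mul_le_mul_left ?_ _
          rw [Real.enorm_of_nonneg (by positivity), Real.enorm_of_nonneg (by have := hr.1; positivity)]
          refine ENNReal.ofReal_le_ofReal (inv_anti₀ (by have := hr.1; positivity) ?_)
          nlinarith [hr.2]
        have e3 : (∫⁻ r, a (r * t) ∂rad n) ^ 2 ≤ ∫⁻ r, a (r * t) ^ 2 ∂rad n := by
          have := lint_cs (rad n) (f := fun r => a (r * t)) (g := fun _ => 1) (by fun_prop) (by fun_prop)
          simpa using this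
        exact (pow_le_pow_left' e2 2).trans e3
    _ = ∫⁻ t, (∫⁻ r, a (r * t) ^ 2 ∂rad n) ∂mdt := by
        have hm1 : Measurable fun q : ℝ × ℝ => a (q.2 * q.1) ^ 2 := by fun_prop
        have hm2 : Measurable fun t => ∫⁻ r, a (r * t) ^ 2 ∂rad n := hm1.lintegral_prod_right'
        rw [mdt_lintegral hm2.aemeasurable]
    _ = ∫⁻ r, (∫⁻ t, a (r * t) ^ 2 ∂mdt) ∂rad n := by
        have hm1 : Measurable fun q : ℝ × ℝ => a (q.2 * q.1) ^ 2 := by fun_prop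
        rw [lintegral_lintegral_swap hm1.aemeasurable]
    _ = ∫⁻ _r, (∫⁻ t, a t ^ 2 ∂mdt) ∂rad n := by
        refine lintegral_congr_ae ?_
        filter_upwards [hr01] with r hr
        exact mdt_scale (g := fun t => a t ^ 2) (by fun_prop) hr.1
    _ = _ := by simp [ha]

lemma sph_ae {n : ℕ} (f g : Eucl n → ℝ) (h : f =ᵐ[volume] g) :
    ∀ᵐ x, ∀ᵐ t : ℝ, sphereAvg n f x t = sphereAvg n g x t := by
  have hfin : IsFiniteMeasure (sphereMeasure n) := by
    have : IsFiniteMeasure ((volume : Measure (Eucl n)).restrict (ball 0 1 \ {0})) :=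
      ⟨by rw [Measure.restrict_apply_univ]; exact (measure_mono sdiff_subset).trans_lt measure_ball_lt_top⟩
    unfold sphereMeasure
    infer_instance
  obtain ⟨Z, hZ, hZm, hZ0⟩ := exists_measurable_superset_of_null h
  have h1 : ∀ᵐ x : Eucl n, ∀ᵐ q : ℝ × Eucl n ∂(volume.prod (sphereMeasure n)), x + q.1 • q.2 ∉ Z := by
    rw [Measure.ae_ae_comm]
    · refine Eventually.of_forall fun q => ?_
      have := (measurePreserving_add_right (volume : Measure (Eucl n)) (q.1 • q.2)).quasiMeasurePreserving.ae
        (p := fun x => x ∉ Z) (measure_eq_zero_iff_ae_notMem.1 hZ0)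
      exact this
    · have : Measurable fun q : Eucl n × (ℝ × Eucl n) => q.1 + q.2.1 • q.2.2 := by fun_prop
      exact this hZm.compl
  filter_upwards [h1] with x hx
  filter_upwards [Measure.ae_ae_of_ae_prod hx] with t ht
  unfold sphereAvg
  refine average_congr ?_
  filter_upwards [ht] with z hz
  by_contra hc
  exact hz (hZ hc)

lemma Tsq_ae {n : ℕ} (f g : Eucl n → ℝ) (h : f =ᵐ[volume] g) : ∀ᵐ x, Tsq n f x = Tsq n g x := by
  filter_upwards [h, sph_ae f g h] with x h1 h2
  unfold Tsq
  rw [h1]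
  congr 1
  refine lintegral_congr_ae (ae_restrict_of_ae ?_)
  filter_upwards [h2] with t ht
  rw [ht]

lemma Ssq_ae {n : ℕ} (f g : Eucl n → ℝ) (h : f =ᵐ[volume] g) : ∀ᵐ x, Ssq n f x = Ssq n g x := by
  have hb : ∀ x t, ballAvg n f x t = ballAvg n g x t := fun x t => by
    unfold ballAvg
    exact average_congr (ae_restrict_of_ae h)
  filter_upwards [h] with x h1
  unfold Ssq
  rw [h1]
  simp_rw [hb]

def th {n : ℕ} (x : Eucl n) : ℝ := 1 - (min ‖x‖ 1) ^ 2

def bth {n : ℕ} (x : Eucl n) : ℝ := (om n).toReal⁻¹ * ∫ y in ball (0 : Eucl n) 1, th (x + y)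

def mu {n : ℕ} (x : Eucl n) : ℝ := th x - bth x

def kap {n : ℕ} (x : Eucl n) : ℝ := (n * (om n).toReal)⁻¹ * (‖x‖ ^ n)⁻¹ * ∫ y in ball (0 : Eucl n) ‖x‖, mu y

lemma omr_pos (n : ℕ) : 0 < (om n).toReal := ENNReal.toReal_pos (om_pos n) (om_ne_top n)

lemma th_cont {n : ℕ} : Continuous (th : Eucl n → ℝ) := by unfold th; fun_prop

lemma th_meas {n : ℕ} : Measurable (th : Eucl n → ℝ) := th_cont.measurable

lemma th_nonneg {n : ℕ} (x : Eucl n) : 0 ≤ th x := by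
  unfold th
  have h1 : min ‖x‖ 1 ≤ 1 := min_le_right _ _
  have h2 : 0 ≤ min ‖x‖ 1 := le_min (norm_nonneg _) zero_le_one
  nlinarith

lemma th_le_one {n : ℕ} (x : Eucl n) : th x ≤ 1 := by
  unfold th
  nlinarith [sq_nonneg (min ‖x‖ 1)]

lemma th_supp {n : ℕ} {x : Eucl n} (h : 1 ≤ ‖x‖) : th x = 0 := by
  unfold th
  rw [min_eq_right h]; norm_num

lemma th_lip {n : ℕ} (x y : Eucl n) : |th x - th y| ≤ 2 * ‖x - y‖ := by
  unfold th
  set a := min ‖x‖ 1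
  set b := min ‖y‖ 1
  have ha : a ≤ 1 := min_le_right _ _
  have ha' : 0 ≤ a := le_min (norm_nonneg _) zero_le_one
  have hb : b ≤ 1 := min_le_right _ _
  have hb' : 0 ≤ b := le_min (norm_nonneg _) zero_le_one
  have hab : |b - a| ≤ ‖x - y‖ := by
    rw [abs_sub_comm]
    refine (abs_min_sub_min_le_max _ _ _ _).trans ?_
    simp only [sub_self, abs_zero]
    exact max_le (abs_norm_sub_norm_le _ _) (norm_nonneg _)
  rw [show 1 - a ^ 2 - (1 - b ^ 2) = (b + a) * (b - a) by ring, abs_mul, abs_of_nonneg (by positivity)]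
  exact mul_le_mul (by linarith) hab (abs_nonneg _) (by norm_num)

lemma cont_int {n : ℕ} {g : Eucl n → ℝ} (hg : Continuous g) (x : Eucl n) (r : ℝ) : IntegrableOn g (ball x r) volume :=
  (hg.continuousOn.integrableOn_compact (isCompact_closedBall x r)).mono_set ball_subset_closedBall

lemma ball_shift {n : ℕ} (g : Eucl n → ℝ) (x : Eucl n) (r : ℝ) :
    ∫ y in ball (0 : Eucl n) r, g (x + y) = ∫ y in ball x r, g y := by
  have h := (measurePreserving_add_left (volume : Measure (Eucl n)) x).setIntegral_preimage_emb
    (MeasurableEquiv.addLeft x).measurableEmbedding g (ball x r)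
  rw [← h]
  congr 2
  ext y
  simp

lemma bth_eq {n : ℕ} (x : Eucl n) : bth x = (om n).toReal⁻¹ * ∫ y in ball x 1, th y := by
  unfold bth; rw [ball_shift]

lemma vol_real {n : ℕ} (x : Eucl n) {r : ℝ} (hr : 0 < r) : volume.real (ball x r) = r ^ n * (om n).toReal := by
  rw [measureReal_def, vol_ball x hr, ENNReal.toReal_mul, ENNReal.toReal_ofReal (by positivity)]

lemma avg_le {n : ℕ} {g : Eucl n → ℝ} (hg : Continuous g) {C : ℝ} (hC : ∀ y, |g y| ≤ C) :
    |(om n).toReal⁻¹ * ∫ y in ball (0 : Eucl n) 1, g y| ≤ C := by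
  have h1 : |∫ y in ball (0 : Eucl n) 1, g y| ≤ C * volume.real (ball (0 : Eucl n) 1) := by
    rw [← Real.norm_eq_abs]
    exact norm_setIntegral_le_of_norm_le_const measure_ball_lt_top fun y _ => hC y
  rw [vol_real _ one_pos, one_pow, one_mul] at h1
  have := omr_pos n
  rw [abs_mul, abs_of_pos (by positivity), inv_mul_le_iff₀ this]
  linarith

lemma bth_lip {n : ℕ} (x y : Eucl n) : |bth x - bth y| ≤ 2 * ‖x - y‖ := by
  have hc : ∀ x : Eucl n, Continuous fun z => th (x + z) := fun x => th_cont.comp (by fun_prop)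
  unfold bth
  rw [← mul_sub, ← integral_sub (cont_int (hc x) 0 1) (cont_int (hc y) 0 1)]
  refine avg_le ((hc x).sub (hc y)) fun z => (th_lip _ _).trans (by simp)

lemma bth_nonneg {n : ℕ} (x : Eucl n) : 0 ≤ bth x := by
  unfold bth
  have := omr_pos n
  have h : 0 ≤ ∫ y in ball (0 : Eucl n) 1, th (x + y) := integral_nonneg fun y => th_nonneg _
  positivity

lemma bth_le_one {n : ℕ} (x : Eucl n) : bth x ≤ 1 := by
  refine (le_abs_self _).trans ?_
  unfold bth
  have hc : Continuous fun z => th (x + z) := th_cont.comp (by fun_prop)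
  exact avg_le hc fun z => by rw [abs_of_nonneg (th_nonneg _)]; exact th_le_one _

lemma bth_supp {n : ℕ} {x : Eucl n} (h : 2 ≤ ‖x‖) : bth x = 0 := by
  unfold bth
  rw [setIntegral_eq_zero_of_forall_eq_zero, mul_zero]
  intro y hy
  rw [mem_ball_zero_iff] at hy
  refine th_supp ?_
  have := norm_sub_norm_le x (-y)
  rw [sub_neg_eq_add, norm_neg] at this
  linarith

lemma mu_lip {n : ℕ} (x y : Eucl n) : |mu x - mu y| ≤ 4 * ‖x - y‖ := by
  unfold mu
  have h1 := th_lip x y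
  have h2 := bth_lip x y
  rw [abs_le] at *
  constructor <;> linarith [h1.1, h1.2, h2.1, h2.2]

lemma mu_abs {n : ℕ} (x : Eucl n) : |mu x| ≤ 1 := by
  unfold mu
  rw [abs_le]
  constructor <;> linarith [th_nonneg x, th_le_one x, bth_nonneg x, bth_le_one x]

lemma mu_supp {n : ℕ} {x : Eucl n} (h : 2 ≤ ‖x‖) : mu x = 0 := by
  unfold mu
  rw [th_supp (by linarith), bth_supp h, sub_zero]

lemma lip_cont {n : ℕ} {g : Eucl n → ℝ} {C : ℝ} (hC : 0 ≤ C) (h : ∀ x y, |g x - g y| ≤ C * ‖x - y‖) : Continuous g := by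
  refine (LipschitzWith.of_dist_le_mul (K := ⟨C, hC⟩) fun x y => ?_).continuous
  rw [Real.dist_eq, dist_eq_norm]
  exact h x y

lemma bth_cont {n : ℕ} : Continuous (bth : Eucl n → ℝ) := lip_cont (by norm_num) bth_lip
lemma mu_cont {n : ℕ} : Continuous (mu : Eucl n → ℝ) := lip_cont (by norm_num) mu_lip

lemma th_radial {n : ℕ} {x y : Eucl n} (h : ‖x‖ = ‖y‖) : th x = th y := by unfold th; rw [h]

lemma bth_radial {n : ℕ} {x y : Eucl n} (h : ‖x‖ = ‖y‖) : bth x = bth y := by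
  set L : Eucl n ≃ₗᵢ[ℝ] Eucl n := (ℝ ∙ (x - y))ᗮ.reflection
  have hL : L x = y := Submodule.reflection_sub h
  unfold bth
  congr 1
  have hh := L.measurePreserving.setIntegral_preimage_emb L.toHomeomorph.measurableEmbedding (fun z => th (y + z)) (ball 0 1)
  rw [← hh]
  have hs : L ⁻¹' ball 0 1 = ball 0 1 := by
    ext z; simp
  rw [hs]
  congr 1; ext z
  refine th_radial ?_
  rw [← hL, ← map_add, L.norm_map]

lemma mu_radial {n : ℕ} {x y : Eucl n} (h : ‖x‖ = ‖y‖) : mu x = mu y := by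
  unfold mu; rw [th_radial h, bth_radial h]

/-- bathtub inequality -/
lemma bathtub {n : ℕ} (y : Eucl n) {r : ℝ} (hr : 0 < r) : ∫ z in ball y r, th z ≤ ∫ z in ball (0 : Eucl n) r, th z := by
  set c : ℝ := 1 - (min r 1) ^ 2 with hc
  have hc0 : 0 ≤ c := by
    have h1 : min r 1 ≤ 1 := min_le_right _ _
    have h2 : 0 ≤ min r 1 := le_min hr.le zero_le_one
    rw [hc]; nlinarith
  set g : Eucl n → ℝ := fun z => max (th z - c) 0 with hg
  have hgc : Continuous g := by have := @th_cont n; fun_prop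
  have hin : ∀ z, ‖z‖ < r → g z = th z - c := by
    intro z hz
    refine max_eq_left ?_
    have h1 : min ‖z‖ 1 ≤ min r 1 := min_le_min_right _ hz.le
    have h2 : 0 ≤ min ‖z‖ 1 := le_min (norm_nonneg _) zero_le_one
    unfold th
    rw [hc]; nlinarith
  have hout : ∀ z, ¬ ‖z‖ < r → g z = 0 := by
    intro z hz
    refine max_eq_right ?_
    have h1 : min r 1 ≤ min ‖z‖ 1 := min_le_min_right _ (not_lt.1 hz)
    have h2 : 0 ≤ min r 1 := le_min hr.le zero_le_one
    unfold th
    rw [hc]; nlinarith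
  have hgi : Integrable g volume := by
    have h1 : IntegrableOn g (ball 0 r) volume := cont_int hgc 0 r
    rw [← integrable_indicator_iff measurableSet_ball] at h1
    refine h1.congr (Eventually.of_forall fun z => ?_)
    by_cases hz : z ∈ ball (0 : Eucl n) r
    · simp only [indicator_of_mem hz]
    · simp only [indicator_of_notMem hz]
      rw [hout z (by rwa [mem_ball_zero_iff] at hz)]
  have hcon : ∀ y : Eucl n, ∫ z in ball y r, (th z - c) = (∫ z in ball y r, th z) - c * (r ^ n * (om n).toReal) := by
    intro y
    rw [integral_sub (cont_int th_cont y r) (cont_int continuous_const y r), setIntegral_const, vol_real y hr, smul_eq_mul, mul_comm c]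
  have hfull : ∫ z, g z = ∫ z in ball (0 : Eucl n) r, (th z - c) := by
    rw [← integral_indicator measurableSet_ball]
    congr 1; ext z
    by_cases hz : z ∈ ball (0 : Eucl n) r
    · simp only [indicator_of_mem hz]; exact hin z (by rwa [mem_ball_zero_iff] at hz)
    · simp only [indicator_of_notMem hz]
      rw [hout z (by rwa [mem_ball_zero_iff] at hz)]
  have h1 : ∫ z in ball y r, (th z - c) ≤ ∫ z in ball y r, g z :=
    integral_mono (cont_int (th_cont.sub continuous_const) y r) (cont_int hgc y r) fun z => le_max_left _ _
  have h2 : ∫ z in ball y r, g z ≤ ∫ z, g z := setIntegral_le_integral hgi (Eventually.of_forall fun z => le_max_right _ _)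
  have h3 := hcon y
  have h4 := hcon 0
  linarith

lemma bth_ball {n : ℕ} (r : ℝ) :
    ∫ x in ball (0 : Eucl n) r, bth x = (om n).toReal⁻¹ * ∫ y in ball (0 : Eucl n) 1, (∫ z in ball y r, th z) := by
  unfold bth
  rw [integral_const_mul]
  congr 1
  have hc : Continuous fun q : Eucl n × Eucl n => th (q.1 + q.2) := th_cont.comp (by fun_prop)
  have : IsFiniteMeasure ((volume : Measure (Eucl n)).restrict (ball 0 r)) := ⟨by simp [measure_ball_lt_top]⟩
  have : IsFiniteMeasure ((volume : Measure (Eucl n)).restrict (ball 0 1)) := ⟨by simp [measure_ball_lt_top]⟩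
  rw [integral_integral_swap]
  · congr 1; ext y
    rw [← ball_shift th y r]
    simp only [add_comm y]
  · refine Integrable.of_bound hc.aestronglyMeasurable 1 (Eventually.of_forall fun q => ?_)
    simp only [Function.uncurry]
    rw [Real.norm_of_nonneg (th_nonneg _)]; exact th_le_one _

lemma J_cont {n : ℕ} (r : ℝ) : Continuous fun y : Eucl n => ∫ z in ball y r, th z := by
  have : ∀ y : Eucl n, ∫ z in ball y r, th z = ∫ z in ball (0 : Eucl n) r, th (y + z) := fun y => (ball_shift _ _ _).symm
  simp_rw [this]
  have hc : ∀ x : Eucl n, Continuous fun z => th (x + z) := fun x => th_cont.comp (by fun_prop)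
  refine lip_cont (C := 2 * volume.real (ball (0 : Eucl n) r)) (by positivity) fun x y => ?_
  rw [← integral_sub (cont_int (hc x) 0 r) (cont_int (hc y) 0 r)]
  rw [mul_right_comm, ← Real.norm_eq_abs]
  refine norm_setIntegral_le_of_norm_le_const (C := 2 * ‖x - y‖) measure_ball_lt_top fun z _ => ?_
  exact (th_lip _ _).trans (by simp)

lemma mu_ball {n : ℕ} (r : ℝ) : ∫ x in ball (0 : Eucl n) r, mu x
    = (∫ x in ball (0 : Eucl n) r, th x) - (om n).toReal⁻¹ * ∫ y in ball (0 : Eucl n) 1, (∫ z in ball y r, th z) := by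
  unfold mu
  rw [integral_sub (cont_int th_cont 0 r) (cont_int bth_cont 0 r), bth_ball]

lemma avg_const {n : ℕ} (c : ℝ) : (om n).toReal⁻¹ * ∫ _y in ball (0 : Eucl n) 1, c = c := by
  rw [setIntegral_const, vol_real _ one_pos, one_pow, one_mul, smul_eq_mul, inv_mul_cancel_left₀ (omr_pos n).ne']

lemma mu_ball_nonneg {n : ℕ} (r : ℝ) : 0 ≤ ∫ x in ball (0 : Eucl n) r, mu x := by
  rcases le_or_gt r 0 with hr | hr
  · rw [ball_eq_empty.2 hr]; simp
  rw [mu_ball, sub_nonneg]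
  have h : ∫ y in ball (0 : Eucl n) 1, (∫ z in ball y r, th z) ≤ ∫ _y in ball (0 : Eucl n) 1, ∫ z in ball (0 : Eucl n) r, th z :=
    integral_mono (cont_int (J_cont r) 0 1) (cont_int continuous_const 0 1) fun y => bathtub y hr
  have := omr_pos n
  calc _ ≤ (om n).toReal⁻¹ * ∫ _y in ball (0 : Eucl n) 1, ∫ z in ball (0 : Eucl n) r, th z := by gcongr
    _ = _ := avg_const _

lemma mu_ball_zero {n : ℕ} {r : ℝ} (hr : 2 ≤ r) : ∫ x in ball (0 : Eucl n) r, mu x = 0 := by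
  have hz : ∀ y ∈ ball (0 : Eucl n) 1, ∫ z in ball y r, th z = ∫ z : Eucl n, th z := by
    intro y hy
    refine setIntegral_eq_integral_of_forall_compl_eq_zero fun z hz => th_supp ?_
    rw [mem_ball_zero_iff] at hy
    rw [mem_ball_iff_norm, not_lt] at hz
    linarith [norm_sub_le z y]
  rw [mu_ball, setIntegral_congr_fun measurableSet_ball hz, avg_const, hz 0 (mem_ball_self one_pos), sub_self]

lemma a_lt {n : ℕ} (hn : 0 < n) : (om n).toReal⁻¹ * ∫ y in ball (0 : Eucl n) 1, th y < 1 := by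
  have hc : Continuous fun y : Eucl n => 1 - th y := continuous_const.sub th_cont
  have h1 : 0 < ∫ y in ball (0 : Eucl n) 1, (1 - th y) := by
    rw [setIntegral_pos_iff_support_of_nonneg_ae (Eventually.of_forall fun y => sub_nonneg.2 (th_le_one y)) (cont_int hc 0 1)]
    have : ball (0 : Eucl n) 1 ≤ᵐ[volume] ((Function.support fun y : Eucl n => 1 - th y) ∩ ball 0 1 : Set (Eucl n)) := by
      filter_upwards [ae_ne0 hn] with y hy h
      refine ⟨?_, h⟩
      have h0 : 0 < ‖y‖ := norm_pos_iff.2 hy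
      have : 0 < min ‖y‖ 1 := lt_min h0 one_pos
      simp only [Function.mem_support, th]
      have : 0 < (min ‖y‖ 1) ^ 2 := by positivity
      intro hh; linarith
    exact lt_of_lt_of_le (pos_iff_ne_zero.2 (om_pos n)) (measure_mono_ae this)
  rw [integral_sub (cont_int continuous_const 0 1) (cont_int th_cont 0 1)] at h1
  have h2 := avg_const (n := n) 1
  have := omr_pos n
  have h3 : 0 < (om n).toReal⁻¹ * ((∫ _y in ball (0 : Eucl n) 1, (1:ℝ)) - ∫ y in ball (0 : Eucl n) 1, th y) := by positivity
  rw [mul_sub, h2] at h3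
  linarith

lemma mu_lower {n : ℕ} {x : Eucl n} (hx : ‖x‖ ≤ 1) : 1 - ‖x‖ ^ 2 - (om n).toReal⁻¹ * ∫ y in ball (0 : Eucl n) 1, th y ≤ mu x := by
  unfold mu
  rw [bth_eq]
  have h1 : th x = 1 - ‖x‖ ^ 2 := by unfold th; rw [min_eq_left hx]
  have := omr_pos n
  have h2 : (om n).toReal⁻¹ * ∫ y in ball x 1, th y ≤ (om n).toReal⁻¹ * ∫ y in ball (0 : Eucl n) 1, th y := by
    have := bathtub x one_pos
    gcongr
  linarith

lemma kap_nonneg {n : ℕ} (x : Eucl n) : 0 ≤ kap x := by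
  unfold kap
  have := omr_pos n
  have := mu_ball_nonneg (n := n) ‖x‖
  positivity

lemma kap_supp {n : ℕ} {x : Eucl n} (h : 2 ≤ ‖x‖) : kap x = 0 := by
  unfold kap
  rw [mu_ball_zero h, mul_zero]

lemma kap_abs {n : ℕ} (hn : 0 < n) (x : Eucl n) : |kap x| ≤ 1 := by
  unfold kap
  have h0 := omr_pos n
  rcases eq_or_ne x 0 with rfl | hx
  · simp
  have hx0 : 0 < ‖x‖ := norm_pos_iff.2 hx
  have h1 : |∫ y in ball (0 : Eucl n) ‖x‖, mu y| ≤ 1 * volume.real (ball (0 : Eucl n) ‖x‖) := by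
    rw [← Real.norm_eq_abs]
    exact norm_setIntegral_le_of_norm_le_const measure_ball_lt_top fun y _ => mu_abs y
  rw [vol_real _ hx0, one_mul] at h1
  have hn' : (1 : ℝ) ≤ n := by exact_mod_cast hn
  rw [abs_mul, abs_of_nonneg (by positivity)]
  calc _ ≤ ((n : ℝ) * (om n).toReal)⁻¹ * (‖x‖ ^ n)⁻¹ * (‖x‖ ^ n * (om n).toReal) := by gcongr
    _ = (n : ℝ)⁻¹ := by field_simp
    _ ≤ 1 := inv_le_one_of_one_le₀ hn'

lemma kap_meas {n : ℕ} : Measurable (kap : Eucl n → ℝ) := by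
  have h : ∀ x : Eucl n, kap x = (n * (om n).toReal)⁻¹ * (‖x‖ ^ n)⁻¹ * ∫ y : Eucl n, ({q : Eucl n × Eucl n | ‖q.2‖ < ‖q.1‖}.indicator (fun q => mu q.2)) (x, y) := by
    intro x
    unfold kap
    rw [← integral_indicator measurableSet_ball]
    congr 2; ext y
    simp only [indicator, mem_ball_zero_iff, mem_ofPred_eq]
  have hm : Measurable fun q : Eucl n × Eucl n => ({q : Eucl n × Eucl n | ‖q.2‖ < ‖q.1‖}.indicator (fun q => mu q.2)) q :=
    Measurable.indicator (mu_cont.measurable.comp measurable_snd) (measurableSet_lt measurable_snd.norm measurable_fst.norm)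
  have h2 := (hm.stronglyMeasurable.integral_prod_right' (ν := (volume : Measure (Eucl n)))).measurable
  rw [funext h]
  fun_prop

lemma bdd_supp_int {n : ℕ} {K : Eucl n → ℝ} {C M : ℝ} (hm : Measurable K) (hb : ∀ x, |K x| ≤ C) (hs : ∀ x, M ≤ ‖x‖ → K x = 0) :
    Integrable K volume := by
  have h1 : IntegrableOn K (ball 0 M) volume :=
    Measure.integrableOn_of_bounded (M := C) measure_ball_lt_top.ne hm.aestronglyMeasurable (Eventually.of_forall fun x => hb x)
  refine h1.integrable_of_forall_notMem_eq_zero fun x hx => hs x ?_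
  rw [mem_ball_zero_iff] at hx
  exact not_lt.1 hx

lemma kap_int {n : ℕ} (hn : 0 < n) : Integrable (kap : Eucl n → ℝ) volume :=
  bdd_supp_int kap_meas (kap_abs hn) fun _ => kap_supp

lemma kap_pos {n : ℕ} (hn : 0 < n) : 0 < ∫ x : Eucl n, kap x := by
  rw [integral_pos_iff_support_of_nonneg (fun x => kap_nonneg x) (kap_int hn)]
  set a := (om n).toReal⁻¹ * ∫ y in ball (0 : Eucl n) 1, th y with ha
  have ha1 : a < 1 := a_lt hn
  have ha0 : 0 ≤ a := by
    have := omr_pos n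
    have h : 0 ≤ ∫ y in ball (0 : Eucl n) 1, th y := integral_nonneg fun y => th_nonneg _
    positivity
  set δ := (1 - a) / 2 with hδ
  have hδ0 : 0 < δ := by rw [hδ]; linarith
  have hδ1 : δ < 1 := by rw [hδ]; linarith
  have hmu : ∀ x : Eucl n, ‖x‖ < δ → 0 < mu x := by
    intro x hx
    have h1 := mu_lower (x := x) (by linarith)
    rw [← ha] at h1
    nlinarith [norm_nonneg x]
  have hsub : ball (0 : Eucl n) δ ≤ᵐ[volume] Function.support (kap : Eucl n → ℝ) := by
    filter_upwards [ae_ne0 hn] with x hx hxb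
    have hxb : ‖x‖ < δ := by rw [← mem_ball_zero_iff]; exact hxb
    have hx0 : 0 < ‖x‖ := norm_pos_iff.2 hx
    have h1 : 0 < ∫ y in ball (0 : Eucl n) ‖x‖, mu y := by
      rw [setIntegral_pos_iff_support_of_nonneg_ae _ (cont_int mu_cont _ _)]
      · have : ball (0 : Eucl n) ‖x‖ ⊆ (Function.support mu) ∩ ball (0 : Eucl n) ‖x‖ := by
          intro y hy
          refine ⟨(hmu y ?_).ne', hy⟩
          rw [mem_ball_zero_iff] at hy
          linarith
        exact (measure_ball_pos volume 0 hx0).trans_le (measure_mono this)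
      · filter_upwards [ae_restrict_mem measurableSet_ball] with y hy
        rw [mem_ball_zero_iff] at hy
        exact (hmu y (by linarith)).le
    have := omr_pos n
    have hn' : (0:ℝ) < n := by exact_mod_cast hn
    refine ne_of_gt ?_
    unfold kap
    positivity
  exact (measure_ball_pos volume 0 hδ0).trans_le (measure_mono_ae hsub)

lemma kd_kap {n : ℕ} {x : Eucl n} (hx : x ≠ 0) {a : ℝ} (ha : 0 < a) :
    kd kap a x = (n * (om n).toReal)⁻¹ * ∫ y in ball (0 : Eucl n) a⁻¹, mu (‖x‖ • y) := by
  have hx0 : 0 < ‖x‖ := norm_pos_iff.2 hx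
  rw [Measure.setIntegral_comp_smul_of_pos _ _ _ hx0, _root_.smul_ball hx0.ne', smul_zero, finrank_euclideanSpace_fin, norm_norm]
  unfold kd kap
  rw [norm_smul, Real.norm_of_nonneg (by positivity), smul_eq_mul, mul_pow, mul_comm ‖x‖, inv_pow]
  field_simp

lemma mdt_integral {I : Set ℝ} (hI : MeasurableSet I) (h0 : I ⊆ Ioi 0) (g : ℝ → ℝ) :
    ∫ t in I, g t ∂mdt = ∫ t in I, t⁻¹ * g t := by
  unfold mdt
  rw [restrict_withDensity hI, Measure.restrict_restrict hI, inter_eq_left.2 h0,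
    integral_withDensity_eq_integral_toReal_smul (by fun_prop) (by simp)]
  refine setIntegral_congr_fun hI fun r hr => ?_
  have : 0 < r := h0 hr
  simp only [smul_eq_mul]
  rw [ENNReal.toReal_ofReal (by positivity)]

lemma kap_diff {n : ℕ} (hn : 0 < n) {x : Eucl n} (hx : x ≠ 0) {a b : ℝ} (ha : 0 < a) (hab : a ≤ b) :
    ∫ t in Ioc a b, kd mu t x ∂mdt = kd kap a x - kd kap b x := by
  have hx0 : 0 < ‖x‖ := norm_pos_iff.2 hx
  have hb : 0 < b := ha.trans_le hab
  have h0 := omr_pos n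
  have hn' : (0:ℝ) < n := by exact_mod_cast hn
  have : Nontrivial (Eucl n) := ⟨x, 0, hx⟩
  have hba : b⁻¹ ≤ a⁻¹ := inv_anti₀ ha hab
  have hmc : Continuous fun y : Eucl n => mu (‖x‖ • y) := mu_cont.comp (by fun_prop)
  set G : ℝ → ℝ := (Ico b⁻¹ a⁻¹).indicator fun s => mu (s • x) with hG
  rw [kd_kap hx ha, kd_kap hx hb, ← mul_sub, ← setIntegral_sdiff measurableSet_ball (cont_int hmc 0 a⁻¹) (ball_subset_ball hba),
    ← integral_indicator (measurableSet_ball.diff measurableSet_ball)]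
  have h1 : ∀ y : Eucl n, (ball (0 : Eucl n) a⁻¹ \ ball 0 b⁻¹).indicator (fun y => mu (‖x‖ • y)) y = G ‖y‖ := by
    intro y
    simp only [hG, indicator, Set.mem_sdiff, mem_ball_zero_iff, mem_Ico, not_lt, and_comm]
    split_ifs with h
    · exact mu_radial (by rw [norm_smul, norm_smul, norm_norm, norm_norm, mul_comm])
    · rfl
  simp_rw [h1]
  rw [integral_fun_norm_addHaar, finrank_euclideanSpace_fin, ← integral_comp_rpow_Ioi _ (p := -1) (by norm_num),
    mdt_integral measurableSet_Ioc (fun t ht => ha.trans ht.1), ← integral_indicator measurableSet_Ioc, ← integral_indicator measurableSet_Ioi]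
  change _ = (n * (om n).toReal)⁻¹ * (n • (om n).toReal • _)
  rw [nsmul_eq_mul, smul_eq_mul, ← mul_assoc (n : ℝ), inv_mul_cancel_left₀ (by positivity)]
  congr 1; ext t
  by_cases ht : 0 < t
  · rw [indicator_of_mem (show t ∈ Ioi (0:ℝ) from ht)]
    simp only [smul_eq_mul, Real.rpow_neg_one, hG, indicator]
    have hiff : t⁻¹ ∈ Ico b⁻¹ a⁻¹ ↔ t ∈ Ioc a b := by
      simp only [mem_Ico, mem_Ioc]
      rw [inv_le_inv₀ hb ht, inv_lt_inv₀ ht ha, and_comm]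
    simp only [hiff]
    split_ifs with h
    · unfold kd
      have : t ^ (-1 - 1 : ℝ) = (t ^ 2)⁻¹ := by
        rw [show (-1 - 1 : ℝ) = -(2 : ℕ) by norm_num, Real.rpow_neg ht.le, Real.rpow_natCast]
      rw [this]
      obtain ⟨m, rfl⟩ : ∃ m, n = m + 1 := ⟨n - 1, by omega⟩
      simp only [add_tsub_cancel_right, abs_neg, abs_one, one_mul]
      rw [inv_pow]
      field_simp
      ring
    · simp
  · rw [indicator_of_notMem (show t ∉ Ioi (0:ℝ) from ht), indicator_of_notMem (fun h => ht (ha.trans h.1))]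

lemma mdt_fin {a b : ℝ} (ha : 0 < a) : IsFiniteMeasure (mdt.restrict (Ioc a b)) := by
  constructor
  rw [Measure.restrict_apply_univ]
  refine lt_of_le_of_lt (mdt_le measurableSet_Ioc ha (fun t ht => ht.1.le)) ?_
  simp [ENNReal.mul_lt_top]

lemma kd_lip' {n : ℕ} {K : Eucl n → ℝ} {C : ℝ} (hK : ∀ x y, |K x - K y| ≤ C * ‖x - y‖) {t : ℝ} (ht : 0 < t)
    (x y : Eucl n) : |kd K t x - kd K t y| ≤ C * ‖x - y‖ * (t ^ (n + 1))⁻¹ := by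
  unfold kd
  rw [← mul_sub, abs_mul, abs_of_pos (by positivity)]
  have h := hK (t⁻¹ • x) (t⁻¹ • y)
  rw [← smul_sub, norm_smul, Real.norm_of_nonneg (by positivity)] at h
  calc _ ≤ (t ^ n)⁻¹ * (C * (t⁻¹ * ‖x - y‖)) := by gcongr
    _ = _ := by rw [pow_succ]; field_simp

lemma kd_supp' {n : ℕ} {K : Eucl n → ℝ} {M : ℝ} (hs : ∀ x, M ≤ ‖x‖ → K x = 0) {t : ℝ} (ht : 0 < t)
    {x : Eucl n} (hx : M * t ≤ ‖x‖) : kd K t x = 0 := by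
  unfold kd
  rw [hs, mul_zero]
  rwa [norm_smul, Real.norm_of_nonneg (by positivity), ← div_eq_inv_mul, le_div_iff₀ ht]

lemma mdt_pow_real {m : ℕ} (hm : 0 < m) {a b : ℝ} (ha : 0 < a) :
    IntegrableOn (fun t => (t ^ m)⁻¹) (Ioc a b) mdt ∧ ∫ t in Ioc a b, (t ^ m)⁻¹ ∂mdt ≤ (a ^ m)⁻¹ := by
  have h1 : ∫⁻ t in Ioc a b, ENNReal.ofReal ((t ^ m)⁻¹) ∂mdt ≤ ENNReal.ofReal ((a ^ m)⁻¹) :=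
    (lintegral_mono_set fun t ht => ht.1).trans (mdt_pow hm ha)
  have hnn : 0 ≤ᵐ[mdt.restrict (Ioc a b)] fun t => (t ^ m)⁻¹ := by
    filter_upwards [ae_restrict_mem measurableSet_Ioc] with t ht
    have : 0 < t := ha.trans ht.1
    simp only [Pi.zero_apply]
    positivity
  have hme : Measurable fun t : ℝ => (t ^ m)⁻¹ := by fun_prop
  constructor
  · refine ⟨hme.aestronglyMeasurable, ?_⟩
    rw [hasFiniteIntegral_iff_ofReal hnn]
    exact h1.trans_lt ENNReal.ofReal_lt_top
  · rw [integral_eq_lintegral_of_nonneg_ae hnn hme.aestronglyMeasurable]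
    exact ENNReal.toReal_le_of_le_ofReal (by positivity) h1

lemma kap_lip {n : ℕ} (hn : 0 < n) {x y : Eucl n} (hx : x ≠ 0) (hy : y ≠ 0) {a : ℝ} (ha : 0 < a) :
    |kd kap a x - kd kap a y| ≤ 4 * ‖x - y‖ * (a ^ (n + 1))⁻¹ := by
  have key : ∀ b, a ≤ b → |(kd kap a x - kd kap b x) - (kd kap a y - kd kap b y)| ≤ 4 * ‖x - y‖ * (a ^ (n + 1))⁻¹ := by
    intro b hab
    have := mdt_fin (b := b) ha
    rw [← kap_diff hn hx ha hab, ← kap_diff hn hy ha hab]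
    have hintg : ∀ x : Eucl n, IntegrableOn (fun t => kd mu t x) (Ioc a b) mdt := by
      intro x
      refine Integrable.of_bound ?_ ((a ^ n)⁻¹) ?_
      · exact ((kd_meas mu_cont.measurable).comp (by fun_prop : Measurable fun t : ℝ => (t, x))).aestronglyMeasurable
      · filter_upwards [ae_restrict_mem measurableSet_Ioc] with t ht
        have ht0 : 0 < t := ha.trans ht.1
        refine (kd_bdd mu_abs ht0 x).trans ?_
        rw [one_mul]
        exact inv_anti₀ (by positivity) (pow_le_pow_left₀ ha.le ht.1.le _)
    rw [← integral_sub (hintg x) (hintg y), ← Real.norm_eq_abs]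
    obtain ⟨h1, h2⟩ := mdt_pow_real (m := n + 1) (by omega) (b := b) ha
    refine (norm_integral_le_of_norm_le (h1.const_mul (4 * ‖x - y‖)) ?_).trans ?_
    · filter_upwards [ae_restrict_mem measurableSet_Ioc] with t ht
      exact kd_lip' mu_lip (ha.trans ht.1) x y
    · rw [integral_const_mul]
      gcongr
  have hz : ∀ z : Eucl n, Tendsto (fun b => kd kap b z) atTop (𝓝 0) := by
    intro z
    have h0 : Tendsto (fun b : ℝ => 1 * (b ^ n)⁻¹) atTop (𝓝 0) := by
      simp only [one_mul]
      exact tendsto_inv_atTop_zero.comp (tendsto_pow_atTop hn.ne')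
    refine squeeze_zero_norm' ?_ h0
    filter_upwards [eventually_gt_atTop 0] with b hb using kd_bdd (kap_abs hn) hb z
  have hlim := ((tendsto_const_nhds (x := kd kap a x)).sub (hz x)).sub ((tendsto_const_nhds (x := kd kap a y)).sub (hz y))
  simp only [sub_zero] at hlim
  refine le_of_tendsto hlim.abs ?_
  filter_upwards [eventually_ge_atTop a] with b hb using key b hb

lemma ae_ne {n : ℕ} (hn : 0 < n) (x : Eucl n) : ∀ᵐ z : Eucl n, x - z ≠ 0 :=
  (Measure.measurePreserving_sub_left (volume : Measure (Eucl n)) x).quasiMeasurePreserving.ae (ae_ne0 hn)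

lemma cv_int' {n : ℕ} {K : Eucl n → ℝ} {C : ℝ} (hm : Measurable K) (hb : ∀ x, |K x| ≤ C) {t : ℝ} (ht : 0 < t)
    {g : Eucl n → ℝ} (hg : Integrable g volume) (x : Eucl n) : Integrable (fun z => kd K t (x - z) * g z) volume := by
  refine hg.bdd_mul (c := C * (t ^ n)⁻¹) ?_ (Eventually.of_forall fun z => kd_bdd hb ht _)
  exact ((kd_meas1 hm t).comp (measurable_const.sub measurable_id)).aestronglyMeasurable

lemma cv_diff {n : ℕ} (hn : 0 < n) {g : Eucl n → ℝ} (hgm : Measurable g) (hg : Integrable g volume) {a b : ℝ} (ha : 0 < a) (hab : a ≤ b) (x : Eucl n) :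
    ∫ t in Ioc a b, cv mu t g x ∂mdt = cv kap a g x - cv kap b g x := by
  have := mdt_fin (b := b) ha
  unfold cv
  have hm : Measurable fun q : ℝ × Eucl n => kd mu q.1 (x - q.2) * g q.2 :=
    ((kd_meas mu_cont.measurable).comp (by fun_prop : Measurable fun q : ℝ × Eucl n => (q.1, x - q.2))).mul (hgm.comp measurable_snd)
  rw [integral_integral_swap]
  · rw [← integral_sub (cv_int' kap_meas (kap_abs hn) ha hg x) (cv_int' kap_meas (kap_abs hn) (ha.trans_le hab) hg x)]
    refine integral_congr_ae ?_
    filter_upwards [ae_ne hn x] with z hz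
    rw [integral_mul_const, kap_diff hn hz ha hab, sub_mul]
  · have h1 : Integrable (fun q : ℝ × Eucl n => (1:ℝ) * g q.2) ((mdt.restrict (Ioc a b)).prod volume) :=
      (integrable_const (1:ℝ)).mul_prod hg
    refine (h1.norm.const_mul ((a ^ n)⁻¹)).mono' hm.aestronglyMeasurable ?_
    have h2 : ∀ᵐ q : ℝ × Eucl n ∂((mdt.restrict (Ioc a b)).prod volume), q.1 ∈ Ioc a b :=
      Measure.quasiMeasurePreserving_fst.ae (ae_restrict_mem measurableSet_Ioc)
    filter_upwards [h2] with q hq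
    have ht0 : 0 < q.1 := ha.trans hq.1
    have h3 : |kd mu q.1 (x - q.2)| ≤ (a ^ n)⁻¹ := by
      refine (kd_bdd mu_abs ht0 _).trans ?_
      rw [one_mul]
      exact inv_anti₀ (by positivity) (pow_le_pow_left₀ ha.le hq.1.le _)
    simp only [Function.uncurry, one_mul]
    rw [norm_mul]
    exact mul_le_mul_of_nonneg_right h3 (norm_nonneg _)

lemma cv_supp {n : ℕ} {K : Eucl n → ℝ} {M ρ : ℝ} (hs : ∀ x, M ≤ ‖x‖ → K x = 0) {t : ℝ} (ht : 0 < t) {g : Eucl n → ℝ}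
    (hg : ∀ x, ρ ≤ ‖x‖ → g x = 0) {x : Eucl n} (hx : ρ + M * t ≤ ‖x‖) : cv K t g x = 0 := by
  unfold cv
  rw [← integral_zero (Eucl n) ℝ]
  congr 1; ext z
  by_cases hz : ρ ≤ ‖z‖
  · rw [hg z hz, mul_zero]
  · rw [kd_supp' hs ht, zero_mul]
    have := norm_sub_norm_le x z
    push Not at hz
    linarith

lemma cv_near {n : ℕ} (hn : 0 < n) {g : Eucl n → ℝ} (hg : Integrable g volume) {L : ℝ} (hL0 : 0 ≤ L) (hL : ∀ x y, |g x - g y| ≤ L * ‖x - y‖)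
    {a : ℝ} (ha : 0 < a) (x : Eucl n) : |cv kap a g x - (∫ y : Eucl n, kap y) * g x| ≤ L * (2 * a) * ∫ y : Eucl n, kap y := by
  have hki : Integrable (kd kap a : Eucl n → ℝ) volume := by
    refine bdd_supp_int (kd_meas1 kap_meas a) (fun x => kd_bdd (kap_abs hn) ha x) (M := 2 * a) fun x hx => kd_supp' (fun y => kap_supp) ha hx
  have hki' : Integrable (fun z => kd kap a (x - z)) volume := hki.comp_sub_left x
  have hc : ∫ z, kd kap a (x - z) = ∫ y : Eucl n, kap y := by
    rw [integral_sub_left_eq_self (fun z => kd kap a z), kd_integral ha]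
  have hc2 : ∫ z, kd kap a (x - z) * (g z - g x) = cv kap a g x - (∫ y : Eucl n, kap y) * g x := by
    simp_rw [mul_sub]
    rw [integral_sub (cv_int' kap_meas (kap_abs hn) ha hg x) (hki'.mul_const _), integral_mul_const, hc]
    rfl
  rw [← hc2, ← Real.norm_eq_abs, ← hc, ← integral_const_mul]
  refine norm_integral_le_of_norm_le (hki'.const_mul _) (Eventually.of_forall fun z => ?_)
  have hnn : 0 ≤ kd kap a (x - z) := by unfold kd; have := kap_nonneg (a⁻¹ • (x - z)); positivity
  rw [norm_mul, Real.norm_of_nonneg hnn, mul_comm]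
  by_cases hz : 2 * a ≤ ‖x - z‖
  · rw [kd_supp' (fun y => kap_supp) ha hz]; simp
  · push Not at hz
    have h1 := hL z x
    refine mul_le_mul_of_nonneg_right ?_ hnn
    rw [Real.norm_eq_abs]
    refine h1.trans ?_
    rw [norm_sub_rev]
    exact mul_le_mul_of_nonneg_left hz.le hL0

lemma cv_far {n : ℕ} (hn : 0 < n) {g : Eucl n → ℝ} (hg : Integrable g volume) (hgz : Integrable (fun z => ‖z‖ * |g z|) volume)
    (h0 : ∫ z, g z = 0) {R : ℝ} (hR : 0 < R) {x : Eucl n} (hx : x ≠ 0) :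
    |cv kap R g x| ≤ 4 * (R ^ (n + 1))⁻¹ * ∫ z, ‖z‖ * |g z| := by
  have h1 : cv kap R g x = ∫ z, (kd kap R (x - z) - kd kap R x) * g z := by
    simp_rw [sub_mul]
    rw [integral_sub (cv_int' kap_meas (kap_abs hn) hR hg x) (hg.const_mul _), integral_const_mul, h0, mul_zero, sub_zero]
    rfl
  rw [h1, ← Real.norm_eq_abs, ← integral_const_mul]
  refine norm_integral_le_of_norm_le (hgz.const_mul _) ?_
  filter_upwards [ae_ne hn x] with z hz
  rw [norm_mul, Real.norm_eq_abs, Real.norm_eq_abs]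
  have := kap_lip hn hz hx hR
  rw [sub_sub_cancel_left, norm_neg] at this
  calc _ ≤ 4 * ‖z‖ * (R ^ (n + 1))⁻¹ * |g z| := by gcongr
    _ = _ := by ring

lemma pair_int {n : ℕ} {f G : Eucl n → ℝ} (hf : ∀ x r, IntegrableOn f (ball x r) volume) (hG : Measurable G) {B r : ℝ}
    (hB : ∀ᵐ x, |G x| ≤ B) (hs : ∀ x, r ≤ ‖x‖ → G x = 0) : Integrable (fun x => f x * G x) volume := by
  have h1 : IntegrableOn (fun x => f x * G x) (ball 0 r) volume := by
    refine Integrable.mul_bdd (c := B) (hf 0 r) hG.aestronglyMeasurable (ae_restrict_of_ae hB)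
  rwa [integrableOn_iff_integrable_of_support_subset] at h1
  intro x hx
  by_contra hcon
  exact hx (by simp only; rw [hs x (by simpa using hcon), mul_zero])

lemma pair_bound {n : ℕ} {f G : Eucl n → ℝ} (hf : ∀ x r, IntegrableOn f (ball x r) volume) {B r : ℝ}
    (hB : ∀ᵐ x, |G x| ≤ B) (hs : ∀ x, r ≤ ‖x‖ → G x = 0) : |∫ x, f x * G x| ≤ B * ∫ x in ball 0 r, |f x| := by
  have h1 : ∫ x, f x * G x = ∫ x in ball 0 r, f x * G x := by
    rw [setIntegral_eq_integral_of_forall_compl_eq_zero]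
    intro x hx
    rw [hs x (by simpa using hx), mul_zero]
  rw [h1, ← Real.norm_eq_abs, ← integral_const_mul]
  refine norm_integral_le_of_norm_le ((hf 0 r).abs.const_mul _) ?_
  filter_upwards [ae_restrict_of_ae hB] with x hx
  rw [norm_mul, mul_comm, Real.norm_eq_abs, Real.norm_eq_abs]
  gcongr

lemma kap_limit {n : ℕ} (hn : 0 < n) {f g : Eucl n → ℝ} (hf : ∀ x r, IntegrableOn f (ball x r) volume)
    {c : ℝ} (hc : ∀ R, 1 ≤ R → ∫ x in ball 0 R, |f x| ≤ c * R ^ n)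
    (hgm : Continuous g) {ρ : ℝ} (hρ : 0 < ρ) (hgs : ∀ x, ρ ≤ ‖x‖ → g x = 0) {L : ℝ} (hL0 : 0 ≤ L) (hL : ∀ x y, |g x - g y| ≤ L * ‖x - y‖)
    (h0 : ∫ z, g z = 0) :
    Tendsto (fun N : ℕ => ∫ x, f x * (cv kap ((N:ℝ) + 1)⁻¹ g x - cv kap ((N:ℝ) + 1) g x)) atTop (𝓝 ((∫ y : Eucl n, kap y) * ∫ x, f x * g x)) := by
  have hcs : HasCompactSupport g := by
    refine HasCompactSupport.intro (isCompact_closedBall (0 : Eucl n) ρ) fun x hx => hgs x ?_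
    rw [mem_closedBall, dist_zero_right, not_le] at hx
    exact hx.le
  have hg : Integrable g volume := hgm.integrable_of_hasCompactSupport hcs
  have hgz : Integrable (fun z => ‖z‖ * |g z|) volume :=
    (continuous_norm.mul hgm.abs).integrable_of_hasCompactSupport (hcs.norm.mul_left)
  obtain ⟨M, hM0, hM⟩ := bdd_of_cs hgm hcs
  set k := ∫ y : Eucl n, kap y with hk
  have hk0 : 0 < k := kap_pos hn
  set m1 := ∫ z, ‖z‖ * |g z| with hm1
  have hm10 : 0 ≤ m1 := integral_nonneg fun z => by positivity
  have hcvm : ∀ t, Measurable (cv kap t g) := fun t => cv_meas_x kap_meas hgm.measurable t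
  have hc0 : 0 ≤ c := by
    have := hc 1 le_rfl
    rw [one_pow, mul_one] at this
    exact (integral_nonneg fun x => abs_nonneg _).trans this
  -- integrability
  have hI0 : Integrable (fun x => f x * (k * g x)) volume :=
    pair_int hf (measurable_const.mul hgm.measurable) (B := k * M) (Eventually.of_forall fun x => by
      rw [abs_mul, abs_of_pos hk0]; exact mul_le_mul_of_nonneg_left (hM x) hk0.le) (r := ρ) fun x hx => by rw [hgs x hx, mul_zero]
  have hI1 : ∀ a, 0 < a → a ≤ 1 → Integrable (fun x => f x * (cv kap a g x - k * g x)) volume ∧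
      |∫ x, f x * (cv kap a g x - k * g x)| ≤ (L * (2 * a) * k) * ∫ x in ball 0 (ρ + 2), |f x| := by
    intro a ha ha1
    have hs : ∀ x, ρ + 2 ≤ ‖x‖ → cv kap a g x - k * g x = 0 := by
      intro x hx
      rw [cv_supp (fun y => kap_supp) ha hgs (by linarith), hgs x (by linarith)]; ring
    have hb : ∀ᵐ x, |cv kap a g x - k * g x| ≤ L * (2 * a) * k := Eventually.of_forall fun x => cv_near hn hg hL0 hL ha x
    exact ⟨pair_int hf ((hcvm a).sub (measurable_const.mul hgm.measurable)) hb hs, pair_bound hf hb hs⟩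
  have hI2 : ∀ R, 1 ≤ R → Integrable (fun x => f x * cv kap R g x) volume ∧
      |∫ x, f x * cv kap R g x| ≤ 4 * m1 * c * (ρ + 2) ^ n * R⁻¹ := by
    intro R hR
    have hR0 : 0 < R := by linarith
    have hs : ∀ x, ρ * R + 2 * R ≤ ‖x‖ → cv kap R g x = 0 := by
      intro x hx
      refine cv_supp (fun y => kap_supp) hR0 hgs ?_
      nlinarith
    have hb : ∀ᵐ x : Eucl n, |cv kap R g x| ≤ 4 * (R ^ (n + 1))⁻¹ * m1 := by
      filter_upwards [ae_ne0 hn] with x hx using cv_far hn hg hgz h0 hR0 hx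
    refine ⟨pair_int hf (hcvm R) hb hs, (pair_bound hf hb hs).trans ?_⟩
    have h3 := hc (ρ * R + 2 * R) (by nlinarith)
    calc _ ≤ 4 * (R ^ (n + 1))⁻¹ * m1 * (c * (ρ * R + 2 * R) ^ n) := by gcongr
      _ = _ := by
        rw [← add_mul, mul_pow, pow_succ]
        field_simp
  have hsplit : ∀ N : ℕ, ∫ x, f x * (cv kap ((N:ℝ) + 1)⁻¹ g x - cv kap ((N:ℝ) + 1) g x) =
      (∫ x, f x * (cv kap ((N:ℝ) + 1)⁻¹ g x - k * g x)) - (∫ x, f x * cv kap ((N:ℝ) + 1) g x) + k * ∫ x, f x * g x := by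
    intro N
    have e1 := (hI1 ((N:ℝ) + 1)⁻¹ (by positivity) (inv_le_one_of_one_le₀ (by linarith [Nat.cast_nonneg (α := ℝ) N]))).1
    have e2 := (hI2 ((N:ℝ) + 1) (by linarith [Nat.cast_nonneg (α := ℝ) N])).1
    rw [← integral_const_mul, ← integral_sub e1 e2]
    have e3 : (fun x => k * (f x * g x)) = fun x => f x * (k * g x) := by ext x; ring
    have e4 := integral_add (e1.sub e2) hI0
    simp only [Pi.sub_apply] at e4
    rw [e3, ← e4]
    congr 1; ext x; ring
  simp_rw [hsplit]
  have hinv : Tendsto (fun N : ℕ => ((N:ℝ) + 1)⁻¹) atTop (𝓝 0) := by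
    simpa using tendsto_one_div_add_atTop_nhds_zero_nat (𝕜 := ℝ)
  have t1 : Tendsto (fun N : ℕ => ∫ x, f x * (cv kap ((N:ℝ) + 1)⁻¹ g x - k * g x)) atTop (𝓝 0) := by
    refine squeeze_zero_norm (fun N => (hI1 ((N:ℝ) + 1)⁻¹ (by positivity) (inv_le_one_of_one_le₀ (by linarith [Nat.cast_nonneg (α := ℝ) N]))).2) ?_
    have := ((hinv.const_mul 2).const_mul L).mul_const k |>.mul_const (∫ x in ball 0 (ρ + 2), |f x|)
    simpa using this
  have t2 : Tendsto (fun N : ℕ => ∫ x, f x * cv kap ((N:ℝ) + 1) g x) atTop (𝓝 0) := by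
    refine squeeze_zero_norm (fun N => (hI2 ((N:ℝ) + 1) (by linarith [Nat.cast_nonneg (α := ℝ) N])).2) ?_
    simpa using hinv.const_mul (4 * m1 * c * (ρ + 2) ^ n)
  simpa using (t1.sub t2).add_const (k * ∫ x, f x * g x)

lemma cv_bd {n : ℕ} {K : Eucl n → ℝ} {C : ℝ} (hb : ∀ x, |K x| ≤ C) {t : ℝ} (ht : 0 < t)
    {g : Eucl n → ℝ} (hg : Integrable g volume) (x : Eucl n) : |cv K t g x| ≤ C * (t ^ n)⁻¹ * ∫ z, |g z| := by
  unfold cv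
  rw [← Real.norm_eq_abs, ← integral_const_mul]
  refine norm_integral_le_of_norm_le (hg.abs.const_mul _) (Eventually.of_forall fun z => ?_)
  rw [norm_mul]
  exact mul_le_mul_of_nonneg_right (kd_bdd hb ht _) (norm_nonneg _)

/-- ball average, measurable version -/
def bav {n : ℕ} (f : Eucl n → ℝ) (t : ℝ) (x : Eucl n) : ℝ := (om n).toReal⁻¹ * ∫ y in ball (0 : Eucl n) 1, f (x + t • y)

lemma bav_meas {n : ℕ} {f : Eucl n → ℝ} (hfm : Measurable f) : Measurable fun q : ℝ × Eucl n => bav f q.1 q.2 := by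
  have : Measurable fun q : (ℝ × Eucl n) × Eucl n => f (q.1.2 + q.1.1 • q.2) := by fun_prop
  exact (this.stronglyMeasurable.integral_prod_right'.measurable).const_mul _

lemma clip_eq {n : ℕ} (u : Eucl n → ℝ) (x : Eucl n) (t : ℝ) :
    ∫ y in ball (0 : Eucl n) 1, u (x + (ball (0 : Eucl n) 1).indicator (fun y => t • y) y) = ∫ y in ball (0 : Eucl n) 1, u (x + t • y) :=
  setIntegral_congr_fun measurableSet_ball fun y hy => by
    beta_reduce
    rw [indicator_of_mem hy]

lemma clip_eq' {n : ℕ} (u : Eucl n → ℝ) (x : Eucl n) (t : ℝ) :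
    ∫ y in ball (0 : Eucl n) 1, u (x - (ball (0 : Eucl n) 1).indicator (fun y => t • y) y) = ∫ y in ball (0 : Eucl n) 1, u (x + t • y) := by
  rw [← integral_indicator measurableSet_ball, ← integral_indicator measurableSet_ball,
    ← integral_neg_eq_self _ (volume : Measure (Eucl n))]
  congr 1; ext y
  by_cases hy : y ∈ ball (0 : Eucl n) 1
  · have hy' : -y ∈ ball (0 : Eucl n) 1 := by simpa using hy
    rw [indicator_of_mem hy, indicator_of_mem hy', indicator_of_mem hy']
    simp
  · have hy' : -y ∉ ball (0 : Eucl n) 1 := by simpa using hy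
    rw [indicator_of_notMem hy, indicator_of_notMem hy']

lemma bav_sym {n : ℕ} {f u : Eucl n → ℝ} (hfm : Measurable f) (hf : ∀ x r, IntegrableOn f (ball x r) volume)
    (hu : Measurable u) {M r : ℝ} (hM : ∀ x, |u x| ≤ M) (hr : ∀ x, r ≤ ‖x‖ → u x = 0) {t : ℝ} (ht : 0 < t) :
    Integrable (fun x => bav f t x * u x) volume ∧ Integrable (fun x => f x * bav u t x) volume ∧
    ∫ x, bav f t x * u x = ∫ x, f x * bav u t x := by
  set ν := (volume : Measure (Eucl n)).restrict (ball 0 1) with hν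
  have hfin : IsFiniteMeasure ν := ⟨by rw [hν, Measure.restrict_apply_univ]; exact measure_ball_lt_top⟩
  set c : Eucl n → Eucl n := (ball (0 : Eucl n) 1).indicator (fun y => t • y) with hc
  have hcm : Measurable c := (measurable_id.const_smul t).indicator measurableSet_ball
  have hcb : ∀ y, ‖c y‖ ≤ t := by
    intro y
    rw [hc]
    by_cases hy : y ∈ ball (0 : Eucl n) 1
    · rw [indicator_of_mem hy, norm_smul, Real.norm_of_nonneg ht.le]
      rw [mem_ball_zero_iff] at hy
      nlinarith
    · rw [indicator_of_notMem hy, norm_zero]; exact ht.le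
  have hI1 : Integrable (fun q : Eucl n × Eucl n => f (q.1 + c q.2) * u q.1) (volume.prod ν) :=
    shift_int ν hfm hf hcm hcb (k := fun x _ => u x) (hu.comp measurable_fst) (fun x _ => hM x) (r := r)
      fun x _ hx => hr x (by simpa using hx)
  have hI2 : Integrable (fun q : Eucl n × Eucl n => f (q.1 + 0) * u (q.1 - c q.2)) (volume.prod ν) :=
    shift_int ν hfm hf (c := fun _ => 0) measurable_const (M := 0) (fun _ => by simp) (k := fun x a => u (x - c a))
      (hu.comp (measurable_fst.sub (hcm.comp measurable_snd))) (fun x _ => hM _) (r := r + t)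
      fun x a hx => hr _ (by
        rw [mem_ball_zero_iff, not_lt] at hx
        have := norm_sub_norm_le x (c a)
        linarith [hcb a])
  simp only [add_zero] at hI2
  have e1 : ∀ x, bav f t x * u x = (om n).toReal⁻¹ * ∫ y, f (x + c y) * u x ∂ν := by
    intro x
    rw [integral_mul_const, hν, hc, clip_eq, bav]; ring
  have e2 : ∀ x, f x * bav u t x = (om n).toReal⁻¹ * ∫ y, f x * u (x - c y) ∂ν := by
    intro x
    rw [integral_const_mul, hν, hc, clip_eq', bav]; ring
  simp_rw [e1, e2]
  refine ⟨hI1.integral_prod_left.const_mul _, hI2.integral_prod_left.const_mul _, ?_⟩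
  rw [integral_const_mul, integral_const_mul, integral_integral_swap (f := fun x y => f (x + c y) * u x) hI1, integral_integral_swap (f := fun x y => f x * u (x - c y)) hI2]
  congr 2; ext y
  rw [← integral_sub_right_eq_self (fun x => f (x + c y) * u x) (c y)]
  simp

lemma bav_cv {n : ℕ} {g : Eucl n → ℝ} (hgm : Measurable g) (hg : Integrable g volume) {t : ℝ} (ht : 0 < t) (x : Eucl n) :
    bav (cv th t g) t x = cv bth t g x := by
  set ν := (volume : Measure (Eucl n)).restrict (ball 0 1) with hν
  have hfin : IsFiniteMeasure ν := ⟨by rw [hν, Measure.restrict_apply_univ]; exact measure_ball_lt_top⟩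
  have hth : ∀ x : Eucl n, |th x| ≤ 1 := fun x => by rw [abs_of_nonneg (th_nonneg x)]; exact th_le_one x
  have hm : Measurable fun q : Eucl n × Eucl n => kd th t (x + t • q.1 - q.2) * g q.2 :=
    ((kd_meas1 th_meas t).comp (by fun_prop : Measurable fun q : Eucl n × Eucl n => x + t • q.1 - q.2)).mul (hgm.comp measurable_snd)
  have hI : Integrable (fun q : Eucl n × Eucl n => kd th t (x + t • q.1 - q.2) * g q.2) (ν.prod volume) := by
    have h1 : Integrable (fun q : Eucl n × Eucl n => (1:ℝ) * g q.2) (ν.prod volume) :=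
      (integrable_const (1:ℝ)).mul_prod hg
    refine (h1.norm.const_mul (1 * (t ^ n)⁻¹)).mono' hm.aestronglyMeasurable (Eventually.of_forall fun q => ?_)
    rw [norm_mul, one_mul (g q.2)]
    exact mul_le_mul_of_nonneg_right (kd_bdd hth ht _) (norm_nonneg _)
  unfold bav cv
  rw [integral_integral_swap hI, ← integral_const_mul]
  congr 1; ext z
  rw [integral_mul_const, ← mul_assoc]
  congr 1
  unfold kd bth
  rw [integral_const_mul]
  have : ∀ y : Eucl n, t⁻¹ • (x + t • y - z) = t⁻¹ • (x - z) + y := by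
    intro y
    rw [add_sub_right_comm, smul_add, inv_smul_smul₀ ht.ne']
  simp_rw [this]
  ring

lemma pairing {n : ℕ} {f g : Eucl n → ℝ} (hfm : Measurable f) (hf : ∀ x r, IntegrableOn f (ball x r) volume)
    (hgm : Measurable g) (hg : Integrable g volume) {ρ : ℝ} (hgs : ∀ x, ρ ≤ ‖x‖ → g x = 0) {t : ℝ} (ht : 0 < t) :
    ∫ x, (f x - bav f t x) * cv th t g x = ∫ x, f x * cv mu t g x := by
  have hth : ∀ x : Eucl n, |th x| ≤ 1 := fun x => by rw [abs_of_nonneg (th_nonneg x)]; exact th_le_one x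
  have hbth : ∀ x : Eucl n, |bth x| ≤ 1 := fun x => by rw [abs_of_nonneg (bth_nonneg x)]; exact bth_le_one x
  have hbd := cv_bd hth ht hg
  have hsu : ∀ x, ρ + 1 * t ≤ ‖x‖ → cv th t g x = 0 := fun x hx => cv_supp (fun y hy => th_supp hy) ht hgs hx
  have hum : Measurable (cv th t g) := cv_meas_x th_meas hgm t
  obtain ⟨i1, i2, e⟩ := bav_sym hfm hf hum hbd hsu ht
  have i0 : Integrable (fun x => f x * cv th t g x) volume := pair_int hf hum (Eventually.of_forall hbd) hsu
  have e1 : ∀ x, cv mu t g x = cv th t g x - bav (cv th t g) t x := by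
    intro x
    rw [bav_cv hgm hg ht]
    unfold cv
    rw [← integral_sub (cv_int' th_meas hth ht hg x) (cv_int' bth_cont.measurable hbth ht hg x)]
    congr 1; ext z
    unfold kd mu
    ring
  simp_rw [e1, sub_mul, mul_sub]
  rw [integral_sub i0 i1, integral_sub i0 i2, e]

lemma th_line {n : ℕ} (i : Fin n) {t : ℝ} (ht : 0 < t) (x z : Eucl n) (hne : ‖x - z‖ ≠ t) :
    lineDeriv ℝ (fun z => kd th t (x - z)) z (EuclideanSpace.single i (1:ℝ)) = 2 * t⁻¹ * kd (etc n i) t (x - z) := by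
  set v : Eucl n := EuclideanSpace.single i (1:ℝ) with hv
  have hcont : Continuous fun s : ℝ => ‖x - (z + s • v)‖ := by fun_prop
  have hinner : ⟪x - z, v⟫ = (x - z) i := by
    rw [hv, EuclideanSpace.inner_single_right]; simp
  have hnt : ∀ y : Eucl n, ‖t⁻¹ • y‖ = ‖y‖ / t := fun y => by
    rw [norm_smul, Real.norm_of_nonneg (by positivity), div_eq_inv_mul]
  refine HasLineDerivAt.lineDeriv ?_
  unfold HasLineDerivAt
  rcases lt_or_gt_of_ne hne with h | h
  · have hev : ∀ᶠ s : ℝ in 𝓝 0, ‖x - (z + s • v)‖ < t := by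
      refine hcont.continuousAt.eventually_lt continuousAt_const ?_
      simpa using h
    have heq : (fun s : ℝ => kd th t (x - (z + s • v))) =ᶠ[𝓝 0] fun s =>
        (t ^ n)⁻¹ * (1 - (‖x - z‖ ^ 2 - 2 * s * ⟪x - z, v⟫ + s ^ 2 * ‖v‖ ^ 2) / t ^ 2) := by
      filter_upwards [hev] with s hs
      unfold kd th
      rw [hnt, min_eq_left ((div_le_one ht).2 hs.le), div_pow]
      congr 3
      rw [← sub_sub, norm_sub_sq_real, inner_smul_right, norm_smul, mul_pow, Real.norm_eq_abs, sq_abs]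
      ring
    refine HasDerivAt.congr_of_eventuallyEq ?_ heq
    have hd : HasDerivAt (fun s : ℝ => (t ^ n)⁻¹ * (1 - (‖x - z‖ ^ 2 - 2 * s * ⟪x - z, v⟫ + s ^ 2 * ‖v‖ ^ 2) / t ^ 2))
        ((t ^ n)⁻¹ * (0 - (0 - 2 * 1 * ⟪x - z, v⟫ + (2 * (0:ℝ) ^ 1 * 1) * ‖v‖ ^ 2) / t ^ 2)) 0 := by
      refine HasDerivAt.const_mul _ ?_
      refine (hasDerivAt_const _ _).sub (HasDerivAt.div_const ?_ _)
      refine ((hasDerivAt_const _ _).sub (((hasDerivAt_id (0:ℝ)).const_mul 2).mul_const _)).add (HasDerivAt.mul_const ?_ _)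
      simpa using hasDerivAt_pow 2 (0:ℝ)
    refine hd.congr_deriv ?_
    unfold kd etc
    rw [if_pos (by rw [hnt]; exact (div_lt_one ht).2 h), hinner]
    simp only [PiLp.smul_apply, smul_eq_mul]
    field_simp
    ring
  · have hev : ∀ᶠ s : ℝ in 𝓝 0, t < ‖x - (z + s • v)‖ := by
      refine continuousAt_const.eventually_lt hcont.continuousAt ?_
      simpa using h
    have heq : (fun s : ℝ => kd th t (x - (z + s • v))) =ᶠ[𝓝 0] fun s => 0 := by
      filter_upwards [hev] with s hs
      exact kd_supp' (M := 1) (fun y hy => th_supp hy) ht (by linarith)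
    refine HasDerivAt.congr_of_eventuallyEq ?_ heq
    rw [kd_supp' (M := 1) (etc_CZK n i).supp ht (by linarith), mul_zero]
    exact hasDerivAt_const _ _

lemma ibp {n : ℕ} (hn : 0 < n) (i : Fin n) {t : ℝ} (ht : 0 < t) {h : Eucl n → ℝ} (hc : ContDiff ℝ (⊤ : ℕ∞) h) (hs : HasCompactSupport h) (x : Eucl n) :
    t⁻¹ * cv (etc n i) t h x = -(1/2) * cv th t (fun z => fderiv ℝ h z (EuclideanSpace.single i (1:ℝ))) x := by
  set v : Eucl n := EuclideanSpace.single i (1:ℝ) with hv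
  obtain ⟨D, hD⟩ := (hc.of_le (by norm_cast) : ContDiff ℝ 1 h).lipschitzWith_of_hasCompactSupport hs (by norm_num)
  have hk : LipschitzWith (Real.toNNReal (2 * (t ^ (n + 1))⁻¹)) (fun z => kd th t (x - z)) := by
    refine LipschitzWith.of_dist_le_mul fun a b => ?_
    rw [Real.dist_eq, Real.coe_toNNReal _ (by positivity)]
    refine (kd_lip' th_lip ht _ _).trans (le_of_eq ?_)
    rw [sub_sub_sub_cancel_left, dist_comm, dist_eq_norm]
    ring
  have key := hk.integral_lineDeriv_mul_eq (μ := volume) hD hs v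
  have e1 : ∫ z, lineDeriv ℝ (fun z => kd th t (x - z)) z v * h z = 2 * t⁻¹ * cv (etc n i) t h x := by
    unfold cv
    rw [← integral_const_mul]
    refine integral_congr_ae ?_
    have : Nonempty (Fin n) := ⟨i⟩
    have hsph : ∀ᵐ z : Eucl n, z ∉ sphere x t := measure_eq_zero_iff_ae_notMem.1 (Measure.addHaar_sphere volume x t)
    filter_upwards [hsph] with z hz
    rw [th_line i ht x z (by rw [mem_sphere, dist_comm, dist_eq_norm] at hz; exact hz)]
    ring
  have e2 : ∫ z, lineDeriv ℝ h z (-v) * kd th t (x - z) = - cv th t (fun z => fderiv ℝ h z v) x := by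
    unfold cv
    rw [← integral_neg]
    congr 1; ext z
    rw [(hc.differentiable (by simp) z).lineDeriv_eq_fderiv, map_neg]
    ring
  rw [e1, e2] at key
  linarith

lemma etc_odd {n : ℕ} (i : Fin n) (t : ℝ) (x : Eucl n) : kd (etc n i) t (-x) = - kd (etc n i) t x := by
  unfold kd etc
  rw [smul_neg, norm_neg]
  split_ifs <;> simp

def Pm (n : ℕ) : Measure (ℝ × Eucl n) := mdt.prod volume

instance (n : ℕ) : SFinite (Pm n) := by unfold Pm; infer_instance

def Fk {n : ℕ} (i : Fin n) (I : Set ℝ) (D : ℝ × Eucl n → ℝ) (y : Eucl n) : ℝ :=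
  ∫ q in I ×ˢ univ, q.1⁻¹ * kd (etc n i) q.1 (y - q.2) * D q ∂(Pm n)

lemma Fker_meas {n : ℕ} (i : Fin n) {D : ℝ × Eucl n → ℝ} (hD : Measurable D) :
    Measurable fun P : Eucl n × (ℝ × Eucl n) => P.2.1⁻¹ * kd (etc n i) P.2.1 (P.1 - P.2.2) * D P.2 := by
  have h1 : Measurable fun P : Eucl n × (ℝ × Eucl n) => kd (etc n i) P.2.1 (P.1 - P.2.2) :=
    (kd_meas (etc_CZK n i).meas).comp (by fun_prop : Measurable fun P : Eucl n × (ℝ × Eucl n) => (P.2.1, P.1 - P.2.2))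
  fun_prop

lemma Fk_meas {n : ℕ} (i : Fin n) (I : Set ℝ) {D : ℝ × Eucl n → ℝ} (hD : Measurable D) : Measurable (Fk i I D) :=
  (Fker_meas i hD).stronglyMeasurable.integral_prod_right'.measurable

lemma Dind {n : ℕ} {D : ℝ × Eucl n → ℝ} {a b : ℝ} {I : Set ℝ} (hIm : MeasurableSet I) (hI : I ⊆ Ioc a b) {r : ℝ}
    (hDi : IntegrableOn D (Ioc a b ×ˢ ball 0 r) (Pm n)) :
    IntegrableOn ((univ ×ˢ ball (0 : Eucl n) r).indicator D) (I ×ˢ univ) (Pm n) := by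
  have hms : MeasurableSet ((univ : Set ℝ) ×ˢ ball (0 : Eucl n) r) := MeasurableSet.univ.prod measurableSet_ball
  unfold IntegrableOn
  rw [integrable_indicator_iff hms, IntegrableOn, Measure.restrict_restrict hms]
  refine hDi.mono_set ?_
  intro q hq
  exact ⟨hI hq.2.1, hq.1.2⟩

lemma Fker_bd {n : ℕ} (i : Fin n) {D : ℝ × Eucl n → ℝ} {a b R : ℝ} (ha : 0 < a) {y : Eucl n} (hy : ‖y‖ ≤ R) {q : ℝ × Eucl n} (hq : q.1 ∈ Ioc a b) :
    ‖q.1⁻¹ * kd (etc n i) q.1 (y - q.2) * D q‖ ≤ a⁻¹ * (a ^ n)⁻¹ * ‖(univ ×ˢ ball (0 : Eucl n) (R + b)).indicator D q‖ := by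
  have ht0 : 0 < q.1 := ha.trans hq.1
  by_cases hx : q.2 ∈ ball (0 : Eucl n) (R + b)
  · have hm : q ∈ (univ : Set ℝ) ×ˢ ball (0 : Eucl n) (R + b) := ⟨mem_univ _, hx⟩
    rw [indicator_of_mem hm, norm_mul, norm_mul]
    refine mul_le_mul_of_nonneg_right (mul_le_mul ?_ ?_ (norm_nonneg _) (by positivity)) (norm_nonneg _)
    · rw [Real.norm_of_nonneg (by positivity)]
      exact inv_anti₀ ha hq.1.le
    · refine (kd_bdd (etc_CZK n i).bdd ht0 _).trans ?_
      rw [one_mul]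
      exact inv_anti₀ (by positivity) (pow_le_pow_left₀ ha.le hq.1.le _)
  · rw [kd_supp' (M := 1) (etc_CZK n i).supp ht0, mul_zero, zero_mul, norm_zero]
    · positivity
    · rw [mem_ball_zero_iff, not_lt] at hx
      have := norm_sub_norm_le q.2 y
      rw [norm_sub_rev] at this
      linarith [hq.2]

lemma Fker_int {n : ℕ} (i : Fin n) {D : ℝ × Eucl n → ℝ} (hD : Measurable D) {a b : ℝ} (ha : 0 < a) {I : Set ℝ} (hIm : MeasurableSet I) (hI : I ⊆ Ioc a b)
    (hDi : ∀ r, IntegrableOn D (Ioc a b ×ˢ ball 0 r) (Pm n)) (y : Eucl n) :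
    IntegrableOn (fun q => q.1⁻¹ * kd (etc n i) q.1 (y - q.2) * D q) (I ×ˢ univ) (Pm n) := by
  refine (((Dind hIm hI (hDi (‖y‖ + b))).norm).const_mul (a⁻¹ * (a ^ n)⁻¹)).mono' ?_ ?_
  · exact ((Fker_meas i hD).comp (by fun_prop : Measurable fun q : ℝ × Eucl n => (y, q))).aestronglyMeasurable
  · filter_upwards [ae_restrict_mem (hIm.prod MeasurableSet.univ)] with q hq
    exact Fker_bd i ha le_rfl (hI hq.1)

lemma Fk_sub {n : ℕ} (i : Fin n) {D : ℝ × Eucl n → ℝ} (hD : Measurable D) {a b : ℝ} (ha : 0 < a) {J : Set ℝ} (hJm : MeasurableSet J) (hJ : J ⊆ Ioc a b)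
    (hDi : ∀ r, IntegrableOn D (Ioc a b ×ˢ ball 0 r) (Pm n)) (y : Eucl n) :
    Fk i (Ioc a b \ J) D y = Fk i (Ioc a b) D y - Fk i J D y := by
  unfold Fk
  have : (Ioc a b \ J) ×ˢ (univ : Set (Eucl n)) = (Ioc a b ×ˢ univ) \ (J ×ˢ univ) := by
    ext q; simp
  rw [this, setIntegral_sdiff (hJm.prod MeasurableSet.univ) (Fker_int i hD ha measurableSet_Ioc Subset.rfl hDi y)
    (prod_mono hJ Subset.rfl)]

lemma Fk_dual {n : ℕ} (i : Fin n) {D : ℝ × Eucl n → ℝ} (hD : Measurable D) {a b : ℝ} (ha : 0 < a) {I : Set ℝ} (hIm : MeasurableSet I) (hI : I ⊆ Ioc a b)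
    (hDi : ∀ r, IntegrableOn D (Ioc a b ×ˢ ball 0 r) (Pm n)) {h : Eucl n → ℝ} (hhm : Measurable h) (hh : Integrable h volume) {R : ℝ}
    (hR : ∀ x, R ≤ ‖x‖ → h x = 0) :
    Integrable (fun y => Fk i I D y * h y) volume ∧
    Integrable (fun q : ℝ × Eucl n => q.1⁻¹ * cv (etc n i) q.1 h q.2 * D q) ((Pm n).restrict (I ×ˢ univ)) ∧
    ∫ y, Fk i I D y * h y = - ∫ q in I ×ˢ univ, q.1⁻¹ * cv (etc n i) q.1 h q.2 * D q ∂(Pm n) := by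
  have hm : Measurable fun P : Eucl n × (ℝ × Eucl n) => P.2.1⁻¹ * kd (etc n i) P.2.1 (P.1 - P.2.2) * D P.2 * h P.1 :=
    (Fker_meas i hD).mul (hhm.comp measurable_fst)
  have hintg : Integrable (fun P : Eucl n × (ℝ × Eucl n) => P.2.1⁻¹ * kd (etc n i) P.2.1 (P.1 - P.2.2) * D P.2 * h P.1)
      (volume.prod ((Pm n).restrict (I ×ˢ univ))) := by
    have h1 := hh.mul_prod (Dind hIm hI (hDi (R + b)))
    refine (h1.norm.const_mul (a⁻¹ * (a ^ n)⁻¹)).mono' hm.aestronglyMeasurable ?_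
    have h2 : ∀ᵐ P : Eucl n × (ℝ × Eucl n) ∂(volume.prod ((Pm n).restrict (I ×ˢ univ))), P.2 ∈ I ×ˢ univ :=
      Measure.quasiMeasurePreserving_snd.ae (ae_restrict_mem (hIm.prod MeasurableSet.univ))
    filter_upwards [h2] with P hP
    by_cases hy : R ≤ ‖P.1‖
    · rw [hR _ hy, mul_zero, norm_zero]; positivity
    · push Not at hy
      rw [norm_mul, norm_mul (h P.1), mul_left_comm, mul_comm]
      exact mul_le_mul_of_nonneg_left (Fker_bd i ha hy.le (hI hP.1)) (norm_nonneg _)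
  have e1 : ∀ y, Fk i I D y * h y = ∫ q in I ×ˢ univ, q.1⁻¹ * kd (etc n i) q.1 (y - q.2) * D q * h y ∂(Pm n) := by
    intro y
    rw [integral_mul_const]; rfl
  have e2 : ∀ q : ℝ × Eucl n, ∫ y, q.1⁻¹ * kd (etc n i) q.1 (y - q.2) * D q * h y = -(q.1⁻¹ * cv (etc n i) q.1 h q.2 * D q) := by
    intro q
    have : ∀ y, q.1⁻¹ * kd (etc n i) q.1 (y - q.2) * D q * h y = -(q.1⁻¹ * D q) * (kd (etc n i) q.1 (q.2 - y) * h y) := by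
      intro y
      rw [← neg_sub q.2 y, etc_odd]; ring
    simp_rw [this]
    rw [integral_const_mul]
    unfold cv
    ring
  refine ⟨?_, ?_, ?_⟩
  · simp_rw [e1]
    exact hintg.integral_prod_left
  · have := hintg.integral_prod_right
    simp only [e2] at this
    simpa using this.neg
  · simp_rw [e1]
    rw [integral_integral_swap (f := fun (y : Eucl n) (q : ℝ × Eucl n) => q.1⁻¹ * kd (etc n i) q.1 (y - q.2) * D q * h y) hintg]
    simp_rw [e2]
    rw [integral_neg]

def Df {n : ℕ} (f : Eucl n → ℝ) (q : ℝ × Eucl n) : ℝ := f q.2 - bav f q.1 q.2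

lemma Df_meas {n : ℕ} {f : Eucl n → ℝ} (hf : Measurable f) : Measurable (Df f) :=
  (hf.comp measurable_snd).sub (bav_meas hf)

lemma Pm_res {n : ℕ} (I : Set ℝ) (s : Set (Eucl n)) : (Pm n).restrict (I ×ˢ s) = (mdt.restrict I).prod (volume.restrict s) := by
  unfold Pm
  rw [Measure.prod_restrict]

lemma Df_int {n : ℕ} {f : Eucl n → ℝ} (hfm : Measurable f) (hf : ∀ x r, IntegrableOn f (ball x r) volume) {a b : ℝ} (ha : 0 < a) (r : ℝ) :
    IntegrableOn (Df f) (Ioc a b ×ˢ ball 0 r) (Pm n) := by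
  have hfi := mdt_fin (b := b) ha
  have hres := Pm_res (Ioc a b) (ball (0 : Eucl n) r)
  unfold IntegrableOn
  rw [hres]
  have h1 : Integrable (fun q : ℝ × Eucl n => (1:ℝ) * f q.2) ((mdt.restrict (Ioc a b)).prod (volume.restrict (ball 0 r))) :=
    (integrable_const (1:ℝ)).mul_prod (hf 0 r)
  simp only [one_mul] at h1
  refine h1.sub ⟨(bav_meas hfm).aestronglyMeasurable, ?_⟩
  unfold HasFiniteIntegral
  rw [lintegral_prod _ (bav_meas hfm).enorm.aemeasurable]
  set Q := ENNReal.ofReal ((om n).toReal⁻¹) * ((volume (ball (0 : Eucl n) 1)) * ∫⁻ x in ball 0 (r + b), ‖f x‖ₑ) with hQ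
  have hQt : Q ≠ ∞ := by
    rw [hQ]
    exact ENNReal.mul_ne_top ENNReal.ofReal_ne_top (ENNReal.mul_ne_top measure_ball_lt_top.ne (hf 0 (r + b)).2.ne)
  have hb : ∀ t ∈ Ioc a b, ∫⁻ x in ball 0 r, ‖bav f t x‖ₑ ≤ Q := by
    intro t ht
    have ht0 : 0 < t := ha.trans ht.1
    set c : Eucl n → Eucl n := (ball (0 : Eucl n) 1).indicator (fun y => t • y) with hc
    have hcm : Measurable c := (measurable_id.const_smul t).indicator measurableSet_ball
    have hcb : ∀ y, ‖c y‖ ≤ b := by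
      intro y
      rw [hc]
      by_cases hy : y ∈ ball (0 : Eucl n) 1
      · rw [indicator_of_mem hy, norm_smul, Real.norm_of_nonneg ht0.le]
        rw [mem_ball_zero_iff] at hy
        nlinarith [ht.2]
      · rw [indicator_of_notMem hy, norm_zero]; linarith [ht.2]
    have hS := shift_lint (volume.restrict (ball (0 : Eucl n) 1)) hfm.enorm hcm hcb r
    rw [Measure.restrict_apply_univ] at hS
    have hmm : Measurable fun x : Eucl n => ∫⁻ y in ball (0 : Eucl n) 1, ‖f (x + c y)‖ₑ := by
      have : Measurable fun q : Eucl n × Eucl n => ‖f (q.1 + c q.2)‖ₑ :=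
        (hfm.comp (measurable_fst.add (hcm.comp measurable_snd))).enorm
      exact this.lintegral_prod_right'
    rw [hQ]
    refine le_trans ?_ (mul_le_mul_right hS _)
    rw [← lintegral_const_mul _ hmm]
    refine lintegral_mono fun x => ?_
    unfold bav
    rw [enorm_mul, Real.enorm_of_nonneg (by positivity), ← clip_eq]
    exact mul_le_mul_right (enorm_integral_le_lintegral_enorm _) _
  calc _ ≤ ∫⁻ t in Ioc a b, Q ∂mdt := setLIntegral_mono' measurableSet_Ioc hb
    _ < ∞ := by
      rw [lintegral_const]
      exact ENNReal.mul_lt_top hQt.lt_top (measure_lt_top _ _)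

lemma Fk_test {n : ℕ} (hn : 0 < n) (i : Fin n) {f : Eucl n → ℝ} (hfm : Measurable f) (hf : ∀ x r, IntegrableOn f (ball x r) volume)
    {h g : Eucl n → ℝ} (hc : ContDiff ℝ (⊤ : ℕ∞) h) (hs : HasCompactSupport h)
    (hgd : g = fun z => fderiv ℝ h z (EuclideanSpace.single i (1:ℝ))) (hgc : Continuous g) {ρ : ℝ} (hgs : ∀ x, ρ ≤ ‖x‖ → g x = 0)
    (hg : Integrable g volume) (hhs : ∀ x, ρ ≤ ‖x‖ → h x = 0) {a b : ℝ} (ha : 0 < a) (hab : a ≤ b) :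
    ∫ y, Fk i (Ioc a b) (Df f) y * h y = 1 / 2 * ∫ x, f x * (cv kap a g x - cv kap b g x) := by
  have hfi := mdt_fin (b := b) ha
  have hhi : Integrable h volume := hc.continuous.integrable_of_hasCompactSupport hs
  obtain ⟨-, h2, h3⟩ := Fk_dual i (Df_meas hfm) ha measurableSet_Ioc Subset.rfl (Df_int hfm hf ha) hc.continuous.measurable hhi hhs
  have hres := Pm_res (Ioc a b) (univ : Set (Eucl n))
  rw [Measure.restrict_univ] at hres
  rw [h3, hres, integral_prod _ (hres ▸ h2), ← integral_neg]
  have e1 : ∀ t ∈ Ioc a b, -∫ x, t⁻¹ * cv (etc n i) t h x * Df f (t, x) = 1 / 2 * ∫ x, f x * cv mu t g x := by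
    intro t ht
    have ht0 : 0 < t := ha.trans ht.1
    rw [← pairing hfm hf hgc.measurable hg hgs ht0, ← integral_const_mul, ← integral_neg]
    congr 1; ext x
    rw [ibp hn i ht0 hc hs x, ← hgd]
    unfold Df
    ring
  rw [setIntegral_congr_fun measurableSet_Ioc e1, integral_const_mul]
  congr 1
  have hm : Measurable fun q : ℝ × Eucl n => f q.2 * cv mu q.1 g q.2 :=
    (hfm.comp measurable_snd).mul (cv_meas mu_cont.measurable hgc.measurable)
  have hI : Integrable (fun q : ℝ × Eucl n => f q.2 * cv mu q.1 g q.2) ((mdt.restrict (Ioc a b)).prod volume) := by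
    have h1 : Integrable (fun q : ℝ × Eucl n => (1:ℝ) * (ball (0 : Eucl n) (ρ + 2 * b)).indicator f q.2) ((mdt.restrict (Ioc a b)).prod volume) :=
      (integrable_const (1:ℝ)).mul_prod ((integrable_indicator_iff measurableSet_ball).2 (hf 0 (ρ + 2 * b)))
    refine (h1.norm.const_mul (1 * (a ^ n)⁻¹ * ∫ z, |g z|)).mono' hm.aestronglyMeasurable ?_
    have h2 : ∀ᵐ q : ℝ × Eucl n ∂((mdt.restrict (Ioc a b)).prod volume), q.1 ∈ Ioc a b :=
      Measure.quasiMeasurePreserving_fst.ae (ae_restrict_mem measurableSet_Ioc)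
    have hgn : 0 ≤ ∫ z, |g z| := integral_nonneg fun z => abs_nonneg _
    filter_upwards [h2] with q hq
    have ht0 : 0 < q.1 := ha.trans hq.1
    by_cases hx : q.2 ∈ ball (0 : Eucl n) (ρ + 2 * b)
    · rw [indicator_of_mem hx, one_mul (f q.2), norm_mul, mul_comm]
      refine mul_le_mul_of_nonneg_right ((cv_bd mu_abs ht0 hg _).trans ?_) (norm_nonneg _)
      refine mul_le_mul_of_nonneg_right ?_ hgn
      rw [one_mul, one_mul]
      exact inv_anti₀ (by positivity) (pow_le_pow_left₀ ha.le hq.1.le _)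
    · rw [cv_supp (fun y => mu_supp) ht0 hgs, mul_zero, norm_zero]
      · positivity
      · rw [mem_ball_zero_iff, not_lt] at hx
        linarith [hq.2]
  rw [integral_integral_swap (f := fun t x => f x * cv mu t g x) hI]
  congr 1; ext x
  rw [integral_const_mul, cv_diff hn hgc.measurable hg ha hab]

lemma Fk_lim {n : ℕ} (hn : 0 < n) (i : Fin n) {f : Eucl n → ℝ} (hfm : Measurable f) (hf : ∀ x r, IntegrableOn f (ball x r) volume)
    {c : ℝ} (hcg : ∀ R, 1 ≤ R → ∫ x in ball 0 R, |f x| ≤ c * R ^ n)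
    {h : Eucl n → ℝ} (hc : ContDiff ℝ (⊤ : ℕ∞) h) (hs : HasCompactSupport h) :
    Tendsto (fun N : ℕ => ∫ y, Fk i (Ioc ((N:ℝ) + 1)⁻¹ ((N:ℝ) + 1)) (Df f) y * h y) atTop
      (𝓝 (1 / 2 * ((∫ y : Eucl n, kap y) * ∫ x, f x * fderiv ℝ h x (EuclideanSpace.single i (1:ℝ))))) := by
  set v : Eucl n := EuclideanSpace.single i (1:ℝ) with hv
  set g : Eucl n → ℝ := fun z => fderiv ℝ h z v with hg
  have hgC : ContDiff ℝ 1 g := by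
    have : ContDiff ℝ 2 h := hc.of_le (by norm_cast)
    exact (this.fderiv_right (m := 1) (by norm_num)).clm_apply contDiff_const
  have hgs : HasCompactSupport g := hs.fderiv_apply ℝ v
  obtain ⟨r1, hr1, h1⟩ := supp_ball hgs
  obtain ⟨r2, hr2, h2⟩ := supp_ball hs
  have hgs' : ∀ x, max r1 r2 ≤ ‖x‖ → g x = 0 := fun x hx => h1 x (by rw [mem_ball_zero_iff, not_lt]; exact (le_max_left _ _).trans hx)
  have hhs' : ∀ x, max r1 r2 ≤ ‖x‖ → h x = 0 := fun x hx => h2 x (by rw [mem_ball_zero_iff, not_lt]; exact (le_max_right _ _).trans hx)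
  have hgi : Integrable g volume := hgC.continuous.integrable_of_hasCompactSupport hgs
  obtain ⟨L, hL⟩ := hgC.lipschitzWith_of_hasCompactSupport hgs (by norm_num)
  obtain ⟨D, hD⟩ := (hc.of_le (by norm_cast) : ContDiff ℝ 1 h).lipschitzWith_of_hasCompactSupport hs (by norm_num)
  have h0 : ∫ z, g z = 0 := by
    have := (LipschitzWith.const' (K := 0) (1:ℝ) : LipschitzWith 0 fun _ : Eucl n => (1:ℝ)).integral_lineDeriv_mul_eq (μ := volume) hD hs (-v)
    have hl0 : ∀ x : Eucl n, lineDeriv ℝ (fun _ : Eucl n => (1:ℝ)) x (-v) = 0 := fun x => by simp [lineDeriv]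
    simp only [hl0, zero_mul, integral_zero, neg_neg, mul_one] at this
    rw [this]
    congr 1 with z
    rw [(hc.differentiable (by simp) z).lineDeriv_eq_fderiv]
  have key := (kap_limit hn hf hcg hgC.continuous (lt_max_of_lt_left hr1) hgs' L.2 (fun x y => by
    have := hL.dist_le_mul x y
    rwa [Real.dist_eq, dist_eq_norm] at this) h0).const_mul (1/2)
  refine key.congr fun N => ?_
  have hN : (0:ℝ) ≤ N := Nat.cast_nonneg N
  rw [Fk_test hn i hfm hf hc hs hg hgC.continuous hgs' hgi hhs' (by positivity)]
  exact (inv_le_one_of_one_le₀ (by linarith)).trans (by linarith)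

def SI {n : ℕ} (D : ℝ × Eucl n → ℝ) (I : Set ℝ) (x : Eucl n) : ℝ≥0∞ := ∫⁻ t in I, ‖t⁻¹ * D (t, x)‖ₑ ^ 2 ∂mdt

lemma SI_meas {n : ℕ} {D : ℝ × Eucl n → ℝ} (hD : Measurable D) (I : Set ℝ) : Measurable (SI D I) := by
  have : Measurable fun q : Eucl n × ℝ => ‖q.2⁻¹ * D (q.2, q.1)‖ₑ ^ 2 := by fun_prop
  exact this.lintegral_prod_right'

lemma half_sq (a : ℝ≥0∞) : (a ^ (1/2 : ℝ)) ^ 2 = a := by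
  rw [← ENNReal.rpow_natCast, ← ENNReal.rpow_mul]
  norm_num

lemma half_rpow (a : ℝ≥0∞) (p : ℝ) : (a ^ (1/2 : ℝ)) ^ p = a ^ (p / 2) := by
  rw [← ENNReal.rpow_mul]
  congr 1; ring

lemma Fk_norm {n : ℕ} (hn : 0 < n) (i : Fin n) {p q : ℝ} {W V : Eucl n → ℝ≥0∞} {A : ℝ≥0∞} (hA : APair n p q W V A) :
    ∃ C : ℝ≥0∞, C ≠ ∞ ∧ ∀ (D : ℝ × Eucl n → ℝ) (a b : ℝ) (I : Set ℝ), Measurable D → 0 < a → MeasurableSet I → I ⊆ Ioc a b →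
      (∀ r, IntegrableOn D (Ioc a b ×ˢ ball 0 r) (Pm n)) →
      ∫⁻ y, ‖Fk i I D y‖ₑ ^ p * W y ≤ C * ∫⁻ x, (SI D I x) ^ (p / 2) * W x := by
  have hp := hA.hpq.pos
  have hq := hA.hpq.symm.pos
  obtain ⟨CU, hCU, hU⟩ := thmU hn (etc_CZK n i) hA.symm
  obtain ⟨C', hC', hab⟩ := absorb hA (C := 1 + CU) (by finiteness)
  refine ⟨C', hC', fun D a b I hD ha hIm hI hDi => ?_⟩
  have hFm := Fk_meas i I hD
  refine hab (fun y => ‖Fk i I D y‖ₑ) _ hFm.enorm ?_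
  rintro g hg ⟨M, hMt, hM⟩ ⟨m, hm⟩
  set h : Eucl n → ℝ := fun y => (if 0 ≤ Fk i I D y then 1 else -1) * (g y * W y).toReal with hh
  have hhm : Measurable h :=
    (Measurable.ite (measurableSet_le measurable_const hFm) measurable_const measurable_const).mul (hg.mul hA.mW).ennreal_toReal
  have hfin : ∀ y, g y * W y ≠ ∞ := fun y => ENNReal.mul_ne_top (ne_top_of_le_ne_top hMt (hM y)) (hA.W_ne_top y)
  have hhe : ∀ y, ‖h y‖ₑ = g y * W y := by
    intro y
    simp only [hh]
    rw [enorm_mul]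
    have : ‖(if 0 ≤ Fk i I D y then (1:ℝ) else -1)‖ₑ = 1 := by split_ifs <;> simp
    rw [this, one_mul, Real.enorm_of_nonneg ENNReal.toReal_nonneg, ENNReal.ofReal_toReal (hfin y)]
  have hhs : ∀ x, (m : ℝ) ≤ ‖x‖ → h x = 0 := by
    intro x hx
    simp only [hh]
    rw [hm x (by rw [mem_ball_zero_iff, not_lt]; exact hx)]
    simp
  have hhi : Integrable h volume := by
    refine ⟨hhm.aestronglyMeasurable, ?_⟩
    unfold HasFiniteIntegral
    simp_rw [hhe]
    calc ∫⁻ y, g y * W y ≤ ∫⁻ y in ball 0 m, M * W y := by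
          rw [← lintegral_indicator measurableSet_ball]
          refine lintegral_mono fun y => ?_
          by_cases hy : y ∈ ball (0 : Eucl n) m
          · rw [indicator_of_mem hy]
            exact mul_le_mul_left (hM y) _
          · rw [hm y hy, zero_mul]; exact zero_le
      _ = M * ∫⁻ y in ball 0 m, W y := lintegral_const_mul _ hA.mW
      _ < ∞ := ENNReal.mul_lt_top hMt.lt_top (hA.finW 0 m).lt_top
  obtain ⟨d1, d2, d3⟩ := Fk_dual i hD ha hIm hI hDi hhm hhi hhs
  have hpos : ∀ y, 0 ≤ Fk i I D y * h y := by
    intro y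
    simp only [hh]
    split_ifs with h0
    · exact mul_nonneg h0 (by rw [one_mul]; exact ENNReal.toReal_nonneg)
    · push Not at h0
      rw [neg_one_mul, mul_neg, ← neg_mul]
      exact mul_nonneg (by linarith) ENNReal.toReal_nonneg
  have hres := Pm_res I (univ : Set (Eucl n))
  rw [Measure.restrict_univ] at hres
  have hmq : Measurable fun q : ℝ × Eucl n => ‖cv (etc n i) q.1 h q.2‖ₑ * ‖q.1⁻¹ * D q‖ₑ :=
    (cv_meas (etc_CZK n i).meas hhm).enorm.mul ((measurable_fst.inv.mul hD).enorm)
  have hmA : Measurable (fun x => (Asq (etc n i) (Ioi 0) h x) ^ (1/2 : ℝ)) := (Asq_meas (etc_CZK n i).meas hhm _).pow_const _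
  have hmS : Measurable (fun x => (SI D I x) ^ (1/2 : ℝ)) := (SI_meas hD I).pow_const _
  calc ∫⁻ y, ‖Fk i I D y‖ₑ * (g y * W y) = ∫⁻ y, ENNReal.ofReal (Fk i I D y * h y) := by
        refine lintegral_congr fun y => ?_
        rw [← Real.enorm_of_nonneg (hpos y), enorm_mul, hhe]
    _ = ENNReal.ofReal (∫ y, Fk i I D y * h y) := (ofReal_integral_eq_lintegral_ofReal d1 (Eventually.of_forall hpos)).symm
    _ ≤ ‖∫ y, Fk i I D y * h y‖ₑ := by rw [Real.enorm_of_nonneg (integral_nonneg hpos)]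
    _ = ‖∫ q in I ×ˢ univ, q.1⁻¹ * cv (etc n i) q.1 h q.2 * D q ∂(Pm n)‖ₑ := by rw [d3, enorm_neg]
    _ ≤ ∫⁻ q in I ×ˢ univ, ‖q.1⁻¹ * cv (etc n i) q.1 h q.2 * D q‖ₑ ∂(Pm n) := enorm_integral_le_lintegral_enorm _
    _ = ∫⁻ q, ‖cv (etc n i) q.1 h q.2‖ₑ * ‖q.1⁻¹ * D q‖ₑ ∂((mdt.restrict I).prod volume) := by
        rw [hres]
        refine lintegral_congr fun q => ?_
        rw [← enorm_mul]; congr 1; ring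
    _ = ∫⁻ x, ∫⁻ t in I, ‖cv (etc n i) t h x‖ₑ * ‖t⁻¹ * D (t, x)‖ₑ ∂mdt := lintegral_prod_symm _ hmq.aemeasurable
    _ ≤ ∫⁻ x, (SI D I x) ^ (1/2 : ℝ) * (Asq (etc n i) (Ioi 0) h x) ^ (1/2 : ℝ) := by
        refine lintegral_mono fun x => ?_
        rw [mul_comm]
        refine cs_of_sq_le _ ?_ ?_ ?_ ?_
        · exact ((cv_meas_t (etc_CZK n i).meas hhm x).enorm).aemeasurable
        · have : Measurable fun t : ℝ => ‖t⁻¹ * D (t, x)‖ₑ := by fun_prop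
          exact this.aemeasurable
        · rw [half_sq]
          unfold Asq
          rw [mdt_restrict_Ioi]
          exact lintegral_mono' Measure.restrict_le_self le_rfl
        · rw [half_sq]; rfl
    _ ≤ (∫⁻ x, (SI D I x) ^ (p / 2) * W x) + ∫⁻ x, (Asq (etc n i) (Ioi 0) h x) ^ (q / 2) * V x := by
        refine (hA.young hmS.aemeasurable).trans (le_of_eq ?_)
        simp_rw [half_rpow]
    _ ≤ (∫⁻ x, (SI D I x) ^ (p / 2) * W x) + CU * ∫⁻ x, g x ^ q * W x := by
        gcongr
        refine (hU h hhm fun x r => hhi.integrableOn).trans (le_of_eq ?_)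
        congr 1
        refine lintegral_congr fun y => ?_
        rw [hhe, ENNReal.mul_rpow_of_nonneg _ _ hq.le, mul_assoc, hA.V_eq]
    _ ≤ _ := by
        gcongr
        · exact le_mul_of_one_le_left zero_le le_self_add
        · exact le_add_self

lemma eLp_eq {n : ℕ} {p : ℝ} (hp : 0 < p) {W : Eucl n → ℝ≥0∞} (hW : Measurable W) {u : Eucl n → ℝ} (hu : Measurable u) :
    eLpNorm u (ENNReal.ofReal p) (volume.withDensity W) = (∫⁻ x, ‖u x‖ₑ ^ p * W x) ^ (1 / p) := by
  rw [eLpNorm_eq_lintegral_rpow_enorm_toReal (by simpa using hp) ENNReal.ofReal_ne_top, ENNReal.toReal_ofReal hp.le]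
  rw [lintegral_withDensity_eq_lintegral_mul _ hW (by fun_prop)]
  congr 1
  refine lintegral_congr fun x => ?_
  rw [Pi.mul_apply, mul_comm]

lemma ae_wd {n : ℕ} {W : Eucl n → ℝ≥0∞} (hW : Measurable W) (h0 : ∀ x, W x ≠ 0) {u v : Eucl n → ℝ} (h : u =ᵐ[volume.withDensity W] v) :
    u =ᵐ[volume] v := by
  refine (withDensity_absolutelyContinuous' hW.aemeasurable (Eventually.of_forall h0)).ae_le h

lemma Lp_complete {n : ℕ} {p q : ℝ} {W V : Eucl n → ℝ≥0∞} {A : ℝ≥0∞} (hA : APair n p q W V A) {u : ℕ → Eucl n → ℝ}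
    (hu : ∀ N, Measurable (u N)) {B : ℝ≥0∞} (hB : B ≠ ∞) (hfin : ∀ N, ∫⁻ x, ‖u N x‖ₑ ^ p * W x ≤ B) {τ : ℕ → ℝ≥0∞} (hτ : Tendsto τ atTop (𝓝 0))
    (hcau : ∀ M N, M ≤ N → ∫⁻ x, ‖u N x - u M x‖ₑ ^ p * W x ≤ τ M) :
    ∃ U : Eucl n → ℝ, Measurable U ∧ ∫⁻ x, ‖U x‖ₑ ^ p * W x ≤ B ∧ ∃ φ : ℕ → ℕ, StrictMono φ ∧
      Tendsto (fun k => ∫⁻ x, ‖u (φ k) x - U x‖ₑ ^ p * W x) atTop (𝓝 0) := by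
  have hp := hA.hpq.pos
  have hp1 := hA.hpq.lt
  set μ := (volume : Measure (Eucl n)).withDensity W with hμ
  have hW0 := hA.W_ne_zero
  have hne : ∀ N, eLpNorm (u N) (ENNReal.ofReal p) μ ≤ B ^ (1 / p) := fun N => by
    rw [hμ, eLp_eq hp hA.mW (hu N)]
    exact ENNReal.rpow_le_rpow (hfin N) (by positivity)
  have hBt : B ^ (1 / p) ≠ ∞ := ENNReal.rpow_ne_top_of_nonneg (by positivity) hB
  have hmem : ∀ N, MemLp (u N) (ENNReal.ofReal p) μ := fun N => ⟨(hu N).aestronglyMeasurable, (hne N).trans_lt hBt.lt_top⟩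
  have hτ' : Tendsto (fun N => τ N ^ (1 / p)) atTop (𝓝 0) := by
    have := (ENNReal.continuous_rpow_const (y := 1 / p)).tendsto 0 |>.comp hτ
    rwa [ENNReal.zero_rpow_of_pos (by positivity)] at this
  obtain ⟨φ, hφ, hφ2⟩ := extraction_forall_of_eventually (P := fun n k => τ k ^ (1 / p) < (2⁻¹ : ℝ≥0∞) ^ n) fun n =>
    hτ'.eventually (gt_mem_nhds (ENNReal.pow_pos (by simp) n))
  have hle : ∀ M N, M ≤ N → eLpNorm (u N - u M) (ENNReal.ofReal p) μ ≤ τ M ^ (1 / p) := fun M N h => by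
    rw [hμ, eLp_eq hp hA.mW ((hu N).sub (hu M))]
    exact ENNReal.rpow_le_rpow (hcau M N h) (by positivity)
  have hpe : (1 : ℝ≥0∞) ≤ ENNReal.ofReal p := by rw [← ENNReal.ofReal_one]; exact ENNReal.ofReal_le_ofReal hp1.le
  obtain ⟨U0, hU0, hlim⟩ := Lp.cauchy_complete_eLpNorm hpe (fun k => hmem (φ k)) (B := fun k => (2⁻¹ : ℝ≥0∞) ^ k)
    (by rw [ENNReal.tsum_geometric]; simp) (by
      have aux : ∀ N m k : ℕ, N ≤ m → m ≤ k → eLpNorm (u (φ k) - u (φ m)) (ENNReal.ofReal p) μ < (2⁻¹ : ℝ≥0∞) ^ N := by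
        intro N m k h1 h2
        refine (hle _ _ (hφ.monotone h2)).trans_lt ((hφ2 m).trans_le ?_)
        exact pow_le_pow_right_of_le_one' (by simp) h1
      intro N k m hk hm
      rcases le_total m k with h | h
      · exact aux N m k hm h
      · rw [eLpNorm_sub_comm]
        exact aux N k m hk h)
  set U := hU0.1.mk U0 with hU
  have hUm : Measurable U := hU0.1.stronglyMeasurable_mk.measurable
  have hae : U0 =ᵐ[μ] U := hU0.1.ae_eq_mk
  have hlim2 : Tendsto (fun k => eLpNorm (u (φ k) - U) (ENNReal.ofReal p) μ) atTop (𝓝 0) := by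
    refine hlim.congr fun k => ?_
    refine eLpNorm_congr_ae ?_
    filter_upwards [hae] with x hx
    simp only [Pi.sub_apply, hx]
  have hUB : eLpNorm U (ENNReal.ofReal p) μ ≤ B ^ (1 / p) := by
    have h1 : ∀ k, eLpNorm U (ENNReal.ofReal p) μ ≤ eLpNorm (u (φ k) - U) (ENNReal.ofReal p) μ + B ^ (1 / p) := by
      intro k
      have e : U = (U - u (φ k)) + u (φ k) := by simp
      calc eLpNorm U (ENNReal.ofReal p) μ = eLpNorm ((U - u (φ k)) + u (φ k)) (ENNReal.ofReal p) μ := by rw [← e]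
        _ ≤ eLpNorm (U - u (φ k)) (ENNReal.ofReal p) μ + eLpNorm (u (φ k)) (ENNReal.ofReal p) μ :=
          eLpNorm_add_le (hUm.sub (hu _)).aestronglyMeasurable (hu _).aestronglyMeasurable hpe
        _ ≤ _ := by
          rw [eLpNorm_sub_comm]
          exact add_le_add le_rfl (hne _)
    have h2 := hlim2.add_const (B ^ (1 / p))
    rw [zero_add] at h2
    exact ge_of_tendsto' h2 h1
  refine ⟨U, hUm, ?_, φ, hφ, ?_⟩
  · rw [hμ, eLp_eq hp hA.mW hUm] at hUB
    exact (ENNReal.rpow_le_rpow_iff (by positivity)).1 hUB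
  · have h3 : ∀ k, ∫⁻ x, ‖u (φ k) x - U x‖ₑ ^ p * W x = (eLpNorm (u (φ k) - U) (ENNReal.ofReal p) μ) ^ p := by
      intro k
      rw [hμ, eLp_eq hp hA.mW ((hu _).sub hUm), ← ENNReal.rpow_mul, one_div_mul_cancel hp.ne', ENNReal.rpow_one]
      rfl
    simp_rw [h3]
    have := (ENNReal.continuous_rpow_const (y := p)).tendsto 0 |>.comp hlim2
    rwa [ENNReal.zero_rpow_of_pos hp] at this

def IN (N : ℕ) : Set ℝ := Ioc ((N:ℝ) + 1)⁻¹ ((N:ℝ) + 1)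

lemma IN_meas (N : ℕ) : MeasurableSet (IN N) := measurableSet_Ioc

lemma IN_mono {M N : ℕ} (h : M ≤ N) : IN M ⊆ IN N := by
  have h' : (M:ℝ) ≤ N := by exact_mod_cast h
  refine Ioc_subset_Ioc (inv_anti₀ (by positivity) (by linarith)) (by linarith)

lemma IN_pos (N : ℕ) : IN N ⊆ Ioi 0 := fun t ht => lt_trans (by positivity) ht.1

lemma SI_tail {n : ℕ} {D : ℝ × Eucl n → ℝ} (hD : Measurable D) {x : Eucl n} (hx : SI D (Ioi 0) x ≠ ∞) :
    Tendsto (fun N => SI D (Ioi 0 \ IN N) x) atTop (𝓝 0) := by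
  set ν := mdt.withDensity fun t => ‖t⁻¹ * D (t, x)‖ₑ ^ 2 with hν
  have hms : ∀ N, MeasurableSet (Ioi (0:ℝ) \ IN N) := fun N => measurableSet_Ioi.diff (IN_meas N)
  have e : ∀ N, SI D (Ioi 0 \ IN N) x = ν (Ioi 0 \ IN N) := fun N => by
    rw [hν, withDensity_apply _ (hms N)]; rfl
  have e0 : SI D (Ioi 0) x = ν (Ioi 0) := by
    rw [hν, withDensity_apply _ measurableSet_Ioi]; rfl
  simp_rw [e]
  have h1 := tendsto_measure_iInter_atTop (μ := ν) (s := fun N => Ioi (0:ℝ) \ IN N) (fun N => (hms N).nullMeasurableSet)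
    (fun M N h => sdiff_subset_sdiff_right (IN_mono h)) ⟨0, ne_top_of_le_ne_top (e0 ▸ hx) (measure_mono sdiff_subset)⟩
  have h2 : (⋂ N, Ioi (0:ℝ) \ IN N) = ∅ := by
    rw [Set.eq_empty_iff_forall_notMem]
    intro t ht
    rw [mem_iInter] at ht
    have ht0 : 0 < t := (ht 0).1
    obtain ⟨N, hN⟩ := exists_nat_gt (max t t⁻¹)
    have h3 : t < N := (le_max_left _ _).trans_lt hN
    have h4 : t⁻¹ < N := (le_max_right _ _).trans_lt hN
    refine (ht N).2 ⟨?_, by linarith⟩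
    rw [inv_lt_comm₀ (by positivity) ht0]
    linarith
  rw [h2, measure_empty] at h1
  exact h1

lemma SI_mono {n : ℕ} (D : ℝ × Eucl n → ℝ) {I J : Set ℝ} (h : I ⊆ J) (x : Eucl n) : SI D I x ≤ SI D J x :=
  lintegral_mono_set h

lemma tau_lim {n : ℕ} {p q : ℝ} {W V : Eucl n → ℝ≥0∞} {A : ℝ≥0∞} (hA : APair n p q W V A) {D : ℝ × Eucl n → ℝ} (hD : Measurable D)
    (hfin : ∫⁻ x, SI D (Ioi 0) x ^ (p / 2) * W x ≠ ∞) :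
    Tendsto (fun N => ∫⁻ x, SI D (Ioi 0 \ IN N) x ^ (p / 2) * W x) atTop (𝓝 0) := by
  have hp := hA.hpq.pos
  have hm : ∀ I, Measurable fun x => SI D I x ^ (p / 2) * W x := fun I => ((SI_meas hD I).pow_const _).mul hA.mW
  have := tendsto_lintegral_of_dominated_convergence (μ := volume) (f := fun _ => (0 : ℝ≥0∞))
    (F := fun N x => SI D (Ioi 0 \ IN N) x ^ (p / 2) * W x) (fun x => SI D (Ioi 0) x ^ (p / 2) * W x) (fun N => hm _)
    (fun N => Eventually.of_forall fun x => mul_le_mul_left (ENNReal.rpow_le_rpow (SI_mono D sdiff_subset x) (by positivity)) _) hfin ?_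
  · simpa using this
  · filter_upwards [ae_lt_top (hm _) hfin] with x hx
    have hx2 : SI D (Ioi 0) x ≠ ∞ := by
      intro h
      rw [h, ENNReal.top_rpow_of_pos (by positivity), ENNReal.top_mul (hA.W_ne_zero x)] at hx
      exact lt_irrefl _ hx
    have h1 := (ENNReal.continuous_rpow_const (y := p / 2)).tendsto 0 |>.comp (SI_tail hD hx2)
    rw [ENNReal.zero_rpow_of_pos (by positivity)] at h1
    have h2 := ENNReal.Tendsto.mul_const (b := W x) h1 (Or.inr (hA.W_ne_top x))
    rwa [zero_mul] at h2

lemma Ssq_eq {n : ℕ} {f : Eucl n → ℝ} (hf : Measurable f) (x : Eucl n) : Ssq n f x = (SI (Df f) (Ioi 0) x) ^ (1/2 : ℝ) := by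
  unfold Ssq SI
  congr 1
  rw [mdt_restrict_Ioi]
  have hg : Measurable fun t : ℝ => Df f (t, x) := (Df_meas hf).comp (by fun_prop)
  rw [← sq_int_eq hg]
  refine setLIntegral_congr_fun measurableSet_Ioi fun t ht => ?_
  simp only [Df]
  rw [ballAvg_eq f x ht]
  rfl

lemma cs_dual {n : ℕ} {p q : ℝ} {W V : Eucl n → ℝ≥0∞} {A : ℝ≥0∞} (hA : APair n p q W V A) {h : Eucl n → ℝ} (hc : Continuous h)
    (hs : HasCompactSupport h) : ∫⁻ x, ‖h x‖ₑ ^ q * V x ≠ ∞ := by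
  have hq := hA.hpq.symm.pos
  obtain ⟨M, hM0, hM⟩ := bdd_of_cs hc hs
  obtain ⟨r, hr, h0⟩ := supp_ball hs
  have : ∫⁻ x, ‖h x‖ₑ ^ q * V x ≤ ENNReal.ofReal M ^ q * ∫⁻ x in ball 0 r, V x := by
    rw [← lintegral_const_mul _ hA.mV, ← lintegral_indicator measurableSet_ball]
    refine lintegral_mono fun x => ?_
    by_cases hx : x ∈ ball 0 r
    · simp only [indicator_of_mem hx]
      gcongr
      rw [Real.enorm_eq_ofReal_abs]
      exact ENNReal.ofReal_le_ofReal (hM x)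
    · simp [h0 x hx, ENNReal.zero_rpow_of_pos hq]
  exact ne_top_of_le_ne_top (ENNReal.mul_ne_top (ENNReal.rpow_ne_top_of_nonneg hq.le ENNReal.ofReal_ne_top) (hA.finV 0 r)) this

lemma pair_fin {n : ℕ} {p q : ℝ} {W V : Eucl n → ℝ≥0∞} {A : ℝ≥0∞} (hA : APair n p q W V A) {u h : Eucl n → ℝ} (hu : Measurable u)
    (hup : ∫⁻ x, ‖u x‖ₑ ^ p * W x ≠ ∞) (hc : Continuous h) (hs : HasCompactSupport h) : Integrable (fun x => u x * h x) volume := by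
  have hp := hA.hpq.pos
  have hq := hA.hpq.symm.pos
  refine ⟨(hu.mul hc.measurable).aestronglyMeasurable, ?_⟩
  unfold HasFiniteIntegral
  simp only [enorm_mul]
  refine (hA.hold hu.enorm.aemeasurable hc.measurable.enorm.aemeasurable).trans_lt ?_
  exact ENNReal.mul_lt_top (ENNReal.rpow_lt_top_of_nonneg (by positivity) hup) (ENNReal.rpow_lt_top_of_nonneg (by positivity) (cs_dual hA hc hs))

lemma coord {n : ℕ} (hn : 0 < n) (i : Fin n) {p q : ℝ} {W V : Eucl n → ℝ≥0∞} {A : ℝ≥0∞} (hA : APair n p q W V A) :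
    ∃ C : ℝ≥0∞, C ≠ ∞ ∧ ∀ f : Eucl n → ℝ, Measurable f → ∫⁻ x, ‖f x‖ₑ ^ p * W x ≠ ∞ → ∫⁻ x, Ssq n f x ^ p * W x ≠ ∞ →
      ∃ U : Eucl n → ℝ, Measurable U ∧ ∫⁻ x, ‖U x‖ₑ ^ p * W x ≤ C * ∫⁻ x, Ssq n f x ^ p * W x ∧
        ∀ h : Eucl n → ℝ, ContDiff ℝ (⊤ : ℕ∞) h → HasCompactSupport h →
          ∫ x, U x * h x = 1 / 2 * ((∫ y : Eucl n, kap y) * ∫ x, f x * fderiv ℝ h x (EuclideanSpace.single i (1:ℝ))) := by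
  have hp := hA.hpq.pos
  have hq := hA.hpq.symm.pos
  obtain ⟨C, hC, hFk⟩ := Fk_norm hn i hA
  refine ⟨C, hC, fun f hfm hfp hS => ?_⟩
  have hf := hA.l1on hfm.aestronglyMeasurable hfp
  have hD := Df_meas hfm
  have hSe : ∫⁻ x, SI (Df f) (Ioi 0) x ^ (p / 2) * W x = ∫⁻ x, Ssq n f x ^ p * W x :=
    lintegral_congr fun x => by rw [Ssq_eq hfm, half_rpow]
  have ha : ∀ N : ℕ, 0 < ((N:ℝ) + 1)⁻¹ := fun N => by positivity
  have hDi : ∀ N : ℕ, ∀ r, IntegrableOn (Df f) (Ioc ((N:ℝ) + 1)⁻¹ ((N:ℝ) + 1) ×ˢ ball 0 r) (Pm n) := fun N r => Df_int hfm hf (ha N) r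
  have hmon : ∀ I ⊆ Ioi (0:ℝ), ∀ J ⊆ I, ∫⁻ x, SI (Df f) J x ^ (p / 2) * W x ≤ ∫⁻ x, SI (Df f) I x ^ (p / 2) * W x := fun I _ J hJ =>
    lintegral_mono fun x => mul_le_mul_left (ENNReal.rpow_le_rpow (SI_mono _ hJ x) (by positivity)) _
  have hτ : Tendsto (fun N => C * ∫⁻ x, SI (Df f) (Ioi 0 \ IN N) x ^ (p / 2) * W x) atTop (𝓝 0) := by
    have := ENNReal.Tendsto.const_mul (tau_lim hA hD (by rwa [hSe])) (Or.inr hC)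
    rwa [mul_zero] at this
  have hB : C * ∫⁻ x, Ssq n f x ^ p * W x ≠ ∞ := ENNReal.mul_ne_top hC hS
  obtain ⟨U, hUm, hUB, φ, hφ, hlim⟩ := Lp_complete hA (u := fun N => Fk i (IN N) (Df f)) (fun N => Fk_meas i _ hD) hB
    (fun N => by
      rw [← hSe]
      refine (hFk _ _ _ (IN N) hD (ha N) (IN_meas N) Subset.rfl (hDi N)).trans (mul_le_mul_right (hmon _ Subset.rfl _ (IN_pos N)) _))
    hτ (fun M N hMN => by
      have e : ∀ x, Fk i (IN N) (Df f) x - Fk i (IN M) (Df f) x = Fk i (IN N \ IN M) (Df f) x := fun x =>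
        (Fk_sub i hD (ha N) (IN_meas M) (IN_mono hMN) (hDi N) x).symm
      simp only [e]
      refine (hFk _ _ _ (IN N \ IN M) hD (ha N) ((IN_meas N).diff (IN_meas M)) sdiff_subset (hDi N)).trans (mul_le_mul_right (hmon _ sdiff_subset _ ?_) _)
      exact sdiff_subset_sdiff_left (IN_pos N))
  refine ⟨U, hUm, hUB, fun h hc hs => ?_⟩
  obtain ⟨c, hct, hcg⟩ := hA.growth hfm.enorm.aemeasurable hfp
  have hl1 := Fk_lim hn i hfm hf (c := c.toReal) (fun R hR => by
    rw [integral_eq_lintegral_of_nonneg_ae (Eventually.of_forall fun x => abs_nonneg _) (by fun_prop)]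
    have := hcg R hR
    simp only [Real.enorm_eq_ofReal_abs] at this
    have h2 := ENNReal.toReal_mono (ENNReal.mul_ne_top hct ENNReal.ofReal_ne_top) this
    rwa [ENNReal.toReal_mul, ENNReal.toReal_ofReal (by positivity)] at h2) hc hs
  have hl2 := hl1.comp hφ.tendsto_atTop
  refine tendsto_nhds_unique ?_ hl2
  have hUp := ne_top_of_le_ne_top hB hUB
  have hintg : Integrable (fun x => U x * h x) volume := pair_fin hA hUm hUp hc.continuous hs
  refine tendsto_integral_of_L1 _ hintg.aestronglyMeasurable (Eventually.of_forall fun k => ?_) ?_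
  · refine pair_fin hA (Fk_meas i _ hD) ?_ hc.continuous hs
    refine ne_top_of_le_ne_top hB ?_
    rw [← hSe]
    exact (hFk _ _ _ (IN (φ k)) hD (ha _) (IN_meas _) Subset.rfl (hDi _)).trans (mul_le_mul_right (hmon _ Subset.rfl _ (IN_pos _)) _)
  · have hK := ENNReal.rpow_ne_top_of_nonneg (y := 1 / q) (by positivity) (cs_dual hA hc.continuous hs)
    have h3 : Tendsto (fun k => (∫⁻ x, ‖Fk i (IN (φ k)) (Df f) x - U x‖ₑ ^ p * W x) ^ (1 / p) * (∫⁻ x, ‖h x‖ₑ ^ q * V x) ^ (1 / q)) atTop (𝓝 0) := by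
      have h4 := ((ENNReal.continuous_rpow_const (y := 1 / p)).tendsto 0).comp hlim
      rw [ENNReal.zero_rpow_of_pos (by positivity)] at h4
      have := ENNReal.Tendsto.mul_const h4 (Or.inr hK)
      rwa [zero_mul] at this
    refine tendsto_of_tendsto_of_tendsto_of_le_of_le tendsto_const_nhds h3 (fun k => zero_le) fun k => ?_
    refine le_trans (le_of_eq ?_) (hA.hold ((Fk_meas i _ hD).sub hUm).enorm.aemeasurable hc.continuous.measurable.enorm.aemeasurable)
    refine lintegral_congr fun x => ?_
    rw [← enorm_mul, sub_mul]
    rfl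

lemma inner_coord {n : ℕ} (a v : Eucl n) : ⟪a, v⟫ = ∑ i, v i * a i := by
  simp [PiLp.inner_apply]

lemma lin_sum {n : ℕ} (L : Eucl n →L[ℝ] ℝ) (v : Eucl n) : L v = ∑ i, v i * L (EuclideanSpace.single i (1:ℝ)) := by
  have h : v = ∑ i, v i • EuclideanSpace.single i (1:ℝ) := by
    ext j
    simp [Finset.sum_apply, Pi.single_apply]
  conv_lhs => rw [h]
  simp [map_sum]

lemma wg_ae {n : ℕ} {f f' : Eucl n → ℝ} {F F' : Eucl n → Eucl n} (hf : f =ᵐ[volume] f') (hF : F =ᵐ[volume] F')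
    (h : HasWeakGradient n f F) : HasWeakGradient n f' F' := by
  intro φ hc hs v
  have h1 : ∫ x, f' x * fderiv ℝ φ x v = ∫ x, f x * fderiv ℝ φ x v := integral_congr_ae (by filter_upwards [hf] with x hx; rw [hx])
  have h2 : ∫ x, ⟪F' x, v⟫ * φ x = ∫ x, ⟪F x, v⟫ * φ x := integral_congr_ae (by filter_upwards [hF] with x hx; rw [hx])
  rw [h1, h2]
  exact h φ hc hs v

lemma coord_li {n : ℕ} {F : Eucl n → Eucl n} (hF : LocallyIntegrable F volume) (i : Fin n) : LocallyIntegrable (fun x => F x i) volume := by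
  intro x
  obtain ⟨s, hs, h⟩ := hF x
  exact ⟨s, hs, (EuclideanSpace.proj (𝕜 := ℝ) i : Eucl n →L[ℝ] ℝ).integrable_comp h⟩

lemma wg_unique {n : ℕ} {f : Eucl n → ℝ} {F F' : Eucl n → Eucl n} (hF : LocallyIntegrable F volume) (hF' : LocallyIntegrable F' volume)
    (h : HasWeakGradient n f F) (h' : HasWeakGradient n f F') : F =ᵐ[volume] F' := by
  have : ∀ i, ∀ᵐ x, F x i = F' x i := fun i => by
    refine ae_eq_of_integral_contDiff_smul_eq (coord_li hF i) (coord_li hF' i) fun g hg hgs => ?_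
    have a := h g (by exact_mod_cast hg) hgs (EuclideanSpace.single i (1:ℝ))
    have b := h' g (by exact_mod_cast hg) hgs (EuclideanSpace.single i (1:ℝ))
    rw [a] at b
    have b := neg_injective b
    simpa [mul_comm, inner_coord, Pi.single_apply] using b
  filter_upwards [ae_all_iff.2 this] with x hx
  ext i
  exact hx i

lemma S_lower {n : ℕ} (hn : 0 < n) {p q : ℝ} {W V : Eucl n → ℝ≥0∞} {A : ℝ≥0∞} (hA : APair n p q W V A) :
    ∃ C : ℝ≥0∞, C ≠ ∞ ∧ ∀ f : Eucl n → ℝ, Measurable f → ∫⁻ x, ‖f x‖ₑ ^ p * W x ≠ ∞ → ∫⁻ x, Ssq n f x ^ p * W x ≠ ∞ →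
      ∃ F : Eucl n → Eucl n, Measurable F ∧ HasWeakGradient n f F ∧ ∫⁻ x, ‖F x‖ₑ ^ p * W x ≤ C * ∫⁻ x, Ssq n f x ^ p * W x := by
  have hp := hA.hpq.pos
  choose C hC hU using fun i : Fin n => coord hn i hA
  set k := ∫ y : Eucl n, kap y with hk
  have hk0 : 0 < k := kap_pos hn
  set c : ℝ := -(2 / k) with hcdef
  refine ⟨(n : ℝ≥0∞) ^ p * ∑ i, ‖c‖ₑ ^ p * C i, ?_, fun f hfm hfp hS => ?_⟩
  · refine ENNReal.mul_ne_top (ENNReal.rpow_ne_top_of_nonneg hp.le (by simp)) ?_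
    refine (ENNReal.sum_lt_top.2 fun i _ => ENNReal.mul_lt_top (ENNReal.rpow_lt_top_of_nonneg hp.le enorm_ne_top) (hC i).lt_top).ne
  choose U hUm hUB hUd using fun i => hU i f hfm hfp hS
  have hUp := fun i => ne_top_of_le_ne_top (ENNReal.mul_ne_top (hC i) hS) (hUB i)
  set F : Eucl n → Eucl n := fun x => WithLp.toLp 2 fun i => c * U i x with hF
  have hFm : Measurable F := by
    refine (WithLp.measurable_toLp 2 _).comp (measurable_pi_lambda _ fun i => (hUm i).const_mul c)
  have hFi : ∀ x i, F x i = c * U i x := fun x i => rfl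
  refine ⟨F, hFm, ?_, ?_⟩
  · intro φ hc hs v
    have hd : ∀ i, Integrable (fun x => f x * fderiv ℝ φ x (EuclideanSpace.single i (1:ℝ))) volume := fun i =>
      pair_fin hA hfm hfp ((hc.continuous_fderiv (by simp)).clm_apply continuous_const) (hs.fderiv_apply ℝ _)
    have hu : ∀ i, Integrable (fun x => U i x * φ x) volume := fun i => pair_fin hA (hUm i) (hUp i) hc.continuous hs
    have e1 : ∫ x, f x * fderiv ℝ φ x v = ∑ i, v i * ∫ x, f x * fderiv ℝ φ x (EuclideanSpace.single i (1:ℝ)) := by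
      simp_rw [← integral_const_mul]
      rw [← integral_finsetSum _ fun i _ => (hd i).const_mul _]
      refine integral_congr_ae (Eventually.of_forall fun x => ?_)
      simp only
      rw [lin_sum, Finset.mul_sum]
      exact Finset.sum_congr rfl fun i _ => by ring
    have e2 : ∫ x, ⟪F x, v⟫ * φ x = ∑ i, (v i * c) * ∫ x, U i x * φ x := by
      simp_rw [← integral_const_mul]
      rw [← integral_finsetSum _ fun i _ => (hu i).const_mul _]
      refine integral_congr_ae (Eventually.of_forall fun x => ?_)
      simp only
      rw [inner_coord, Finset.sum_mul]
      exact Finset.sum_congr rfl fun i _ => by rw [hFi]; ring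
    rw [e1, e2, ← Finset.sum_neg_distrib]
    refine Finset.sum_congr rfl fun i _ => ?_
    rw [hUd i φ hc hs, hcdef]
    field_simp
  · have hpt : ∀ x, ‖F x‖ₑ ^ p * W x ≤ ∑ i, ((n : ℝ≥0∞) ^ p * ‖c‖ₑ ^ p) * (‖U i x‖ₑ ^ p * W x) := fun x => by
      have h1 : ‖F x‖ₑ ≤ ∑ i, ‖c * U i x‖ₑ := by
        have : F x = ∑ i, (c * U i x) • EuclideanSpace.single i (1:ℝ) := by
          ext j
          simp [Finset.sum_apply, Pi.single_apply, hFi]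
        rw [this]
        refine (enorm_sum_le _ _).trans (Finset.sum_le_sum fun i _ => ?_)
        rw [enorm_smul]
        refine le_of_eq ?_
        rw [← ofReal_norm (EuclideanSpace.single i (1:ℝ))]
        simp
      calc ‖F x‖ₑ ^ p * W x ≤ ((n : ℝ≥0∞) ^ p * ∑ i, ‖c * U i x‖ₑ ^ p) * W x :=
            mul_le_mul_left ((ENNReal.rpow_le_rpow h1 hp.le).trans (sum_rpow_le _ hp)) _
        _ = _ := by
          rw [Finset.mul_sum, Finset.sum_mul]
          refine Finset.sum_congr rfl fun i _ => ?_
          rw [enorm_mul, ENNReal.mul_rpow_of_nonneg _ _ hp.le]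
          ring
    have hm : ∀ i, Measurable fun x => ‖U i x‖ₑ ^ p * W x := fun i => ((hUm i).enorm.pow_const _).mul hA.mW
    refine (lintegral_mono hpt).trans ?_
    rw [lintegral_finsetSum _ fun i _ => (hm i).const_mul _, mul_assoc, Finset.sum_mul, Finset.mul_sum]
    refine Finset.sum_le_sum fun i _ => ?_
    rw [lintegral_const_mul _ (hm i), mul_assoc, mul_assoc]
    exact mul_le_mul_right (mul_le_mul_right (hUB i) _) _

lemma core {n : ℕ} (hn : 0 < n) {p q : ℝ} {W V : Eucl n → ℝ≥0∞} {A : ℝ≥0∞} (hA : APair n p q W V A) :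
    ∃ C : ℝ≥0∞, C ≠ ∞ ∧ ∀ f : Eucl n → ℝ, AEStronglyMeasurable f volume → ∫⁻ x, ‖f x‖ₑ ^ p * W x ≠ ∞ →
      (∀ F : Eucl n → Eucl n, LocallyIntegrable F volume → HasWeakGradient n f F → ∫⁻ x, Tsq n f x ^ p * W x ≤ C * ∫⁻ x, ‖F x‖ₑ ^ p * W x) ∧
      ∫⁻ x, Ssq n f x ^ p * W x ≤ ∫⁻ x, Tsq n f x ^ p * W x ∧
      (∫⁻ x, Ssq n f x ^ p * W x ≠ ∞ → ∃ F : Eucl n → Eucl n, LocallyIntegrable F volume ∧ AEStronglyMeasurable F volume ∧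
        HasWeakGradient n f F ∧ ∫⁻ x, ‖F x‖ₑ ^ p * W x ≤ C * ∫⁻ x, Ssq n f x ^ p * W x) := by
  have hp := hA.hpq.pos
  obtain ⟨C1, hC1, hT⟩ := T_upper hn hA
  obtain ⟨C2, hC2, hL⟩ := S_lower hn hA
  refine ⟨C1 + C2, ENNReal.add_ne_top.2 ⟨hC1, hC2⟩, fun f hf hfp => ?_⟩
  obtain ⟨g, hgs, hfg⟩ := hf
  have hg : Measurable g := hgs.measurable
  have hgp : ∫⁻ x, ‖g x‖ₑ ^ p * W x ≠ ∞ := by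
    rwa [lintegral_congr_ae (g := fun x => ‖f x‖ₑ ^ p * W x) (by filter_upwards [hfg] with x hx; rw [hx])]
  have hgi := hA.l1on hg.aestronglyMeasurable hgp
  have eT : ∫⁻ x, Tsq n f x ^ p * W x = ∫⁻ x, Tsq n g x ^ p * W x :=
    lintegral_congr_ae (by filter_upwards [Tsq_ae f g hfg] with x hx; rw [hx])
  have eS : ∫⁻ x, Ssq n f x ^ p * W x = ∫⁻ x, Ssq n g x ^ p * W x :=
    lintegral_congr_ae (by filter_upwards [Ssq_ae f g hfg] with x hx; rw [hx])
  refine ⟨fun F hF hwg => ?_, ?_, fun hS => ?_⟩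
  · obtain ⟨G, hGs, hFG⟩ := hF.aestronglyMeasurable
    have hG : Measurable G := hGs.measurable
    have eF : ∫⁻ x, ‖F x‖ₑ ^ p * W x = ∫⁻ x, ‖G x‖ₑ ^ p * W x :=
      lintegral_congr_ae (by filter_upwards [hFG] with x hx; rw [hx])
    rw [eT, eF]
    refine (hT g G hg hG hgi (fun x r => ?_) (wg_ae hfg hFG hwg)).trans (mul_le_mul_left le_self_add _)
    exact (APair.of_locint hF x r).congr (ae_restrict_of_ae hFG)
  · rw [eT, eS]
    exact lintegral_mono fun x => mul_le_mul_left (ENNReal.rpow_le_rpow (S_le_T hn hg hgi x) hp.le) _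
  · rw [eS] at hS ⊢
    obtain ⟨F, hFm, hwg, hb⟩ := hL g hg hgp hS
    refine ⟨F, APair.locint (hA.l1on hFm.aestronglyMeasurable (ne_top_of_le_ne_top (ENNReal.mul_ne_top hC2 hS) hb)), hFm.aestronglyMeasurable,
      wg_ae hfg.symm (ae_eq_refl F) hwg, hb.trans (mul_le_mul_left le_add_self _)⟩

lemma wconv {E : Type*} [NormedAddCommGroup E] {p : ℝ} (hp : 0 < p) (a : E) (w : ℝ) : ENNReal.ofReal (‖a‖ ^ p * w) = ‖a‖ₑ ^ p * ENNReal.ofReal w := by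
  rw [ENNReal.ofReal_mul (by positivity), ← ENNReal.ofReal_rpow_of_nonneg (norm_nonneg _) hp.le, ofReal_norm]

lemma wS {n : ℕ} {p : ℝ} (hp : 0 < p) (w g : Eucl n → ℝ) : wLpNormS n p w g = (∫⁻ x, ‖g x‖ₑ ^ p * ENNReal.ofReal (w x)) ^ (1 / p) := by
  unfold wLpNormS
  congr 1
  exact lintegral_congr fun x => wconv hp (g x) (w x)

lemma wV {n : ℕ} {p : ℝ} (hp : 0 < p) (w : Eucl n → ℝ) (g : Eucl n → Eucl n) : wLpNormV n p w g = (∫⁻ x, ‖g x‖ₑ ^ p * ENNReal.ofReal (w x)) ^ (1 / p) := by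
  unfold wLpNormV
  congr 1
  exact lintegral_congr fun x => wconv hp (g x) (w x)

lemma main_aux (n : ℕ) (hn : 0 < n) (p : ℝ) (hp : 1 < p)
    (w : Eucl n → ℝ) (hw : IsApWeight n p w) :
    (∀ f : Eucl n → ℝ, MemwLpS n p w f →
      (((∃ F : Eucl n → Eucl n, LocallyIntegrable f volume ∧ LocallyIntegrable F volume ∧
            MemwLpV n p w F ∧ HasWeakGradient n f F) ↔
          ∫⁻ x, Tsq n f x ^ p * ENNReal.ofReal (w x) < ∞) ∧
        ((∃ F : Eucl n → Eucl n, LocallyIntegrable f volume ∧ LocallyIntegrable F volume ∧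
            MemwLpV n p w F ∧ HasWeakGradient n f F) ↔
          ∫⁻ x, Ssq n f x ^ p * ENNReal.ofReal (w x) < ∞))) ∧
    ∃ C : ℝ, 1 ≤ C ∧
      ∀ (f : Eucl n → ℝ) (F : Eucl n → Eucl n),
        MemwLpS n p w f → LocallyIntegrable f volume → LocallyIntegrable F volume →
          MemwLpV n p w F → HasWeakGradient n f F →
            (ENNReal.ofReal C)⁻¹ * wLpNormV n p w F
                ≤ (∫⁻ x, Tsq n f x ^ p * ENNReal.ofReal (w x)) ^ (1/p) ∧
              (∫⁻ x, Tsq n f x ^ p * ENNReal.ofReal (w x)) ^ (1/p)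
                ≤ ENNReal.ofReal C * wLpNormV n p w F ∧
              (ENNReal.ofReal C)⁻¹ * wLpNormV n p w F
                ≤ (∫⁻ x, Ssq n f x ^ p * ENNReal.ofReal (w x)) ^ (1/p) ∧
              (∫⁻ x, Ssq n f x ^ p * ENNReal.ofReal (w x)) ^ (1/p)
                ≤ ENNReal.ofReal C * wLpNormV n p w F := by
  have hp0 : 0 < p := by linarith
  obtain ⟨q, V, A, hA⟩ := IsApWeight.pair hp hw
  obtain ⟨C, hC, hcore⟩ := core hn hA
  have fin : ∀ a : ℝ≥0∞, a ^ (1 / p) < ∞ ↔ a < ∞ := fun a => ENNReal.rpow_lt_top_iff_of_pos (by positivity)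
  have hS : ∀ f, MemwLpS n p w f → ∫⁻ x, ‖f x‖ₑ ^ p * ENNReal.ofReal (w x) ≠ ∞ := fun f hf => by
    have := hf.2
    rw [wS hp0, fin] at this
    exact this.ne
  have hV : ∀ F, MemwLpV n p w F → ∫⁻ x, ‖F x‖ₑ ^ p * ENNReal.ofReal (w x) < ∞ := fun F hF => by
    have := hF.2
    rwa [wV hp0, fin] at this
  constructor
  · intro f hf
    obtain ⟨h1, h2, h3⟩ := hcore f hf.1 (hS f hf)
    have i1 : (∃ F : Eucl n → Eucl n, LocallyIntegrable f volume ∧ LocallyIntegrable F volume ∧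
            MemwLpV n p w F ∧ HasWeakGradient n f F) → ∫⁻ x, Tsq n f x ^ p * ENNReal.ofReal (w x) < ∞ := by
      rintro ⟨F, _, hF, hFV, hwg⟩
      exact (h1 F hF hwg).trans_lt (ENNReal.mul_lt_top hC.lt_top (hV F hFV))
    have i2 : ∫⁻ x, Ssq n f x ^ p * ENNReal.ofReal (w x) < ∞ → (∃ F : Eucl n → Eucl n, LocallyIntegrable f volume ∧ LocallyIntegrable F volume ∧
            MemwLpV n p w F ∧ HasWeakGradient n f F) := by
      intro h
      obtain ⟨F, hF, hFm, hwg, hb⟩ := h3 h.ne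
      refine ⟨F, APair.locint (hA.l1on hf.1 (hS f hf)), hF, ⟨hFm, ?_⟩, hwg⟩
      rw [wV hp0, fin]
      exact hb.trans_lt (ENNReal.mul_lt_top hC.lt_top h)
    exact ⟨⟨i1, fun h => i2 (h2.trans_lt h)⟩, ⟨fun h => h2.trans_lt (i1 h), i2⟩⟩
  · set c : ℝ := max 1 (C ^ (1 / p)).toReal with hc
    have hCt : C ^ (1 / p) ≠ ∞ := ENNReal.rpow_ne_top_of_nonneg (by positivity) hC
    have hcC : C ^ (1 / p) ≤ ENNReal.ofReal c := by
      rw [← ENNReal.ofReal_toReal hCt]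
      exact ENNReal.ofReal_le_ofReal (le_max_right _ _)
    have hc1 : 1 ≤ c := le_max_left _ _
    refine ⟨c, hc1, fun f F hf hfl hFl hFV hwg => ?_⟩
    obtain ⟨h1, h2, h3⟩ := hcore f hf.1 (hS f hf)
    have hT := h1 F hFl hwg
    have hTf := hT.trans_lt (ENNReal.mul_lt_top hC.lt_top (hV F hFV))
    obtain ⟨G, hG, hGm, hwgG, hb⟩ := h3 (h2.trans_lt hTf).ne
    have hae := wg_unique hFl hG hwg hwgG
    have eF : ∫⁻ x, ‖F x‖ₑ ^ p * ENNReal.ofReal (w x) = ∫⁻ x, ‖G x‖ₑ ^ p * ENNReal.ofReal (w x) :=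
      lintegral_congr_ae (by filter_upwards [hae] with x hx; rw [hx])
    rw [← eF] at hb
    have key : ∀ a b : ℝ≥0∞, a ≤ C * b → a ^ (1 / p) ≤ ENNReal.ofReal c * b ^ (1 / p) := fun a b h => by
      refine (ENNReal.rpow_le_rpow h (by positivity)).trans ?_
      rw [ENNReal.mul_rpow_of_nonneg _ _ (by positivity)]
      exact mul_le_mul_left hcC _
    have hc0 : ENNReal.ofReal c ≠ 0 := by simp; linarith
    have inv : ∀ a b : ℝ≥0∞, a ≤ ENNReal.ofReal c * b → (ENNReal.ofReal c)⁻¹ * a ≤ b := fun a b h => by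
      refine (mul_le_mul_right h _).trans ?_
      rw [← mul_assoc, ENNReal.inv_mul_cancel hc0 ENNReal.ofReal_ne_top, one_mul]
    rw [wV hp0]
    have hST := ENNReal.rpow_le_rpow h2 (show 0 ≤ 1 / p by positivity)
    exact ⟨(inv _ _ (key _ _ hb)).trans hST, key _ _ hT, inv _ _ (key _ _ hb), hST.trans (key _ _ hT)⟩

/-- For `1 < p < ∞`, `w ∈ A_p` and `f ∈ L^p_w(ℝⁿ)`, the conditions
`f ∈ W^{1,p}_w(ℝⁿ)`, `Tf ∈ L^p_w(ℝⁿ)` and `Sf ∈ L^p_w(ℝⁿ)` are equivalent; moreover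
for `f ∈ W^{1,p}_w(ℝⁿ)`, `‖Tf‖_{L^p_w} ≈ ‖Sf‖_{L^p_w} ≈ ‖∇f‖_{L^p_w}`. -/
theorem weighted_sobolev_characterization (n : ℕ) (hn : 0 < n) (p : ℝ) (hp : 1 < p)
    (w : Eucl n → ℝ) (hw : IsApWeight n p w) :
    (∀ f : Eucl n → ℝ, MemwLpS n p w f →
      (((∃ F : Eucl n → Eucl n, LocallyIntegrable f volume ∧ LocallyIntegrable F volume ∧
            MemwLpV n p w F ∧ HasWeakGradient n f F) ↔
          ∫⁻ x, Tsq n f x ^ p * ENNReal.ofReal (w x) < ∞) ∧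
        ((∃ F : Eucl n → Eucl n, LocallyIntegrable f volume ∧ LocallyIntegrable F volume ∧
            MemwLpV n p w F ∧ HasWeakGradient n f F) ↔
          ∫⁻ x, Ssq n f x ^ p * ENNReal.ofReal (w x) < ∞))) ∧
    ∃ C : ℝ, 1 ≤ C ∧
      ∀ (f : Eucl n → ℝ) (F : Eucl n → Eucl n),
        MemwLpS n p w f → LocallyIntegrable f volume → LocallyIntegrable F volume →
          MemwLpV n p w F → HasWeakGradient n f F →
            (ENNReal.ofReal C)⁻¹ * wLpNormV n p w F
                ≤ (∫⁻ x, Tsq n f x ^ p * ENNReal.ofReal (w x)) ^ (1/p) ∧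
              (∫⁻ x, Tsq n f x ^ p * ENNReal.ofReal (w x)) ^ (1/p)
                ≤ ENNReal.ofReal C * wLpNormV n p w F ∧
              (ENNReal.ofReal C)⁻¹ * wLpNormV n p w F
                ≤ (∫⁻ x, Ssq n f x ^ p * ENNReal.ofReal (w x)) ^ (1/p) ∧
              (∫⁻ x, Ssq n f x ^ p * ENNReal.ofReal (w x)) ^ (1/p)
                ≤ ENNReal.ofReal C * wLpNormV n p w F := by
  exact main_aux n hn p hp w hw

end
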